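/- Let f : ℝ → ℝ be a function of finite variation, i.e. f = f₊ − f₋ with f₊, f₋ : ℝ → ℝ increasing, and let A(·) be a continuous adapted process with A(0) = 0 and finite total variation on each compact interval [0,t]. Then pathwise uniqueness holds for the generalized perturbed Tanaka equation Y(t) = y + ∫₀ᵗ f(Y(s)) dM(s) + A(t) + N(t), 0 ≤ t < ∞: any two solutions on the same filtered probability space with the same initial value y and the same M, N, A are indistinguishable. -/

import Mathlib

open MeasureTheory ProbabilityTheory Filter Set

noncomputable section

namespace SDEPaper

/-- The signum convention of the paper: `psgn y = 1` for `y > 0`, `= -1` for `y ≤ 0`. -/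
def psgn (y : ℝ) : ℝ := if 0 < y then 1 else -1

variable {Ω : Type*} [m : MeasurableSpace Ω]

/-- The σ-algebra generated by the process `Ξ` on the time interval `[0, t]`. -/
def natSA {E : Type*} [MeasurableSpace E] (Ξ : ℝ → Ω → E) (t : ℝ) : MeasurableSpace Ω :=
  ⨆ s ∈ Icc (0 : ℝ) t, MeasurableSpace.comap (Ξ s) inferInstance

/-- The `μ`-augmentation of a σ-algebra. -/
def augSA (μ : Measure Ω) (m' : MeasurableSpace Ω) : MeasurableSpace Ω :=
  m' ⊔ MeasurableSpace.generateFrom {A : Set Ω | μ A = 0}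

/-- `𝔉^Ξ(t)`: the `μ`-augmented σ-algebra generated by the process `Ξ` up to time `t`. -/
def natFilt {E : Type*} [MeasurableSpace E] (μ : Measure Ω) (Ξ : ℝ → Ω → E) (t : ℝ) :
    MeasurableSpace Ω := augSA μ (natSA Ξ t)

/-- Dyadic left-point Riemann sum of `H` against `X` on `[0,t]`. -/
def rsum (H X : ℝ → Ω → ℝ) (t : ℝ) (n : ℕ) (ω : Ω) : ℝ :=
  ∑ i ∈ Finset.range (2 ^ n),
    H (t * i / 2 ^ n) ω * (X (t * (i + 1) / 2 ^ n) ω - X (t * i / 2 ^ n) ω)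

/-- `I = ∫₀^· H dX`: dyadic Riemann sums converge in probability, and `I 0 = 0` a.s. -/
def IsSI (μ : Measure Ω) (H X I : ℝ → Ω → ℝ) : Prop :=
  (∀ᵐ ω ∂μ, I 0 ω = 0) ∧
  ∀ t : ℝ, 0 ≤ t → TendstoInMeasure μ (fun n => rsum H X t n) atTop (I t)

/-- `I = ∫₀^· H₁ dX₁ + ∫₀^· H₂ dX₂` in the sense of convergence in probability
of dyadic Riemann sums. -/
def IsSI2 (μ : Measure Ω) (H₁ X₁ H₂ X₂ I : ℝ → Ω → ℝ) : Prop :=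
  (∀ᵐ ω ∂μ, I 0 ω = 0) ∧
  ∀ t : ℝ, 0 ≤ t →
    TendstoInMeasure μ (fun n ω => rsum H₁ X₁ t n ω + rsum H₂ X₂ t n ω) atTop (I t)

/-- Dyadic sums of products of increments. -/
def qsum (X Y : ℝ → Ω → ℝ) (t : ℝ) (n : ℕ) (ω : Ω) : ℝ :=
  ∑ i ∈ Finset.range (2 ^ n),
    (X (t * (i + 1) / 2 ^ n) ω - X (t * i / 2 ^ n) ω) *
      (Y (t * (i + 1) / 2 ^ n) ω - Y (t * i / 2 ^ n) ω)

/-- `C = ⟨X,Y⟩`: the quadratic covariation, as a limit in probability of dyadic sums. -/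
def IsQV (μ : Measure Ω) (X Y C : ℝ → Ω → ℝ) : Prop :=
  ∀ t : ℝ, 0 ≤ t → TendstoInMeasure μ (fun n => qsum X Y t n) atTop (C t)

/-- `W` is a standard one-dimensional Brownian motion with respect to the family of
σ-algebras `F` (a filtration contained in the ambient σ-algebra). -/
structure IsBM (μ : Measure Ω) (F : ℝ → MeasurableSpace Ω) (W : ℝ → Ω → ℝ) : Prop where
  le : ∀ t : ℝ, F t ≤ m
  mono : Monotone F
  adapted : ∀ t : ℝ, 0 ≤ t → MeasurableSpace.comap (W t) inferInstance ≤ F t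
  init : ∀ᵐ ω ∂μ, W 0 ω = 0
  cont : ∀ᵐ ω ∂μ, Continuous fun t => W t ω
  law : ∀ s t : ℝ, 0 ≤ s → s ≤ t →
    μ.map (fun ω => W t ω - W s ω) = gaussianReal 0 ((t - s).toNNReal)
  indep : ∀ s t : ℝ, 0 ≤ s → s ≤ t →
    Indep (MeasurableSpace.comap (fun ω => W t ω - W s ω) inferInstance) (F s) μ

/-- `(B₁, B₂)` is a planar Brownian motion: two independent standard Brownian motions
with respect to the common filtration `F`. -/
def IsPlanarBM (μ : Measure Ω) (F : ℝ → MeasurableSpace Ω) (B₁ B₂ : ℝ → Ω → ℝ) : Prop :=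
  IsBM μ F B₁ ∧ IsBM μ F B₂ ∧
    IndepFun (fun ω => (fun t => B₁ t ω)) (fun ω => (fun t => B₂ t ω)) μ

/-- `L` is the (right) local time at the origin of the process `Y`:
`L t = lim_{ε ↓ 0} (4ε)⁻¹ ∫₀ᵗ 1{|Y(s)| < ε} ds`. -/
def IsLocalTime (μ : Measure Ω) (Y L : ℝ → Ω → ℝ) : Prop :=
  ∀ᵐ ω ∂μ, ∀ t : ℝ, 0 ≤ t →
    Tendsto (fun ε : ℝ =>
        (4 * ε)⁻¹ * ∫ s in (0:ℝ)..t, (if |Y s ω| < ε then (1:ℝ) else 0))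
      (nhdsWithin 0 (Ioi 0)) (nhds (L t ω))

/-- A continuous local martingale with respect to the filtration `F`. -/
def IsContLocMart (μ : Measure Ω) (F : Filtration ℝ m) (M : ℝ → Ω → ℝ) : Prop :=
  (∀ᵐ ω ∂μ, Continuous fun t => M t ω) ∧ StronglyAdapted F M ∧
    ∃ τ : ℕ → Ω → ℝ, (∀ n, IsStoppingTime F (fun ω => (τ n ω : WithTop ℝ))) ∧
      (∀ᵐ ω ∂μ, Tendsto (fun n => τ n ω) atTop atTop) ∧
      ∀ n, Martingale (fun t ω => M (min t (τ n ω)) ω) F μ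

/-- Orthogonality: the cross-variation `⟨M,N⟩` vanishes identically. -/
def Orthogonal (μ : Measure Ω) (M N : ℝ → Ω → ℝ) : Prop :=
  IsQV μ M N fun _ _ => 0

/-- Domination: `⟨M⟩(t) = ∫₀ᵗ q(s) d⟨N⟩(s)` for a progressively measurable
process `q` with values in `[0,c]`. -/
def Dominated (μ : Measure Ω) (F : Filtration ℝ m) (M N : ℝ → Ω → ℝ) (c : ℝ) : Prop :=
  ∃ QM QN q : ℝ → Ω → ℝ, IsQV μ M M QM ∧ IsQV μ N N QN ∧
    ProgMeasurable F q ∧ (∀ t ω, q t ω ∈ Icc (0:ℝ) c) ∧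
    ∀ᵐ ω ∂μ, ∃ ν : Measure ℝ,
      (∀ a b : ℝ, 0 ≤ a → a ≤ b → ν (Ioc a b) = ENNReal.ofReal (QN b ω - QN a ω)) ∧
      ∀ t : ℝ, 0 ≤ t → QM t ω = ∫ s in Ioc (0:ℝ) t, q s ω ∂ν

/-- The law of the two-dimensional process `(X₁, X₂)` on path space. -/
def pathLaw (μ : Measure Ω) (X₁ X₂ : ℝ → Ω → ℝ) : Measure (ℝ → ℝ × ℝ) :=
  μ.map fun ω => (fun t => (X₁ t ω, X₂ t ω))
/-- `(X₁, X₂)` solves the system (1.1)-(1.2) driven by `(B₁, B₂)`. -/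
def Solves11 (μ : Measure Ω) (F : ℝ → MeasurableSpace Ω) (g h ρ σ x₁ x₂ : ℝ)
    (B₁ B₂ X₁ X₂ : ℝ → Ω → ℝ) : Prop :=
  (∀ t : ℝ, 0 ≤ t →
    MeasurableSpace.comap (fun ω => (X₁ t ω, X₂ t ω)) inferInstance ≤ F t) ∧
  (∀ᵐ ω ∂μ, Continuous (fun t => X₁ t ω) ∧ Continuous (fun t => X₂ t ω)) ∧
  ∃ I₁ I₂ : ℝ → Ω → ℝ,
    IsSI μ (fun s ω => if X₁ s ω ≤ X₂ s ω then σ else ρ) B₁ I₁ ∧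
    IsSI μ (fun s ω => if X₁ s ω ≤ X₂ s ω then ρ else σ) B₂ I₂ ∧
    ∀ᵐ ω ∂μ, ∀ t : ℝ, 0 ≤ t →
      X₁ t ω = x₁ + (∫ s in (0:ℝ)..t, (if X₁ s ω ≤ X₂ s ω then g else -h)) + I₁ t ω ∧
      X₂ t ω = x₂ + (∫ s in (0:ℝ)..t, (if X₁ s ω ≤ X₂ s ω then -h else g)) + I₂ t ω

/-- `(X₁, X₂)` solves the system (4.7)-(4.8), driven by the single Brownian motion `W`. -/
def Solves47 (μ : Measure Ω) (F : ℝ → MeasurableSpace Ω) (g h x₁ x₂ : ℝ)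
    (W X₁ X₂ : ℝ → Ω → ℝ) : Prop :=
  (∀ t : ℝ, 0 ≤ t →
    MeasurableSpace.comap (fun ω => (X₁ t ω, X₂ t ω)) inferInstance ≤ F t) ∧
  (∀ᵐ ω ∂μ, Continuous (fun t => X₁ t ω) ∧ Continuous (fun t => X₂ t ω)) ∧
  ∃ I₁ I₂ : ℝ → Ω → ℝ,
    IsSI μ (fun s ω => if X₁ s ω ≤ X₂ s ω then (0:ℝ) else 1) W I₁ ∧
    IsSI μ (fun s ω => if X₁ s ω ≤ X₂ s ω then (-1:ℝ) else 0) W I₂ ∧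
    ∀ᵐ ω ∂μ, ∀ t : ℝ, 0 ≤ t →
      X₁ t ω = x₁ + (∫ s in (0:ℝ)..t, (if X₁ s ω ≤ X₂ s ω then g else -h)) + I₁ t ω ∧
      X₂ t ω = x₂ + (∫ s in (0:ℝ)..t, (if X₁ s ω ≤ X₂ s ω then -h else g)) + I₂ t ω

/-- `(X₁, X₂)` solves the system (4.9)-(4.10), driven by the single Brownian motion `V`. -/
def Solves49 (μ : Measure Ω) (F : ℝ → MeasurableSpace Ω) (g h x₁ x₂ : ℝ)
    (V X₁ X₂ : ℝ → Ω → ℝ) : Prop :=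
  (∀ t : ℝ, 0 ≤ t →
    MeasurableSpace.comap (fun ω => (X₁ t ω, X₂ t ω)) inferInstance ≤ F t) ∧
  (∀ᵐ ω ∂μ, Continuous (fun t => X₁ t ω) ∧ Continuous (fun t => X₂ t ω)) ∧
  ∃ I₁ I₂ : ℝ → Ω → ℝ,
    IsSI μ (fun s ω => if X₁ s ω ≤ X₂ s ω then (0:ℝ) else 1) V I₁ ∧
    IsSI μ (fun s ω => if X₁ s ω ≤ X₂ s ω then (1:ℝ) else 0) V I₂ ∧
    ∀ᵐ ω ∂μ, ∀ t : ℝ, 0 ≤ t →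
      X₁ t ω = x₁ + (∫ s in (0:ℝ)..t, (if X₁ s ω ≤ X₂ s ω then g else -h)) + I₁ t ω ∧
      X₂ t ω = x₂ + (∫ s in (0:ℝ)..t, (if X₁ s ω ≤ X₂ s ω then -h else g)) + I₂ t ω

/-- `(X₁, X₂)` solves the system (2.12)-(2.13), driven by the planar BM `(W₁, W₂)`. -/
def Solves212 (μ : Measure Ω) (F : ℝ → MeasurableSpace Ω) (g h ρ σ x₁ x₂ : ℝ)
    (W₁ W₂ X₁ X₂ : ℝ → Ω → ℝ) : Prop :=
  (∀ t : ℝ, 0 ≤ t →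
    MeasurableSpace.comap (fun ω => (X₁ t ω, X₂ t ω)) inferInstance ≤ F t) ∧
  (∀ᵐ ω ∂μ, Continuous (fun t => X₁ t ω) ∧ Continuous (fun t => X₂ t ω)) ∧
  ∃ I₁ I₂ : ℝ → Ω → ℝ,
    IsSI2 μ (fun s ω => if X₁ s ω ≤ X₂ s ω then 0 else ρ) W₁
            (fun s ω => if X₁ s ω ≤ X₂ s ω then σ else 0) W₂ I₁ ∧
    IsSI2 μ (fun s ω => if X₁ s ω ≤ X₂ s ω then -ρ else 0) W₁
            (fun s ω => if X₁ s ω ≤ X₂ s ω then 0 else -σ) W₂ I₂ ∧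
    ∀ᵐ ω ∂μ, ∀ t : ℝ, 0 ≤ t →
      X₁ t ω = x₁ + (∫ s in (0:ℝ)..t, (if X₁ s ω ≤ X₂ s ω then g else -h)) + I₁ t ω ∧
      X₂ t ω = x₂ + (∫ s in (0:ℝ)..t, (if X₁ s ω ≤ X₂ s ω then -h else g)) + I₂ t ω

/-- `(X₁, X₂)` solves the system (2.14)-(2.15), driven by the planar BM `(V₁, V₂)`. -/
def Solves214 (μ : Measure Ω) (F : ℝ → MeasurableSpace Ω) (g h ρ σ x₁ x₂ : ℝ)
    (V₁ V₂ X₁ X₂ : ℝ → Ω → ℝ) : Prop :=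
  (∀ t : ℝ, 0 ≤ t →
    MeasurableSpace.comap (fun ω => (X₁ t ω, X₂ t ω)) inferInstance ≤ F t) ∧
  (∀ᵐ ω ∂μ, Continuous (fun t => X₁ t ω) ∧ Continuous (fun t => X₂ t ω)) ∧
  ∃ I₁ I₂ : ℝ → Ω → ℝ,
    IsSI2 μ (fun s ω => if X₁ s ω ≤ X₂ s ω then 0 else ρ) V₁
            (fun s ω => if X₁ s ω ≤ X₂ s ω then σ else 0) V₂ I₁ ∧
    IsSI2 μ (fun s ω => if X₁ s ω ≤ X₂ s ω then ρ else 0) V₁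
            (fun s ω => if X₁ s ω ≤ X₂ s ω then 0 else σ) V₂ I₂ ∧
    ∀ᵐ ω ∂μ, ∀ t : ℝ, 0 ≤ t →
      X₁ t ω = x₁ + (∫ s in (0:ℝ)..t, (if X₁ s ω ≤ X₂ s ω then g else -h)) + I₁ t ω ∧
      X₂ t ω = x₂ + (∫ s in (0:ℝ)..t, (if X₁ s ω ≤ X₂ s ω then -h else g)) + I₂ t ω

/-- `(X₁, X₂)` solves the system `dX = Σ(X) dU + G(X) dt` of (eq:xSigma), where
`Σ(x) = Σ₊ 1{x₁ > x₂} + Σ₋ 1{x₁ ≤ x₂}`. -/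
def SolvesGen (μ : Measure Ω) (F : ℝ → MeasurableSpace Ω) (g h : ℝ)
    (Sp Sm : Matrix (Fin 2) (Fin 2) ℝ) (x₁ x₂ : ℝ)
    (U₁ U₂ X₁ X₂ : ℝ → Ω → ℝ) : Prop :=
  (∀ t : ℝ, 0 ≤ t →
    MeasurableSpace.comap (fun ω => (X₁ t ω, X₂ t ω)) inferInstance ≤ F t) ∧
  (∀ᵐ ω ∂μ, Continuous (fun t => X₁ t ω) ∧ Continuous (fun t => X₂ t ω)) ∧
  ∃ I₁ I₂ : ℝ → Ω → ℝ,
    IsSI2 μ (fun s ω => if X₁ s ω ≤ X₂ s ω then Sm 0 0 else Sp 0 0) U₁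
            (fun s ω => if X₁ s ω ≤ X₂ s ω then Sm 0 1 else Sp 0 1) U₂ I₁ ∧
    IsSI2 μ (fun s ω => if X₁ s ω ≤ X₂ s ω then Sm 1 0 else Sp 1 0) U₁
            (fun s ω => if X₁ s ω ≤ X₂ s ω then Sm 1 1 else Sp 1 1) U₂ I₂ ∧
    ∀ᵐ ω ∂μ, ∀ t : ℝ, 0 ≤ t →
      X₁ t ω = x₁ + (∫ s in (0:ℝ)..t, (if X₁ s ω ≤ X₂ s ω then g else -h)) + I₁ t ω ∧
      X₂ t ω = x₂ + (∫ s in (0:ℝ)..t, (if X₁ s ω ≤ X₂ s ω then -h else g)) + I₂ t ω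


/-- `Y` solves the generalized perturbed Tanaka equation
`Y(t) = y + ∫₀ᵗ f(Y(s)) dM(s) + A(t) + N(t)`. -/
def SolvesGenPerturbedTanaka (μ : Measure Ω) (F : ℝ → MeasurableSpace Ω)
    (f : ℝ → ℝ) (M N A : ℝ → Ω → ℝ) (y : ℝ) (Y : ℝ → Ω → ℝ) : Prop :=
  (∀ t : ℝ, 0 ≤ t → MeasurableSpace.comap (Y t) inferInstance ≤ F t) ∧
  (∀ᵐ ω ∂μ, Continuous fun t => Y t ω) ∧
  ∃ I : ℝ → Ω → ℝ, IsSI μ (fun s ω => f (Y s ω)) M I ∧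
    ∀ᵐ ω ∂μ, ∀ t : ℝ, 0 ≤ t → Y t ω = y + I t ω + A t ω + N t ω


set_option linter.unusedSectionVars false

/-- probability of an event inside `G` -/
def pr (μ : Measure Ω) (G : Set Ω) (p : Ω → Prop) : ℝ := μ.real {ω | ω ∈ G ∧ p ω}

section prsec
variable {μ : Measure Ω} [IsProbabilityMeasure μ] {G : Set Ω}

lemma pr_nonneg (p : Ω → Prop) : 0 ≤ pr μ G p := measureReal_nonneg

lemma pr_mono {p q : Ω → Prop} (h : ∀ ω ∈ G, p ω → q ω) : pr μ G p ≤ pr μ G q := by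
  refine measureReal_mono ?_ (measure_ne_top _ _)
  rintro ω ⟨h1, h2⟩; exact ⟨h1, h ω h1 h2⟩

lemma pr_or {p q r : Ω → Prop} (h : ∀ ω ∈ G, p ω → q ω ∨ r ω) :
    pr μ G p ≤ pr μ G q + pr μ G r := by
  refine le_trans (measureReal_mono (s₂ := {ω | ω ∈ G ∧ q ω} ∪ {ω | ω ∈ G ∧ r ω}) ?_ (measure_ne_top _ _))
    (measureReal_union_le _ _)
  rintro ω ⟨h1, h2⟩
  rcases h ω h1 h2 with h | h
  · exact Or.inl ⟨h1, h⟩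
  · exact Or.inr ⟨h1, h⟩

lemma pr_or3 {p q r s : Ω → Prop} (h : ∀ ω ∈ G, p ω → q ω ∨ r ω ∨ s ω) :
    pr μ G p ≤ pr μ G q + pr μ G r + pr μ G s := by
  have h1 := pr_or (μ := μ) (G := G) (p := p) (q := q) (r := fun ω => r ω ∨ s ω) h
  have h2 := pr_or (μ := μ) (G := G) (p := fun ω => r ω ∨ s ω) (q := r) (r := s)
    (fun _ _ h => h)
  linarith

lemma pr_or4 {p q r s t : Ω → Prop} (h : ∀ ω ∈ G, p ω → q ω ∨ r ω ∨ s ω ∨ t ω) :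
    pr μ G p ≤ pr μ G q + pr μ G r + pr μ G s + pr μ G t := by
  have h1 := pr_or (μ := μ) (G := G) (p := p) (q := q) (r := fun ω => r ω ∨ s ω ∨ t ω) h
  have h2 := pr_or3 (μ := μ) (G := G) (p := fun ω => r ω ∨ s ω ∨ t ω) (q := r) (r := s) (s := t)
    (fun _ _ h => h)
  linarith

lemma pr_false {p : Ω → Prop} (h : ∀ ω ∈ G, ¬ p ω) : pr μ G p = 0 := by
  have : {ω | ω ∈ G ∧ p ω} = ∅ := by
    ext ω; simp only [mem_ofPred_eq, mem_empty_iff_false, iff_false, not_and]; exact h ω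
  unfold pr; rw [this]; simp

lemma pr_exists {ι : Type*} (s : Finset ι) (p : ι → Ω → Prop) :
    pr μ G (fun ω => ∃ i ∈ s, p i ω) ≤ ∑ i ∈ s, pr μ G (p i) := by
  classical
  induction s using Finset.induction_on with
  | empty => rw [pr_false (by simp)]; simp
  | insert a s ha ih =>
    rw [Finset.sum_insert ha]
    refine le_trans (pr_or (q := p a) (r := fun ω => ∃ i ∈ s, p i ω) ?_) (by linarith)
    rintro ω _ ⟨i, hi, h⟩
    rcases Finset.mem_insert.1 hi with rfl | hi
    · exact Or.inl h
    · exact Or.inr ⟨i, hi, h⟩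

lemma pr_le_of_subset {G' : Set Ω} {p q : Ω → Prop} (h : ∀ ω ∈ G, p ω → ω ∈ G' ∧ q ω) :
    pr μ G p ≤ pr μ G' q := by
  refine measureReal_mono ?_ (measure_ne_top _ _)
  rintro ω ⟨h1, h2⟩; exact h ω h1 h2

/-- Chebyshev -/
lemma pr_le_integral_sq {X : Ω → ℝ} (hX : Integrable (fun ω => X ω ^ 2) μ) {l : ℝ} (hl : 0 < l) :
    pr μ G (fun ω => l < |X ω|) ≤ (∫ ω, X ω ^ 2 ∂μ) / l ^ 2 := by
  have := mul_meas_ge_le_integral_of_nonneg (μ := μ) (f := fun ω => X ω ^ 2)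
    (ae_of_all _ fun ω => sq_nonneg _) hX (l ^ 2)
  rw [le_div_iff₀ (by positivity), mul_comm]
  refine le_trans ?_ this
  refine mul_le_mul_of_nonneg_left ?_ (by positivity)
  refine measureReal_mono ?_ (measure_ne_top _ _)
  rintro ω ⟨_, h⟩
  simp only [mem_ofPred_eq]
  rw [← sq_abs (X ω)]
  exact pow_le_pow_left₀ hl.le h.le 2

/-- Markov -/
lemma pr_le_integral {X : Ω → ℝ} (hX : Integrable X μ) (h0 : ∀ ω, 0 ≤ X ω) {l : ℝ} (hl : 0 < l) :
    pr μ G (fun ω => l < X ω) ≤ (∫ ω, X ω ∂μ) / l := by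
  have := mul_meas_ge_le_integral_of_nonneg (μ := μ) (f := X)
    (ae_of_all _ h0) hX l
  rw [le_div_iff₀ (by positivity), mul_comm]
  refine le_trans ?_ this
  refine mul_le_mul_of_nonneg_left ?_ (by positivity)
  refine measureReal_mono ?_ (measure_ne_top _ _)
  rintro ω ⟨_, h⟩
  exact h.le

end prsec

/-- bounded measurable -/
def Bdd (m' : MeasurableSpace Ω) (X : Ω → ℝ) : Prop :=
  Measurable[m'] X ∧ ∃ C, ∀ ω, |X ω| ≤ C

namespace Bdd
variable {m' m'' : MeasurableSpace Ω} {X Y : Ω → ℝ}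

lemma mono (h : Bdd m' X) (hm : m' ≤ m'') : Bdd m'' X := ⟨h.1.mono hm le_rfl, h.2⟩

lemma const (c : ℝ) : Bdd m' (fun _ => c) := ⟨measurable_const, |c|, fun _ => le_rfl⟩

lemma add (hX : Bdd m' X) (hY : Bdd m' Y) : Bdd m' (fun ω => X ω + Y ω) := by
  obtain ⟨a, C, hC⟩ := hX
  obtain ⟨b, D, hD⟩ := hY
  exact ⟨a.add b, C + D, fun ω => (abs_add_le _ _).trans (add_le_add (hC ω) (hD ω))⟩

lemma neg (hX : Bdd m' X) : Bdd m' (fun ω => - X ω) := by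
  obtain ⟨a, C, hC⟩ := hX
  exact ⟨a.neg, C, fun ω => by rw [abs_neg]; exact hC ω⟩

lemma sub (hX : Bdd m' X) (hY : Bdd m' Y) : Bdd m' (fun ω => X ω - Y ω) := by
  simpa [sub_eq_add_neg] using hX.add hY.neg

lemma mul (hX : Bdd m' X) (hY : Bdd m' Y) : Bdd m' (fun ω => X ω * Y ω) := by
  obtain ⟨a, C, hC⟩ := hX
  obtain ⟨b, D, hD⟩ := hY
  refine ⟨a.mul b, C * D, fun ω => ?_⟩
  rw [abs_mul]
  exact mul_le_mul (hC ω) (hD ω) (abs_nonneg _) ((abs_nonneg _).trans (hC ω))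

lemma sq (hX : Bdd m' X) : Bdd m' (fun ω => X ω ^ 2) := by
  simpa [pow_two] using hX.mul hX

lemma sum {ι : Type*} (s : Finset ι) {X : ι → Ω → ℝ} (h : ∀ i ∈ s, Bdd m' (X i)) :
    Bdd m' (fun ω => ∑ i ∈ s, X i ω) := by
  classical
  induction s using Finset.induction_on with
  | empty => simpa using const 0
  | insert a s ha ih =>
    simp only [Finset.sum_insert ha]
    exact (h a (Finset.mem_insert_self _ _)).add
      (ih fun i hi => h i (Finset.mem_insert_of_mem hi))

lemma ind {p : Ω → Prop} [DecidablePred p] (hp : MeasurableSet[m'] {ω | p ω}) :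
    Bdd m' (fun ω => if p ω then (1:ℝ) else 0) :=
  ⟨Measurable.ite hp measurable_const measurable_const, 1, fun ω => by
    show |if p ω then (1:ℝ) else 0| ≤ 1
    split_ifs <;> simp⟩

lemma abs (hX : Bdd m' X) : Bdd m' (fun ω => |X ω|) := by
  obtain ⟨a, C, hC⟩ := hX
  exact ⟨measurable_abs.comp a, C, fun ω => by rw [abs_abs]; exact hC ω⟩

lemma mset_le (h : Bdd m' X) (l : ℝ) : MeasurableSet[m'] {ω | X ω ≤ l} := h.1 measurableSet_Iic

end Bdd

lemma Bdd.integrable {μ : Measure Ω} [IsFiniteMeasure μ] {X : Ω → ℝ} (h : Bdd m X) :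
    Integrable X μ := by
  obtain ⟨a, C, hC⟩ := h
  exact Integrable.of_bound a.aestronglyMeasurable C (ae_of_all _ fun ω => by simpa using hC ω)


/-- bounded martingale differences -/
structure MD (μ : Measure Ω) (Fn : ℕ → MeasurableSpace Ω) (d : ℕ → Ω → ℝ) : Prop where
  le : ∀ i, Fn i ≤ m
  mono : Monotone Fn
  bdd : ∀ i, Bdd (Fn (i + 1)) (d i)
  orth : ∀ i, ∀ Z, Bdd (Fn i) Z → ∫ ω, Z ω * d i ω ∂μ = 0

namespace MD
variable {μ : Measure Ω} [IsProbabilityMeasure μ] {Fn : ℕ → MeasurableSpace Ω} {d : ℕ → Ω → ℝ}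

lemma bddm (h : MD μ Fn d) (i : ℕ) : Bdd m (d i) := (h.bdd i).mono (h.le _)

lemma bdd_sum (h : MD μ Fn d) (n : ℕ) : Bdd (Fn n) (fun ω => ∑ i ∈ Finset.range n, d i ω) :=
  Bdd.sum _ fun i hi => (h.bdd i).mono (h.mono (Finset.mem_range.1 hi))

lemma transform (h : MD μ Fn d) {c : ℕ → Ω → ℝ} (hc : ∀ i, Bdd (Fn i) (c i)) :
    MD μ Fn (fun i ω => c i ω * d i ω) where
  le := h.le
  mono := h.mono
  bdd i := ((hc i).mono (h.mono (Nat.le_succ i))).mul (h.bdd i)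
  orth i Z hZ := by
    have := h.orth i (fun ω => Z ω * c i ω) (hZ.mul (hc i))
    simpa [mul_assoc] using this

lemma sq (h : MD μ Fn d) (n : ℕ) :
    ∫ ω, (∑ i ∈ Finset.range n, d i ω) ^ 2 ∂μ = ∑ i ∈ Finset.range n, ∫ ω, (d i ω) ^ 2 ∂μ := by
  induction n with
  | zero => simp
  | succ n ih =>
    have h1 := h.orth n _ (h.bdd_sum n)
    have e : ∀ ω, (∑ i ∈ Finset.range (n + 1), d i ω) ^ 2 =
        (∑ i ∈ Finset.range n, d i ω) ^ 2 + (2 * ((∑ i ∈ Finset.range n, d i ω) * d n ω)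
          + d n ω ^ 2) := by
      intro ω; rw [Finset.sum_range_succ]; ring
    have b1 := ((h.bdd_sum n).mono (h.le n))
    have b2 := (b1.mul (h.bddm n))
    simp_rw [e]
    rw [integral_add b1.sq.integrable
        (((Bdd.const 2).mul b2).add (h.bddm n).sq).integrable,
      integral_add ((Bdd.const 2).mul b2).integrable (h.bddm n).sq.integrable,
      integral_const_mul, h1, ih, Finset.sum_range_succ]
    ring

/-- `E S_n² = E Σ d²` -/
lemma sq' (h : MD μ Fn d) (n : ℕ) :
    ∫ ω, (∑ i ∈ Finset.range n, d i ω) ^ 2 ∂μ = ∫ ω, ∑ i ∈ Finset.range n, (d i ω) ^ 2 ∂μ := by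
  rw [h.sq, integral_finsetSum]
  intro i _; exact (h.bddm i).sq.integrable

/-- Lenglart-type maximal inequality -/
lemma len (h : MD μ Fn d) {G : Set Ω} (n : ℕ) {κ l : ℝ} (hκ : 0 ≤ κ) (hl : 0 < l) {mx : Ω → ℝ}
    (hmx : Integrable mx μ) (hm : ∀ ω, ∀ i < n, d i ω ^ 2 ≤ mx ω) (hm0 : ∀ ω, 0 ≤ mx ω) :
    pr μ G (fun ω => ∃ i ≤ n, l < |∑ j ∈ Finset.range i, d j ω|) ≤
      pr μ G (fun ω => κ < ∑ j ∈ Finset.range n, d j ω ^ 2) + (κ + ∫ ω, mx ω ∂μ) / l ^ 2 := by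
  classical
  set S : ℕ → Ω → ℝ := fun i ω => ∑ j ∈ Finset.range i, d j ω with hS
  set P : ℕ → Ω → Prop := fun j ω => ∀ k ≤ j, |S k ω| ≤ l ∧ ∑ j ∈ Finset.range k, d j ω ^ 2 ≤ κ
    with hP
  set ξ : ℕ → Ω → ℝ := fun j ω => if P j ω then 1 else 0 with hξ
  have hPm : ∀ j, MeasurableSet[Fn j] {ω | P j ω} := by
    intro j
    have : {ω | P j ω} = ⋂ k ∈ Finset.range (j + 1),
        ({ω | |S k ω| ≤ l} ∩ {ω | ∑ j ∈ Finset.range k, d j ω ^ 2 ≤ κ}) := by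
      ext ω; simp [hP, Nat.lt_succ_iff]
    rw [this]
    refine Finset.measurableSet_biInter _ fun k hk => ?_
    have hk' : k ≤ j := Nat.lt_succ_iff.1 (Finset.mem_range.1 hk)
    refine @MeasurableSet.inter _ (Fn j) _ _ ?_ ?_
    · exact ((h.bdd_sum k).mono (h.mono hk')).abs.mset_le l
    · refine (Bdd.sum (m' := Fn j) _ fun i hi => ?_).mset_le κ
      exact ((h.bdd i).mono (h.mono ((Finset.mem_range.1 hi).trans_le hk'))).sq
  have hd' : MD μ Fn (fun i ω => ξ i ω * d i ω) := h.transform fun i => Bdd.ind (hPm i)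
  have hsq := hd'.sq' n
  have hle : ∀ ω, ∑ i ∈ Finset.range n, (ξ i ω * d i ω) ^ 2 ≤ κ + mx ω := by
    intro ω
    by_cases hall : ∀ i < n, P i ω
    · rcases Nat.eq_zero_or_pos n with rfl | hn
      · simp; linarith [hm0 ω]
      obtain ⟨k, rfl⟩ := Nat.exists_eq_succ_of_ne_zero hn.ne'
      rw [Finset.sum_range_succ]
      have h1 := ((hall k (Nat.lt_succ_self k)) k le_rfl).2
      have h2 : ∑ i ∈ Finset.range k, (ξ i ω * d i ω) ^ 2 = ∑ i ∈ Finset.range k, d i ω ^ 2 := by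
        refine Finset.sum_congr rfl fun i hi => ?_
        have := hall i ((Finset.mem_range.1 hi).trans (Nat.lt_succ_self k))
        simp [hξ, this]
      have h3 : (ξ k ω * d k ω) ^ 2 = d k ω ^ 2 := by
        have := hall k (Nat.lt_succ_self k)
        simp [hξ, this]
      rw [h2, h3]
      have := hm ω k (Nat.lt_succ_self k)
      linarith
    · push Not at hall
      have hex : ∃ i, ¬ P i ω := by obtain ⟨i, _, h⟩ := hall; exact ⟨i, h⟩
      let k := Nat.find hex
      have hk : ¬ P k ω := Nat.find_spec hex
      have hk' : ∀ i < k, P i ω := fun i hi => not_not.1 (Nat.find_min hex hi)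
      have hkn : k < n := by
        obtain ⟨i, hi, hi'⟩ := hall
        exact lt_of_le_of_lt (Nat.find_min' hex hi') hi
      have hz : ∀ i, k ≤ i → ξ i ω = 0 := by
        intro i hi
        have : ¬ P i ω := fun hp => hk fun j hj => hp j (hj.trans hi)
        simp [hξ, this]
      have h2 : ∑ i ∈ Finset.range n, (ξ i ω * d i ω) ^ 2
          = ∑ i ∈ Finset.range k, d i ω ^ 2 := by
        rw [← Finset.sum_range_add_sum_Ico _ hkn.le]
        rw [Finset.sum_eq_zero (s := Finset.Ico k n), add_zero]
        · refine Finset.sum_congr rfl fun i hi => ?_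
          have := hk' i (Finset.mem_range.1 hi)
          simp [hξ, this]
        · intro i hi
          rw [hz i (Finset.mem_Ico.1 hi).1]; simp
      rw [h2]
      rcases Nat.eq_zero_or_pos k with hk0 | hkp
      · rw [hk0]; simp; linarith [hm0 ω]
      obtain ⟨k', hkk⟩ := Nat.exists_eq_succ_of_ne_zero hkp.ne'
      rw [hkk, Finset.sum_range_succ]
      have h1 := ((hk' k' (by omega)) k' le_rfl).2
      have := hm ω k' (by omega)
      linarith
  have hE : ∫ ω, (∑ i ∈ Finset.range n, ξ i ω * d i ω) ^ 2 ∂μ ≤ κ + ∫ ω, mx ω ∂μ := by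
    rw [hsq]
    have : ∫ ω, (κ + mx ω) ∂μ = κ + ∫ ω, mx ω ∂μ := by
      rw [integral_add (integrable_const _) hmx]; simp
    rw [← this]
    refine integral_mono ?_ ((integrable_const _).add hmx) hle
    exact (Bdd.sum _ fun i _ => (hd'.bddm i).sq).integrable
  have hC := pr_le_integral_sq (μ := μ) (G := G) (X := fun ω => ∑ i ∈ Finset.range n, ξ i ω * d i ω)
    (((hd'.bdd_sum n).mono (h.le n)).sq.integrable) hl
  refine (pr_or (q := fun ω => κ < ∑ j ∈ Finset.range n, d j ω ^ 2)
    (r := fun ω => l < |∑ i ∈ Finset.range n, ξ i ω * d i ω|) ?_).trans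
    (add_le_add le_rfl (hC.trans (div_le_div_of_nonneg_right hE (by positivity))))
  rintro ω - ⟨i0, hi0, hi0'⟩
  by_cases hq : κ < ∑ j ∈ Finset.range n, d j ω ^ 2
  · exact Or.inl hq
  right
  have hex : ∃ i, l < |S i ω| := ⟨i0, hi0'⟩
  let k := Nat.find hex
  have hk : l < |S k ω| := Nat.find_spec hex
  have hk' : ∀ i < k, |S i ω| ≤ l := fun i hi => not_lt.1 (Nat.find_min hex hi)
  have hkn : k ≤ n := (Nat.find_min' hex hi0').trans hi0
  have hq' : ∀ j ≤ n, ∑ j ∈ Finset.range j, d j ω ^ 2 ≤ κ := by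
    intro j hj
    refine le_trans ?_ (not_lt.1 hq)
    exact Finset.sum_le_sum_of_subset_of_nonneg (Finset.range_mono hj)
      fun i _ _ => sq_nonneg _
  have e : ∑ i ∈ Finset.range n, ξ i ω * d i ω = S k ω := by
    rw [← Finset.sum_range_add_sum_Ico _ hkn, Finset.sum_eq_zero (s := Finset.Ico k n), add_zero]
    · refine Finset.sum_congr rfl fun i hi => ?_
      have hi := Finset.mem_range.1 hi
      have : P i ω := fun j hj => ⟨hk' j (by omega), hq' j (by omega)⟩
      simp [hξ, this]
    · intro i hi
      have : ¬ P i ω := fun hp => not_lt.2 (hp k (Finset.mem_Ico.1 hi).1).1 hk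
      simp [hξ, this]
  rw [e]; exact hk

end MD

/-- dyadic grid points -/
def pt (T : ℝ) (n i : ℕ) : ℝ := T * i / 2 ^ n

/-- grid increments -/
def dX (X : ℝ → Ω → ℝ) (T : ℝ) (n i : ℕ) (ω : Ω) : ℝ := X (pt T n (i + 1)) ω - X (pt T n i) ω

lemma pt_nonneg {T : ℝ} (hT : 0 ≤ T) (n i : ℕ) : 0 ≤ pt T n i := by unfold pt; positivity

lemma pt_mono {T : ℝ} (hT : 0 ≤ T) (n : ℕ) : Monotone (pt T n) := by
  intro i j h; unfold pt; gcongr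

lemma pt_zero {T : ℝ} (n : ℕ) : pt T n 0 = 0 := by simp [pt]

lemma pt_top {T : ℝ} (n : ℕ) : pt T n (2 ^ n) = T := by simp [pt]

lemma pt_le {T : ℝ} (hT : 0 ≤ T) {n i : ℕ} (h : i ≤ 2 ^ n) : pt T n i ≤ T := by
  exact (pt_mono hT n h).trans_eq (pt_top n)

lemma pt_add {T : ℝ} (n k i : ℕ) : pt T (n + k) (i * 2 ^ k) = pt T n i := by
  unfold pt; push_cast; rw [pow_add]; field_simp

lemma pt_sub {T : ℝ} (n i j : ℕ) : pt T n i - pt T n j = T * ((i : ℝ) - j) / 2 ^ n := by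
  unfold pt; ring

lemma pt_mem {T : ℝ} (hT : 0 ≤ T) {n i : ℕ} (h : i ≤ 2 ^ n) : pt T n i ∈ Icc 0 T :=
  ⟨pt_nonneg hT n i, pt_le hT h⟩

lemma sum_dX (X : ℝ → Ω → ℝ) (T : ℝ) (n i : ℕ) (ω : Ω) :
    ∑ j ∈ Finset.range i, dX X T n j ω = X (pt T n i) ω - X 0 ω := by
  induction i with
  | zero => simp [pt_zero]
  | succ i ih => rw [Finset.sum_range_succ, ih, dX]; ring

/-- mesh goes to zero -/
lemma mesh_small (T : ℝ) {ρ : ℝ} (hρ : 0 < ρ) : ∀ᶠ n : ℕ in atTop, T / 2 ^ n ≤ ρ := by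
  have : Tendsto (fun n : ℕ => T * (1 / 2 : ℝ) ^ n) atTop (nhds (T * 0)) :=
    (tendsto_pow_atTop_nhds_zero_of_lt_one (by norm_num) (by norm_num)).const_mul T
  rw [mul_zero] at this
  filter_upwards [this.eventually (gt_mem_nhds hρ)] with n hn
  have e : T / 2 ^ n = T * (1 / 2 : ℝ) ^ n := by rw [div_pow, one_pow]; ring
  rw [e]; exact hn.le

/-- adapted process, all paths continuous -/
structure Adp (F : Filtration ℝ m) (X : ℝ → Ω → ℝ) : Prop where
  cont : ∀ ω, Continuous fun t => X t ω
  meas : ∀ t, 0 ≤ t → Measurable[F t] (X t)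

/-- bounded continuous martingale on `[0,∞)` -/
structure Drv (μ : Measure Ω) (F : Filtration ℝ m) (B : ℝ) (X : ℝ → Ω → ℝ) : Prop
    extends Adp F X where
  bd : ∀ t, 0 ≤ t → ∀ ω, |X t ω| ≤ B
  zero : ∀ ω, X 0 ω = 0
  mart : ∀ s t, 0 ≤ s → s ≤ t → ∀ Z, Bdd (F s) Z → ∫ ω, Z ω * (X t ω - X s ω) ∂μ = 0

section modsec
variable {μ : Measure Ω} [IsProbabilityMeasure μ]

lemma mod_exists {X : ℝ → Ω → ℝ} (hc : ∀ ω, Continuous fun t => X t ω)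
    (hm : ∀ t, 0 ≤ t → Measurable (X t)) {T : ℝ} (hT : 0 ≤ T) {δ ε : ℝ} (hδ : 0 < δ) (hε : 0 < ε) :
    ∃ ρ > 0, ∃ E, MeasurableSet E ∧ μ.real E ≤ ε ∧ ∀ ω ∉ E, ∀ s ∈ Icc 0 T, ∀ t ∈ Icc 0 T,
      |s - t| ≤ ρ → |X s ω - X t ω| ≤ δ := by
  haveI : Nonempty (Icc (0:ℝ) T) := ⟨⟨0, le_rfl, hT⟩⟩
  let q : ℕ → Icc (0:ℝ) T := TopologicalSpace.denseSeq _
  have hq : DenseRange q := TopologicalSpace.denseRange_denseSeq _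
  let E : ℕ → Set Ω := fun k => ⋃ i : ℕ, ⋃ j : ℕ,
    {ω | |(q i : ℝ) - q j| < 1 / ((k : ℝ) + 1) ∧ δ < |X (q i) ω - X (q j) ω|}
  have hE : ∀ k, MeasurableSet (E k) := by
    intro k
    refine MeasurableSet.iUnion fun i => MeasurableSet.iUnion fun j => ?_
    refine MeasurableSet.inter (s₁ := {ω | |(q i : ℝ) - q j| < 1 / ((k : ℝ) + 1)})
      (MeasurableSet.const _) ?_
    exact measurableSet_lt measurable_const
      ((hm _ (q i).2.1).sub (hm _ (q j).2.1)).abs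
  have hsub : ∀ k ω, ω ∉ E k → ∀ s ∈ Icc 0 T, ∀ t ∈ Icc 0 T, |s - t| < 1 / ((k : ℝ) + 1) →
      |X s ω - X t ω| ≤ δ := by
    intro k ω hω s hs t ht hst
    by_contra hlt
    push Not at hlt
    let U : Set (Icc (0:ℝ) T × Icc (0:ℝ) T) :=
      {p | |(p.1 : ℝ) - p.2| < 1 / ((k : ℝ) + 1)} ∩ {p | δ < |X p.1 ω - X p.2 ω|}
    have c1 : Continuous fun p : Icc (0:ℝ) T × Icc (0:ℝ) T => |(p.1 : ℝ) - p.2| := by fun_prop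
    have c2 : Continuous fun p : Icc (0:ℝ) T × Icc (0:ℝ) T => |X p.1 ω - X p.2 ω| := by
      refine Continuous.abs (Continuous.sub ?_ ?_)
      · exact (hc ω).comp (by fun_prop)
      · exact (hc ω).comp (by fun_prop)
    have hU : IsOpen U := (isOpen_lt c1 continuous_const).inter (isOpen_lt continuous_const c2)
    obtain ⟨⟨i, j⟩, hij⟩ := (hq.prodMap hq).exists_mem_open hU ⟨(⟨s, hs⟩, ⟨t, ht⟩), hst, hlt⟩
    exact hω (mem_iUnion.2 ⟨i, mem_iUnion.2 ⟨j, hij⟩⟩)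
  have hanti : Antitone E := by
    intro a b hab ω hω
    simp only [E, mem_iUnion, mem_ofPred_eq] at hω ⊢
    obtain ⟨i, j, h1, h2⟩ := hω
    refine ⟨i, j, h1.trans_le ?_, h2⟩
    apply one_div_le_one_div_of_le (by positivity)
    exact_mod_cast Nat.add_le_add_right hab 1
  have hempty : ⋂ k, E k = ∅ := by
    ext ω
    simp only [mem_iInter, mem_empty_iff_false, iff_false, not_forall]
    have huc : UniformContinuousOn (fun t => X t ω) (Icc 0 T) :=
      isCompact_Icc.uniformContinuousOn_of_continuous (hc ω).continuousOn
    obtain ⟨r, hr, h⟩ := Metric.uniformContinuousOn_iff.1 huc δ hδ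
    obtain ⟨k, hk⟩ := exists_nat_one_div_lt hr
    refine ⟨k, fun hω => ?_⟩
    simp only [E, mem_iUnion, mem_ofPred_eq] at hω
    obtain ⟨i, j, h1, h2⟩ := hω
    have := h (q i) (q i).2 (q j) (q j).2 (by rw [Real.dist_eq]; exact h1.trans hk)
    rw [Real.dist_eq] at this
    linarith
  have hlim := tendsto_measure_iInter_atTop (μ := μ) (fun k => (hE k).nullMeasurableSet) hanti
    ⟨0, measure_ne_top _ _⟩
  rw [hempty, measure_empty] at hlim
  have hlim' : Tendsto (fun k => μ.real (E k)) atTop (nhds 0) := by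
    have := (ENNReal.tendsto_toReal ENNReal.zero_ne_top).comp hlim
    exact this
  obtain ⟨k, hk⟩ := (hlim'.eventually (gt_mem_nhds hε)).exists
  refine ⟨1 / ((k : ℝ) + 1) / 2, by positivity, E k, hE k, hk.le, fun ω hω s hs t ht hst => ?_⟩
  refine hsub k ω hω s hs t ht (hst.trans_lt ?_)
  exact half_lt_self (by positivity)

lemma Adp.mod {F : Filtration ℝ m} {X : ℝ → Ω → ℝ} (h : Adp F X) {T : ℝ} (hT : 0 ≤ T) {δ ε : ℝ}
    (hδ : 0 < δ) (hε : 0 < ε) :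
    ∃ ρ > 0, ∃ E, MeasurableSet E ∧ μ.real E ≤ ε ∧ ∀ ω ∉ E, ∀ s ∈ Icc 0 T, ∀ t ∈ Icc 0 T,
      |s - t| ≤ ρ → |X s ω - X t ω| ≤ δ :=
  mod_exists h.cont (fun t ht => (h.meas t ht).mono (F.le t) le_rfl) hT hδ hε

lemma Drv.osc {F : Filtration ℝ m} {B : ℝ} {X : ℝ → Ω → ℝ} (h : Drv μ F B X) {T : ℝ} (hT : 0 ≤ T)
    {ε : ℝ} (hε : 0 < ε) :
    ∃ ρ > 0, ∃ mx : Ω → ℝ, Bdd m mx ∧ (∀ ω, 0 ≤ mx ω) ∧ ∫ ω, mx ω ∂μ ≤ ε ∧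
      ∀ ω, ∀ s ∈ Icc 0 T, ∀ t ∈ Icc 0 T, |s - t| ≤ ρ → (X s ω - X t ω) ^ 2 ≤ mx ω := by
  classical
  have hδ : 0 < √(ε / 2) := Real.sqrt_pos.2 (by positivity)
  have hε' : 0 < ε / 2 / (4 * B ^ 2 + 1) := by positivity
  obtain ⟨ρ, hρ, E, hE, hμ, hmod⟩ := h.toAdp.mod (μ := μ) hT hδ hε'
  have hbI : Bdd m (fun ω => if ω ∈ E then (1:ℝ) else 0) := Bdd.ind hE
  refine ⟨ρ, hρ, fun ω => ε / 2 + (4 * B ^ 2) * (if ω ∈ E then 1 else 0),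
    (Bdd.const _).add ((Bdd.const _).mul hbI), fun ω => by positivity, ?_, ?_⟩
  · rw [integral_add (integrable_const _) ((Bdd.const _).mul hbI).integrable,
      integral_const_mul]
    have e : ∫ ω, (if ω ∈ E then (1:ℝ) else 0) ∂μ = μ.real E := by
      have : (fun ω => if ω ∈ E then (1:ℝ) else 0) = E.indicator 1 := by
        ext ω; simp [indicator]
      rw [this, integral_indicator_one hE]
    rw [e]
    simp only [integral_const, probReal_univ, smul_eq_mul, one_mul]
    have h1 : 4 * B ^ 2 * μ.real E ≤ (4 * B ^ 2 + 1) * (ε / 2 / (4 * B ^ 2 + 1)) := by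
      gcongr; linarith
    rw [mul_div_cancel₀ _ (by positivity)] at h1
    linarith
  · intro ω s hs t ht hst
    by_cases hω : ω ∈ E
    · simp only [hω, if_true, mul_one]
      have h1 := h.bd s hs.1 ω
      have h2 := h.bd t ht.1 ω
      rw [abs_le] at h1 h2
      nlinarith
    · simp only [hω, if_false, mul_zero, add_zero]
      have h1 := hmod ω hω s hs t ht hst
      rw [← sq_abs]
      calc |X s ω - X t ω| ^ 2 ≤ √(ε / 2) ^ 2 := by gcongr
        _ = ε / 2 := Real.sq_sqrt (by positivity)

end modsec

namespace Drv
variable {μ : Measure Ω} [IsProbabilityMeasure μ] {F : Filtration ℝ m} {B : ℝ} {X : ℝ → Ω → ℝ}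

lemma bdd (h : Drv μ F B X) {t : ℝ} (ht : 0 ≤ t) : Bdd (F t) (X t) := ⟨h.meas t ht, B, h.bd t ht⟩

lemma B_nonneg (h : Drv μ F B X) : 0 ≤ B := by
  have : Nonempty Ω := by
    by_contra hne
    rw [not_nonempty_iff] at hne
    have := measure_univ (μ := μ)
    rw [univ_eq_empty_iff.2 hne] at this
    simp at this
  exact (abs_nonneg _).trans (h.bd 0 le_rfl (Classical.arbitrary Ω))

lemma bdd_dX (h : Drv μ F B X) {T : ℝ} (hT : 0 ≤ T) (n i : ℕ) :
    Bdd (F (pt T n (i + 1))) (dX X T n i) :=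
  (h.bdd (pt_nonneg hT n _)).sub ((h.bdd (pt_nonneg hT n i)).mono
    (F.mono (pt_mono hT n (Nat.le_succ i))))

lemma md (h : Drv μ F B X) {T : ℝ} (hT : 0 ≤ T) (n : ℕ) :
    MD μ (fun i => F (pt T n i)) (dX X T n) where
  le i := F.le _
  mono i j hij := F.mono (pt_mono hT n hij)
  bdd i := h.bdd_dX hT n i
  orth i Z hZ := h.mart _ _ (pt_nonneg hT n i) (pt_mono hT n (Nat.le_succ i)) Z hZ

lemma sum_sq (h : Drv μ F B X) {T : ℝ} (hT : 0 ≤ T) (n i : ℕ) :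
    ∫ ω, ∑ j ∈ Finset.range i, dX X T n j ω ^ 2 ∂μ = ∫ ω, X (pt T n i) ω ^ 2 ∂μ := by
  rw [← (h.md hT n).sq' i]
  simp_rw [sum_dX, h.zero, sub_zero]

lemma sum_sq_le (h : Drv μ F B X) {T : ℝ} (hT : 0 ≤ T) (n i : ℕ) :
    ∫ ω, ∑ j ∈ Finset.range i, dX X T n j ω ^ 2 ∂μ ≤ B ^ 2 := by
  rw [h.sum_sq hT]
  have hb := ((h.bdd (pt_nonneg hT n i)).mono (F.le _))
  calc ∫ ω, X (pt T n i) ω ^ 2 ∂μ ≤ ∫ _, B ^ 2 ∂μ := by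
        refine integral_mono hb.sq.integrable (integrable_const _) fun ω => ?_
        show X (pt T n i) ω ^ 2 ≤ B ^ 2
        rw [← sq_abs]
        exact pow_le_pow_left₀ (abs_nonneg _) (h.bd _ (pt_nonneg hT n i) ω) 2
    _ = B ^ 2 := by simp

/-- Isometry bound: transforms with `|c| ≤ C`. -/
lemma iso_le (h : Drv μ F B X) {T : ℝ} (hT : 0 ≤ T) (n i : ℕ) {c : ℕ → Ω → ℝ} {C : ℝ}
    (hc : ∀ j, Measurable[F (pt T n j)] (c j)) (hC : ∀ j ω, |c j ω| ≤ C) :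
    ∫ ω, (∑ j ∈ Finset.range i, c j ω * dX X T n j ω) ^ 2 ∂μ ≤ C ^ 2 * B ^ 2 := by
  have hc' : ∀ j, Bdd (F (pt T n j)) (c j) := fun j => ⟨hc j, C, hC j⟩
  rw [((h.md hT n).transform hc').sq' i]
  have h1 : ∀ ω, ∑ j ∈ Finset.range i, (c j ω * dX X T n j ω) ^ 2 ≤
      C ^ 2 * ∑ j ∈ Finset.range i, dX X T n j ω ^ 2 := by
    intro ω
    rw [Finset.mul_sum]
    refine Finset.sum_le_sum fun j _ => ?_
    rw [mul_pow]
    refine mul_le_mul_of_nonneg_right ?_ (sq_nonneg _)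
    rw [← sq_abs]; exact pow_le_pow_left₀ (abs_nonneg _) (hC j ω) 2
  have hb : Bdd m (fun ω => ∑ j ∈ Finset.range i, dX X T n j ω ^ 2) :=
    Bdd.sum _ fun j _ => ((h.md hT n).bddm j).sq
  refine (integral_mono ?_ ((Bdd.const _).mul hb).integrable h1).trans ?_
  · exact (Bdd.sum _ fun j _ => (((h.md hT n).transform hc').bddm j).sq).integrable
  · rw [integral_const_mul]
    exact mul_le_mul_of_nonneg_left (h.sum_sq_le hT n i) (sq_nonneg _)

/-- quadratic sums are tight -/
lemma sq_tight (h : Drv μ F B X) {T : ℝ} (hT : 0 ≤ T) (G : Set Ω) (n i : ℕ) {l : ℝ} (hl : 0 < l) :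
    pr μ G (fun ω => l < ∑ j ∈ Finset.range i, dX X T n j ω ^ 2) ≤ B ^ 2 / l := by
  have hb : Bdd m (fun ω => ∑ j ∈ Finset.range i, dX X T n j ω ^ 2) :=
    Bdd.sum _ fun j _ => ((h.md hT n).bddm j).sq
  refine (pr_le_integral hb.integrable (fun ω => Finset.sum_nonneg fun j _ => sq_nonneg _) hl).trans
    (div_le_div_of_nonneg_right (h.sum_sq_le hT n i) hl.le)

/-- Maximal inequality in the limit: if weighted squares are small w.h.p., so is the maximum of the
transform; the transforms may depend on the level. -/
lemma len_small (h : Drv μ F B X) {T : ℝ} (hT : 0 ≤ T) (C : ℝ) {ε : ℝ} (hε : 0 < ε) :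
    ∃ κ > 0, ∀ᶠ n in atTop, ∀ (G : Set Ω) (c : ℕ → Ω → ℝ),
      (∀ j, Measurable[F (pt T n j)] (c j)) → (∀ j ω, |c j ω| ≤ C) →
      pr μ G (fun ω => ∃ i ≤ 2 ^ n, ε < |∑ j ∈ Finset.range i, c j ω * dX X T n j ω|) ≤
      pr μ G (fun ω => κ < ∑ j ∈ Finset.range (2 ^ n), c j ω ^ 2 * dX X T n j ω ^ 2) + ε := by
  obtain ⟨ρ, hρ, mx, hmx, hmx0, hIntg, hosc⟩ := h.osc (μ := μ) hT
    (show 0 < ε ^ 3 / 2 / (C ^ 2 + 1) by positivity)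
  refine ⟨ε ^ 3 / 2, by positivity, ?_⟩
  filter_upwards [mesh_small T hρ] with n hn G c hc hC
  have hc' : ∀ j, Bdd (F (pt T n j)) (c j) := fun j => ⟨hc j, C, hC j⟩
  have := ((h.md hT n).transform hc').len (G := G) (2 ^ n) (κ := ε ^ 3 / 2) (l := ε) (by positivity) hε
    (mx := fun ω => C ^ 2 * mx ω) ((Bdd.const _).mul hmx).integrable ?_
    (fun ω => mul_nonneg (sq_nonneg _) (hmx0 ω))
  · simp_rw [mul_pow] at this
    refine this.trans (add_le_add le_rfl ?_)
    rw [integral_const_mul, div_le_iff₀ (by positivity)]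
    have h1 : C ^ 2 * ∫ ω, mx ω ∂μ ≤ (C ^ 2 + 1) * (ε ^ 3 / 2 / (C ^ 2 + 1)) := by
      gcongr
      · exact integral_nonneg hmx0
      · linarith
    rw [mul_div_cancel₀ _ (by positivity)] at h1
    nlinarith
  · intro ω i hi
    show (c i ω * dX X T n i ω) ^ 2 ≤ C ^ 2 * mx ω
    rw [mul_pow]
    refine mul_le_mul ?_ ?_ (sq_nonneg _) (sq_nonneg _)
    · rw [← sq_abs]; exact pow_le_pow_left₀ (abs_nonneg _) (hC i ω) 2
    · refine hosc ω _ (pt_mem hT hi) _ (pt_mem hT hi.le) ?_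
      rw [pt_sub]; push_cast
      rw [show T * ((i : ℝ) + 1 - i) / 2 ^ n = T / 2 ^ n by ring, abs_of_nonneg (by positivity)]
      exact hn

end Drv

lemma sum_range_mul' {M : Type*} [AddCommMonoid M] (f : ℕ → M) (a b : ℕ) :
    ∑ J ∈ Finset.range (a * b), f J =
      ∑ i ∈ Finset.range a, ∑ j ∈ Finset.range b, f (i * b + j) := by
  induction a with
  | zero => simp
  | succ a ih => rw [Nat.succ_mul, Finset.sum_range_add, ih, Finset.sum_range_succ]

/-- convergence in probability on `G` -/
def CP (μ : Measure Ω) (G : Set Ω) (X : ℕ → Ω → ℝ) (Y : Ω → ℝ) : Prop :=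
  ∀ ε > 0, ∀ᶠ n in atTop, pr μ G (fun ω => ε < |X n ω - Y ω|) ≤ ε

section
variable {μ : Measure Ω} [IsProbabilityMeasure μ] {G : Set Ω}

lemma CP.sub_zero {X X' : ℕ → Ω → ℝ} {Y : Ω → ℝ} (h : CP μ G X Y)
    (h' : CP μ G (fun n ω => X n ω - X' n ω) 0) : CP μ G X' Y := by
  intro ε hε
  filter_upwards [h (ε / 2) (by positivity), h' (ε / 2) (by positivity)] with n h1 h2
  refine (pr_or (q := fun ω => ε / 2 < |X n ω - Y ω|)
    (r := fun ω => ε / 2 < |X n ω - X' n ω - (0 : Ω → ℝ) ω|) ?_).trans (by linarith)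
  intro ω _ h
  by_contra hc
  push Not at hc
  obtain ⟨a, b⟩ := hc
  simp only [Pi.zero_apply, _root_.sub_zero] at b
  rw [abs_le] at a b
  have : |X' n ω - Y ω| ≤ ε := by rw [abs_le]; constructor <;> linarith
  linarith

lemma CP.sub {X X' : ℕ → Ω → ℝ} {Y Y' : Ω → ℝ} (h : CP μ G X Y)
    (h' : CP μ G X' Y') : CP μ G (fun n ω => X n ω - X' n ω) (fun ω => Y ω - Y' ω) := by
  intro ε hε
  filter_upwards [h (ε / 2) (by positivity), h' (ε / 2) (by positivity)] with n h1 h2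
  refine (pr_or (q := fun ω => ε / 2 < |X n ω - Y ω|)
    (r := fun ω => ε / 2 < |X' n ω - Y' ω|) ?_).trans (by linarith)
  intro ω _ h
  by_contra hc
  push Not at hc
  obtain ⟨a, b⟩ := hc
  rw [abs_le] at a b
  have : |X n ω - X' n ω - (Y ω - Y' ω)| ≤ ε := by rw [abs_le]; constructor <;> linarith
  linarith

lemma CP.add_zero {X X' : ℕ → Ω → ℝ} (h : CP μ G X 0)
    (h' : CP μ G X' 0) : CP μ G (fun n ω => X n ω + X' n ω) 0 := by
  intro ε hε
  filter_upwards [h (ε / 2) (by positivity), h' (ε / 2) (by positivity)] with n h1 h2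
  refine (pr_or (q := fun ω => ε / 2 < |X n ω - (0 : Ω → ℝ) ω|)
    (r := fun ω => ε / 2 < |X' n ω - (0 : Ω → ℝ) ω|) ?_).trans (by linarith)
  intro ω _ h
  by_contra hc
  push Not at hc
  obtain ⟨a, b⟩ := hc
  simp only [Pi.zero_apply, _root_.sub_zero] at a b h
  rw [abs_le] at a b
  have : |X n ω + X' n ω| ≤ ε := by rw [abs_le]; constructor <;> linarith
  linarith
end

namespace Drv
variable {μ : Measure Ω} [IsProbabilityMeasure μ] {F : Filtration ℝ m} {B : ℝ} {X : ℝ → Ω → ℝ}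

lemma len_osc (h : Drv μ F B X) {T : ℝ} (hT : 0 ≤ T) (C : ℝ) {ε : ℝ} (hε : 0 < ε) :
    ∃ δ > 0, ∀ᶠ n in atTop, ∀ (G : Set Ω) (c : ℕ → Ω → ℝ),
      (∀ j, Measurable[F (pt T n j)] (c j)) → (∀ j ω, |c j ω| ≤ C) →
      pr μ G (fun ω => ∃ i ≤ 2 ^ n, ε < |∑ j ∈ Finset.range i, c j ω * dX X T n j ω|) ≤
      pr μ G (fun ω => ∃ j < 2 ^ n, δ < |c j ω|) + ε := by
  obtain ⟨κ, hκ, hev⟩ := h.len_small (μ := μ) hT C (half_pos hε)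
  -- choose δ with B² δ² / κ ≤ ε/2
  let δ : ℝ := √(κ * (ε / 2) / (B ^ 2 + 1))
  have hδ : 0 < δ := Real.sqrt_pos.2 (by positivity)
  have hδ2 : δ ^ 2 = κ * (ε / 2) / (B ^ 2 + 1) := Real.sq_sqrt (by positivity)
  refine ⟨δ, hδ, ?_⟩
  filter_upwards [hev] with n hn G c hc hC
  have h1 := hn G c hc hC
  have h2 := h.sq_tight (μ := μ) hT G n (2 ^ n) (l := κ / δ ^ 2) (by positivity)
  have h3 : B ^ 2 / (κ / δ ^ 2) ≤ ε / 2 := by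
    rw [div_div_eq_mul_div, hδ2, div_le_iff₀ hκ]
    rw [mul_div_assoc']
    rw [div_le_iff₀ (by positivity)]
    nlinarith [mul_pos hκ hε]
  have h4 : pr μ G (fun ω => ∃ i ≤ 2 ^ n, ε < |∑ j ∈ Finset.range i, c j ω * dX X T n j ω|) ≤
      pr μ G (fun ω => ∃ i ≤ 2 ^ n, ε / 2 < |∑ j ∈ Finset.range i, c j ω * dX X T n j ω|) :=
    pr_mono fun ω _ ⟨i, hi, h⟩ => ⟨i, hi, by linarith⟩
  have h5 : pr μ G (fun ω => κ < ∑ j ∈ Finset.range (2 ^ n), c j ω ^ 2 * dX X T n j ω ^ 2) ≤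
      pr μ G (fun ω => ∃ j < 2 ^ n, δ < |c j ω|) +
      pr μ G (fun ω => κ / δ ^ 2 < ∑ j ∈ Finset.range (2 ^ n), dX X T n j ω ^ 2) := by
    refine pr_or fun ω _ h => ?_
    by_contra hcon
    push Not at hcon
    obtain ⟨h6, h7⟩ := hcon
    have : ∑ j ∈ Finset.range (2 ^ n), c j ω ^ 2 * dX X T n j ω ^ 2 ≤
        δ ^ 2 * ∑ j ∈ Finset.range (2 ^ n), dX X T n j ω ^ 2 := by
      rw [Finset.mul_sum]
      refine Finset.sum_le_sum fun j hj => ?_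
      refine mul_le_mul_of_nonneg_right ?_ (sq_nonneg _)
      rw [← sq_abs]
      exact pow_le_pow_left₀ (abs_nonneg _) (h6 j (Finset.mem_range.1 hj)) 2
    rw [le_div_iff₀ (by positivity)] at h7
    linarith
  linarith

/-- a transform by oscillations of a process on blocks of `b` grid cells vanishes -/
lemma block_small {Z : ℝ → Ω → ℝ} {B' : ℝ} (h : Drv μ F B X) (hZ : Drv μ F B' Z) {T : ℝ}
    (hT : 0 ≤ T) (b : ℕ) (hb : 0 < b) {ε : ℝ} (hε : 0 < ε) :
    ∀ᶠ n in atTop, ∀ (G : Set Ω), 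
      pr μ G (fun ω => ∃ i ≤ 2 ^ n, ε < |∑ j ∈ Finset.range i,
        (Z (pt T n j) ω - Z (pt T n (b * (j / b))) ω) * dX X T n j ω|) ≤ ε := by
  obtain ⟨δ, hδ, hev⟩ := h.len_osc (μ := μ) hT (2 * B') (half_pos hε)
  obtain ⟨ρ, hρ, E, hE, hμ, hmod⟩ := hZ.toAdp.mod (μ := μ) hT hδ (half_pos hε)
  filter_upwards [hev, mesh_small (T * b) hρ] with n hn hmesh G
  have hle : ∀ j, b * (j / b) ≤ j := fun j => Nat.mul_div_le j b
  have h1 := hn G (fun j ω => Z (pt T n j) ω - Z (pt T n (b * (j / b))) ω) ?_ ?_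
  · have h2 : pr μ G (fun ω => ∃ i ≤ 2 ^ n, ε < |∑ j ∈ Finset.range i,
        (Z (pt T n j) ω - Z (pt T n (b * (j / b))) ω) * dX X T n j ω|) ≤
      pr μ G (fun ω => ∃ i ≤ 2 ^ n, ε / 2 < |∑ j ∈ Finset.range i,
        (Z (pt T n j) ω - Z (pt T n (b * (j / b))) ω) * dX X T n j ω|) :=
      pr_mono fun ω _ ⟨i, hi, h⟩ => ⟨i, hi, by linarith⟩
    have h3 : pr μ G (fun ω => ∃ j < 2 ^ n,
        δ < |Z (pt T n j) ω - Z (pt T n (b * (j / b))) ω|) ≤ μ.real E := by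
      refine measureReal_mono ?_ (measure_ne_top _ _)
      rintro ω ⟨_, j, hj, hd⟩
      by_contra hω
      refine absurd hd (not_lt.2 (hmod ω hω _ (pt_mem hT hj.le) _
        (pt_mem hT ((hle j).trans hj.le)) ?_))
      rw [pt_sub]
      have h5 : j % b < b := Nat.mod_lt j hb
      have h4 : ((j : ℝ) - (b * (j / b) : ℕ)) ≤ b ∧ 0 ≤ ((j : ℝ) - (b * (j / b) : ℕ)) := by
        have h6 := Nat.div_add_mod j b
        have : (j : ℝ) = (b * (j / b) : ℕ) + (j % b : ℕ) := by exact_mod_cast h6.symm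
        rw [this]
        have h7 : ((j % b : ℕ) : ℝ) ≤ b := by exact_mod_cast h5.le
        constructor <;> simp only [add_sub_cancel_left]
        · exact h7
        · positivity
      rw [abs_of_nonneg (by have := h4.2; positivity)]
      refine le_trans ?_ hmesh
      gcongr
      exact h4.1
    linarith
  · intro j
    exact ((hZ.bdd (pt_nonneg hT n j)).sub
      ((hZ.bdd (pt_nonneg hT n _)).mono (F.mono (pt_mono hT n (hle j))))).1
  · intro j ω
    have h1 := hZ.bd _ (pt_nonneg hT n j) ω
    have h2 := hZ.bd _ (pt_nonneg hT n (b * (j / b))) ω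
    rw [abs_le] at h1 h2
    show |Z (pt T n j) ω - Z (pt T n (b * (j / b))) ω| ≤ 2 * B'
    rw [abs_le]; constructor <;> linarith

lemma prod_identity (X Z : ℝ → Ω → ℝ) (T : ℝ) (N b a : ℕ) (hb : 0 < b) (ω : Ω) :
    ∑ i ∈ Finset.range a, (X (pt T N (b * (i + 1))) ω - X (pt T N (b * i)) ω) *
      (Z (pt T N (b * (i + 1))) ω - Z (pt T N (b * i)) ω) =
    ∑ j ∈ Finset.range (a * b), dX X T N j ω * dX Z T N j ω +
    (∑ j ∈ Finset.range (a * b), (X (pt T N j) ω - X (pt T N (b * (j / b))) ω) * dX Z T N j ω +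
    ∑ j ∈ Finset.range (a * b), (Z (pt T N j) ω - Z (pt T N (b * (j / b))) ω) * dX X T N j ω) := by
  rw [sum_range_mul', sum_range_mul', sum_range_mul', ← Finset.sum_add_distrib,
    ← Finset.sum_add_distrib]
  refine Finset.sum_congr rfl fun i _ => ?_
  have key : ∀ r ≤ b, (X (pt T N (i * b + r)) ω - X (pt T N (b * i)) ω) *
      (Z (pt T N (i * b + r)) ω - Z (pt T N (b * i)) ω) =
      ∑ j ∈ Finset.range r, dX X T N (i * b + j) ω * dX Z T N (i * b + j) ω +
      (∑ j ∈ Finset.range r, (X (pt T N (i * b + j)) ω - X (pt T N (b * ((i * b + j) / b))) ω)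
        * dX Z T N (i * b + j) ω +
      ∑ j ∈ Finset.range r, (Z (pt T N (i * b + j)) ω - Z (pt T N (b * ((i * b + j) / b))) ω)
        * dX X T N (i * b + j) ω) := by
    intro r
    induction r with
    | zero => intro _; simp [mul_comm]
    | succ r ih =>
      intro hr
      have e : (i * b + r) / b = i := by
        rw [Nat.add_comm, Nat.add_mul_div_right _ _ hb, Nat.div_eq_of_lt (by omega), zero_add]
      simp only [Finset.sum_range_succ]
      have := ih (by omega)
      rw [e]
      unfold dX at *
      rw [show i * b + (r + 1) = i * b + r + 1 by ring]
      linear_combination this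
  have := key b le_rfl
  rw [show b * (i + 1) = i * b + b by ring]
  exact this

/-- L3: quadratic sums along `[0, pt T k b]` vs. the fine grid -/
lemma qsum_fine {Z : ℝ → Ω → ℝ} {B' : ℝ} (h : Drv μ F B X) (hZ : Drv μ F B' Z) {T : ℝ}
    (hT : 0 ≤ T) (G : Set Ω) (k b : ℕ) (hb : b ≤ 2 ^ k) :
    CP μ G (fun n ω => qsum X Z (pt T k b) n ω -
      ∑ j ∈ Finset.range (b * 2 ^ n), dX X T (k + n) j ω * dX Z T (k + n) j ω) 0 := by
  rcases Nat.eq_zero_or_pos b with rfl | hb0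
  · intro ε hε
    refine Eventually.of_forall fun n => ?_
    rw [pr_false]
    · exact hε.le
    · intro ω _
      simp [qsum, pt]
      exact hε.le
  intro ε hε
  have e1 := h.block_small (μ := μ) hZ hT b hb0 (half_pos hε)
  have e2 := hZ.block_small (μ := μ) h hT b hb0 (half_pos hε)
  have ha : Tendsto (fun n => k + n) atTop atTop := tendsto_atTop_mono (fun n => by simp) tendsto_id
  filter_upwards [ha.eventually e1, ha.eventually e2] with n h1 h2
  refine (pr_or (fun ω _ h => ?_)).trans ((add_le_add (h1 G) (h2 G)).trans_eq (by ring))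
  have e : qsum X Z (pt T k b) n ω =
      ∑ i ∈ Finset.range (2 ^ n), (X (pt T (k + n) (b * (i + 1))) ω - X (pt T (k + n) (b * i)) ω) *
      (Z (pt T (k + n) (b * (i + 1))) ω - Z (pt T (k + n) (b * i)) ω) := by
    unfold qsum
    refine Finset.sum_congr rfl fun i _ => ?_
    have t1 : pt T k b * (i : ℝ) / 2 ^ n = pt T (k + n) (b * i) := by
      unfold pt; push_cast; rw [pow_add]; field_simp
    have t2 : pt T k b * ((i : ℝ) + 1) / 2 ^ n = pt T (k + n) (b * (i + 1)) := by
      unfold pt; push_cast; rw [pow_add]; field_simp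
    rw [t1, t2]
  by_contra hcon
  push Not at hcon
  have hle : 2 ^ n * b ≤ 2 ^ (k + n) := by
    rw [pow_add, mul_comm]; exact Nat.mul_le_mul_right _ hb
  have a1 := hcon.1 _ hle
  have a2 := hcon.2 _ hle
  rw [e, prod_identity _ _ _ _ _ _ hb0, mul_comm b, Pi.zero_apply, sub_zero,
    add_sub_cancel_left] at h
  rw [abs_le] at a1 a2
  have : |∑ j ∈ Finset.range (2 ^ n * b),
          (X (pt T (k + n) j) ω - X (pt T (k + n) (b * (j / b))) ω) * dX Z T (k + n) j ω +
        ∑ j ∈ Finset.range (2 ^ n * b),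
          (Z (pt T (k + n) j) ω - Z (pt T (k + n) (b * (j / b))) ω) * dX X T (k + n) j ω| ≤ ε := by
    rw [abs_le]; constructor <;> linarith
  linarith

end Drv

/-- fine quadratic sum over the cell `(l,i)` -/
def cellS (X : ℝ → Ω → ℝ) (T : ℝ) (l i n : ℕ) (ω : Ω) : ℝ :=
  ∑ j ∈ Finset.range (2 ^ n), dX X T (l + n) (i * 2 ^ n + j) ω ^ 2

/-- domination on cells -/
def CellDom (μ : Measure Ω) (G : Set Ω) (T c : ℝ) (M N : ℝ → Ω → ℝ) : Prop :=
  ∀ᶠ l in atTop, ∀ i < 2 ^ l, ∀ δ > 0, ∀ᶠ n in atTop,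
    pr μ G (fun ω => c * cellS N T l i n ω + δ < cellS M T l i n ω) ≤ δ

lemma cellS_nonneg (X : ℝ → Ω → ℝ) (T : ℝ) (l i n : ℕ) (ω : Ω) : 0 ≤ cellS X T l i n ω :=
  Finset.sum_nonneg fun _ _ => sq_nonneg _

section
variable {μ : Measure Ω} [IsProbabilityMeasure μ] {F : Filtration ℝ m} {B B' : ℝ}
  {M N : ℝ → Ω → ℝ} {G : Set Ω}

lemma cell_conv (h : Drv μ F B M) {T : ℝ} (hT : 0 ≤ T) {Q : ℝ → Ω → ℝ}
    (hQ : ∀ t ∈ Icc 0 T, CP μ G (fun n => qsum M M t n) (Q t)) (l i : ℕ) (hi : i < 2 ^ l) :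
    CP μ G (fun n => cellS M T l i n)
      (fun ω => Q (pt T l (i + 1)) ω - Q (pt T l i) ω) := by
  have h1 : ∀ b ≤ 2 ^ l, CP μ G (fun n ω =>
      ∑ j ∈ Finset.range (b * 2 ^ n), dX M T (l + n) j ω * dX M T (l + n) j ω)
      (Q (pt T l b)) := fun b hb =>
    (hQ _ (pt_mem hT hb)).sub_zero (h.qsum_fine h hT G l b hb)
  have h2 := (h1 (i + 1) hi).sub (h1 i hi.le)
  convert h2 using 3 with n ω
  rw [Nat.succ_mul, Finset.sum_range_add, add_sub_cancel_left]
  simp [cellS, pow_two]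

lemma CellDom.of_qv (hM : Drv μ F B M) (hN : Drv μ F B' N) {T c : ℝ} (hT : 0 ≤ T) (hc : 0 ≤ c)
    {QM QN : ℝ → Ω → ℝ}
    (hQM : ∀ t ∈ Icc 0 T, CP μ G (fun n => qsum M M t n) (QM t))
    (hQN : ∀ t ∈ Icc 0 T, CP μ G (fun n => qsum N N t n) (QN t))
    (hdom : ∀ ω ∈ G, ∀ a b, 0 ≤ a → a ≤ b → QM b ω - QM a ω ≤ c * max (QN b ω - QN a ω) 0) :
    CellDom μ G T c M N := by
  refine Eventually.of_forall fun l i hi δ hδ => ?_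
  have h1 := cell_conv hM hT hQM l i hi (δ / 2) (by positivity)
  have hd : 0 < min (δ / 2) (δ / (2 * (c + 1))) := by positivity
  have h2 := cell_conv hN hT hQN l i hi _ hd
  filter_upwards [h1, h2] with n h1 h2
  refine (pr_or (fun ω hω h => ?_)).trans
    ((add_le_add h1 (h2.trans (min_le_left _ _))).trans_eq (by ring))
  by_contra hcon
  push Not at hcon
  obtain ⟨a, b⟩ := hcon
  have b := b.trans (min_le_right _ _)
  have hd := hdom ω hω (pt T l i) (pt T l (i + 1)) (pt_nonneg hT _ _)
    (pt_mono hT l (Nat.le_succ i))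
  rw [abs_le] at a b
  have hm : max (QN (pt T l (i + 1)) ω - QN (pt T l i) ω) 0 ≤
      cellS N T l i n ω + δ / (2 * (c + 1)) := by
    apply max_le
    · linarith
    · have := cellS_nonneg N T l i n ω
      positivity
  have hm' := mul_le_mul_of_nonneg_left hm hc
  have : c * (δ / (2 * (c + 1))) ≤ δ / 2 := by
    rw [mul_div_assoc', div_le_div_iff₀ (by positivity) (by positivity)]
    nlinarith
  linarith

lemma cell_total (X : ℝ → Ω → ℝ) (T : ℝ) (l n : ℕ) (v : ℕ → ℝ) (ω : Ω) :
    ∑ J ∈ Finset.range (2 ^ (l + n)), v J * dX X T (l + n) J ω ^ 2 =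
    ∑ i ∈ Finset.range (2 ^ l), ∑ j ∈ Finset.range (2 ^ n),
      v (i * 2 ^ n + j) * dX X T (l + n) (i * 2 ^ n + j) ω ^ 2 := by
  rw [pow_add, sum_range_mul']

lemma cell_total' (X : ℝ → Ω → ℝ) (T : ℝ) (l n : ℕ) (ω : Ω) :
    ∑ J ∈ Finset.range (2 ^ (l + n)), dX X T (l + n) J ω ^ 2 =
    ∑ i ∈ Finset.range (2 ^ l), cellS X T l i n ω := by
  have := cell_total X T l n (fun _ => 1) ω
  simpa [cellS] using this

lemma pt_cell_close {T : ℝ} (hT : 0 ≤ T) (l n i j : ℕ) (hj : j ≤ 2 ^ n) :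
    |pt T (l + n) (i * 2 ^ n + j) - pt T l i| ≤ T / 2 ^ l := by
  rw [← pt_add l n i, pt_sub]
  push_cast
  rw [add_sub_cancel_left, abs_of_nonneg (by positivity), pow_add,
    div_le_div_iff₀ (by positivity) (by positivity)]
  have : (j : ℝ) ≤ 2 ^ n := by exact_mod_cast hj
  have h3 : T * j ≤ T * 2 ^ n := by gcongr
  have : (0:ℝ) ≤ 2 ^ l := by positivity
  nlinarith

/-- L4 -/
lemma CellDom.weighted (hcd : CellDom μ G T c M N) (hM : Drv μ F B M) (hN : Drv μ F B' N)
    (hT : 0 ≤ T) (hc : 0 ≤ c) {w : ℝ → Ω → ℝ} (hwc : ∀ ω, Continuous fun t => w t ω)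
    (hwm : ∀ t, 0 ≤ t → Measurable (w t)) {W : ℝ} (hw0 : ∀ t ω, 0 ≤ w t ω)
    (hwW : ∀ t ω, w t ω ≤ W) {ε : ℝ} (hε : 0 < ε) :
    ∀ᶠ n in atTop, pr μ G (fun ω =>
      c * (∑ j ∈ Finset.range (2 ^ n), w (pt T n j) ω * dX N T n j ω ^ 2) + ε <
      ∑ j ∈ Finset.range (2 ^ n), w (pt T n j) ω * dX M T n j ω ^ 2) ≤ ε := by
  -- tightness level
  obtain ⟨K, hK, hKM, hKN⟩ : ∃ K > 0, B ^ 2 / K ≤ ε / 5 ∧ B' ^ 2 / K ≤ ε / 5 := by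
    refine ⟨(B ^ 2 + B' ^ 2 + 1) * 5 / ε, by positivity, ?_, ?_⟩
    · rw [div_div_eq_mul_div, div_le_iff₀ (by positivity)]; nlinarith [sq_nonneg B, sq_nonneg B']
    · rw [div_div_eq_mul_div, div_le_iff₀ (by positivity)]; nlinarith [sq_nonneg B, sq_nonneg B']
  set δ : ℝ := ε / (3 * (K + 1) * (c + 1)) with hδd
  have hδ : 0 < δ := by positivity
  obtain ⟨ρ, hρ, E, hE, hμE, hmod⟩ := mod_exists (μ := μ) hwc hwm hT hδ
    (show 0 < ε / 5 by positivity)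
  obtain ⟨l, hl1, hl2⟩ := (hcd.and (mesh_small T hρ)).exists
  have hW0 : 0 ≤ W + 1 := by
    haveI : Nonempty Ω := by
      by_contra hne
      rw [not_nonempty_iff] at hne
      have := measure_univ (μ := μ)
      rw [univ_eq_empty_iff.2 hne] at this
      simp at this
    have := (hw0 0 (Classical.arbitrary Ω)).trans (hwW 0 _)
    linarith
  set d : ℝ := min (ε / 5 / 2 ^ l) (ε / (3 * (W + 1) * 2 ^ l + 1)) with hdd
  have hd : 0 < d := by positivity
  have hall : ∀ᶠ n in atTop, ∀ i ∈ Finset.range (2 ^ l),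
      pr μ G (fun ω => c * cellS N T l i n ω + d < cellS M T l i n ω) ≤ d := by
    rw [Filter.eventually_all_finset]
    intro i hi
    exact hl1 i (Finset.mem_range.1 hi) d hd
  have hmain : ∀ᶠ n in atTop, pr μ G (fun ω =>
      c * (∑ j ∈ Finset.range (2 ^ (l + n)), w (pt T (l + n) j) ω * dX N T (l + n) j ω ^ 2) + ε <
      ∑ j ∈ Finset.range (2 ^ (l + n)), w (pt T (l + n) j) ω * dX M T (l + n) j ω ^ 2) ≤ ε := by
    filter_upwards [hall] with n hn
    have p1 := hM.sq_tight (μ := μ) hT G (l + n) (2 ^ (l + n)) hK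
    have p2 := hN.sq_tight (μ := μ) hT G (l + n) (2 ^ (l + n)) hK
    have p3 : pr μ G (fun ω => ω ∈ E) ≤ ε / 5 :=
      (measureReal_mono (fun ω h => h.2) (measure_ne_top _ _)).trans hμE
    have p4 : pr μ G (fun ω => ∃ i ∈ Finset.range (2 ^ l),
        c * cellS N T l i n ω + d < cellS M T l i n ω) ≤ ε / 5 := by
      refine (pr_exists _ _).trans ((Finset.sum_le_sum hn).trans ?_)
      rw [Finset.sum_const, Finset.card_range, nsmul_eq_mul]
      push_cast
      calc (2:ℝ) ^ l * d ≤ 2 ^ l * (ε / 5 / 2 ^ l) := by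
            gcongr; exact min_le_left _ _
        _ = ε / 5 := by field_simp
    refine (pr_or4 (fun ω hω h => ?_)).trans
      ((add_le_add (add_le_add (add_le_add p1 p2) p3) p4).trans (by linarith))
    by_contra hcon
    push Not at hcon
    obtain ⟨q1, q2, q3, q4⟩ := hcon
    have hclose : ∀ i < 2 ^ l, ∀ j < 2 ^ n,
        |w (pt T (l + n) (i * 2 ^ n + j)) ω - w (pt T l i) ω| ≤ δ := by
      intro i hi j hj
      refine hmod ω q3 _ (pt_mem hT ?_) _ (pt_mem hT hi.le)
        ((pt_cell_close hT l n i j hj.le).trans hl2)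
      calc i * 2 ^ n + j ≤ (i + 1) * 2 ^ n := by rw [add_mul]; omega
        _ ≤ 2 ^ l * 2 ^ n := Nat.mul_le_mul_right _ hi
        _ = 2 ^ (l + n) := (pow_add _ _ _).symm
    have u1 : ∑ j ∈ Finset.range (2 ^ (l + n)), w (pt T (l + n) j) ω * dX M T (l + n) j ω ^ 2 ≤
        ∑ i ∈ Finset.range (2 ^ l), w (pt T l i) ω * cellS M T l i n ω +
          δ * ∑ i ∈ Finset.range (2 ^ l), cellS M T l i n ω := by
      rw [cell_total M T l n (fun J => w (pt T (l + n) J) ω), Finset.mul_sum,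
        ← Finset.sum_add_distrib]
      refine Finset.sum_le_sum fun i hi => ?_
      rw [← add_mul, cellS, Finset.mul_sum]
      refine Finset.sum_le_sum fun j hj => ?_
      refine mul_le_mul_of_nonneg_right ?_ (sq_nonneg _)
      have := (abs_le.1 (hclose i (Finset.mem_range.1 hi) j (Finset.mem_range.1 hj))).2
      linarith
    have u2 : ∑ i ∈ Finset.range (2 ^ l), w (pt T l i) ω * cellS N T l i n ω ≤
        ∑ j ∈ Finset.range (2 ^ (l + n)), w (pt T (l + n) j) ω * dX N T (l + n) j ω ^ 2 +
          δ * ∑ i ∈ Finset.range (2 ^ l), cellS N T l i n ω := by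
      rw [cell_total N T l n (fun J => w (pt T (l + n) J) ω), Finset.mul_sum,
        ← Finset.sum_add_distrib]
      refine Finset.sum_le_sum fun i hi => ?_
      rw [cellS, Finset.mul_sum, Finset.mul_sum, ← Finset.sum_add_distrib]
      refine Finset.sum_le_sum fun j hj => ?_
      rw [← add_mul]
      refine mul_le_mul_of_nonneg_right ?_ (sq_nonneg _)
      have := (abs_le.1 (hclose i (Finset.mem_range.1 hi) j (Finset.mem_range.1 hj))).1
      linarith
    have u3 : ∑ i ∈ Finset.range (2 ^ l), w (pt T l i) ω * cellS M T l i n ω ≤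
        c * ∑ i ∈ Finset.range (2 ^ l), w (pt T l i) ω * cellS N T l i n ω + 2 ^ l * (W * d) := by
      have : ∑ i ∈ Finset.range (2 ^ l), (W * d) = 2 ^ l * (W * d) := by
        rw [Finset.sum_const, Finset.card_range, nsmul_eq_mul]; push_cast; rfl
      rw [← this, Finset.mul_sum, ← Finset.sum_add_distrib]
      refine Finset.sum_le_sum fun i hi => ?_
      have h1 := mul_le_mul_of_nonneg_left (q4 i hi) (hw0 (pt T l i) ω)
      have h2 := mul_le_mul_of_nonneg_right (hwW (pt T l i) ω) hd.le
      nlinarith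
    rw [cell_total'] at q1 q2
    have v1 : δ * ∑ i ∈ Finset.range (2 ^ l), cellS M T l i n ω ≤ δ * K := by gcongr
    have v2 : δ * ∑ i ∈ Finset.range (2 ^ l), cellS N T l i n ω ≤ δ * K := by gcongr
    have v3 := mul_le_mul_of_nonneg_left (u2.trans (add_le_add le_rfl v2)) hc
    have v4 : δ * K ≤ ε / 3 := by
      rw [hδd, div_mul_eq_mul_div, div_le_div_iff₀ (by positivity) (by positivity)]
      have : 0 ≤ ε * (K * c + 1 + c) := by positivity
      nlinarith
    have v5 : c * (δ * K) ≤ ε / 3 := by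
      rw [hδd, div_mul_eq_mul_div, mul_div_assoc', div_le_div_iff₀ (by positivity) (by positivity)]
      have : 0 ≤ ε * (K + 1 + c) := by positivity
      nlinarith
    have v6 : 2 ^ l * (W * d) ≤ ε / 3 := by
      have h1 : d ≤ ε / (3 * (W + 1) * 2 ^ l + 1) := min_le_right _ _
      have h2 : 2 ^ l * (W * d) ≤ 2 ^ l * (W + 1) * d := by
        have : 0 ≤ 2 ^ l * d := by positivity
        nlinarith
      refine h2.trans ((mul_le_mul_of_nonneg_left h1 (by positivity)).trans ?_)
      rw [mul_div_assoc', div_le_div_iff₀ (by positivity) (by positivity)]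
      nlinarith
    linarith
  rw [Filter.eventually_atTop] at hmain ⊢
  obtain ⟨n0, hn0⟩ := hmain
  refine ⟨l + n0, fun n hn => ?_⟩
  obtain ⟨k, rfl⟩ := Nat.exists_eq_add_of_le (show l ≤ n by omega)
  exact hn0 k (by omega)
end

/-- approximation property: coarse increments of `I` are transforms of `M` plus terms of tight
total variation. -/
def AP (μ : Measure Ω) (F : Filtration ℝ m) (T : ℝ) (G : Set Ω) (M I : ℝ → Ω → ℝ) : Prop :=
  ∃ K C : ℝ, 0 ≤ K ∧ 0 ≤ C ∧ ∀ᶠ k in atTop, ∀ ε > 0, ∃ (l : ℕ) (h : ℕ → Ω → ℝ) (b : ℕ → Ω → ℝ),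
    (∀ j, Measurable[F (pt T (k + l) j)] (h j)) ∧ (∀ j ω, |h j ω| ≤ C) ∧
    (∀ r > 0, pr μ G (fun ω => r < ∑ i ∈ Finset.range (2 ^ k), |b i ω|) ≤ K / r) ∧
    pr μ G (fun ω => ∃ i < 2 ^ k, ε < |dX I T k i ω -
      (∑ j ∈ Finset.range (2 ^ l), h (i * 2 ^ l + j) ω * dX M T (k + l) (i * 2 ^ l + j) ω
        + b i ω)|) ≤ ε

lemma meas_coarse {F : Filtration ℝ m} {T : ℝ} (hT : 0 ≤ T) {k l : ℕ} {c : ℕ → Ω → ℝ}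
    (hc : ∀ i, Measurable[F (pt T k i)] (c i)) (J : ℕ) :
    Measurable[F (pt T (k + l) J)] (c (J / 2 ^ l)) := by
  refine (hc (J / 2 ^ l)).mono (F.mono ?_) le_rfl
  rw [← pt_add k l]
  exact pt_mono hT _ (Nat.div_mul_le_self J _)

lemma block_div {l i j : ℕ} (hj : j < 2 ^ l) : (i * 2 ^ l + j) / 2 ^ l = i := by
  rw [Nat.add_comm, Nat.add_mul_div_right _ _ (by positivity), Nat.div_eq_of_lt hj, zero_add]

lemma exists_div_le (a : ℝ) {ε : ℝ} (hε : 0 < ε) : ∃ r > 0, a / r ≤ ε := by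
  refine ⟨(|a| + 1) / ε, by positivity, ?_⟩
  rw [div_div_eq_mul_div, div_le_iff₀ (by positivity)]
  nlinarith [le_abs_self a]

lemma exists_div_sq_le (a : ℝ) {ε : ℝ} (hε : 0 < ε) : ∃ r > 0, a / r ^ 2 ≤ ε := by
  obtain ⟨r, hr, h⟩ := exists_div_le |a| hε
  refine ⟨√r, Real.sqrt_pos.2 hr, ?_⟩
  rw [Real.sq_sqrt hr.le]
  exact (div_le_div_of_nonneg_right (le_abs_self a) hr.le).trans h

section
variable {μ : Measure Ω} [IsProbabilityMeasure μ] {F : Filtration ℝ m} {B B' T : ℝ}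
  {M N I : ℝ → Ω → ℝ} {G : Set Ω}

lemma Drv.gi (hM : Drv μ F B M) (hT : 0 ≤ T) {ε : ℝ} (hε : 0 < ε) :
    ∃ r > 0, ∀ (k : ℕ) (c : ℕ → Ω → ℝ), (∀ i, Measurable[F (pt T k i)] (c i)) →
      (∀ i ω, |c i ω| ≤ 1) →
      pr μ G (fun ω => r < |∑ i ∈ Finset.range (2 ^ k), c i ω * dX M T k i ω|) ≤ ε := by
  obtain ⟨r, hr, h⟩ := exists_div_sq_le (B ^ 2) hε
  refine ⟨r, hr, fun k c hc hc1 => ?_⟩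
  have h1 := hM.iso_le (μ := μ) hT k (2 ^ k) hc hc1
  have hb : Bdd m (fun ω => ∑ i ∈ Finset.range (2 ^ k), c i ω * dX M T k i ω) :=
    (((hM.md hT k).transform fun j => ⟨hc j, 1, hc1 j⟩).bdd_sum (2 ^ k)).mono (F.le _)
  refine (pr_le_integral_sq hb.sq.integrable hr).trans (le_trans ?_ h)
  refine div_le_div_of_nonneg_right (h1.trans_eq (by ring)) (by positivity)

lemma AP.gi (hI : AP μ F T G M I) (hM : Drv μ F B M) (hT : 0 ≤ T) {ε : ℝ} (hε : 0 < ε) :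
    ∃ r > 0, ∀ᶠ k in atTop, ∀ (c : ℕ → Ω → ℝ), (∀ i, Measurable[F (pt T k i)] (c i)) →
      (∀ i ω, |c i ω| ≤ 1) →
      pr μ G (fun ω => r < |∑ i ∈ Finset.range (2 ^ k), c i ω * dX I T k i ω|) ≤ ε := by
  obtain ⟨K, C, hK, hC, hev⟩ := hI
  obtain ⟨r1, hr1, h1⟩ := exists_div_sq_le (C ^ 2 * B ^ 2) (show 0 < ε / 3 by positivity)
  obtain ⟨r2, hr2, h2⟩ := exists_div_le K (show 0 < ε / 3 by positivity)
  refine ⟨r1 + r2 + 1, by positivity, ?_⟩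
  filter_upwards [hev] with k hk c hc hc1
  obtain ⟨l, h, b, hh, hhC, hb, herr⟩ := hk (min (ε / 3) (1 / 2 ^ k)) (by positivity)
  set c' : ℕ → Ω → ℝ := fun J ω => c (J / 2 ^ l) ω * h J ω with hc'
  have hc'm : ∀ J, Measurable[F (pt T (k + l) J)] (c' J) := fun J =>
    (meas_coarse hT hc J).mul (hh J)
  have hc'b : ∀ J ω, |c' J ω| ≤ C := fun J ω => by
    simp only [hc', abs_mul]
    have := hc1 (J / 2 ^ l) ω
    calc _ ≤ 1 * C := mul_le_mul this (hhC J ω) (abs_nonneg _) zero_le_one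
      _ = C := one_mul _
  have p1 : pr μ G (fun ω => r1 < |∑ J ∈ Finset.range (2 ^ (k + l)),
      c' J ω * dX M T (k + l) J ω|) ≤ ε / 3 := by
    have h3 := hM.iso_le (μ := μ) hT (k + l) (2 ^ (k + l)) hc'm hc'b
    have hbd : Bdd m (fun ω => ∑ i ∈ Finset.range (2 ^ (k + l)), c' i ω * dX M T (k + l) i ω) :=
      (((hM.md hT (k + l)).transform fun j => ⟨hc'm j, C, hc'b j⟩).bdd_sum _).mono (F.le _)
    exact (pr_le_integral_sq hbd.sq.integrable hr1).trans
      ((div_le_div_of_nonneg_right h3 (by positivity)).trans h1)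
  have p2 := (hb r2 hr2).trans h2
  have p3 := herr.trans (min_le_left _ _)
  refine (pr_or3 (fun ω hω h' => ?_)).trans ((add_le_add (add_le_add p1 p2) p3).trans (by linarith))
  by_contra hcon
  push Not at hcon
  obtain ⟨q1, q2, q3⟩ := hcon
  have e : ∑ i ∈ Finset.range (2 ^ k), c i ω * dX I T k i ω =
      ∑ J ∈ Finset.range (2 ^ (k + l)), c' J ω * dX M T (k + l) J ω +
      (∑ i ∈ Finset.range (2 ^ k), c i ω * b i ω +
      ∑ i ∈ Finset.range (2 ^ k), c i ω * (dX I T k i ω -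
      (∑ j ∈ Finset.range (2 ^ l), h (i * 2 ^ l + j) ω * dX M T (k + l) (i * 2 ^ l + j) ω
        + b i ω))) := by
    rw [pow_add, sum_range_mul', ← Finset.sum_add_distrib, ← Finset.sum_add_distrib]
    refine Finset.sum_congr rfl fun i _ => ?_
    have : ∑ j ∈ Finset.range (2 ^ l), c' (i * 2 ^ l + j) ω * dX M T (k + l) (i * 2 ^ l + j) ω =
        c i ω * ∑ j ∈ Finset.range (2 ^ l), h (i * 2 ^ l + j) ω *
          dX M T (k + l) (i * 2 ^ l + j) ω := by
      rw [Finset.mul_sum]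
      refine Finset.sum_congr rfl fun j hj => ?_
      simp only [hc', block_div (Finset.mem_range.1 hj)]
      ring
    rw [this]; ring
  have q4 : |∑ i ∈ Finset.range (2 ^ k), c i ω * b i ω| ≤ r2 := by
    refine (Finset.abs_sum_le_sum_abs _ _).trans (le_trans (Finset.sum_le_sum fun i _ => ?_) q2)
    rw [abs_mul]
    exact mul_le_of_le_one_left (abs_nonneg _) (hc1 i ω)
  have q5 : |∑ i ∈ Finset.range (2 ^ k), c i ω * (dX I T k i ω -
      (∑ j ∈ Finset.range (2 ^ l), h (i * 2 ^ l + j) ω * dX M T (k + l) (i * 2 ^ l + j) ω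
        + b i ω))| ≤ 1 := by
    refine (Finset.abs_sum_le_sum_abs _ _).trans ?_
    have : ∑ i ∈ Finset.range (2 ^ k), (1 / 2 ^ k : ℝ) = 1 := by
      rw [Finset.sum_const, Finset.card_range, nsmul_eq_mul]; push_cast; field_simp
    rw [← this]
    refine Finset.sum_le_sum fun i hi => ?_
    rw [abs_mul]
    exact (mul_le_of_le_one_left (abs_nonneg _) (hc1 i ω)).trans
      ((q3 i (Finset.mem_range.1 hi)).trans (min_le_right _ _))
  rw [e] at h'
  have := abs_add_three (∑ J ∈ Finset.range (2 ^ (k + l)), c' J ω * dX M T (k + l) J ω)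
    (∑ i ∈ Finset.range (2 ^ k), c i ω * b i ω) (∑ i ∈ Finset.range (2 ^ k), c i ω * (dX I T k i ω -
      (∑ j ∈ Finset.range (2 ^ l), h (i * 2 ^ l + j) ω * dX M T (k + l) (i * 2 ^ l + j) ω
        + b i ω)))
  rw [← add_assoc] at h'
  linarith

/-- exact orthogonality on fine grids -/
def Orth (μ : Measure Ω) (F : Filtration ℝ m) (T : ℝ) (M N : ℝ → Ω → ℝ) : Prop :=
  ∀ᶠ n in atTop, ∀ i, ∀ Z, Bdd (F (pt T n i)) Z → ∫ ω, Z ω * (dX M T n i ω * dX N T n i ω) ∂μ = 0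

/-- truncation of a martingale transform -/
lemma MD.trunc {Fn : ℕ → MeasurableSpace Ω} {d : ℕ → Ω → ℝ} (h : MD μ Fn d) {D L : ℝ} (hL : 0 ≤ L)
    (hD0 : 0 ≤ D) (hD : ∀ i ω, |d i ω| ≤ D) :
    ∃ ξ : ℕ → Ω → ℝ, (∀ j, Measurable[Fn j] (ξ j)) ∧ (∀ j ω, |ξ j ω| ≤ 1) ∧
      (∀ i ω, |∑ j ∈ Finset.range i, ξ j ω * d j ω| ≤ L + D) ∧
      ∀ n ω, (∀ i ≤ n, |∑ j ∈ Finset.range i, d j ω| ≤ L) → ∀ j < n, ξ j ω = 1 := by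
  classical
  set P : ℕ → Ω → Prop := fun j ω => ∀ k ≤ j, |∑ j ∈ Finset.range k, d j ω| ≤ L with hP
  have hPm : ∀ j, MeasurableSet[Fn j] {ω | P j ω} := by
    intro j
    have : {ω | P j ω} = ⋂ k ∈ Finset.range (j + 1),
        {ω | |∑ j ∈ Finset.range k, d j ω| ≤ L} := by
      ext ω; simp [hP]
    rw [this]
    refine Finset.measurableSet_biInter _ fun k hk => ?_
    have hk' : k ≤ j := Nat.lt_succ_iff.1 (Finset.mem_range.1 hk)
    exact ((h.bdd_sum k).mono (h.mono hk')).abs.mset_le L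
  refine ⟨fun j ω => if P j ω then 1 else 0, fun j => (Bdd.ind (hPm j)).1, fun j ω => ?_, ?_, ?_⟩
  · show |if P j ω then (1:ℝ) else 0| ≤ 1
    split_ifs <;> simp
  · intro i ω
    have key : ∀ i, (∃ k, P k ω ∧ k ≤ i ∧ ∑ j ∈ Finset.range i, (if P j ω then (1:ℝ) else 0) * d j ω
        = ∑ j ∈ Finset.range k, d j ω) ∨ |∑ j ∈ Finset.range i, (if P j ω then (1:ℝ) else 0) * d j ω|
          ≤ L + D ∧ ¬ P i ω := by
      intro i
      induction i with
      | zero => 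
        left
        refine ⟨0, fun k hk => ?_, le_rfl, by simp⟩
        rw [Nat.le_zero.1 hk]; simpa using hL
      | succ i ih =>
        by_cases hPi : P i ω
        · have e : ∑ j ∈ Finset.range i, (if P j ω then (1:ℝ) else 0) * d j ω
              = ∑ j ∈ Finset.range i, d j ω := by
            refine Finset.sum_congr rfl fun j hj => ?_
            have : P j ω := fun k hk => hPi k (hk.trans (Finset.mem_range.1 hj).le)
            simp [this]
          by_cases hPi1 : P (i + 1) ω
          · left
            refine ⟨i + 1, hPi1, le_rfl, ?_⟩
            rw [Finset.sum_range_succ, e, if_pos hPi, one_mul, Finset.sum_range_succ]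
          · right
            refine ⟨?_, hPi1⟩
            rw [Finset.sum_range_succ, e, if_pos hPi, one_mul]
            exact (abs_add_le _ _).trans (add_le_add (hPi i le_rfl) (hD i ω))
        · right
          have hPi1 : ¬ P (i + 1) ω := fun hp => hPi fun k hk => hp k (by omega)
          refine ⟨?_, hPi1⟩
          rw [Finset.sum_range_succ, if_neg hPi, zero_mul, add_zero]
          rcases ih with ⟨k, hk, _, e⟩ | ⟨h1, _⟩
          · rw [e]; have := hk k le_rfl; linarith
          · exact h1
    show |∑ j ∈ Finset.range i, (if P j ω then (1:ℝ) else 0) * d j ω| ≤ L + D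
    rcases key i with ⟨k, hk, _, e⟩ | ⟨h1, _⟩
    · rw [e]; have := hk k le_rfl; linarith
    · exact h1
  · intro n ω hn j hj
    have : P j ω := fun k hk => hn k (by omega)
    show (if P j ω then (1:ℝ) else 0) = 1
    simp [this]

/-- block products are coarse martingale differences -/
lemma block_md (hM : Drv μ F B M) (hN : Drv μ F B' N) (hT : 0 ≤ T) {k l : ℕ}
    (ho : ∀ i, ∀ Z, Bdd (F (pt T (k + l) i)) Z →
      ∫ ω, Z ω * (dX M T (k + l) i ω * dX N T (k + l) i ω) ∂μ = 0)
    {h w : ℕ → Ω → ℝ} (hh : ∀ j, Bdd (F (pt T (k + l) j)) (h j))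
    (hw : ∀ i, Bdd (F (pt T k i)) (w i)) :
    MD μ (fun i => F (pt T k i)) (fun i ω => w i ω * (dX N T k i ω *
      ∑ j ∈ Finset.range (2 ^ l), h (i * 2 ^ l + j) ω * dX M T (k + l) (i * 2 ^ l + j) ω)) := by
  have hbM := fun J => hM.bdd_dX hT (k + l) J
  have hbN := fun J => hN.bdd_dX hT (k + l) J
  have mdM := (hM.md hT (k + l)).transform hh
  have mdN := hN.md hT (k + l)
  -- block sums
  have hZb : ∀ i r, Bdd (F (pt T (k + l) (i * 2 ^ l + r))) (fun ω =>
      ∑ j ∈ Finset.range r, h (i * 2 ^ l + j) ω * dX M T (k + l) (i * 2 ^ l + j) ω) := by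
    intro i r
    refine Bdd.sum _ fun j hj => ?_
    exact (mdM.bdd (i * 2 ^ l + j)).mono (F.mono (pt_mono hT _ (by
      have := Finset.mem_range.1 hj; omega)))
  have hNb : ∀ i r, Bdd (F (pt T (k + l) (i * 2 ^ l + r))) (fun ω =>
      N (pt T (k + l) (i * 2 ^ l + r)) ω - N (pt T (k + l) (i * 2 ^ l)) ω) := by
    intro i r
    exact (hN.bdd (pt_nonneg hT _ _)).sub ((hN.bdd (pt_nonneg hT _ _)).mono
      (F.mono (pt_mono hT _ (by omega))))
  have hend : ∀ i, pt T (k + l) (i * 2 ^ l + 2 ^ l) = pt T k (i + 1) := by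
    intro i; rw [← pt_add k l (i + 1)]; congr 1; ring
  have hdN : ∀ i ω, dX N T k i ω =
      N (pt T (k + l) (i * 2 ^ l + 2 ^ l)) ω - N (pt T (k + l) (i * 2 ^ l)) ω := by
    intro i ω; rw [hend, pt_add, dX]
  have main : ∀ i, ∀ V, Bdd (F (pt T k i)) V → ∀ r, ∫ ω, V ω *
      ((N (pt T (k + l) (i * 2 ^ l + r)) ω - N (pt T (k + l) (i * 2 ^ l)) ω) *
      ∑ j ∈ Finset.range r, h (i * 2 ^ l + j) ω * dX M T (k + l) (i * 2 ^ l + j) ω) ∂μ = 0 := by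
    intro i V hV r
    rw [← pt_add k l i] at hV
    induction r with
    | zero => simp
    | succ r ih =>
      set J := i * 2 ^ l + r with hJ
      have hVJ : Bdd (F (pt T (k + l) J)) V := hV.mono (F.mono (pt_mono hT _ (by omega)))
      set ZZ : Ω → ℝ := fun ω =>
        ∑ j ∈ Finset.range r, h (i * 2 ^ l + j) ω * dX M T (k + l) (i * 2 ^ l + j) ω with hZZ
      set NN : Ω → ℝ := fun ω => N (pt T (k + l) J) ω - N (pt T (k + l) (i * 2 ^ l)) ω with hNN
      have i1 : ∫ ω, (V ω * ZZ ω) * dX N T (k + l) J ω ∂μ = 0 :=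
        mdN.orth J _ (hVJ.mul (hZb i r))
      have i2 : ∫ ω, (V ω * NN ω) * (h J ω * dX M T (k + l) J ω) ∂μ = 0 :=
        mdM.orth J _ (hVJ.mul (hNb i r))
      have i3 : ∫ ω, (V ω * h J ω) * (dX M T (k + l) J ω * dX N T (k + l) J ω) ∂μ = 0 :=
        ho J _ (hVJ.mul (hh J))
      have bV := hVJ.mono (F.le _)
      have bZ := (hZb i r).mono (F.le _)
      have bN := (hNb i r).mono (F.le _)
      have bm := (hbM J).mono (F.le _)
      have bn := (hbN J).mono (F.le _)
      have bh := (hh J).mono (F.le _)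
      have e : ∀ ω, V ω * ((N (pt T (k + l) (i * 2 ^ l + (r + 1))) ω
          - N (pt T (k + l) (i * 2 ^ l)) ω) *
          ∑ j ∈ Finset.range (r + 1), h (i * 2 ^ l + j) ω * dX M T (k + l) (i * 2 ^ l + j) ω) =
          V ω * (NN ω * ZZ ω) + ((V ω * ZZ ω) * dX N T (k + l) J ω +
          ((V ω * NN ω) * (h J ω * dX M T (k + l) J ω) +
          (V ω * h J ω) * (dX M T (k + l) J ω * dX N T (k + l) J ω))) := by
        intro ω
        rw [Finset.sum_range_succ]
        simp only [hZZ, hNN, dX]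
        rw [show i * 2 ^ l + (r + 1) = J + 1 by rw [hJ]; ring]
        ring
      simp_rw [e]
      rw [integral_add (bV.mul (bN.mul bZ)).integrable
        (((bV.mul bZ).mul bn).add (((bV.mul bN).mul (bh.mul bm)).add
          ((bV.mul bh).mul (bm.mul bn)))).integrable,
        integral_add ((bV.mul bZ).mul bn).integrable (((bV.mul bN).mul (bh.mul bm)).add
          ((bV.mul bh).mul (bm.mul bn))).integrable,
        integral_add ((bV.mul bN).mul (bh.mul bm)).integrable
          ((bV.mul bh).mul (bm.mul bn)).integrable, i1, i2, i3, ih]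
      simp
  refine ⟨fun i => F.le _, fun i j hij => F.mono (pt_mono hT k hij), fun i => ?_, fun i V hV => ?_⟩
  · refine ((hw i).mono (F.mono (pt_mono hT k (Nat.le_succ i)))).mul ((hN.bdd_dX hT k i).mul ?_)
    have := hZb i (2 ^ l)
    rwa [hend] at this
  · have := main i (fun ω => V ω * w i ω) (hV.mul (hw i)) (2 ^ l)
    simp_rw [hdN]
    simpa [mul_assoc] using this

/-- coarse increments of a transform are martingale differences -/
lemma block_md1 (hM : Drv μ F B M) (hT : 0 ≤ T) {k l : ℕ}
    {h : ℕ → Ω → ℝ} (hh : ∀ j, Bdd (F (pt T (k + l) j)) (h j)) :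
    MD μ (fun i => F (pt T k i)) (fun i ω =>
      ∑ j ∈ Finset.range (2 ^ l), h (i * 2 ^ l + j) ω * dX M T (k + l) (i * 2 ^ l + j) ω) := by
  have mdM := (hM.md hT (k + l)).transform hh
  refine ⟨fun i => F.le _, fun i j hij => F.mono (pt_mono hT k hij), fun i => ?_, fun i V hV => ?_⟩
  · refine Bdd.sum _ fun j hj => ?_
    refine (mdM.bdd (i * 2 ^ l + j)).mono (F.mono ?_)
    rw [← pt_add k l (i + 1)]
    refine pt_mono hT _ ?_
    have := Finset.mem_range.1 hj
    rw [add_mul]; omega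
  · rw [← pt_add k l i] at hV
    simp_rw [Finset.mul_sum]
    have hVJ : ∀ j, Bdd (F (pt T (k + l) (i * 2 ^ l + j))) V :=
      fun j => hV.mono (F.mono (pt_mono hT _ (by omega)))
    rw [integral_finsetSum]
    · exact Finset.sum_eq_zero fun j _ => mdM.orth _ V (hVJ j)
    · intro j _
      exact (((hVJ j).mono (F.le _)).mul (mdM.bddm _)).integrable

end

section
variable {μ : Measure Ω} [IsProbabilityMeasure μ] {F : Filtration ℝ m} {B B' T : ℝ}
  {M N I : ℝ → Ω → ℝ} {G : Set Ω}

lemma pr_exc {E : Set Ω} {ε : ℝ} (hE : μ.real E ≤ ε) : pr μ G (fun ω => ω ∈ E) ≤ ε :=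
  (measureReal_mono (fun _ h => h.2) (measure_ne_top _ _)).trans hE

lemma dX_bd {X : ℝ → Ω → ℝ} (h : Drv μ F B X) (hT : 0 ≤ T) (n i : ℕ) (ω : Ω) :
    |dX X T n i ω| ≤ 2 * B := by
  have h1 := h.bd _ (pt_nonneg hT n (i + 1)) ω
  have h2 := h.bd _ (pt_nonneg hT n i) ω
  unfold dX
  have := abs_sub (X (pt T n (i + 1)) ω) (X (pt T n i) ω)
  linarith

lemma mesh_pt (hT : 0 ≤ T) {n i : ℕ} {ρ : ℝ} (h : T / 2 ^ n ≤ ρ) :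
    |pt T n (i + 1) - pt T n i| ≤ ρ := by
  have e : pt T n (i + 1) - pt T n i = T / 2 ^ n := by rw [pt_sub]; push_cast; ring
  rw [e, abs_of_nonneg (by positivity)]; exact h

lemma Drv.max_tight (hM : Drv μ F B M) (hT : 0 ≤ T) {C : ℝ} (hC : 0 ≤ C) {ε : ℝ} (hε : 0 < ε) :
    ∃ L > 0, ∀ (n : ℕ) (h : ℕ → Ω → ℝ), (∀ j, Measurable[F (pt T n j)] (h j)) →
      (∀ j ω, |h j ω| ≤ C) →
      pr μ G (fun ω => ∃ i ≤ 2 ^ n, L < |∑ j ∈ Finset.range i, h j ω * dX M T n j ω|) ≤ ε := by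
  obtain ⟨κ, hκ, h1⟩ := exists_div_le (C ^ 2 * B ^ 2) (show 0 < ε / 2 by positivity)
  obtain ⟨L, hL, h2⟩ := exists_div_sq_le (κ + (C * (2 * B)) ^ 2) (show 0 < ε / 2 by positivity)
  refine ⟨L, hL, fun n h hh hhC => ?_⟩
  have md := (hM.md hT n).transform fun j => (⟨hh j, C, hhC j⟩ : Bdd _ (h j))
  have hd : ∀ ω, ∀ i < 2 ^ n, (h i ω * dX M T n i ω) ^ 2 ≤ (C * (2 * B)) ^ 2 := by
    intro ω i _
    rw [← sq_abs, abs_mul]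
    exact pow_le_pow_left₀ (by positivity)
      (mul_le_mul (hhC i ω) (dX_bd hM hT n i ω) (abs_nonneg _) hC) 2
  refine (md.len (G := G) (2 ^ n) hκ.le hL (integrable_const _) hd (fun _ => sq_nonneg _)).trans ?_
  have hb : Bdd m (fun ω => ∑ j ∈ Finset.range (2 ^ n), (h j ω * dX M T n j ω) ^ 2) :=
    Bdd.sum _ fun j _ => (md.bddm j).sq
  have h3 := pr_le_integral (μ := μ) (G := G) hb.integrable
    (fun ω => Finset.sum_nonneg fun j _ => sq_nonneg _) hκ
  rw [← md.sq' (2 ^ n)] at h3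
  have h4 := div_le_div_of_nonneg_right (hM.iso_le (μ := μ) hT n (2 ^ n) hh hhC) hκ.le
  have h5 : ∫ _ : Ω, (C * (2 * B)) ^ 2 ∂μ = (C * (2 * B)) ^ 2 := by simp
  rw [h5]
  linarith

set_option maxHeartbeats 1600000 in
lemma AP.ortho (hI : AP μ F T G M I) (hM : Drv μ F B M) (hN : Drv μ F B' N) (ho : Orth μ F T M N)
    (hT : 0 ≤ T) {W : ℝ} (hW : 0 ≤ W) {ε : ℝ} (hε : 0 < ε) :
    ∀ᶠ k in atTop, ∀ w : ℕ → Ω → ℝ, (∀ i, Measurable[F (pt T k i)] (w i)) →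
      (∀ i ω, |w i ω| ≤ W) →
      pr μ G (fun ω => ε < |∑ i ∈ Finset.range (2 ^ k), w i ω * (dX N T k i ω * dX I T k i ω)|)
        ≤ ε := by
  obtain ⟨K, C, hK, hC, hev⟩ := hI
  have hB := hM.B_nonneg
  have hB' := hN.B_nonneg
  obtain ⟨r2, hr2, h2⟩ := exists_div_le K (show 0 < ε / 5 by positivity)
  obtain ⟨L, hL, hLp⟩ := hM.max_tight (G := G) hT hC (show 0 < ε / 5 by positivity)
  obtain ⟨R3, hR3, h3⟩ := exists_div_le (C ^ 2 * B ^ 2) (show 0 < ε / 20 by positivity)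
  set D : ℝ := C * (2 * B) with hD
  have hD0 : 0 ≤ D := by positivity
  set L' : ℝ := 2 * (L + D) with hL'
  set κ : ℝ := ε / 20 * (ε / 3) ^ 2 with hκ
  have hκ0 : 0 < κ := by positivity
  set δ : ℝ := κ / (W ^ 2 * R3 + 1) with hδ
  have hδ0 : 0 < δ := by positivity
  set η : ℝ := min (κ / (W ^ 2 * L' ^ 2 + 1)) (δ * (ε / 20)) with hη
  have hη0 : 0 < η := by positivity
  obtain ⟨ρ, hρ, mx, hmx, hmx0, hIntg, hosc⟩ := hN.osc (μ := μ) hT hη0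
  obtain ⟨ρ', hρ', E, hE, hEμ, hmod⟩ := hN.toAdp.mod (μ := μ) hT
    (show 0 < ε / 3 / (W * r2 + 1) by positivity) (show 0 < ε / 5 by positivity)
  obtain ⟨n0, hn0⟩ := eventually_atTop.1 ho
  filter_upwards [hev, mesh_small T hρ, mesh_small T hρ', eventually_ge_atTop n0]
    with k hk hkρ hkρ' hkn w hw hwW
  obtain ⟨l, h, b, hh, hhC, hb, herr⟩ :=
    hk (min (ε / 5) (ε / 3 / (2 ^ k * (W * (2 * B')) + 1))) (by positivity)
  have ho' := hn0 (k + l) (by omega)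
  have mdd := (hM.md hT (k + l)).transform fun j => (⟨hh j, C, hhC j⟩ : Bdd _ (h j))
  obtain ⟨ξ, hξm, hξ1, hξb, hξe⟩ := mdd.trunc (D := D) (L := L) hL.le hD0 (fun i ω => by
    rw [abs_mul]
    exact mul_le_mul (hhC i ω) (dX_bd hM hT _ i ω) (abs_nonneg _) hC)
  set h' : ℕ → Ω → ℝ := fun j ω => ξ j ω * h j ω with hh'
  have hh'm : ∀ j, Measurable[F (pt T (k + l) j)] (h' j) := fun j => (hξm j).mul (hh j)
  have hh'C : ∀ j ω, |h' j ω| ≤ C := fun j ω => by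
    simp only [hh', abs_mul]
    calc _ ≤ 1 * C := mul_le_mul (hξ1 j ω) (hhC j ω) (abs_nonneg _) zero_le_one
      _ = C := one_mul _
  have hh'b : ∀ j, Bdd (F (pt T (k + l) j)) (h' j) := fun j => ⟨hh'm j, C, hh'C j⟩
  set ΔZ : ℕ → Ω → ℝ := fun i ω =>
    ∑ j ∈ Finset.range (2 ^ l), h' (i * 2 ^ l + j) ω * dX M T (k + l) (i * 2 ^ l + j) ω with hΔZ
  have md1 := block_md1 hM hT hh'b
  have md2 := block_md hM hN hT ho' hh'b (fun i => (⟨hw i, W, hwW i⟩ : Bdd _ (w i)))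
  have hΔb : ∀ i ω, |ΔZ i ω| ≤ L' := by
    intro i ω
    have e : ΔZ i ω = ∑ j ∈ Finset.range (i * 2 ^ l + 2 ^ l), ξ j ω * (h j ω * dX M T (k + l) j ω)
        - ∑ j ∈ Finset.range (i * 2 ^ l), ξ j ω * (h j ω * dX M T (k + l) j ω) := by
      rw [Finset.sum_range_add]; simp only [hΔZ, hh', mul_assoc]; ring
    rw [e]
    have a1 := hξb (i * 2 ^ l + 2 ^ l) ω
    have a2 := hξb (i * 2 ^ l) ω
    have := abs_sub (∑ j ∈ Finset.range (i * 2 ^ l + 2 ^ l), ξ j ω * (h j ω * dX M T (k + l) j ω))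
      (∑ j ∈ Finset.range (i * 2 ^ l), ξ j ω * (h j ω * dX M T (k + l) j ω))
    rw [hL']; linarith
  have hNmx : ∀ ω, ∀ i < 2 ^ k, dX N T k i ω ^ 2 ≤ mx ω := fun ω i hi =>
    hosc ω _ (pt_mem hT hi) _ (pt_mem hT hi.le) (mesh_pt hT hkρ)
  have hwsq : ∀ i ω, w i ω ^ 2 ≤ W ^ 2 := fun i ω => by
    rw [← sq_abs]; exact pow_le_pow_left₀ (abs_nonneg _) (hwW i ω) 2
  have hZsq : ∀ i ω, ΔZ i ω ^ 2 ≤ L' ^ 2 := fun i ω => by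
    rw [← sq_abs]; exact pow_le_pow_left₀ (abs_nonneg _) (hΔb i ω) 2
  -- bound on the total square
  have hS : pr μ G (fun ω => R3 < ∑ i ∈ Finset.range (2 ^ k), ΔZ i ω ^ 2) ≤ ε / 20 := by
    have hbS : Bdd m (fun ω => ∑ i ∈ Finset.range (2 ^ k), ΔZ i ω ^ 2) :=
      Bdd.sum _ fun j _ => (md1.bddm j).sq
    refine (pr_le_integral hbS.integrable
      (fun ω => Finset.sum_nonneg fun j _ => sq_nonneg _) hR3).trans (le_trans ?_ h3)
    refine div_le_div_of_nonneg_right ?_ hR3.le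
    rw [← md1.sq' (2 ^ k)]
    have := hM.iso_le (μ := μ) hT (k + l) (2 ^ (k + l)) hh'm hh'C
    refine le_trans (le_of_eq ?_) this
    congr 1; ext ω
    rw [pow_add, sum_range_mul']
  have hmxp : pr μ G (fun ω => δ < mx ω) ≤ ε / 20 := by
    refine (pr_le_integral hmx.integrable hmx0 hδ0).trans ?_
    rw [div_le_iff₀ hδ0]
    calc _ ≤ η := hIntg
      _ ≤ δ * (ε / 20) := min_le_right _ _
      _ = _ := mul_comm _ _
  have hmain : pr μ G (fun ω => ∃ i ≤ 2 ^ k, ε / 3 < |∑ j ∈ Finset.range i,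
      w j ω * (dX N T k j ω * ΔZ j ω)|) ≤ ε / 5 := by
    have hl := md2.len (G := G) (2 ^ k) hκ0.le (show 0 < ε / 3 by positivity)
      (mx := fun ω => W ^ 2 * L' ^ 2 * mx ω)
      ((hmx.integrable).const_mul _) (fun ω i hi => by
        show (w i ω * (dX N T k i ω * ΔZ i ω)) ^ 2 ≤ _
        have e : (w i ω * (dX N T k i ω * ΔZ i ω)) ^ 2 = w i ω ^ 2 * ΔZ i ω ^ 2 * dX N T k i ω ^ 2 := by
          ring
        rw [e]
        exact mul_le_mul (mul_le_mul (hwsq i ω) (hZsq i ω) (sq_nonneg _) (sq_nonneg _))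
          (hNmx ω i hi) (sq_nonneg _) (by positivity)) (fun ω => by have := hmx0 ω; positivity)
    refine hl.trans ?_
    have p1 : pr μ G (fun ω => κ < ∑ j ∈ Finset.range (2 ^ k),
        (w j ω * (dX N T k j ω * ΔZ j ω)) ^ 2) ≤ ε / 20 + ε / 20 := by
      refine (pr_or (fun ω _ h' => ?_)).trans (add_le_add hmxp hS)
      by_contra hcon
      push Not at hcon
      obtain ⟨q1, q2⟩ := hcon
      have : ∑ j ∈ Finset.range (2 ^ k), (w j ω * (dX N T k j ω * ΔZ j ω)) ^ 2 ≤
          W ^ 2 * δ * ∑ j ∈ Finset.range (2 ^ k), ΔZ j ω ^ 2 := by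
        rw [Finset.mul_sum]
        refine Finset.sum_le_sum fun i hi => ?_
        have e : (w i ω * (dX N T k i ω * ΔZ i ω)) ^ 2 = w i ω ^ 2 * dX N T k i ω ^ 2 * ΔZ i ω ^ 2 := by
          ring
        rw [e]
        refine mul_le_mul_of_nonneg_right ?_ (sq_nonneg _)
        exact mul_le_mul (hwsq i ω) ((hNmx ω i (Finset.mem_range.1 hi)).trans q1) (sq_nonneg _)
          (sq_nonneg _)
      have h5 : W ^ 2 * δ * ∑ j ∈ Finset.range (2 ^ k), ΔZ j ω ^ 2 ≤ W ^ 2 * δ * R3 :=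
        mul_le_mul_of_nonneg_left q2 (by positivity)
      have h6 : W ^ 2 * δ * R3 ≤ κ := by
        have : δ * (W ^ 2 * R3 + 1) = κ := by rw [hδ]; field_simp
        nlinarith
      linarith
    have p2 : (κ + ∫ ω, W ^ 2 * L' ^ 2 * mx ω ∂μ) / (ε / 3) ^ 2 ≤ ε / 20 + ε / 20 := by
      rw [div_le_iff₀ (by positivity), integral_const_mul]
      have h7 : W ^ 2 * L' ^ 2 * ∫ ω, mx ω ∂μ ≤ κ := by
        have a1 : ∫ ω, mx ω ∂μ ≤ κ / (W ^ 2 * L' ^ 2 + 1) := hIntg.trans (min_le_left _ _)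
        have a2 : 0 ≤ ∫ ω, mx ω ∂μ := integral_nonneg hmx0
        rw [le_div_iff₀ (by positivity)] at a1
        nlinarith
      rw [hκ] at h7 ⊢
      linarith
    linarith
  have p2 := (hb r2 hr2).trans h2
  have p3 := herr.trans (min_le_left _ _)
  have p4 : pr μ G (fun ω => ω ∈ E) ≤ ε / 5 := pr_exc hEμ
  have p5 := hLp (k + l) h hh hhC
  refine (pr_or (q := fun ω => (∃ i ≤ 2 ^ k, ε / 3 < |∑ j ∈ Finset.range i,
      w j ω * (dX N T k j ω * ΔZ j ω)|)) (fun ω hω h9 => ?_)).trans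
    ((add_le_add hmain (pr_or4 (fun ω _ h => h)
      |>.trans (add_le_add (add_le_add (add_le_add p2 p3) p4) p5))).trans (by linarith))
  by_contra hcon
  push Not at hcon
  obtain ⟨q1, q2, q3, q4, q5⟩ := hcon
  have q1' := q1 (2 ^ k) le_rfl
  have hξ := hξe (2 ^ (k + l)) ω q5
  set er : ℕ → ℝ := fun i => dX I T k i ω -
      (∑ j ∈ Finset.range (2 ^ l), h (i * 2 ^ l + j) ω * dX M T (k + l) (i * 2 ^ l + j) ω
        + b i ω) with her
  have e : ∑ i ∈ Finset.range (2 ^ k), w i ω * (dX N T k i ω * dX I T k i ω) =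
      ∑ i ∈ Finset.range (2 ^ k), w i ω * (dX N T k i ω * ΔZ i ω) +
      ∑ i ∈ Finset.range (2 ^ k), w i ω * (dX N T k i ω * b i ω) +
      ∑ i ∈ Finset.range (2 ^ k), w i ω * (dX N T k i ω * er i) := by
    rw [← Finset.sum_add_distrib, ← Finset.sum_add_distrib]
    refine Finset.sum_congr rfl fun i hi => ?_
    have : ΔZ i ω = ∑ j ∈ Finset.range (2 ^ l),
        h (i * 2 ^ l + j) ω * dX M T (k + l) (i * 2 ^ l + j) ω := by
      refine Finset.sum_congr rfl fun j hj => ?_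
      simp only [hh']
      rw [hξ, one_mul]
      have h1 := Finset.mem_range.1 hi
      have h2 := Finset.mem_range.1 hj
      calc i * 2 ^ l + j < i * 2 ^ l + 2 ^ l := by omega
        _ = (i + 1) * 2 ^ l := by ring
        _ ≤ 2 ^ k * 2 ^ l := Nat.mul_le_mul_right _ h1
        _ = 2 ^ (k + l) := (pow_add _ _ _).symm
    simp only [her]
    rw [this]; ring
  have b1 : |∑ i ∈ Finset.range (2 ^ k), w i ω * (dX N T k i ω * b i ω)| ≤ ε / 3 := by
    have : |∑ i ∈ Finset.range (2 ^ k), w i ω * (dX N T k i ω * b i ω)| ≤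
        (W * (ε / 3 / (W * r2 + 1))) * ∑ i ∈ Finset.range (2 ^ k), |b i ω| := by
      refine (Finset.abs_sum_le_sum_abs _ _).trans ?_
      rw [Finset.mul_sum]
      refine Finset.sum_le_sum fun i hi => ?_
      rw [abs_mul, abs_mul, ← mul_assoc]
      have hi' := Finset.mem_range.1 hi
      refine mul_le_mul_of_nonneg_right (mul_le_mul (hwW i ω) ?_ (abs_nonneg _) hW) (abs_nonneg _)
      exact hmod ω q4 _ (pt_mem hT hi') _ (pt_mem hT hi'.le) (mesh_pt hT hkρ')
    refine this.trans ((mul_le_mul_of_nonneg_left q2 (by positivity)).trans ?_)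
    have : ε / 3 / (W * r2 + 1) * (W * r2 + 1) = ε / 3 := by field_simp
    have h0 : 0 < ε / 3 / (W * r2 + 1) := by positivity
    nlinarith
  have b2 : |∑ i ∈ Finset.range (2 ^ k), w i ω * (dX N T k i ω * er i)| ≤ ε / 3 := by
    set θ := ε / 3 / (2 ^ k * (W * (2 * B')) + 1) with hθ
    have h0 : 0 < θ := by positivity
    have : |∑ i ∈ Finset.range (2 ^ k), w i ω * (dX N T k i ω * er i)| ≤
        ∑ i ∈ Finset.range (2 ^ k), W * (2 * B') * θ := by
      refine (Finset.abs_sum_le_sum_abs _ _).trans ?_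
      refine Finset.sum_le_sum fun i hi => ?_
      rw [abs_mul, abs_mul, ← mul_assoc]
      have hi' := Finset.mem_range.1 hi
      exact mul_le_mul (mul_le_mul (hwW i ω) (dX_bd hN hT _ i ω) (abs_nonneg _) hW)
        ((q3 i hi').trans (min_le_right _ _)) (abs_nonneg _) (by positivity)
    refine this.trans ?_
    rw [Finset.sum_const, Finset.card_range, nsmul_eq_mul]; push_cast
    have : θ * (2 ^ k * (W * (2 * B')) + 1) = ε / 3 := by rw [hθ]; field_simp
    nlinarith
  rw [e] at h9
  have := abs_add_three (∑ i ∈ Finset.range (2 ^ k), w i ω * (dX N T k i ω * ΔZ i ω))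
    (∑ i ∈ Finset.range (2 ^ k), w i ω * (dX N T k i ω * b i ω))
    (∑ i ∈ Finset.range (2 ^ k), w i ω * (dX N T k i ω * er i))
  linarith

end

/-- semimartingale decomposition on the grid -/
structure Sem (μ : Measure Ω) (F : Filtration ℝ m) (T : ℝ) (G : Set Ω) (M N : ℝ → Ω → ℝ) (R V : ℝ)
    (A I Y : ℝ → Ω → ℝ) : Prop where
  adp : Adp F Y
  ap : AP μ F T G M I
  bd : ∀ ω ∈ G, ∀ t ∈ Icc 0 T, |Y t ω| ≤ R
  eq : ∀ ω ∈ G, ∀ k i, i < 2 ^ k → dX Y T k i ω = dX I T k i ω + dX A T k i ω + dX N T k i ω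
  var : ∀ ω ∈ G, ∀ k, ∑ i ∈ Finset.range (2 ^ k), |dX A T k i ω| ≤ V

/-- test functions for the occupation estimate -/
structure TF (κ W L : ℝ) (wb : ℝ → ℝ → ℝ) : Prop where
  W0 : 0 ≤ W
  L0 : 0 ≤ L
  ex : ∃ Ψ a a' u u' : ℝ → ℝ → ℝ, Continuous (Function.uncurry a) ∧
    Continuous (Function.uncurry a') ∧ Continuous (Function.uncurry u) ∧
    Continuous (Function.uncurry u') ∧ (∀ x y, |a x y| ≤ κ) ∧ (∀ x y, |a' x y| ≤ κ) ∧
    (∀ x y, |u x y| ≤ W) ∧ (∀ x y, |u' x y| ≤ W) ∧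
    (∀ x x' z z', Ψ x x' - Ψ z z' ≤ κ * (|x - z| + |x' - z'|)) ∧
    ∀ y y' e e' n, wb y y' * n ^ 2 / 2 ≤ Ψ (y + (e + n)) (y' + (e' + n)) - Ψ y y'
      - a y y' * (e + n) - a' y y' * (e' + n) - (u y y' * (n * e) + u' y y' * (n * e'))
      + L * (|e + n| ^ 3 + |e' + n| ^ 3)

section
variable {μ : Measure Ω} [IsProbabilityMeasure μ] {F : Filtration ℝ m} {B B' T R V : ℝ}
  {M N A I I' Y Y' : ℝ → Ω → ℝ} {G : Set Ω}

lemma Sem.gi (h : Sem μ F T G M N R V A I Y) (hM : Drv μ F B M) (hN : Drv μ F B' N) (hT : 0 ≤ T)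
    {ε : ℝ} (hε : 0 < ε) :
    ∃ r > 0, ∀ᶠ k in atTop, ∀ (c : ℕ → Ω → ℝ), (∀ i, Measurable[F (pt T k i)] (c i)) →
      (∀ i ω, |c i ω| ≤ 1) →
      pr μ G (fun ω => r < |∑ i ∈ Finset.range (2 ^ k), c i ω * dX Y T k i ω|) ≤ ε := by
  obtain ⟨r1, hr1, h1⟩ := h.ap.gi hM hT (show 0 < ε / 2 by positivity)
  obtain ⟨r2, hr2, h2⟩ := hN.gi (G := G) hT (show 0 < ε / 2 by positivity)
  refine ⟨r1 + |V| + r2, by positivity, ?_⟩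
  filter_upwards [h1] with k hk c hc hc1
  refine (pr_or (fun ω hω h' => ?_)).trans ((add_le_add (hk c hc hc1) (h2 k c hc hc1)).trans
    (by linarith))
  by_contra hcon
  push Not at hcon
  obtain ⟨q1, q2⟩ := hcon
  have e : ∑ i ∈ Finset.range (2 ^ k), c i ω * dX Y T k i ω =
      ∑ i ∈ Finset.range (2 ^ k), c i ω * dX I T k i ω +
      ∑ i ∈ Finset.range (2 ^ k), c i ω * dX A T k i ω +
      ∑ i ∈ Finset.range (2 ^ k), c i ω * dX N T k i ω := by
    rw [← Finset.sum_add_distrib, ← Finset.sum_add_distrib]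
    refine Finset.sum_congr rfl fun i hi => ?_
    rw [h.eq ω hω k i (Finset.mem_range.1 hi)]; ring
  have q3 : |∑ i ∈ Finset.range (2 ^ k), c i ω * dX A T k i ω| ≤ |V| := by
    refine (Finset.abs_sum_le_sum_abs _ _).trans (le_trans (Finset.sum_le_sum fun i _ => ?_)
      ((h.var ω hω k).trans (le_abs_self V)))
    rw [abs_mul]
    exact mul_le_of_le_one_left (abs_nonneg _) (hc1 i ω)
  rw [e] at h'
  have := abs_add_three (∑ i ∈ Finset.range (2 ^ k), c i ω * dX I T k i ω)
    (∑ i ∈ Finset.range (2 ^ k), c i ω * dX A T k i ω)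
    (∑ i ∈ Finset.range (2 ^ k), c i ω * dX N T k i ω)
  linarith

lemma Sem.sq_tight (h : Sem μ F T G M N R V A I Y) (hM : Drv μ F B M) (hN : Drv μ F B' N)
    (hT : 0 ≤ T) (hR : 0 < R) {ε : ℝ} (hε : 0 < ε) :
    ∃ Q > 0, ∀ᶠ k in atTop,
      pr μ G (fun ω => Q < ∑ i ∈ Finset.range (2 ^ k), dX Y T k i ω ^ 2) ≤ ε := by
  obtain ⟨r, hr, h1⟩ := h.gi hM hN hT hε
  refine ⟨R ^ 2 + 2 * R * r, by positivity, ?_⟩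
  filter_upwards [h1] with k hk
  have hc := hk (fun i ω => max (-R) (min R (Y (pt T k i) ω)) / R)
    (fun i => ((measurable_const.max (measurable_const.min (h.adp.meas _ (pt_nonneg hT k i)))).div_const _))
    (fun i ω => by
      rw [abs_div, abs_of_pos hR, div_le_one hR, abs_le]
      exact ⟨le_max_left _ _, max_le (by linarith) (min_le_left _ _)⟩)
  refine (pr_mono fun ω hω h' => ?_).trans hc
  by_contra hcon
  push Not at hcon
  have e1 : ∀ i < 2 ^ k, max (-R) (min R (Y (pt T k i) ω)) / R = Y (pt T k i) ω / R := by
    intro i hi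
    have := abs_le.1 (h.bd ω hω _ (pt_mem hT hi.le))
    rw [min_eq_right this.2, max_eq_right this.1]
  have e2 : ∑ i ∈ Finset.range (2 ^ k), max (-R) (min R (Y (pt T k i) ω)) / R * dX Y T k i ω =
      (1 / R) * ∑ i ∈ Finset.range (2 ^ k), Y (pt T k i) ω * dX Y T k i ω := by
    rw [Finset.mul_sum]
    refine Finset.sum_congr rfl fun i hi => ?_
    rw [e1 i (Finset.mem_range.1 hi)]; ring
  rw [e2] at hcon
  have e3 : ∀ n, ∑ i ∈ Finset.range n, dX Y T k i ω ^ 2 =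
      Y (pt T k n) ω ^ 2 - Y 0 ω ^ 2 - 2 * ∑ i ∈ Finset.range n, Y (pt T k i) ω * dX Y T k i ω := by
    intro n
    induction n with
    | zero => simp [pt_zero]
    | succ n ih => rw [Finset.sum_range_succ, ih, Finset.sum_range_succ]; simp only [dX]; ring
  rw [e3] at h'
  have h5 := h.bd ω hω _ (pt_mem hT (le_refl (2 ^ k)))
  have h6 : Y (pt T k (2 ^ k)) ω ^ 2 ≤ R ^ 2 := by
    rw [← sq_abs]; exact pow_le_pow_left₀ (abs_nonneg _) h5 2
  have h7 := neg_abs_le (1 / R * ∑ i ∈ Finset.range (2 ^ k), Y (pt T k i) ω * dX Y T k i ω)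
  have h8 : -r ≤ 1 / R * ∑ i ∈ Finset.range (2 ^ k), Y (pt T k i) ω * dX Y T k i ω := by linarith
  have h9 : R * (1 / R * ∑ i ∈ Finset.range (2 ^ k), Y (pt T k i) ω * dX Y T k i ω) =
    ∑ i ∈ Finset.range (2 ^ k), Y (pt T k i) ω * dX Y T k i ω := by field_simp
  have h10 := mul_le_mul_of_nonneg_left h8 hR.le
  rw [h9] at h10
  nlinarith [sq_nonneg (Y 0 ω)]

lemma Sem.cube (h : Sem μ F T G M N R V A I Y) (hM : Drv μ F B M) (hN : Drv μ F B' N)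
    (hT : 0 ≤ T) (hR : 0 < R) {ε δ : ℝ} (hε : 0 < ε) (hδ : 0 < δ) :
    ∀ᶠ k in atTop, pr μ G (fun ω => δ < ∑ i ∈ Finset.range (2 ^ k), |dX Y T k i ω| ^ 3) ≤ ε := by
  obtain ⟨Q, hQ, h1⟩ := h.sq_tight hM hN hT hR (show 0 < ε / 2 by positivity)
  obtain ⟨ρ, hρ, E, hE, hEμ, hmod⟩ := h.adp.mod (μ := μ) hT
    (show 0 < δ / Q by positivity) (show 0 < ε / 2 by positivity)
  filter_upwards [h1, mesh_small T hρ] with k hk hkρ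
  refine (pr_or (fun ω hω h' => ?_)).trans ((add_le_add hk (pr_exc hEμ)).trans
    (by linarith))
  by_contra hcon
  push Not at hcon
  obtain ⟨q1, q2⟩ := hcon
  have : ∑ i ∈ Finset.range (2 ^ k), |dX Y T k i ω| ^ 3 ≤
      δ / Q * ∑ i ∈ Finset.range (2 ^ k), dX Y T k i ω ^ 2 := by
    rw [Finset.mul_sum]
    refine Finset.sum_le_sum fun i hi => ?_
    have hi' := Finset.mem_range.1 hi
    rw [← sq_abs (dX Y T k i ω), pow_succ |dX Y T k i ω| 2, mul_comm]
    exact mul_le_mul_of_nonneg_right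
      (hmod ω q2 _ (pt_mem hT hi') _ (pt_mem hT hi'.le) (mesh_pt hT hkρ)) (sq_nonneg _)
  have h2 := mul_le_mul_of_nonneg_left q1 (show 0 ≤ δ / Q by positivity)
  have h3 : δ / Q * Q = δ := by field_simp
  linarith

lemma Sem.ortho (h : Sem μ F T G M N R V A I Y) (hM : Drv μ F B M) (hN : Drv μ F B' N)
    (ho : Orth μ F T M N) (hT : 0 ≤ T) {W : ℝ} (hW : 0 ≤ W) {ε δ : ℝ} (hε : 0 < ε) (hδ : 0 < δ) :
    ∀ᶠ k in atTop, ∀ w : ℕ → Ω → ℝ, (∀ i, Measurable[F (pt T k i)] (w i)) →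
      (∀ i ω, |w i ω| ≤ W) →
      pr μ G (fun ω => δ < |∑ i ∈ Finset.range (2 ^ k),
        w i ω * (dX N T k i ω * (dX I T k i ω + dX A T k i ω))|) ≤ ε := by
  have h1 := h.ap.ortho hM hN ho hT hW (show 0 < min (ε / 2) (δ / 2) by positivity)
  obtain ⟨ρ, hρ, E, hE, hEμ, hmod⟩ := hN.toAdp.mod (μ := μ) hT
    (show 0 < δ / 2 / (W * |V| + 1) by positivity) (show 0 < ε / 2 by positivity)
  filter_upwards [h1, mesh_small T hρ] with k hk hkρ w hw hwW
  refine (pr_or (fun ω hω h' => ?_)).trans ((add_le_add ((hk w hw hwW).trans (min_le_left _ _))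
    (pr_exc hEμ)).trans (by linarith))
  by_contra hcon
  push Not at hcon
  obtain ⟨q1, q2⟩ := hcon
  have q1 := q1.trans (min_le_right _ _)
  have e : ∑ i ∈ Finset.range (2 ^ k), w i ω * (dX N T k i ω * (dX I T k i ω + dX A T k i ω)) =
      ∑ i ∈ Finset.range (2 ^ k), w i ω * (dX N T k i ω * dX I T k i ω) +
      ∑ i ∈ Finset.range (2 ^ k), w i ω * (dX N T k i ω * dX A T k i ω) := by
    rw [← Finset.sum_add_distrib]
    exact Finset.sum_congr rfl fun i hi => by ring
  have b1 : |∑ i ∈ Finset.range (2 ^ k), w i ω * (dX N T k i ω * dX A T k i ω)| ≤ δ / 2 := by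
    have : |∑ i ∈ Finset.range (2 ^ k), w i ω * (dX N T k i ω * dX A T k i ω)| ≤
        (W * (δ / 2 / (W * |V| + 1))) * ∑ i ∈ Finset.range (2 ^ k), |dX A T k i ω| := by
      refine (Finset.abs_sum_le_sum_abs _ _).trans ?_
      rw [Finset.mul_sum]
      refine Finset.sum_le_sum fun i hi => ?_
      rw [abs_mul, abs_mul, ← mul_assoc]
      have hi' := Finset.mem_range.1 hi
      refine mul_le_mul_of_nonneg_right (mul_le_mul (hwW i ω) ?_ (abs_nonneg _) hW) (abs_nonneg _)
      exact hmod ω q2 _ (pt_mem hT hi') _ (pt_mem hT hi'.le) (mesh_pt hT hkρ)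
    refine this.trans ((mul_le_mul_of_nonneg_left ((h.var ω hω k).trans (le_abs_self V))
      (by positivity)).trans ?_)
    have : δ / 2 / (W * |V| + 1) * (W * |V| + 1) = δ / 2 := by field_simp
    have h0 : 0 < δ / 2 / (W * |V| + 1) := by positivity
    nlinarith
  rw [e] at h'
  have := abs_add_le (∑ i ∈ Finset.range (2 ^ k), w i ω * (dX N T k i ω * dX I T k i ω))
    (∑ i ∈ Finset.range (2 ^ k), w i ω * (dX N T k i ω * dX A T k i ω))
  linarith

lemma meas2 (hY : Adp F Y) (hY' : Adp F Y') {a : ℝ → ℝ → ℝ} (ha : Continuous (Function.uncurry a))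
    {t : ℝ} (ht : 0 ≤ t) : Measurable[F t] (fun ω => a (Y t ω) (Y' t ω)) :=
  ha.measurable.comp ((hY.meas t ht).prodMk (hY'.meas t ht))

/-- occupation estimate -/
lemma occ (h : Sem μ F T G M N R V A I Y) (h' : Sem μ F T G M N R V A I' Y') (hM : Drv μ F B M)
    (hN : Drv μ F B' N) (ho : Orth μ F T M N) (hT : 0 ≤ T) (hR : 0 < R) {ε : ℝ} (hε : 0 < ε) :
    ∃ Λ > 0, ∀ κ > 0, ∀ W L wb, TF κ W L wb → ∀ᶠ k in atTop,
      pr μ G (fun ω => κ * Λ < ∑ i ∈ Finset.range (2 ^ k),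
        wb (Y (pt T k i) ω) (Y' (pt T k i) ω) * dX N T k i ω ^ 2) ≤ ε := by
  have h6 : 0 < ε / 6 := by positivity
  obtain ⟨r, hr, h1⟩ := h.gi hM hN hT h6
  obtain ⟨r', hr', h1'⟩ := h'.gi hM hN hT h6
  refine ⟨2 * (4 * R + r + r' + 4), by positivity, fun κ hκ W L wb htf => ?_⟩
  obtain ⟨Ψ, a, a', u, u', ca, ca', cu, cu', ba, ba', bu, bu', hΨ, hkey⟩ := htf.ex
  have hL1 : 0 < L + 1 := by linarith [htf.L0]
  have hδ : 0 < κ / (L + 1) := by positivity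
  filter_upwards [h1, h1', h.cube hM hN hT hR h6 hδ, h'.cube hM hN hT hR h6 hδ,
    h.ortho hM hN ho hT htf.W0 h6 hκ, h'.ortho hM hN ho hT htf.W0 h6 hκ] with k k1 k1' k2 k2' k3 k3'
  have mY := fun (f : ℝ → ℝ → ℝ) (hf : Continuous (Function.uncurry f)) (i : ℕ) =>
    meas2 h.adp h'.adp hf (pt_nonneg hT k i)
  have p1 := k1 (fun i ω => a (Y (pt T k i) ω) (Y' (pt T k i) ω) / κ)
    (fun i => (mY a ca i).div_const _) (fun i ω => by
      rw [abs_div, abs_of_pos hκ, div_le_one hκ]; exact ba _ _)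
  have p1' := k1' (fun i ω => a' (Y (pt T k i) ω) (Y' (pt T k i) ω) / κ)
    (fun i => (mY a' ca' i).div_const _) (fun i ω => by
      rw [abs_div, abs_of_pos hκ, div_le_one hκ]; exact ba' _ _)
  have p3 := k3 (fun i ω => u (Y (pt T k i) ω) (Y' (pt T k i) ω)) (mY u cu) (fun i ω => bu _ _)
  have p3' := k3' (fun i ω => u' (Y (pt T k i) ω) (Y' (pt T k i) ω)) (mY u' cu') (fun i ω => bu' _ _)
  refine (pr_or3 (fun ω hω hc => ?_)).trans ((add_le_add (add_le_add p1 p1')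
    (pr_or4 (fun ω _ h => h) |>.trans (add_le_add (add_le_add (add_le_add k2 k2') p3) p3'))).trans
    (by linarith))
  by_contra hcon
  push Not at hcon
  obtain ⟨q1, q1', q2, q2', q3, q3'⟩ := hcon
  -- telescoping
  have key : (1 / 2) * ∑ i ∈ Finset.range (2 ^ k),
        wb (Y (pt T k i) ω) (Y' (pt T k i) ω) * dX N T k i ω ^ 2 ≤
      (Ψ (Y (pt T k (2 ^ k)) ω) (Y' (pt T k (2 ^ k)) ω) - Ψ (Y 0 ω) (Y' 0 ω))
      - κ * ∑ i ∈ Finset.range (2 ^ k), a (Y (pt T k i) ω) (Y' (pt T k i) ω) / κ * dX Y T k i ω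
      - κ * ∑ i ∈ Finset.range (2 ^ k), a' (Y (pt T k i) ω) (Y' (pt T k i) ω) / κ * dX Y' T k i ω
      - ∑ i ∈ Finset.range (2 ^ k), u (Y (pt T k i) ω) (Y' (pt T k i) ω) *
        (dX N T k i ω * (dX I T k i ω + dX A T k i ω))
      - ∑ i ∈ Finset.range (2 ^ k), u' (Y (pt T k i) ω) (Y' (pt T k i) ω) *
        (dX N T k i ω * (dX I' T k i ω + dX A T k i ω))
      + L * ∑ i ∈ Finset.range (2 ^ k), |dX Y T k i ω| ^ 3
      + L * ∑ i ∈ Finset.range (2 ^ k), |dX Y' T k i ω| ^ 3 := by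
    have tel : Ψ (Y (pt T k (2 ^ k)) ω) (Y' (pt T k (2 ^ k)) ω) - Ψ (Y 0 ω) (Y' 0 ω) =
        ∑ i ∈ Finset.range (2 ^ k), (Ψ (Y (pt T k (i + 1)) ω) (Y' (pt T k (i + 1)) ω)
          - Ψ (Y (pt T k i) ω) (Y' (pt T k i) ω)) := by
      rw [Finset.sum_range_sub (fun i => Ψ (Y (pt T k i) ω) (Y' (pt T k i) ω)), pt_zero]
    rw [tel]
    simp only [Finset.mul_sum]
    simp only [← Finset.sum_sub_distrib, ← Finset.sum_add_distrib]
    refine Finset.sum_le_sum fun i hi => ?_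
    have hi' := Finset.mem_range.1 hi
    have e1 := h.eq ω hω k i hi'
    have e1' := h'.eq ω hω k i hi'
    have := hkey (Y (pt T k i) ω) (Y' (pt T k i) ω) (dX I T k i ω + dX A T k i ω)
      (dX I' T k i ω + dX A T k i ω) (dX N T k i ω)
    rw [← e1, ← e1'] at this
    have e2 : Y (pt T k i) ω + dX Y T k i ω = Y (pt T k (i + 1)) ω := by simp [dX]
    have e2' : Y' (pt T k i) ω + dX Y' T k i ω = Y' (pt T k (i + 1)) ω := by simp [dX]
    rw [e2, e2'] at this
    have e3 : κ * (a (Y (pt T k i) ω) (Y' (pt T k i) ω) / κ * dX Y T k i ω) =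
      a (Y (pt T k i) ω) (Y' (pt T k i) ω) * dX Y T k i ω := by field_simp
    have e3' : κ * (a' (Y (pt T k i) ω) (Y' (pt T k i) ω) / κ * dX Y' T k i ω) =
      a' (Y (pt T k i) ω) (Y' (pt T k i) ω) * dX Y' T k i ω := by field_simp
    rw [e3, e3']
    linarith
  have b0 : Ψ (Y (pt T k (2 ^ k)) ω) (Y' (pt T k (2 ^ k)) ω) - Ψ (Y 0 ω) (Y' 0 ω) ≤ κ * (4 * R) := by
    refine (hΨ _ _ _ _).trans (mul_le_mul_of_nonneg_left ?_ hκ.le)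
    have t0 : (0:ℝ) ∈ Icc 0 T := ⟨le_rfl, hT⟩
    have a1 := h.bd ω hω _ (pt_mem hT (le_refl (2 ^ k)))
    have a2 := h.bd ω hω _ t0
    have a3 := h'.bd ω hω _ (pt_mem hT (le_refl (2 ^ k)))
    have a4 := h'.bd ω hω _ t0
    have := abs_sub (Y (pt T k (2 ^ k)) ω) (Y 0 ω)
    have := abs_sub (Y' (pt T k (2 ^ k)) ω) (Y' 0 ω)
    linarith
  have b1 := mul_le_mul_of_nonneg_left (neg_le_of_abs_le q1) hκ.le
  have b1' := mul_le_mul_of_nonneg_left (neg_le_of_abs_le q1') hκ.le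
  have b3 := neg_le_of_abs_le q3
  have b3' := neg_le_of_abs_le q3'
  have bL : L * (κ / (L + 1)) ≤ κ := by
    rw [← mul_div_assoc, div_le_iff₀ hL1]; nlinarith
  have b2 := (mul_le_mul_of_nonneg_left q2 htf.L0).trans bL
  have b2' := (mul_le_mul_of_nonneg_left q2' htf.L0).trans bL
  nlinarith

end

lemma mvt_sym {k k' : ℝ → ℝ} {h C : ℝ} (hd : ∀ s, HasDerivAt k (k' s) s)
    (hC : ∀ s, |s| ≤ |h| → |k' s| ≤ C) {s : ℝ} (hs : |s| ≤ |h|) : |k s - k 0| ≤ C * |s| := by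
  have := (convex_Icc (-|h|) |h|).norm_image_sub_le_of_norm_hasDerivWithin_le (f := k) (f' := k')
    (C := C) (x := 0) (y := s) (fun x _ => (hd x).hasDerivWithinAt)
    (fun x hx => by rw [Real.norm_eq_abs]; exact hC x (abs_le.2 ⟨hx.1, hx.2⟩))
    ⟨by simp, by simp⟩ (by rw [mem_Icc]; exact abs_le.1 hs)
  simpa [Real.norm_eq_abs] using this

lemma taylor2 {φ ϕ w : ℝ → ℝ} {L : ℝ} (h1 : ∀ x, HasDerivAt φ (ϕ x) x)
    (h2 : ∀ x, HasDerivAt ϕ (w x) x) (hL : ∀ x y, |w x - w y| ≤ L * |x - y|) (hL0 : 0 ≤ L)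
    (x h : ℝ) : |φ (x + h) - φ x - ϕ x * h - w x * h ^ 2 / 2| ≤ L * |h| ^ 3 := by
  have d1 : ∀ s, HasDerivAt (fun s => ϕ (x + s) - w x * s) (w (x + s) - w x) s := by
    intro s
    have := ((h2 (x + s)).comp_const_add x s).sub ((hasDerivAt_id s).const_mul (w x))
    refine this.congr_deriv ?_; simp
  have b1 : ∀ s, |s| ≤ |h| → |ϕ (x + s) - ϕ x - w x * s| ≤ L * |h| ^ 2 := by
    intro s hs
    have := mvt_sym (h := h) d1 (C := L * |h|) (fun s hs => (hL _ _).trans (by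
      rw [add_sub_cancel_left]; exact mul_le_mul_of_nonneg_left hs hL0)) hs
    simp only [add_zero, mul_zero, sub_zero] at this
    rw [show ϕ (x + s) - ϕ x - w x * s = ϕ (x + s) - w x * s - ϕ x by ring]
    refine this.trans ?_
    rw [pow_two, ← mul_assoc]
    exact mul_le_mul_of_nonneg_left hs (by positivity)
  have d2 : ∀ s, HasDerivAt (fun s => φ (x + s) - ϕ x * s - w x * s ^ 2 / 2)
      (ϕ (x + s) - ϕ x - w x * s) s := by
    intro s
    have := (((h1 (x + s)).comp_const_add x s).sub ((hasDerivAt_id s).const_mul (ϕ x))).sub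
      (((hasDerivAt_pow 2 s).const_mul (w x)).div_const 2)
    refine this.congr_deriv ?_
    simp; ring
  have := mvt_sym d2 b1 (le_refl |h|)
  simp only [add_zero, mul_zero, sub_zero] at this
  rw [show φ (x + h) - φ x - ϕ x * h - w x * h ^ 2 / 2 = φ (x + h) - ϕ x * h - w x * h ^ 2 / 2 -
    (φ x - w x * 0 ^ 2 / 2) by ring]
  refine this.trans (le_of_eq (by ring))

section calc1
variable {g : ℝ → ℝ} {C ε : ℝ}

/-- primitive -/
def prim (g : ℝ → ℝ) (x : ℝ) : ℝ := ∫ t in (0:ℝ)..x, g t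

lemma prim_sub (hg : Monotone g) (a b : ℝ) : prim g b - prim g a = ∫ t in a..b, g t :=
  intervalIntegral.integral_interval_sub_left hg.intervalIntegrable hg.intervalIntegrable

lemma prim_lip (hg : Monotone g) (hC : ∀ x, |g x| ≤ C) (a b : ℝ) :
    |prim g b - prim g a| ≤ C * |b - a| := by
  rw [prim_sub hg]
  have := intervalIntegral.norm_integral_le_of_norm_le_const (a := a) (b := b) (f := g) (C := C)
    (fun x _ => by rw [Real.norm_eq_abs]; exact hC x)
  rwa [Real.norm_eq_abs] at this

lemma prim_cont (hg : Monotone g) (hC : ∀ x, |g x| ≤ C) : Continuous (prim g) := by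
  have hC0 : 0 ≤ C := (abs_nonneg _).trans (hC 0)
  refine (LipschitzWith.of_dist_le_mul (K := ⟨C, hC0⟩) fun x y => ?_).continuous
  rw [Real.dist_eq, Real.dist_eq]; exact prim_lip hg hC y x

lemma prim_lower (hg : Monotone g) {a b : ℝ} (hab : a ≤ b) : (b - a) * g a ≤ prim g b - prim g a := by
  rw [prim_sub hg]
  have := intervalIntegral.integral_mono_on (μ := volume) (f := fun _ => g a) (g := g) hab
    intervalIntegrable_const hg.intervalIntegrable (fun x hx => hg hx.1)
  simpa using this

lemma prim_upper (hg : Monotone g) {a b : ℝ} (hab : a ≤ b) : prim g b - prim g a ≤ (b - a) * g b := by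
  rw [prim_sub hg]
  have := intervalIntegral.integral_mono_on (μ := volume) (f := g) (g := fun _ => g b) hab
    hg.intervalIntegrable intervalIntegrable_const (fun x hx => hg hx.2)
  simpa using this

/-- convexity -/
lemma prim_conv (hg : Monotone g) {a b : ℝ} (hab : a ≤ b) {s : ℝ} (hs : 0 ≤ s) :
    prim g (a + s) - prim g a ≤ prim g (b + s) - prim g b := by
  rw [prim_sub hg, prim_sub hg]
  have e : ∫ t in b..(b + s), g t = ∫ t in a..(a + s), g (t + (b - a)) := by
    rw [intervalIntegral.integral_comp_add_right]; congr 1 <;> ring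
  rw [e]
  have hm : Monotone fun t => g (t + (b - a)) := fun x y h => hg (by linarith)
  exact intervalIntegral.integral_mono_on (by linarith) hg.intervalIntegrable hm.intervalIntegrable
    (fun x _ => hg (by linarith))

lemma prim_deriv {h : ℝ → ℝ} (hh : Continuous h) (x : ℝ) : HasDerivAt (prim h) (h x) x :=
  intervalIntegral.integral_hasDerivAt_right (hh.intervalIntegrable _ _)
    (hh.stronglyMeasurableAtFilter _ _) hh.continuousAt

/-- second difference -/
def sdiff2 (ε : ℝ) (H : ℝ → ℝ) (x : ℝ) : ℝ :=
  (1 / ε) * (H (x + 2 * ε) - H (x + ε) - H (x - ε) + H (x - 2 * ε))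

lemma sdiff2_deriv {H h : ℝ → ℝ} (hH : ∀ x, HasDerivAt H (h x) x) (ε x : ℝ) :
    HasDerivAt (sdiff2 ε H) (sdiff2 ε h x) x := by
  unfold sdiff2
  exact (((((hH _).comp_add_const x (2 * ε)).sub ((hH _).comp_add_const x ε)).sub
    ((hH _).comp_sub_const x ε)).add ((hH _).comp_sub_const x (2 * ε))).const_mul (1 / ε)

/-- the weight -/
def wt (g : ℝ → ℝ) (ε : ℝ) : ℝ → ℝ := sdiff2 ε (prim g)

lemma wt_lower (hg : Monotone g) (hε : 0 < ε) (x : ℝ) : g (x + ε) - g (x - ε) ≤ wt g ε x := by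
  have h1 := prim_lower hg (show x + ε ≤ x + 2 * ε by linarith)
  have h2 := prim_upper hg (show x - 2 * ε ≤ x - ε by linarith)
  unfold wt sdiff2
  rw [one_div, inv_mul_eq_div, le_div_iff₀ hε]
  nlinarith

lemma wt_nonneg (hg : Monotone g) (hε : 0 < ε) (x : ℝ) : 0 ≤ wt g ε x :=
  (sub_nonneg.2 (hg (by linarith))).trans (wt_lower hg hε x)

lemma wt_le (hg : Monotone g) (hC : ∀ x, |g x| ≤ C) (hε : 0 < ε) (x : ℝ) : wt g ε x ≤ 2 * C := by
  have h1 := (abs_le.1 (prim_lip hg hC (x + ε) (x + 2 * ε))).2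
  have h2 := (abs_le.1 (prim_lip hg hC (x - 2 * ε) (x - ε))).1
  rw [show x + 2 * ε - (x + ε) = ε by ring, abs_of_pos hε] at h1
  rw [show x - ε - (x - 2 * ε) = ε by ring, abs_of_pos hε] at h2
  unfold wt sdiff2
  rw [one_div, inv_mul_eq_div, div_le_iff₀ hε]
  linarith

lemma wt_lip (hg : Monotone g) (hC : ∀ x, |g x| ≤ C) (hε : 0 < ε) (x y : ℝ) :
    |wt g ε x - wt g ε y| ≤ 4 * C / ε * |x - y| := by
  have h1 := prim_lip hg hC (y + 2 * ε) (x + 2 * ε)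
  have h2 := prim_lip hg hC (y + ε) (x + ε)
  have h3 := prim_lip hg hC (y - ε) (x - ε)
  have h4 := prim_lip hg hC (y - 2 * ε) (x - 2 * ε)
  rw [show x + 2 * ε - (y + 2 * ε) = x - y by ring] at h1
  rw [show x + ε - (y + ε) = x - y by ring] at h2
  rw [show x - ε - (y - ε) = x - y by ring] at h3
  rw [show x - 2 * ε - (y - 2 * ε) = x - y by ring] at h4
  unfold wt sdiff2
  rw [← mul_sub, abs_mul, abs_of_pos (by positivity : 0 < 1 / ε)]
  rw [show 4 * C / ε * |x - y| = (1 / ε) * (4 * (C * |x - y|)) by ring]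
  refine mul_le_mul_of_nonneg_left ?_ (by positivity)
  rw [abs_le] at *
  constructor <;> linarith [h1.1, h1.2, h2.1, h2.2, h3.1, h3.2, h4.1, h4.2]

lemma wt_cont (hg : Monotone g) (hC : ∀ x, |g x| ≤ C) (ε : ℝ) : Continuous (wt g ε) := by
  have := prim_cont hg hC
  unfold wt sdiff2
  fun_prop

/-- first derivative -/
def wt1 (g : ℝ → ℝ) (ε : ℝ) : ℝ → ℝ := sdiff2 ε (prim (prim g))

lemma wt1_deriv (hg : Monotone g) (hC : ∀ x, |g x| ≤ C) (ε x : ℝ) :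
    HasDerivAt (wt1 g ε) (wt g ε x) x :=
  sdiff2_deriv (prim_deriv (prim_cont hg hC)) ε x

lemma wt1_bd (hg : Monotone g) (hC : ∀ x, |g x| ≤ C) (hε : 0 < ε) (x : ℝ) :
    |wt1 g ε x| ≤ 3 * ε * C := by
  have hp := prim_deriv (prim_cont hg hC)
  have d : ∀ s, HasDerivAt (fun s => prim (prim g) (x + ε + s) - prim (prim g) (x - 2 * ε + s))
      (prim g (x + ε + s) - prim g (x - 2 * ε + s)) s := fun s =>
    ((hp _).comp_const_add _ s).sub ((hp _).comp_const_add _ s)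
  have := mvt_sym (h := ε) d (C := 3 * ε * C) (fun s _ => by
    refine (prim_lip hg hC _ _).trans (le_of_eq ?_)
    rw [show x + ε + s - (x - 2 * ε + s) = 3 * ε by ring, abs_of_pos (by positivity)]; ring) le_rfl
  simp only [add_zero] at this
  unfold wt1 sdiff2
  rw [abs_mul, abs_of_pos (by positivity : 0 < 1 / ε), one_div, inv_mul_eq_div, div_le_iff₀ hε]
  rw [abs_of_pos hε] at this
  refine le_trans (le_of_eq ?_) this
  congr 1
  rw [show x + ε + ε = x + 2 * ε by ring, show x - 2 * ε + ε = x - ε by ring]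
  ring

lemma wt1_cont (hg : Monotone g) (hC : ∀ x, |g x| ≤ C) (ε : ℝ) : Continuous (wt1 g ε) :=
  continuous_iff_continuousAt.2 fun x => (wt1_deriv hg hC ε x).continuousAt

/-- averaged over the segment -/
def seg (ψ : ℝ → ℝ → ℝ) (y y' : ℝ) : ℝ := ∫ θ in (0:ℝ)..1, ψ θ (y' + θ * (y - y'))

lemma seg_cont {ψ : ℝ → ℝ → ℝ} (h : Continuous (Function.uncurry ψ)) :
    Continuous (Function.uncurry (seg ψ)) := by
  have : Continuous (Function.uncurry fun (p : ℝ × ℝ) (θ : ℝ) => ψ θ (p.2 + θ * (p.1 - p.2))) := by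
    have h2 : Continuous fun q : (ℝ × ℝ) × ℝ => (q.2, q.1.2 + q.2 * (q.1.1 - q.1.2)) := by fun_prop
    exact h.comp h2
  exact intervalIntegral.continuous_parametric_intervalIntegral_of_continuous' this 0 1

lemma seg_int {ψ : ℝ → ℝ → ℝ} (h : Continuous (Function.uncurry ψ)) (y y' : ℝ) :
    IntervalIntegrable (fun θ => ψ θ (y' + θ * (y - y'))) volume 0 1 := by
  have h2 : Continuous fun q : ℝ => (q, y' + q * (y - y')) := by fun_prop
  exact (h.comp h2).intervalIntegrable _ _

lemma seg_bd {ψ : ℝ → ℝ → ℝ} {K : ℝ} (hK : ∀ θ ∈ Icc (0:ℝ) 1, ∀ x, |ψ θ x| ≤ K) (y y' : ℝ) :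
    |seg ψ y y'| ≤ K := by
  have := intervalIntegral.norm_integral_le_of_norm_le_const (a := 0) (b := 1)
    (f := fun θ => ψ θ (y' + θ * (y - y'))) (C := K) (fun x hx => by
      rw [Real.norm_eq_abs]; rw [uIoc_of_le zero_le_one] at hx
      exact hK x ⟨hx.1.le, hx.2⟩ _)
  simpa [seg] using this

lemma seg_lower {ψ : ℝ → ℝ → ℝ} (h : Continuous (Function.uncurry ψ)) {K : ℝ} {y y' : ℝ}
    (hK : ∀ θ ∈ Icc (0:ℝ) 1, K ≤ ψ θ (y' + θ * (y - y'))) : K ≤ seg ψ y y' := by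
  have := intervalIntegral.integral_mono_on (μ := volume) (f := fun _ => K) zero_le_one
    intervalIntegrable_const (seg_int h y y') hK
  simpa [seg] using this

lemma tf_exists (hg : Monotone g) (hC : ∀ x, |g x| ≤ C) (hε : 0 < ε) :
    ∃ wb, TF (3 * ε * C) (2 * C) (4 * C / ε) wb ∧ Continuous (Function.uncurry wb) ∧
      (∀ y y', 0 ≤ wb y y') ∧ (∀ y y', wb y y' ≤ 2 * C) ∧ (∀ y, g (y + ε) - g (y - ε) ≤ wb y y) ∧
      ∀ y y', ε * |g y - g y'| ≤ wb y y' * (|y - y'| + ε) := by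
  have hC0 : 0 ≤ C := (abs_nonneg _).trans (hC 0)
  have cw := wt_cont hg hC ε
  have c1 := wt1_cont hg hC ε
  have hφ := prim_deriv c1
  have cφ : Continuous (prim (wt1 g ε)) :=
    continuous_iff_continuousAt.2 fun x => (hφ x).continuousAt
  have cu : ∀ {h : ℝ → ℝ} (hh : Continuous h), Continuous (Function.uncurry fun (_ : ℝ) x => h x) :=
    fun hh => hh.comp continuous_snd
  have cuθ : ∀ {h : ℝ → ℝ} (hh : Continuous h),
      Continuous (Function.uncurry fun (θ : ℝ) x => θ * h x) :=
    fun hh => continuous_fst.mul (hh.comp continuous_snd)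
  have cuθ' : ∀ {h : ℝ → ℝ} (hh : Continuous h),
      Continuous (Function.uncurry fun (θ : ℝ) x => (1 - θ) * h x) :=
    fun hh => (continuous_const.sub continuous_fst).mul (hh.comp continuous_snd)
  have bθ : ∀ {h : ℝ → ℝ} {K : ℝ}, (∀ x, |h x| ≤ K) → ∀ θ ∈ Icc (0:ℝ) 1, ∀ x, |θ * h x| ≤ K := by
    intro h K hK θ hθ x
    rw [abs_mul, abs_of_nonneg hθ.1]
    exact (mul_le_of_le_one_left (abs_nonneg _) hθ.2).trans (hK x)
  have bθ' : ∀ {h : ℝ → ℝ} {K : ℝ}, (∀ x, |h x| ≤ K) →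
      ∀ θ ∈ Icc (0:ℝ) 1, ∀ x, |(1 - θ) * h x| ≤ K := by
    intro h K hK θ hθ x
    rw [abs_mul, abs_of_nonneg (by linarith [hθ.2])]
    exact (mul_le_of_le_one_left (abs_nonneg _) (by linarith [hθ.1])).trans (hK x)
  have bw : ∀ x, |wt g ε x| ≤ 2 * C := fun x => by
    rw [abs_of_nonneg (wt_nonneg hg hε x)]; exact wt_le hg hC hε x
  have b1 := wt1_bd hg hC hε
  refine ⟨seg fun _ x => wt g ε x, ⟨by positivity, by positivity, seg fun _ x => prim (wt1 g ε) x,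
    seg fun θ x => θ * wt1 g ε x, seg fun θ x => (1 - θ) * wt1 g ε x,
    seg fun θ x => θ * wt g ε x, seg fun θ x => (1 - θ) * wt g ε x,
    seg_cont (cuθ c1), seg_cont (cuθ' c1), seg_cont (cuθ cw), seg_cont (cuθ' cw),
    seg_bd (bθ b1), seg_bd (bθ' b1), seg_bd (bθ bw), seg_bd (bθ' bw), ?_, ?_⟩,
    seg_cont (cu cw), ?_, ?_, ?_, ?_⟩
  · intro x x' z z'
    unfold seg
    rw [← intervalIntegral.integral_sub (seg_int (cu cφ) _ _) (seg_int (cu cφ) _ _)]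
    have := intervalIntegral.norm_integral_le_of_norm_le_const (a := 0) (b := 1)
      (f := fun θ => prim (wt1 g ε) (x' + θ * (x - x')) - prim (wt1 g ε) (z' + θ * (z - z')))
      (C := 3 * ε * C * (|x - z| + |x' - z'|)) (fun θ hθ => by
        rw [uIoc_of_le zero_le_one] at hθ
        rw [Real.norm_eq_abs]
        set p := z' + θ * (z - z')
        set q := x' + θ * (x - x') with hq
        have h1 := mvt_sym (h := q - p) (fun s => (hφ (p + s)).comp_const_add p s) (C := 3 * ε * C)
          (fun s _ => b1 _) le_rfl
        simp only [add_zero, add_sub_cancel] at h1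
        refine h1.trans (mul_le_mul_of_nonneg_left ?_ (by positivity))
        have : q - p = θ * (x - z) + (1 - θ) * (x' - z') := by simp only [q, p]; ring
        rw [this]
        refine (abs_add_le _ _).trans ?_
        rw [abs_mul, abs_mul, abs_of_nonneg hθ.1.le, abs_of_nonneg (by linarith [hθ.2] : 0 ≤ 1 - θ)]
        have := abs_nonneg (x - z)
        have := abs_nonneg (x' - z')
        nlinarith [hθ.1, hθ.2])
    simp only [sub_zero, abs_one, mul_one, Real.norm_eq_abs] at this
    exact (le_abs_self _).trans this
  · intro y y' e e' n
    have key : ∀ θ ∈ Icc (0:ℝ) 1, wt g ε (y' + θ * (y - y')) * (n ^ 2 / 2) ≤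
        prim (wt1 g ε) ((y' + (e' + n)) + θ * ((y + (e + n)) - (y' + (e' + n))))
        - prim (wt1 g ε) (y' + θ * (y - y'))
        - (θ * wt1 g ε (y' + θ * (y - y'))) * (e + n)
        - ((1 - θ) * wt1 g ε (y' + θ * (y - y'))) * (e' + n)
        - ((θ * wt g ε (y' + θ * (y - y'))) * (n * e)
          + ((1 - θ) * wt g ε (y' + θ * (y - y'))) * (n * e'))
        + 4 * C / ε * (|e + n| ^ 3 + |e' + n| ^ 3) := by
      intro θ hθ
      set x := y' + θ * (y - y') with hx
      set h := θ * (e + n) + (1 - θ) * (e' + n) with hh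
      have e1 : (y' + (e' + n)) + θ * ((y + (e + n)) - (y' + (e' + n))) = x + h := by
        rw [hx, hh]; ring
      rw [e1]
      have ht := (abs_le.1 (taylor2 hφ (wt1_deriv hg hC ε) (wt_lip hg hC hε) (by positivity) x h)).1
      have hcube : |h| ^ 3 ≤ |e + n| ^ 3 + |e' + n| ^ 3 := by
        have h0 : |h| ≤ max |e + n| |e' + n| := by
          rw [hh]
          refine (abs_add_le _ _).trans ?_
          rw [abs_mul, abs_mul, abs_of_nonneg hθ.1, abs_of_nonneg (by linarith [hθ.2] : 0 ≤ 1 - θ)]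
          have := le_max_left |e + n| |e' + n|
          have := le_max_right |e + n| |e' + n|
          nlinarith [hθ.1, hθ.2]
        have h1 := pow_le_pow_left₀ (abs_nonneg _) h0 3
        refine h1.trans ?_
        rcases max_choice |e + n| |e' + n| with h | h <;> rw [h]
        · have : 0 ≤ |e' + n| ^ 3 := by positivity
          linarith
        · have : 0 ≤ |e + n| ^ 3 := by positivity
          linarith
      have hLc := mul_le_mul_of_nonneg_left hcube (show 0 ≤ 4 * C / ε by positivity)
      have hsq : wt g ε x * (n ^ 2 / 2) + wt g ε x * (n * (θ * e + (1 - θ) * e')) ≤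
          wt g ε x * h ^ 2 / 2 := by
        have h0 := mul_nonneg (wt_nonneg hg hε x) (sq_nonneg (θ * e + (1 - θ) * e'))
        have : h = n + (θ * e + (1 - θ) * e') := by rw [hh]; ring
        rw [this]; nlinarith
      have e2 : wt1 g ε x * h = (θ * wt1 g ε x) * (e + n) + ((1 - θ) * wt1 g ε x) * (e' + n) := by
        rw [hh]; ring
      linarith
    have i1 := seg_int (cu cw) y y'
    have i2 := seg_int (cu cφ) (y + (e + n)) (y' + (e' + n))
    have i3 := seg_int (cu cφ) y y'
    have i4 := (seg_int (cuθ c1) y y').mul_const (e + n)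
    have i5 := (seg_int (cuθ' c1) y y').mul_const (e' + n)
    have i6 := (seg_int (cuθ cw) y y').mul_const (n * e)
    have i7 := (seg_int (cuθ' cw) y y').mul_const (n * e')
    have := intervalIntegral.integral_mono_on (μ := volume) zero_le_one (i1.mul_const (n ^ 2 / 2))
      (((((i2.sub i3).sub i4).sub i5).sub (i6.add i7)).add
        (intervalIntegrable_const (c := 4 * C / ε * (|e + n| ^ 3 + |e' + n| ^ 3)))) key
    rw [intervalIntegral.integral_add ((((i2.sub i3).sub i4).sub i5).sub (i6.add i7))
        intervalIntegrable_const,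
      intervalIntegral.integral_sub (((i2.sub i3).sub i4).sub i5) (i6.add i7),
      intervalIntegral.integral_add i6 i7,
      intervalIntegral.integral_sub ((i2.sub i3).sub i4) i5,
      intervalIntegral.integral_sub (i2.sub i3) i4,
      intervalIntegral.integral_sub i2 i3,
      intervalIntegral.integral_mul_const, intervalIntegral.integral_mul_const,
      intervalIntegral.integral_mul_const, intervalIntegral.integral_mul_const,
      intervalIntegral.integral_mul_const, intervalIntegral.integral_const] at this
    simp only [seg]
    simp only [sub_zero, one_smul] at this
    linarith
  · intro y y'
    exact seg_lower (cu cw) fun θ _ => wt_nonneg hg hε _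
  · intro y y'
    exact (le_abs_self _).trans (seg_bd (fun θ _ x => bw x) y y')
  · intro y
    refine seg_lower (cu cw) fun θ _ => ?_
    simpa using wt_lower hg hε y
  · -- main lower bound
    have main : ∀ y y', y' ≤ y → ε * (g y - g y') ≤ seg (fun _ x => wt g ε x) y y' * (y - y' + ε) := by
      intro y y' hyy
      have hw0 : 0 ≤ seg (fun _ x => wt g ε x) y y' :=
        seg_lower (cu cw) fun θ _ => wt_nonneg hg hε _
      by_cases hd : y - y' ≤ ε
      · have : g y - g y' ≤ seg (fun _ x => wt g ε x) y y' := by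
          refine seg_lower (cu cw) fun θ hθ => ?_
          refine le_trans ?_ (wt_lower hg hε _)
          refine sub_le_sub (hg ?_) (hg ?_) <;> nlinarith [hθ.1, hθ.2]
        nlinarith
      · push Not at hd
        have ftc : seg (fun _ x => wt g ε x) y y' * (y - y') = wt1 g ε y - wt1 g ε y' := by
          unfold seg
          rw [← intervalIntegral.integral_mul_const]
          have := intervalIntegral.integral_eq_sub_of_hasDerivAt (a := 0) (b := 1)
            (f := fun θ => wt1 g ε (y' + θ * (y - y')))
            (f' := fun θ => wt g ε (y' + θ * (y - y')) * (y - y')) (fun θ _ => by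
              have h1 : HasDerivAt (fun θ : ℝ => y' + θ * (y - y')) (y - y') θ := by
                simpa using ((hasDerivAt_id θ).mul_const (y - y')).const_add y'
              exact (wt1_deriv hg hC ε _).comp θ h1)
            ((seg_int (cu cw) y y').mul_const _)
          rw [this]; simp
        have hgint : wt1 g ε y - wt1 g ε y' = ∫ x in y'..y, wt g ε x := by
          rw [intervalIntegral.integral_eq_sub_of_hasDerivAt (fun x _ => wt1_deriv hg hC ε x)
            (cw.intervalIntegrable _ _)]
        have m1 : Monotone fun x => g (x + ε) := fun a b h => hg (by linarith)
        have m2 : Monotone fun x => g (x - ε) := fun a b h => hg (by linarith)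
        have hlow : ∫ x in y'..y, (g (x + ε) - g (x - ε)) ≤ ∫ x in y'..y, wt g ε x :=
          intervalIntegral.integral_mono_on hyy (m1.intervalIntegrable.sub m2.intervalIntegrable)
            (cw.intervalIntegrable _ _) (fun x _ => wt_lower hg hε x)
        rw [intervalIntegral.integral_sub m1.intervalIntegrable m2.intervalIntegrable,
          intervalIntegral.integral_comp_add_right, intervalIntegral.integral_comp_sub_right,
          ← prim_sub hg, ← prim_sub hg] at hlow
        have a1 := prim_lower hg (show y ≤ y + ε by linarith)
        have a2 := prim_upper hg (show y' - ε ≤ y' by linarith)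
        have a3 := prim_conv hg (show y' ≤ y - ε by linarith) hε.le
        rw [sub_add_cancel] at a3
        nlinarith
    intro y y'
    rcases le_total y' y with h | h
    · rw [abs_of_nonneg (sub_nonneg.2 (hg h)), abs_of_nonneg (sub_nonneg.2 h)]
      exact main y y' h
    · have hsym : seg (fun _ x => wt g ε x) y y' = seg (fun _ x => wt g ε x) y' y := by
        unfold seg
        have := intervalIntegral.integral_comp_sub_left (a := 0) (b := 1)
          (fun θ => wt g ε (y' + θ * (y - y'))) 1
        simp only [sub_zero, sub_self] at this
        rw [← this]
        congr 1; ext θ; congr 1; ring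
      rw [abs_sub_comm (g y), abs_sub_comm y, hsym, abs_of_nonneg (sub_nonneg.2 (hg h)),
        abs_of_nonneg (sub_nonneg.2 h)]
      exact main y' y h

end calc1

/-- harmonic-type average of `g` just below `r` -/
def hav (g : ℝ → ℝ) (r l : ℝ) : ℝ := l * ∫ v in (0:ℝ)..(1 / l), g (r / (1 + v))

lemma ii_of_bdd {k : ℝ → ℝ} (hk : Measurable k) {C : ℝ} (hC : ∀ x, |k x| ≤ C) (a b : ℝ) :
    IntervalIntegrable k volume a b := by
  refine (intervalIntegrable_const (c := C)).mono_fun hk.aestronglyMeasurable ?_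
  refine Filter.Eventually.of_forall fun x => ?_
  simp only [Real.norm_eq_abs]
  exact (hC x).trans (le_abs_self _)

lemma ii_bd {k : ℝ → ℝ} {C : ℝ} (hC : ∀ x, |k x| ≤ C) {a b : ℝ} (h : a ≤ b) :
    |∫ x in a..b, k x| ≤ C * (b - a) := by
  have := intervalIntegral.norm_integral_le_of_norm_le_const (a := a) (b := b) (f := k) (C := C)
    (fun x _ => hC x)
  rwa [Real.norm_eq_abs, abs_of_nonneg (sub_nonneg.2 h)] at this

lemma hav_bd {g : ℝ → ℝ} {C : ℝ} (hC : ∀ x, |g x| ≤ C) (r : ℝ) {l : ℝ} (hl : 0 ≤ l) :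
    |hav g r l| ≤ C := by
  have hC0 : 0 ≤ C := (abs_nonneg _).trans (hC 0)
  unfold hav
  rcases hl.eq_or_lt with h | h
  · rw [← h]; simpa using hC0
  · have := ii_bd (k := fun v => g (r / (1 + v))) (fun x => hC _) (a := 0) (b := 1 / l) (by positivity)
    rw [abs_mul, abs_of_pos h]
    calc l * _ ≤ l * (C * (1 / l - 0)) := mul_le_mul_of_nonneg_left this hl
      _ = C := by field_simp; ring

lemma hav_diff {g : ℝ → ℝ} (hg : Measurable g) {C : ℝ} (hC : ∀ x, |g x| ≤ C) (r : ℝ) {l l' : ℝ}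
    (hl : 0 < l) (hll : l ≤ l') : |hav g r l - hav g r l'| ≤ 2 * C * (1 - l / l') := by
  have hl' : 0 < l' := hl.trans_le hll
  have hC0 : 0 ≤ C := (abs_nonneg _).trans (hC 0)
  set k : ℝ → ℝ := fun v => g (r / (1 + v)) with hk
  have hkm : Measurable k := hg.comp (by fun_prop)
  have hkC : ∀ x, |k x| ≤ C := fun x => hC _
  have hle : 1 / l' ≤ 1 / l := one_div_le_one_div_of_le hl hll
  have e : hav g r l - hav g r l' = (l - l') * (∫ v in (0:ℝ)..(1 / l'), k v)
      + l * ∫ v in (1 / l')..(1 / l), k v := by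
    unfold hav
    rw [← intervalIntegral.integral_add_adjacent_intervals (ii_of_bdd hkm hkC 0 (1 / l'))
      (ii_of_bdd hkm hkC (1 / l') (1 / l))]
    ring
  rw [e]
  have h1 := ii_bd hkC (a := 0) (b := 1 / l') (by positivity)
  have h2 := ii_bd hkC hle
  refine (abs_add_le _ _).trans ?_
  rw [abs_mul, abs_mul, abs_of_pos hl, abs_of_nonpos (by linarith : l - l' ≤ 0)]
  have a1 := mul_le_mul_of_nonneg_left h1 (by linarith : 0 ≤ -(l - l'))
  have a2 := mul_le_mul_of_nonneg_left h2 hl.le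
  have e1 : -(l - l') * (C * (1 / l' - 0)) = C * (1 - l / l') := by field_simp; ring
  have e2 : l * (C * (1 / l - 1 / l')) = C * (1 - l / l') := by field_simp
  linarith

/-- one full block -/
lemma hav_block (g : ℝ → ℝ) (r : ℝ) {j : ℕ} (hj : 0 < j) :
    ∫ u in (j:ℝ)..(j + 1 : ℕ), g (r * (⌊u⌋₊ : ℝ) / u) = hav g r j := by
  have hj' : (0:ℝ) < j := by exact_mod_cast hj
  have e1 : ∫ u in (j:ℝ)..(j + 1 : ℕ), g (r * (⌊u⌋₊ : ℝ) / u) =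
      ∫ u in (j:ℝ)..(j + 1 : ℕ), g (r * j / u) := by
    apply intervalIntegral.integral_congr_ae
    have : ∀ᵐ u : ℝ, u ≠ ((j + 1 : ℕ) : ℝ) := by
      simp [ae_iff, measure_singleton]
    filter_upwards [this] with u hu hu'
    rw [uIoc_of_le (by push_cast; linarith)] at hu'
    have : ⌊u⌋₊ = j := by
      rw [Nat.floor_eq_iff (hj'.le.trans hu'.1.le)]
      refine ⟨hu'.1.le, lt_of_le_of_ne (by exact_mod_cast hu'.2) (by exact_mod_cast hu)⟩
    rw [this]
  rw [e1]; unfold hav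
  have := intervalIntegral.mul_integral_comp_mul_add (a := 0) (b := 1 / (j:ℝ))
    (f := fun u => g (r * j / u)) (c := (j:ℝ)) (j:ℝ)
  rw [show (j:ℝ) * 0 + j = j by ring, show (j:ℝ) * (1 / j) + j = ((j + 1 : ℕ) : ℝ) by
    push_cast; field_simp; ring] at this
  rw [← this]
  congr 1
  apply intervalIntegral.integral_congr
  intro v _
  simp only
  congr 1
  rw [show (j:ℝ) * v + j = j * (1 + v) by ring, mul_comm r, mul_div_mul_left _ _ hj'.ne']

lemma hav_window {g : ℝ → ℝ} (hg : Measurable g) {C : ℝ} (hC : ∀ x, |g x| ≤ C) (r : ℝ) {l L : ℝ}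
    (hl : 0 < l) (hL : 0 < L) :
    |(∫ u in l..(l + L), g (r * (⌊u⌋₊ : ℝ) / u)) - L * hav g r l| ≤
      2 * C * (L / l) * L + 4 * C := by
  have hC0 : 0 ≤ C := (abs_nonneg _).trans (hC 0)
  set k : ℝ → ℝ := fun u => g (r * (⌊u⌋₊ : ℝ) / u) with hk
  have hkm : Measurable k := hg.comp (by
    refine Measurable.div (measurable_const.mul ?_) measurable_id
    exact (measurable_from_top (f := fun n : ℕ => (n:ℝ))).comp Nat.measurable_floor)
  have hkC : ∀ x, |k x| ≤ C := fun x => hC _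
  have hh := hav_bd hC r hl.le
  set h := hav g r l
  set a := ⌈l⌉₊ with ha
  set b := ⌊l + L⌋₊ with hb
  have ha1 : l ≤ a := Nat.le_ceil l
  have ha2 : (a:ℝ) < l + 1 := Nat.ceil_lt_add_one hl.le
  have hb1 : (b:ℝ) ≤ l + L := Nat.floor_le (by positivity)
  have hb2 : l + L < b + 1 := Nat.lt_floor_add_one _
  have hA : 0 ≤ 2 * C * (L / l) * L := by positivity
  by_cases hab : a ≤ b
  · have e : (∫ u in l..(l + L), k u) = (∫ u in l..a, k u) + (∑ j ∈ Finset.Ico a b, hav g r j)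
        + ∫ u in b..(l + L), k u := by
      have : ∑ j ∈ Finset.Ico a b, hav g r j = ∫ u in (a:ℝ)..b, k u := by
        rw [← intervalIntegral.sum_integral_adjacent_intervals_Ico (a := fun n : ℕ => (n:ℝ)) hab
          (fun j _ => ii_of_bdd hkm hkC _ _)]
        refine Finset.sum_congr rfl fun j hj => ?_
        have h1 := (Finset.mem_Ico.1 hj).1
        have : 0 < j := (Nat.ceil_pos.2 hl).trans_le h1
        exact (hav_block g r this).symm
      rw [this, intervalIntegral.integral_add_adjacent_intervals (ii_of_bdd hkm hkC _ _)
        (ii_of_bdd hkm hkC _ _), intervalIntegral.integral_add_adjacent_intervals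
        (ii_of_bdd hkm hkC _ _) (ii_of_bdd hkm hkC _ _)]
    have h1 := ii_bd hkC ha1
    have h2 := ii_bd hkC hb1
    have h3 : |∑ j ∈ Finset.Ico a b, hav g r j - ((b:ℝ) - a) * h| ≤ L * (2 * C * (L / l)) := by
      have : ((b:ℝ) - a) * h = ∑ j ∈ Finset.Ico a b, h := by
        rw [Finset.sum_const, Nat.card_Ico, nsmul_eq_mul, Nat.cast_sub hab]
      rw [this, ← Finset.sum_sub_distrib]
      refine (Finset.abs_sum_le_sum_abs _ _).trans ?_
      have : ∀ j ∈ Finset.Ico a b, |hav g r j - h| ≤ 2 * C * (L / l) := by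
        intro j hj
        obtain ⟨j1, j2⟩ := Finset.mem_Ico.1 hj
        have hlj : l ≤ j := ha1.trans (by exact_mod_cast j1)
        have j3 : (j:ℝ) ≤ l + L := le_trans (by exact_mod_cast j2.le) hb1
        rw [abs_sub_comm]
        refine (hav_diff hg hC r hl hlj).trans ?_
        refine mul_le_mul_of_nonneg_left ?_ (by positivity)
        have hj0 : (0:ℝ) < j := hl.trans_le hlj
        rw [show 1 - l / j = (j - l) / j by field_simp]
        exact div_le_div₀ hL.le (by linarith) hl hlj
      refine (Finset.sum_le_card_nsmul _ _ _ this).trans ?_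
      rw [Nat.card_Ico, nsmul_eq_mul, Nat.cast_sub hab]
      exact mul_le_mul_of_nonneg_right (by linarith) (by positivity)
    rw [e, show (∫ u in l..a, k u) + (∑ j ∈ Finset.Ico a b, hav g r j) + (∫ u in b..(l + L), k u)
      - L * h = (∑ j ∈ Finset.Ico a b, hav g r j - ((b:ℝ) - a) * h) + (∫ u in l..a, k u)
        + (∫ u in b..(l + L), k u) - (L - (b - a)) * h by ring]
    have h4 : |(L - ((b:ℝ) - a)) * h| ≤ 2 * C := by
      rw [abs_mul]
      refine mul_le_mul ?_ hh (abs_nonneg _) (by norm_num)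
      rw [abs_le]; constructor <;> linarith
    have h1' : |∫ u in l..a, k u| ≤ C := h1.trans (by nlinarith)
    have h2' : |∫ u in b..(l + L), k u| ≤ C := h2.trans (by nlinarith)
    rw [abs_le] at *
    constructor <;> linarith [h1'.1, h1'.2, h2'.1, h2'.2, h3.1, h3.2, h4.1, h4.2]
  · have hL2 : L ≤ 2 := by
      have : (b:ℝ) + 1 ≤ a := by exact_mod_cast not_le.1 hab
      linarith
    have h1 := ii_bd hkC (a := l) (b := l + L) (by linarith)
    have h2 : |L * h| ≤ 2 * C := by
      rw [abs_mul, abs_of_pos hL]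
      exact mul_le_mul hL2 hh (abs_nonneg _) (by norm_num)
    have h3 : C * (l + L - l) ≤ 2 * C := by nlinarith
    refine (abs_sub _ _).trans ?_
    linarith

/-- window average in the parameter `ς` -/
lemma hav_avg {g : ℝ → ℝ} (hg : Measurable g) {C : ℝ} (hC : ∀ x, |g x| ≤ C) {r s a η : ℝ}
    (hs : 0 < s) (ha : 0 < a) (hη : 0 < η) :
    |(1 / η) * (∫ z in a..(a + η), g (r * (⌊s * z⌋₊ : ℝ) / (s * z))) - hav g r (s * a)| ≤
      2 * C * η / a + 4 * C / (s * η) := by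
  have h := hav_window hg hC r (mul_pos hs ha) (mul_pos hs hη)
  have e := intervalIntegral.mul_integral_comp_mul_left (a := a) (b := a + η)
    (f := fun u => g (r * (⌊u⌋₊ : ℝ) / u)) (c := s)
  rw [mul_add] at e
  rw [← e] at h
  have hp : 0 < s * η := by positivity
  have : (1 / η) * (∫ z in a..(a + η), g (r * (⌊s * z⌋₊ : ℝ) / (s * z))) - hav g r (s * a) =
    (1 / (s * η)) * (s * (∫ z in a..(a + η), g (r * (⌊s * z⌋₊ : ℝ) / (s * z)))
      - s * η * hav g r (s * a)) := by field_simp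
  rw [this, abs_mul, abs_of_pos (by positivity)]
  calc _ ≤ 1 / (s * η) * (2 * C * (s * η / (s * a)) * (s * η) + 4 * C) :=
        mul_le_mul_of_nonneg_left h (by positivity)
    _ = _ := by field_simp

section
variable {μ : Measure Ω} [IsProbabilityMeasure μ] {F : Filtration ℝ m} {B : ℝ} {M Y : ℝ → Ω → ℝ} {T : ℝ}
  {G : Set Ω}

/-- second moment -/
def phi (μ : Measure Ω) (M : ℝ → Ω → ℝ) (t : ℝ) : ℝ := ∫ ω, M t ω ^ 2 ∂μ

lemma Drv.phi_cont (h : Drv μ F B M) : ContinuousOn (phi μ M) (Ici 0) := by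
  unfold phi
  intro t ht
  refine tendsto_integral_filter_of_dominated_convergence (fun _ => B ^ 2) ?_ ?_ (integrable_const _) ?_
  · filter_upwards [self_mem_nhdsWithin] with s hs
    exact (((h.bdd hs).mono (F.le _)).sq).1.aestronglyMeasurable
  · filter_upwards [self_mem_nhdsWithin] with s hs
    refine ae_of_all _ fun ω => ?_
    rw [Real.norm_eq_abs, abs_pow]
    exact pow_le_pow_left₀ (abs_nonneg _) (h.bd s hs ω) 2
  · exact ae_of_all _ fun ω => (((h.cont ω).pow 2).continuousAt.tendsto).mono_left nhdsWithin_le_nhds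

lemma Drv.phi_inc (h : Drv μ F B M) {s t : ℝ} (hs : 0 ≤ s) (hst : s ≤ t) :
    ∫ ω, (M t ω - M s ω) ^ 2 ∂μ = phi μ M t - phi μ M s := by
  have hb1 := (h.bdd (hs.trans hst)).mono (F.le _)
  have hb0 := (h.bdd hs).mono (F.le _)
  have h1 := h.mart s t hs hst (M s) (h.bdd hs)
  have e : ∀ ω, (M t ω - M s ω) ^ 2 = M t ω ^ 2 - M s ω ^ 2 - 2 * (M s ω * (M t ω - M s ω)) := by
    intro ω; ring
  simp_rw [e]
  rw [integral_sub (hb1.sq.sub hb0.sq).integrable ((Bdd.const 2).mul (hb0.mul (hb1.sub hb0))).integrable,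
    integral_const_mul, h1, integral_sub hb1.sq.integrable hb0.sq.integrable]
  simp [phi]

lemma Drv.phi_mono (h : Drv μ F B M) {s t : ℝ} (hs : 0 ≤ s) (hst : s ≤ t) :
    phi μ M s ≤ phi μ M t := by
  have := h.phi_inc hs hst
  have h2 : 0 ≤ ∫ ω, (M t ω - M s ω) ^ 2 ∂μ := integral_nonneg fun ω => sq_nonneg _
  linarith

lemma Drv.phi_zero (h : Drv μ F B M) : phi μ M 0 = 0 := by simp [phi, h.zero]

lemma Drv.iso3 (h : Drv μ F B M) (hT : 0 ≤ T) (n i : ℕ) {c : ℕ → Ω → ℝ} {C : ℕ → ℝ}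
    (hc : ∀ j, Measurable[F (pt T n j)] (c j)) (hC : ∀ j ω, |c j ω| ≤ C j) :
    ∫ ω, (∑ j ∈ Finset.range i, c j ω * dX M T n j ω) ^ 2 ∂μ ≤
      ∑ j ∈ Finset.range i, C j ^ 2 * (phi μ M (pt T n (j + 1)) - phi μ M (pt T n j)) := by
  have hc' : ∀ j, Bdd (F (pt T n j)) (c j) := fun j => ⟨hc j, C j, hC j⟩
  rw [((h.md hT n).transform hc').sq i]
  refine Finset.sum_le_sum fun j _ => ?_
  rw [← h.phi_inc (pt_nonneg hT n j) (pt_mono hT n (Nat.le_succ j)), ← integral_const_mul]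
  refine integral_mono (((h.md hT n).transform hc').bddm j).sq.integrable
    ((Bdd.const _).mul ((h.md hT n).bddm j).sq).integrable fun ω => ?_
  show (c j ω * dX M T n j ω) ^ 2 ≤ C j ^ 2 * (dX M T n j ω) ^ 2
  rw [mul_pow]
  refine mul_le_mul_of_nonneg_right ?_ (sq_nonneg _)
  rw [← sq_abs]; exact pow_le_pow_left₀ (abs_nonneg _) (hC j ω) 2

lemma abs_int_le {X : Ω → ℝ} (hX : Bdd m X) {δ : ℝ} (hδ : 0 < δ) (h : ∫ ω, X ω ^ 2 ∂μ ≤ δ ^ 2) :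
    ∫ ω, |X ω| ∂μ ≤ δ := by
  have h1 : ∫ ω, |X ω| ∂μ ≤ ∫ ω, (δ / 2 + X ω ^ 2 * (1 / (2 * δ))) ∂μ := by
    refine integral_mono hX.integrable.abs ((Bdd.const _).add (hX.sq.mul (Bdd.const _))).integrable
      fun ω => ?_
    show |X ω| ≤ δ / 2 + X ω ^ 2 * (1 / (2 * δ))
    rw [← sq_abs (X ω)]
    have : δ / 2 + |X ω| ^ 2 * (1 / (2 * δ)) - |X ω| = (|X ω| - δ) ^ 2 * (1 / (2 * δ)) := by
      field_simp; ring
    have h0 : 0 ≤ (|X ω| - δ) ^ 2 * (1 / (2 * δ)) := by positivity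
    linarith
  rw [integral_add (integrable_const _) (hX.sq.mul (Bdd.const _)).integrable, integral_mul_const] at h1
  simp only [integral_const, probReal_univ, one_smul] at h1
  have h2 : (∫ ω, X ω ^ 2 ∂μ) * (1 / (2 * δ)) ≤ δ ^ 2 * (1 / (2 * δ)) :=
    mul_le_mul_of_nonneg_right h (by positivity)
  have : δ ^ 2 * (1 / (2 * δ)) = δ / 2 := by field_simp
  linarith

lemma joint_gen {Ω' : Type*} [MeasurableSpace Ω'] (u : ℝ → Ω' → ℝ) (hc : ∀ ω, Continuous fun t => u t ω)
    (hm : ∀ t, Measurable (u t)) : Measurable (fun z : ℝ × Ω' => u z.1 z.2) :=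
  (stronglyMeasurable_uncurry_of_continuous_of_stronglyMeasurable (α := Ω') (ι := ℝ) (u := u)
    hc (fun t => (hm t).stronglyMeasurable)).measurable

/-- joint measurability -/
lemma Adp.joint (hY : Adp F Y) {p : ℝ} (hp : 0 ≤ p) :
    @Measurable (ℝ × Ω) ℝ (@Prod.instMeasurableSpace _ _ _ (F p)) _
      (fun z => Y (max 0 (min z.1 p)) z.2) := by
  exact @joint_gen Ω (F p) (fun t ω => Y (max 0 (min t p)) ω)
    (fun ω => (hY.cont ω).comp (by fun_prop))
    (fun t => ((hY.meas _ (le_max_left _ _)).mono (F.mono (max_le hp (min_le_right _ _))) le_rfl))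

lemma Adp.joint' (hY : Adp F Y) : Measurable (fun z : ℝ × Ω => Y (max 0 z.1) z.2) := by
  have := stronglyMeasurable_uncurry_of_continuous_of_stronglyMeasurable (α := Ω) (ι := ℝ)
    (u := fun t ω => Y (max 0 t) ω)
    (fun ω => (hY.cont ω).comp (by fun_prop))
    (fun t => ((hY.meas _ (le_max_left _ _)).mono (F.le _) le_rfl).stronglyMeasurable)
  exact this.measurable

/-- floor to the grid with `2^n ς` points per unit -/
def fl (n : ℕ) (r z : ℝ) : ℝ := r * (⌊r * 2 ^ n * z⌋₊ : ℝ) / (r * 2 ^ n * z)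

lemma fl_nonneg {n : ℕ} {r z : ℝ} (hr : 0 ≤ r) (hz : 0 ≤ z) : 0 ≤ fl n r z := by
  unfold fl; positivity

lemma fl_le {n : ℕ} {r z : ℝ} (hr : 0 ≤ r) (hz : 0 ≤ z) : fl n r z ≤ r := by
  unfold fl
  have h := Nat.floor_le (a := r * 2 ^ n * z) (by positivity)
  rcases (show 0 ≤ r * 2 ^ n * z by positivity).eq_or_lt with h0 | h0
  · rw [← h0]; simpa using hr
  · rw [div_le_iff₀ h0]; exact mul_le_mul_of_nonneg_left h hr

lemma fl_eq {n i : ℕ} {r τ : ℝ} (hτ : 0 < τ) (hr : 0 ≤ r) (h1 : pt τ n i ≤ r) (h2 : r < pt τ n (i + 1)) :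
    fl n r (1 / τ) = pt τ n i := by
  unfold pt at *
  rcases hr.eq_or_lt with h0 | h0
  · rw [← h0] at h1 ⊢
    have : τ * i / 2 ^ n = 0 := le_antisymm h1 (by positivity)
    rw [this]; simp [fl]
  unfold fl
  have : ⌊r * 2 ^ n * (1 / τ)⌋₊ = i := by
    rw [Nat.floor_eq_iff (by positivity)]
    rw [div_le_iff₀ (by positivity)] at h1
    rw [lt_div_iff₀ (by positivity)] at h2
    rw [mul_one_div, le_div_iff₀ hτ, div_lt_iff₀ hτ]
    push_cast at h2
    constructor <;> nlinarith
  rw [this]; field_simp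

lemma fl_meas (n : ℕ) (r : ℝ) : Measurable (fl n r) := by
  unfold fl
  refine Measurable.div (measurable_const.mul ?_) (by fun_prop)
  exact (measurable_from_top (f := fun n : ℕ => (n:ℝ))).comp (Nat.measurable_floor.comp (by fun_prop))

/-- the sums -/
def Zs (f : ℝ → ℝ) (Y M : ℝ → Ω → ℝ) (T : ℝ) (K J n : ℕ) (z : ℝ) (ω : Ω) : ℝ :=
  ∑ j ∈ Finset.range J, f (Y (fl n (pt T K j) z) ω) * dX M T K j ω

lemma sum_Ico_blocks (g : ℕ → ℝ) (a : ℕ → ℕ) (ha : Monotone a) (h0 : a 0 = 0) (N : ℕ) :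
    ∑ j ∈ Finset.range (a N), g j = ∑ i ∈ Finset.range N, ∑ j ∈ Finset.Ico (a i) (a (i + 1)), g j := by
  induction N with
  | zero => simp [h0]
  | succ N ih =>
    rw [Finset.sum_range_succ, ← ih, Finset.range_eq_Ico, Finset.range_eq_Ico,
      Finset.sum_Ico_consecutive _ (Nat.zero_le _) (ha (Nat.le_succ N))]

/-- first grid index `≥ x` -/
def up (T : ℝ) (K : ℕ) (x : ℝ) : ℕ := ⌈x * 2 ^ K / T⌉₊

lemma le_pt_iff (hT : 0 < T) {K : ℕ} {x : ℝ} {j : ℕ} : x ≤ pt T K j ↔ up T K x ≤ j := by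
  unfold up pt
  rw [Nat.ceil_le, div_le_iff₀ hT, le_div_iff₀ (by positivity), mul_comm T]

lemma up_close (hT : 0 < T) (K : ℕ) {x : ℝ} (hx : 0 ≤ x) : |pt T K (up T K x) - x| ≤ T / 2 ^ K := by
  have h1 : x ≤ pt T K (up T K x) := (le_pt_iff hT).2 le_rfl
  have h2 := Nat.ceil_lt_add_one (a := x * 2 ^ K / T) (by positivity)
  rw [abs_of_nonneg (by linarith)]
  change ((up T K x : ℕ) : ℝ) < _ at h2
  unfold pt
  have : T * (up T K x : ℝ) / 2 ^ K ≤ T * (x * 2 ^ K / T + 1) / 2 ^ K := by gcongr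
  have e : T * (x * 2 ^ K / T + 1) / 2 ^ K = x + T / 2 ^ K := by field_simp
  linarith

lemma up_mono (hT : 0 < T) (K : ℕ) : Monotone (up T K) := by
  intro x y h; unfold up; gcongr

lemma V_eq (hT : 0 < T) {τ : ℝ} (hτ : 0 < τ) (f : ℝ → ℝ) (K n : ℕ) (ω : Ω) :
    Zs f Y M T K (up T K τ) n (1 / τ) ω = ∑ i ∈ Finset.range (2 ^ n), f (Y (pt τ n i) ω) *
      (M (pt T K (up T K (pt τ n (i + 1)))) ω - M (pt T K (up T K (pt τ n i))) ω) := by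
  have hm : Monotone fun i => up T K (pt τ n i) := fun i j h => up_mono hT K (pt_mono hτ.le n h)
  have h := sum_Ico_blocks (fun j => f (Y (fl n (pt T K j) (1 / τ)) ω) * dX M T K j ω) _ hm
    (by simp [pt_zero, up]) (2 ^ n)
  rw [pt_top] at h
  unfold Zs
  rw [h]
  refine Finset.sum_congr rfl fun i _ => ?_
  have h2 : ∀ j ∈ Finset.Ico (up T K (pt τ n i)) (up T K (pt τ n (i + 1))),
      f (Y (fl n (pt T K j) (1 / τ)) ω) * dX M T K j ω = f (Y (pt τ n i) ω) * dX M T K j ω := by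
    intro j hj
    obtain ⟨h1, h2⟩ := Finset.mem_Ico.1 hj
    rw [fl_eq hτ (pt_nonneg hT.le K j) ((le_pt_iff hT).2 h1)
      (not_le.1 fun h => (not_le.2 h2) ((le_pt_iff hT).1 h))]
  rw [Finset.sum_congr rfl h2, ← Finset.mul_sum]
  congr 1
  have := Finset.sum_Ico_sub (fun j => M (pt T K j) ω) (hm (Nat.le_succ i))
  exact this

end

section
variable {μ : Measure Ω} [IsProbabilityMeasure μ] {F : Filtration ℝ m} {B : ℝ} {M Y : ℝ → Ω → ℝ} {T : ℝ}
  {G : Set Ω}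

lemma l1_conv {X : ℕ → Ω → ℝ} (hX : ∀ n, Bdd m (X n)) {S : ℝ} (hS : ∀ n, ∫ ω, X n ω ^ 2 ∂μ ≤ S)
    (hG : MeasurableSet G) (hcp : CP μ G X 0) {δ : ℝ} (hδ : 0 < δ) :
    ∀ᶠ n in atTop, ∫ ω in G, |X n ω| ∂μ ≤ δ := by
  have hS0 : 0 ≤ S := (integral_nonneg fun ω => sq_nonneg _).trans (hS 0)
  set l := δ / (2 * (S + 1)) with hl
  have hl0 : 0 < l := by positivity
  have hlS : l * S ≤ δ / 2 := by
    rw [hl, div_mul_eq_mul_div, div_le_div_iff₀ (by positivity) (by positivity)]; nlinarith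
  filter_upwards [hcp (min (δ / 4) (δ * l / 4)) (by positivity)] with n hn
  set bad : Set Ω := {ω | ω ∈ G ∧ δ / 4 < |X n ω|} with hbad
  have hbm : MeasurableSet bad := hG.inter (measurableSet_lt measurable_const (hX n).abs.1)
  have hpb : μ.real bad ≤ δ * l / 4 := by
    refine (measureReal_mono ?_ (measure_ne_top _ _)).trans (hn.trans (min_le_right _ _))
    rintro ω ⟨h1, h2⟩
    exact ⟨h1, lt_of_le_of_lt (min_le_left _ _) (by simpa using h2)⟩
  have hib : Integrable (bad.indicator fun _ => 1 / l) μ := (integrable_const _).indicator hbm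
  have hi2 : Integrable (fun ω => l * X n ω ^ 2) μ := ((Bdd.const l).mul (hX n).sq).integrable
  have key : ∀ ω, G.indicator (fun ω => |X n ω|) ω ≤ δ / 4 + (l * X n ω ^ 2 + bad.indicator (fun _ => 1 / l) ω) := by
    intro ω
    have hs : 0 ≤ l * X n ω ^ 2 := by positivity
    by_cases hωG : ω ∈ G
    · rw [indicator_of_mem hωG]
      by_cases hb : δ / 4 < |X n ω|
      · have : ω ∈ bad := ⟨hωG, hb⟩
        rw [indicator_of_mem this]
        have : |X n ω| ≤ l * X n ω ^ 2 + 1 / l := by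
          rw [← sq_abs]
          have e : l * |X n ω| ^ 2 + 1 / l - |X n ω| = ((l * |X n ω| - 1/2) ^ 2 + 3/4) / l := by
            field_simp; ring
          have : 0 ≤ ((l * |X n ω| - 1/2) ^ 2 + 3/4) / l := by positivity
          linarith
        linarith
      · have : ω ∉ bad := fun h => hb h.2
        rw [indicator_of_notMem this]
        linarith [not_lt.1 hb]
    · rw [indicator_of_notMem hωG]
      have : 0 ≤ bad.indicator (fun _ => 1 / l) ω := indicator_nonneg (fun _ _ => by positivity) _
      positivity
  rw [← integral_indicator hG]
  refine (integral_mono ((hX n).abs.integrable.indicator hG)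
    ((integrable_const _).add (hi2.add hib)) key).trans ?_
  rw [integral_add' (integrable_const _) (hi2.add hib), integral_add' hi2 hib, integral_const_mul,
    integral_indicator hbm]
  simp only [integral_const, probReal_univ, one_smul, smul_eq_mul, measureReal_restrict_apply_univ]
  have h1 : l * ∫ ω, X n ω ^ 2 ∂μ ≤ δ / 2 := (mul_le_mul_of_nonneg_left (hS n) hl0.le).trans hlS
  have h2 : μ.real bad * (1 / l) ≤ δ * l / 4 * (1 / l) := mul_le_mul_of_nonneg_right hpb (by positivity)
  have e : δ * l / 4 * (1 / l) = δ / 4 := by field_simp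
  linarith

lemma rsum_pt (f : ℝ → ℝ) (τ : ℝ) (n : ℕ) (ω : Ω) :
    rsum (fun s ω => f (Y s ω)) M τ n ω = ∑ i ∈ Finset.range (2 ^ n), f (Y (pt τ n i) ω) * dX M τ n i ω := by
  simp [rsum, pt, dX]

lemma Zs_bdd (hM : Drv μ F B M) (hY : Adp F Y) (hT : 0 ≤ T) {f : ℝ → ℝ} (hf : Measurable f) {C : ℝ}
    (hC : ∀ x, |f x| ≤ C) (K J n : ℕ) {z : ℝ} (hz : 0 ≤ z) : Bdd m (Zs f Y M T K J n z) := by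
  refine Bdd.sum _ fun j _ => Bdd.mul ⟨hf.comp ((hY.meas _ (fl_nonneg (pt_nonneg hT K j) hz)).mono (F.le _) le_rfl),
    C, fun ω => hC _⟩ ((hM.md hT K).bddm j)

set_option maxHeartbeats 800000 in
lemma L5a (hM : Drv μ F B M) (hY : Adp F Y) (hT : 0 < T) {f : ℝ → ℝ} (hf : Measurable f) {C : ℝ}
    (hC : ∀ x, |f x| ≤ C) (hG : MeasurableSet G) {I : ℝ → Ω → ℝ} (hIm : ∀ t, 0 ≤ t → Bdd m (I t))
    {τ : ℝ} (hτ : 0 < τ) {k i0 : ℕ} (hτq : τ ≤ pt T k i0)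
    (hcp : CP μ G (fun n => rsum (fun s ω => f (Y s ω)) M τ n) (I τ)) {δ : ℝ} (hδ : 0 < δ)
    (hφ : C ^ 2 * (phi μ M (pt T k i0) - phi μ M τ) ≤ δ ^ 2)
    (hI : ∫ ω, |I τ ω - I (pt T k i0) ω| ∂μ ≤ δ) :
    ∀ᶠ n in atTop, ∀ᶠ l in atTop,
      ∫ ω in G, |Zs f Y M T (k + l) (i0 * 2 ^ l) n (1 / τ) ω - I (pt T k i0) ω| ∂μ ≤ 4 * δ := by
  have hC0 : 0 ≤ C := (abs_nonneg _).trans (hC 0)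
  have hz : 0 ≤ 1 / τ := by positivity
  have hq : 0 ≤ pt T k i0 := hτ.le.trans hτq
  have hfY : ∀ s, 0 ≤ s → Bdd (F s) (fun ω => f (Y s ω)) := fun s hs => ⟨hf.comp (hY.meas s hs), C, fun ω => hC _⟩
  have hRb : ∀ n, Bdd m (fun ω => rsum (fun s ω => f (Y s ω)) M τ n ω) := by
    intro n
    simp_rw [rsum_pt]
    exact Bdd.sum _ fun i _ => ((hfY _ (pt_nonneg hτ.le n i)).mono (F.le _)).mul ((hM.md hτ.le n).bddm i)
  have h3 := l1_conv (μ := μ) (G := G) (X := fun n ω => rsum (fun s ω => f (Y s ω)) M τ n ω - I τ ω)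
    (S := 2 * (C ^ 2 * B ^ 2) + 2 * ∫ ω, I τ ω ^ 2 ∂μ) (fun n => (hRb n).sub (hIm τ hτ.le)) (by
      intro n
      have h1 := hM.iso_le hτ.le n (2 ^ n) (c := fun i ω => f (Y (pt τ n i) ω)) (C := C)
        (fun j => (hfY _ (pt_nonneg hτ.le n j)).1) (fun j ω => hC _)
      simp_rw [← rsum_pt] at h1
      have h2 : ∫ ω, (rsum (fun s ω => f (Y s ω)) M τ n ω - I τ ω) ^ 2 ∂μ ≤
          ∫ ω, (2 * (rsum (fun s ω => f (Y s ω)) M τ n ω) ^ 2 + 2 * I τ ω ^ 2) ∂μ := by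
        refine integral_mono ((hRb n).sub (hIm τ hτ.le)).sq.integrable
          (((Bdd.const 2).mul (hRb n).sq).add ((Bdd.const 2).mul (hIm τ hτ.le).sq)).integrable fun ω => ?_
        show (rsum (fun s ω => f (Y s ω)) M τ n ω - I τ ω) ^ 2 ≤
          2 * (rsum (fun s ω => f (Y s ω)) M τ n ω) ^ 2 + 2 * I τ ω ^ 2
        nlinarith [sq_nonneg (rsum (fun s ω => f (Y s ω)) M τ n ω + I τ ω)]
      rw [integral_add ((Bdd.const 2).mul (hRb n).sq).integrable
        ((Bdd.const 2).mul (hIm τ hτ.le).sq).integrable, integral_const_mul, integral_const_mul] at h2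
      linarith) hG (by
      intro ε hε
      filter_upwards [hcp ε hε] with n hn
      simpa using hn) hδ
  filter_upwards [h3] with n hn
  -- V → R
  have h2 : Tendsto (fun l => ∫ ω, |Zs f Y M T (k + l) (up T (k + l) τ) n (1 / τ) ω -
      rsum (fun s ω => f (Y s ω)) M τ n ω| ∂μ) atTop (nhds 0) := by
    rw [show (0:ℝ) = ∫ ω : Ω, (0:ℝ) ∂μ by simp]
    refine tendsto_integral_of_dominated_convergence (fun _ => ∑ i ∈ Finset.range (2 ^ n), C * (4 * B))
      (fun l => ((Zs_bdd hM hY hT.le hf hC _ _ n hz).sub (hRb n)).abs.1.aestronglyMeasurable)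
      (integrable_const _) ?_ ?_
    · intro l
      refine ae_of_all _ fun ω => ?_
      rw [Real.norm_eq_abs, abs_abs, V_eq hT hτ, rsum_pt, ← Finset.sum_sub_distrib]
      refine (Finset.abs_sum_le_sum_abs _ _).trans (Finset.sum_le_sum fun i _ => ?_)
      rw [← mul_sub, abs_mul]
      refine mul_le_mul (hC _) ?_ (abs_nonneg _) hC0
      have b1 := hM.bd (pt T (k + l) (up T (k + l) (pt τ n (i + 1)))) (pt_nonneg hT.le _ _) ω
      have b2 := hM.bd (pt T (k + l) (up T (k + l) (pt τ n i))) (pt_nonneg hT.le _ _) ω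
      have b3 := dX_bd hM hτ.le n i ω
      rw [abs_le] at *
      constructor <;> linarith [b1.1, b1.2, b2.1, b2.2, b3.1, b3.2]
    · refine ae_of_all _ fun ω => ?_
      have hlim : ∀ x, 0 ≤ x → Tendsto (fun l => M (pt T (k + l) (up T (k + l) x)) ω) atTop (nhds (M x ω)) := by
        intro x hx
        refine ((hM.cont ω).tendsto x).comp ?_
        rw [Metric.tendsto_atTop']
        intro ε hε
        obtain ⟨N, hN⟩ := eventually_atTop.1 (mesh_small T (ρ := ε / 2) (by positivity))
        refine ⟨N, fun l hl => ?_⟩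
        rw [Real.dist_eq]
        have := (up_close hT (k + l) hx).trans (hN (k + l) (by omega))
        linarith
      have : Tendsto (fun l => Zs f Y M T (k + l) (up T (k + l) τ) n (1 / τ) ω) atTop
          (nhds (rsum (fun s ω => f (Y s ω)) M τ n ω)) := by
        simp_rw [V_eq hT hτ, rsum_pt]
        refine tendsto_finsetSum _ fun i _ => Tendsto.const_mul _ ?_
        exact (hlim _ (pt_nonneg hτ.le _ _)).sub (hlim _ (pt_nonneg hτ.le _ _))
      have := (this.sub_const (rsum (fun s ω => f (Y s ω)) M τ n ω)).abs
      simpa using this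
  filter_upwards [h2.eventually (gt_mem_nhds hδ)] with l hl
  set K := k + l with hK
  set J := i0 * 2 ^ l with hJ
  have hpq : pt T K J = pt T k i0 := pt_add k l i0
  set a := up T K τ with ha
  have haJ : a ≤ J := (le_pt_iff hT).1 (by rw [hpq]; exact hτq)
  have hbZ := Zs_bdd hM hY hT.le hf hC K J n hz
  have hbV := Zs_bdd hM hY hT.le hf hC K a n hz
  have h1 : ∫ ω, |Zs f Y M T K J n (1 / τ) ω - Zs f Y M T K a n (1 / τ) ω| ∂μ ≤ δ := by
    refine abs_int_le (hbZ.sub hbV) hδ ?_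
    have e : ∀ ω, Zs f Y M T K J n (1 / τ) ω - Zs f Y M T K a n (1 / τ) ω =
        ∑ j ∈ Finset.range J, (if a ≤ j then f (Y (fl n (pt T K j) (1 / τ)) ω) else 0) * dX M T K j ω := by
      intro ω
      unfold Zs
      rw [Finset.sum_range_sub_sum_range haJ, Finset.sum_filter]
      refine Finset.sum_congr rfl fun j _ => ?_
      split_ifs <;> simp
    simp_rw [e]
    refine (hM.iso3 hT.le K J (C := fun j => if a ≤ j then C else 0) ?_ ?_).trans ?_
    · intro j
      by_cases haj : a ≤ j
      · simp only [haj, if_true]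
        exact hf.comp ((hY.meas _ (fl_nonneg (pt_nonneg hT.le K j) hz)).mono
          (F.mono (fl_le (pt_nonneg hT.le K j) hz)) le_rfl)
      · simp only [haj, if_false]; exact measurable_const
    · intro j ω
      split_ifs
      · exact hC _
      · simp
    · have e2 : ∑ j ∈ Finset.range J, (if a ≤ j then C else 0) ^ 2 * (phi μ M (pt T K (j + 1)) - phi μ M (pt T K j))
          = C ^ 2 * (phi μ M (pt T K J) - phi μ M (pt T K a)) := by
        rw [← Finset.sum_Ico_sub (fun j => phi μ M (pt T K j)) haJ, Finset.mul_sum]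
        rw [← Nat.Ico_zero_eq_range, ← Finset.sum_Ico_consecutive _ (Nat.zero_le a) haJ]
        rw [Finset.sum_eq_zero (s := Finset.Ico 0 a), zero_add]
        · refine Finset.sum_congr rfl fun j hj => ?_
          rw [if_pos (Finset.mem_Ico.1 hj).1]
        · intro j hj
          rw [if_neg (not_le.2 (Finset.mem_Ico.1 hj).2)]; simp
      rw [e2, hpq]
      refine le_trans ?_ hφ
      refine mul_le_mul_of_nonneg_left ?_ (sq_nonneg _)
      have := hM.phi_mono hτ.le ((le_pt_iff hT (K := K) (j := a)).2 le_rfl)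
      linarith
  -- assemble
  have i1 := (hbZ.sub hbV).abs.integrable (μ := μ)
  have i2 := (hbV.sub (hRb n)).abs.integrable (μ := μ)
  have i3 := ((hRb n).sub (hIm τ hτ.le)).abs.integrable (μ := μ)
  have i4 := ((hIm τ hτ.le).sub (hIm _ hq)).abs.integrable (μ := μ)
  have hrs : ∀ {X : Ω → ℝ}, Integrable (fun ω => |X ω|) μ → ∫ ω in G, |X ω| ∂μ ≤ ∫ ω, |X ω| ∂μ :=
    fun hX => setIntegral_le_integral hX (ae_of_all _ fun ω => abs_nonneg _)
  calc ∫ ω in G, |Zs f Y M T K J n (1 / τ) ω - I (pt T k i0) ω| ∂μ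
      ≤ ∫ ω in G, (|Zs f Y M T K J n (1 / τ) ω - Zs f Y M T K a n (1 / τ) ω| +
        (|Zs f Y M T K a n (1 / τ) ω - rsum (fun s ω => f (Y s ω)) M τ n ω| +
        (|rsum (fun s ω => f (Y s ω)) M τ n ω - I τ ω| + |I τ ω - I (pt T k i0) ω|))) ∂μ := by
        refine integral_mono (hbZ.sub (hIm _ hq)).abs.integrable.integrableOn
          (i1.add (i2.add (i3.add i4))).integrableOn fun ω => ?_
        show |Zs f Y M T K J n (1 / τ) ω - I (pt T k i0) ω| ≤ _
        have := abs_add_le (Zs f Y M T K J n (1 / τ) ω - Zs f Y M T K a n (1 / τ) ω)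
          ((Zs f Y M T K a n (1 / τ) ω - rsum (fun s ω => f (Y s ω)) M τ n ω) +
          ((rsum (fun s ω => f (Y s ω)) M τ n ω - I τ ω) + (I τ ω - I (pt T k i0) ω)))
        have h2 := abs_add_le (Zs f Y M T K a n (1 / τ) ω - rsum (fun s ω => f (Y s ω)) M τ n ω)
          ((rsum (fun s ω => f (Y s ω)) M τ n ω - I τ ω) + (I τ ω - I (pt T k i0) ω))
        have h3 := abs_add_le (rsum (fun s ω => f (Y s ω)) M τ n ω - I τ ω) (I τ ω - I (pt T k i0) ω)
        rw [show Zs f Y M T K J n (1 / τ) ω - I (pt T k i0) ω =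
          (Zs f Y M T K J n (1 / τ) ω - Zs f Y M T K a n (1 / τ) ω) +
          ((Zs f Y M T K a n (1 / τ) ω - rsum (fun s ω => f (Y s ω)) M τ n ω) +
          ((rsum (fun s ω => f (Y s ω)) M τ n ω - I τ ω) + (I τ ω - I (pt T k i0) ω))) by ring]
        show _ ≤ |Zs f Y M T K J n (1 / τ) ω - Zs f Y M T K a n (1 / τ) ω| +
        (|Zs f Y M T K a n (1 / τ) ω - rsum (fun s ω => f (Y s ω)) M τ n ω| +
        (|rsum (fun s ω => f (Y s ω)) M τ n ω - I τ ω| + |I τ ω - I (pt T k i0) ω|))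
        linarith
    _ ≤ 4 * δ := by
        have i34 := (((hRb n).sub (hIm τ hτ.le)).abs.add ((hIm τ hτ.le).sub (hIm _ hq)).abs)
        have i234 := (hbV.sub (hRb n)).abs.add i34
        rw [integral_add i1.integrableOn (i234.integrable (μ := μ)).integrableOn,
          integral_add i2.integrableOn (i34.integrable (μ := μ)).integrableOn,
          integral_add i3.integrableOn i4.integrableOn]
        have := hrs i1
        have := hrs i2
        have := hrs i4
        linarith

end

section
variable {μ : Measure Ω} [IsProbabilityMeasure μ] {F : Filtration ℝ m} {B : ℝ} {M Y : ℝ → Ω → ℝ} {T : ℝ}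
  {G : Set Ω}

lemma joint_int {Ω' : Type*} [MeasurableSpace Ω'] {k : ℝ × Ω' → ℝ} (hk : Measurable k) {a b : ℝ} (hab : a ≤ b) :
    Measurable (fun ω => ∫ z in a..b, k (z, ω)) := by
  simp_rw [intervalIntegral.integral_of_le hab]
  have : StronglyMeasurable (fun p : Ω' × ℝ => k (p.2, p.1)) :=
    (hk.comp (measurable_snd.prodMk measurable_fst)).stronglyMeasurable
  exact (this.integral_prod_right' (ν := volume.restrict (Ioc a b))).measurable

lemma Adp.int_meas (hY : Adp F Y) {f : ℝ → ℝ} (hf : Measurable f) {u : ℝ → ℝ} (hu : Measurable u) {p a b : ℝ}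
    (hp : 0 ≤ p) (hab : a ≤ b) (hup : ∀ z ∈ Icc a b, u z ∈ Icc 0 p) :
    Measurable[F p] (fun ω => ∫ z in a..b, f (Y (u z) ω)) := by
  have e : (fun ω => ∫ z in a..b, f (Y (u z) ω)) =
      (fun ω => ∫ z in a..b, f (Y (max 0 (min (u z) p)) ω)) := by
    funext ω
    refine intervalIntegral.integral_congr fun z hz => ?_
    rw [uIcc_of_le hab] at hz
    obtain ⟨h1, h2⟩ := hup z hz
    simp only [min_eq_left h2, max_eq_right h1]
  rw [e]
  refine @joint_int Ω (F p) (fun x => f (Y (max 0 (min (u x.1) p)) x.2)) (hf.comp ?_) a b hab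
  have := hY.joint hp
  refine this.comp (f := fun x : ℝ × Ω => (u x.1, x.2)) ?_
  letI : MeasurableSpace Ω := F p
  exact (hu.comp measurable_fst).prodMk measurable_snd

lemma hav_meas (hY : Adp F Y) {f : ℝ → ℝ} (hf : Measurable f) {p l : ℝ} (hp : 0 ≤ p) (hl : 0 ≤ l) :
    Measurable[F p] (fun ω => hav (fun t => f (Y t ω)) p l) := by
  unfold hav
  refine Measurable.const_mul ?_ l
  refine hY.int_meas hf (u := fun v => p / (1 + v)) (by fun_prop) hp (by positivity) fun z hz => ?_
  have := hz.1
  exact ⟨by positivity, div_le_self hp (by linarith)⟩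

/-- the window average -/
def Hw (f : ℝ → ℝ) (Y : ℝ → Ω → ℝ) (n : ℕ) (p a η : ℝ) (ω : Ω) : ℝ :=
  (1 / η) * ∫ z in a..(a + η), f (Y (fl n p z) ω)

lemma Hw_meas (hY : Adp F Y) {f : ℝ → ℝ} (hf : Measurable f) (n : ℕ) {p a η : ℝ} (hp : 0 ≤ p) (ha : 0 ≤ a)
    (hη : 0 ≤ η) : Measurable[F p] (Hw f Y n p a η) := by
  unfold Hw
  refine Measurable.const_mul ?_ _
  refine hY.int_meas hf (fl_meas n p) hp (by linarith) fun z hz => ?_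
  exact ⟨fl_nonneg hp (ha.trans hz.1), fl_le hp (ha.trans hz.1)⟩

lemma path_meas (hY : Adp F Y) {f : ℝ → ℝ} (hf : Measurable f) (ω : Ω) : Measurable fun t => f (Y t ω) :=
  hf.comp (hY.cont ω).measurable

lemma Hw_bd {f : ℝ → ℝ} {C : ℝ} (hC : ∀ x, |f x| ≤ C) (n : ℕ) {p a η : ℝ} (hη : 0 < η) (ω : Ω) :
    |Hw f Y n p a η ω| ≤ C := by
  unfold Hw
  have := ii_bd (k := fun z => f (Y (fl n p z) ω)) (fun x => hC _) (a := a) (b := a + η) (by linarith)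
  rw [abs_mul, abs_of_pos (by positivity)]
  calc _ ≤ 1 / η * (C * (a + η - a)) := mul_le_mul_of_nonneg_left this (by positivity)
    _ = C := by field_simp; ring

lemma Hw_sub (hY : Adp F Y) {f : ℝ → ℝ} (hf : Measurable f) {C : ℝ} (hC : ∀ x, |f x| ≤ C) (n : ℕ) {p a η : ℝ}
    (hp : 0 < p) (ha : 0 < a) (hη : 0 < η) (ω : Ω) :
    |Hw f Y n p a η ω - hav (fun t => f (Y t ω)) p (p * 2 ^ n * a)| ≤
      2 * C * η / a + 4 * C / (p * 2 ^ n * η) :=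
  hav_avg (path_meas hY hf ω) (fun t => hC _) (r := p) (s := p * 2 ^ n) (by positivity) ha hη

lemma sum_Hw (hY : Adp F Y) {f : ℝ → ℝ} (hf : Measurable f) {C : ℝ} (hC : ∀ x, |f x| ≤ C) (n K J : ℕ) {a η : ℝ}
    (hη : 0 < η) (x : ℝ) (ω : Ω) :
    ∫ z in Ioc a (a + η), (Zs f Y M T K J n z ω - x) =
      η * (∑ j ∈ Finset.range J, Hw f Y n (pt T K j) a η ω * dX M T K j ω - x) := by
  rw [← intervalIntegral.integral_of_le (by linarith)]
  unfold Zs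
  have hi : ∀ j, IntervalIntegrable (fun z => f (Y (fl n (pt T K j) z) ω)) volume a (a + η) := fun j =>
    ii_of_bdd ((path_meas hY hf ω).comp (fl_meas n _)) (fun z => hC _) _ _
  have hs : IntervalIntegrable (fun z => ∑ j ∈ Finset.range J, f (Y (fl n (pt T K j) z) ω) * dX M T K j ω)
      volume a (a + η) := by
    have := IntervalIntegrable.sum (Finset.range J) (fun j _ => (hi j).mul_const (dX M T K j ω))
    have e : (∑ i ∈ Finset.range J, fun x => f (Y (fl n (pt T K i) x) ω) * dX M T K i ω) =
      (fun z => ∑ j ∈ Finset.range J, f (Y (fl n (pt T K j) z) ω) * dX M T K j ω) := by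
      funext z; simp [Finset.sum_apply]
    rw [e] at this
    exact this
  rw [intervalIntegral.integral_sub hs
    intervalIntegrable_const, intervalIntegral.integral_finsetSum (fun j _ => (hi j).mul_const _)]
  simp only [intervalIntegral.integral_const, smul_eq_mul, intervalIntegral.integral_mul_const]
  rw [mul_sub, Finset.mul_sum]
  congr 1
  · refine Finset.sum_congr rfl fun j _ => ?_
    unfold Hw; field_simp
  · ring

set_option maxHeartbeats 800000 in
lemma Hw_cmp (hM : Drv μ F B M) (hY : Adp F Y) (hT : 0 < T) {f : ℝ → ℝ} (hf : Measurable f) {C : ℝ}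
    (hC : ∀ x, |f x| ≤ C) {k i0 : ℕ} {a : ℝ} (ha : 0 < a) {ε : ℝ} (hε : 0 < ε) :
    ∃ η0 > 0, ∀ η, 0 < η → η ≤ η0 → ∀ᶠ n in atTop, ∀ᶠ l in atTop,
      ∫ ω, (∑ j ∈ Finset.range (i0 * 2 ^ l), (Hw f Y n (pt T (k + l) j) a η ω -
        hav (fun t => f (Y t ω)) (pt T (k + l) j) (pt T (k + l) j * 2 ^ n * a)) * dX M T (k + l) j ω) ^ 2 ∂μ
        ≤ ε := by
  have hC0 : 0 ≤ C := (abs_nonneg _).trans (hC 0)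
  have hphiB : ∀ t, 0 ≤ t → phi μ M t ≤ B ^ 2 := by
    intro t ht
    have hb := ((hM.bdd ht).mono (F.le _))
    calc ∫ ω, M t ω ^ 2 ∂μ ≤ ∫ _, B ^ 2 ∂μ := by
          refine integral_mono hb.sq.integrable (integrable_const _) fun ω => ?_
          show M t ω ^ 2 ≤ B ^ 2
          rw [← sq_abs]; exact pow_le_pow_left₀ (abs_nonneg _) (hM.bd _ ht ω) 2
      _ = B ^ 2 := by simp
  -- κ
  obtain ⟨κ, hκ0, hκ⟩ : ∃ κ > 0, κ ^ 2 * B ^ 2 ≤ ε / 2 := by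
    refine ⟨Real.sqrt (ε / (2 * (B ^ 2 + 1))), by positivity, ?_⟩
    rw [Real.sq_sqrt (by positivity), div_mul_eq_mul_div, div_le_div_iff₀ (by positivity) (by positivity)]
    nlinarith [sq_nonneg B]
  refine ⟨κ * a / (4 * (C + 1)), by positivity, fun η hη hηle => ?_⟩
  have hη1 : 2 * C * η / a ≤ κ / 2 := by
    rw [le_div_iff₀ (by positivity)] at hηle
    rw [div_le_div_iff₀ ha (by norm_num)]; nlinarith
  obtain ⟨r0, hr0, hr⟩ : ∃ r0 > 0, (2 * C) ^ 2 * phi μ M (2 * r0) ≤ ε / 2 := by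
    have hc : Tendsto (fun x => (2 * C) ^ 2 * phi μ M x) (nhdsWithin 0 (Ici 0))
        (nhds ((2 * C) ^ 2 * phi μ M 0)) :=
      Tendsto.const_mul _ (hM.phi_cont 0 (by simp : (0:ℝ) ∈ Ici 0))
    rw [hM.phi_zero, mul_zero] at hc
    have := hc.eventually (gt_mem_nhds (by positivity : (0:ℝ) < ε / 2))
    rw [eventually_nhdsWithin_iff, Metric.eventually_nhds_iff] at this
    obtain ⟨δ, hδ, h⟩ := this
    refine ⟨δ / 4, by positivity, (h (y := 2 * (δ / 4)) ?_ ?_).le⟩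
    · rw [Real.dist_eq, sub_zero, abs_of_pos (by positivity)]; linarith
    · simp; positivity
  filter_upwards [mesh_small (4 * C / (r0 * η)) (ρ := κ / 2) (by positivity)] with n hn
  have hfar : ∀ p, r0 ≤ p → 2 * C * η / a + 4 * C / (p * 2 ^ n * η) ≤ κ := by
    intro p hp
    have : 4 * C / (p * 2 ^ n * η) ≤ 4 * C / (r0 * η) / 2 ^ n := by
      rw [div_div]
      have h2 : r0 * η * 2 ^ n ≤ p * 2 ^ n * η := by
        nlinarith [mul_le_mul_of_nonneg_right hp (by positivity : 0 ≤ η * 2 ^ n)]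
      exact div_le_div_of_nonneg_left (by positivity) (by positivity) h2
    linarith
  obtain ⟨L, hL⟩ := eventually_atTop.1 (mesh_small T hr0)
  filter_upwards [eventually_ge_atTop L] with l hl
  set K := k + l with hK
  have hmesh : T / 2 ^ K ≤ r0 := hL K (by omega)
  set J := i0 * 2 ^ l
  set b := up T K r0 with hb
  have hlt : ∀ j, b ≤ j → r0 ≤ pt T K j := fun j h => (le_pt_iff hT).2 h
  refine (hM.iso3 hT.le K J (C := fun j => if b ≤ j then κ else 2 * C) ?_ ?_).trans ?_
  · intro j
    have hp := pt_nonneg hT.le K j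
    exact (Hw_meas hY hf n hp ha.le hη.le).sub (hav_meas hY hf hp (by positivity))
  · intro j ω
    have hp := pt_nonneg hT.le K j
    split_ifs with hj
    · have h0 := hlt j hj
      exact (Hw_sub hY hf hC n (hr0.trans_le h0) ha hη ω).trans (hfar _ h0)
    · refine (abs_sub _ _).trans ?_
      have h1 := Hw_bd (Y := Y) hC n (p := pt T K j) (a := a) hη ω
      have h2 := hav_bd (g := fun t => f (Y t ω)) (fun t => hC _) (pt T K j)
        (l := pt T K j * 2 ^ n * a) (by positivity)
      linarith
  · have hΔ : ∀ j, 0 ≤ phi μ M (pt T K (j + 1)) - phi μ M (pt T K j) := fun j =>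
      sub_nonneg.2 (hM.phi_mono (pt_nonneg hT.le _ _) (pt_mono hT.le _ (Nat.le_succ j)))
    have h1 : ∀ j ∈ Finset.range J, (if b ≤ j then κ else 2 * C) ^ 2 *
        (phi μ M (pt T K (j + 1)) - phi μ M (pt T K j)) ≤
        κ ^ 2 * (phi μ M (pt T K (j + 1)) - phi μ M (pt T K j)) +
        (2 * C) ^ 2 * (if j < b then (phi μ M (pt T K (j + 1)) - phi μ M (pt T K j)) else 0) := by
      intro j _
      by_cases h : b ≤ j
      · rw [if_pos h, if_neg (not_lt.2 h)]; simp
      · rw [if_neg h, if_pos (not_le.1 h)]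
        have := mul_nonneg (sq_nonneg κ) (hΔ j)
        linarith
    refine (Finset.sum_le_sum h1).trans ?_
    rw [Finset.sum_add_distrib, ← Finset.mul_sum, ← Finset.mul_sum, Finset.sum_range_sub
      (fun j => phi μ M (pt T K j)), ← Finset.sum_filter]
    have h2 : ∑ j ∈ Finset.range J with j < b, (phi μ M (pt T K (j + 1)) - phi μ M (pt T K j)) ≤
        phi μ M (pt T K b) := by
      calc _ ≤ ∑ j ∈ Finset.range b, (phi μ M (pt T K (j + 1)) - phi μ M (pt T K j)) := by
            refine Finset.sum_le_sum_of_subset_of_nonneg (fun j hj => ?_) fun j _ _ => hΔ j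
            rw [Finset.mem_filter] at hj; exact Finset.mem_range.2 hj.2
        _ = _ := by
            rw [Finset.sum_range_sub (fun j => phi μ M (pt T K j)), pt_zero, hM.phi_zero, sub_zero]
    have h3 : phi μ M (pt T K b) ≤ phi μ M (2 * r0) := by
      refine hM.phi_mono (pt_nonneg hT.le _ _) ?_
      have := (abs_le.1 (up_close hT K hr0.le)).2
      linarith
    have h4 : phi μ M (pt T K J) - phi μ M (pt T K 0) ≤ B ^ 2 := by
      rw [pt_zero, hM.phi_zero, sub_zero]; exact hphiB _ (pt_nonneg hT.le _ _)
    have := mul_le_mul_of_nonneg_left h4 (sq_nonneg κ)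
    have := mul_le_mul_of_nonneg_left (h2.trans h3) (sq_nonneg (2 * C))
    linarith

end

section
variable {μ : Measure Ω} [IsProbabilityMeasure μ] {F : Filtration ℝ m} {B : ℝ} {M Y : ℝ → Ω → ℝ} {T : ℝ}
  {G : Set Ω}

lemma dbl_lim {S : Set ℝ} {D : ℕ → ℕ → ℝ → ENNReal} (hD : ∀ n l, Measurable (D n l)) {K c : ENNReal}
    (hK : ∀ n l, ∀ z ∈ S, D n l z ≤ K) (hKt : K ≠ ⊤) (hS : MeasurableSet S) (hv : volume S ≠ ⊤)
    (h : ∀ z ∈ S, ∀ᶠ n in atTop, ∀ᶠ l in atTop, D n l z ≤ c) {x : ENNReal} (hx : c * volume S < x) :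
    ∀ᶠ n in atTop, ∀ᶠ l in atTop, ∫⁻ z in S, D n l z ≤ x := by
  have hfin : ∫⁻ _ in S, K ∂(volume : Measure ℝ) ≠ ⊤ := by
    rw [setLIntegral_const]; exact ENNReal.mul_ne_top hKt hv
  have h1 : ∀ n, limsup (fun l => ∫⁻ z in S, D n l z) atTop ≤ ∫⁻ z in S, limsup (fun l => D n l z) atTop :=
    fun n => limsup_lintegral_le (fun _ => K) (hD n)
      (fun l => (ae_restrict_iff' hS).2 (ae_of_all _ fun z hz => hK n l z hz)) hfin
  have h2 : limsup (fun n => ∫⁻ z in S, limsup (fun l => D n l z) atTop) atTop ≤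
      ∫⁻ z in S, limsup (fun n => limsup (fun l => D n l z) atTop) atTop :=
    limsup_lintegral_le (fun _ => K) (fun n => Measurable.limsup (hD n))
      (fun n => (ae_restrict_iff' hS).2 (ae_of_all _ fun z hz =>
        limsup_le_of_le (by isBoundedDefault) (Eventually.of_forall fun l => hK n l z hz))) hfin
  have h3 : ∫⁻ z in S, limsup (fun n => limsup (fun l => D n l z) atTop) atTop ≤ c * volume S := by
    rw [← setLIntegral_const]
    refine setLIntegral_mono' hS fun z hz => ?_
    refine limsup_le_of_le (by isBoundedDefault) ?_
    filter_upwards [h z hz] with n hn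
    exact limsup_le_of_le (by isBoundedDefault) hn
  have h4 := eventually_lt_of_limsup_lt ((h2.trans h3).trans_lt hx)
  filter_upwards [h4] with n hn
  filter_upwards [eventually_lt_of_limsup_lt ((h1 n).trans_lt hn)] with l hl
  exact hl.le

lemma pr_le_setIntegral {X : Ω → ℝ} (hG : MeasurableSet G) (hX : Integrable X μ) (h0 : ∀ ω, 0 ≤ X ω) {l : ℝ}
    (hl : 0 < l) : pr μ G (fun ω => l < X ω) ≤ (∫ ω in G, X ω ∂μ) / l := by
  have := pr_le_integral (μ := μ) (G := G) (X := G.indicator X) (hX.indicator hG)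
    (fun ω => indicator_nonneg (fun ω _ => h0 ω) ω) hl
  rw [integral_indicator hG] at this
  refine (pr_mono fun ω hω h => ?_).trans this
  rwa [indicator_of_mem hω]

set_option maxHeartbeats 1600000 in
lemma avg_win (hM : Drv μ F B M) (hY : Adp F Y) (hT : 0 < T) {f : ℝ → ℝ} (hf : Measurable f) {C : ℝ}
    (hC : ∀ x, |f x| ≤ C) (hG : MeasurableSet G) {I : ℝ → Ω → ℝ} {R : ℝ} (hR : 0 ≤ R)
    (hIm : ∀ t, 0 ≤ t → Measurable (I t)) (hIR : ∀ t ω, |I t ω| ≤ R) {k i0 : ℕ}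
    {δ a η : ℝ} (ha : 0 < a) (hη : 0 < η) (hδ : 0 < δ)
    (h : ∀ z ∈ Ioc a (a + η), ∀ᶠ n in atTop, ∀ᶠ l in atTop,
      ∫ ω in G, |Zs f Y M T (k + l) (i0 * 2 ^ l) n z ω - I (pt T k i0) ω| ∂μ ≤ δ) :
    ∀ᶠ n in atTop, ∀ᶠ l in atTop,
      ∫ ω in G, |∑ j ∈ Finset.range (i0 * 2 ^ l), Hw f Y n (pt T (k + l) j) a η ω * dX M T (k + l) j ω
        - I (pt T k i0) ω| ∂μ ≤ 2 * δ := by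
  set q := pt T k i0 with hq
  have hq0 : 0 ≤ q := pt_nonneg hT.le _ _
  have hC0 : 0 ≤ C := (abs_nonneg _).trans (hC 0)
  have hB0 := hM.B_nonneg
  have hIq : Bdd m (I q) := ⟨hIm q hq0, R, hIR q⟩
  let kk : ℕ → ℕ → ℝ × Ω → ℝ := fun n l x =>
    ∑ j ∈ Finset.range (i0 * 2 ^ l), f (Y (max 0 (fl n (pt T (k + l) j) x.1)) x.2) * dX M T (k + l) j x.2 - I q x.2
  have hkm : ∀ n l, Measurable (kk n l) := by
    intro n l
    refine Measurable.sub (Finset.measurable_sum _ fun j _ => Measurable.mul ?_ ?_) ((hIm q hq0).comp measurable_snd)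
    · exact hf.comp (hY.joint'.comp (((fl_meas n _).comp measurable_fst).prodMk measurable_snd))
    · exact ((hM.md hT.le (k + l)).bddm j).1.comp measurable_snd
  have hke : ∀ n l z ω, 0 ≤ z → kk n l (z, ω) = Zs f Y M T (k + l) (i0 * 2 ^ l) n z ω - I q ω := by
    intro n l z ω hz
    simp only [kk, Zs]
    congr 1
    refine Finset.sum_congr rfl fun j _ => ?_
    rw [max_eq_right (fl_nonneg (pt_nonneg hT.le _ _) hz)]
  have hZb : ∀ n l z, 0 ≤ z → Bdd m (fun ω => Zs f Y M T (k + l) (i0 * 2 ^ l) n z ω - I q ω) := fun n l z hz =>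
    (Zs_bdd hM hY hT.le hf hC _ _ n hz).sub hIq
  let D : ℕ → ℕ → ℝ → ENNReal := fun n l z => ∫⁻ ω in G, ‖kk n l (z, ω)‖ₑ ∂μ
  have hDe : ∀ n l z, 0 ≤ z → D n l z =
      ENNReal.ofReal (∫ ω in G, |Zs f Y M T (k + l) (i0 * 2 ^ l) n z ω - I q ω| ∂μ) := by
    intro n l z hz
    have := ofReal_integral_norm_eq_lintegral_enorm (hZb n l z hz).integrable.integrableOn (μ := μ.restrict G)
    simp only [Real.norm_eq_abs] at this
    rw [this]
    refine lintegral_congr fun ω => ?_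
    rw [hke n l z ω hz]
  have hDm : ∀ n l, Measurable (D n l) := fun n l => (hkm n l).enorm.lintegral_prod_right'
  have hDb : ∀ n l, ∀ z ∈ Ioc a (a + η), D n l z ≤ ENNReal.ofReal (C * B + 1 + R) := by
    intro n l z hz
    have hz0 : 0 ≤ z := ha.le.trans hz.1.le
    rw [hDe n l z hz0]
    refine ENNReal.ofReal_le_ofReal ?_
    have hZ := Zs_bdd hM hY hT.le hf hC (k + l) (i0 * 2 ^ l) n hz0
    calc _ ≤ ∫ ω, |Zs f Y M T (k + l) (i0 * 2 ^ l) n z ω - I q ω| ∂μ :=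
          setIntegral_le_integral (hZb n l z hz0).integrable.abs (ae_of_all _ fun ω => abs_nonneg _)
      _ ≤ ∫ ω, (|Zs f Y M T (k + l) (i0 * 2 ^ l) n z ω| + R) ∂μ := by
          refine integral_mono (hZb n l z hz0).integrable.abs (hZ.abs.add (Bdd.const R)).integrable fun ω => ?_
          exact (abs_sub _ _).trans (add_le_add_right (hIR q ω) _)
      _ = ∫ ω, |Zs f Y M T (k + l) (i0 * 2 ^ l) n z ω| ∂μ + R := by
          rw [integral_add hZ.abs.integrable (integrable_const _)]; simp
      _ ≤ _ := by
          refine add_le_add_left (abs_int_le hZ (by positivity) ?_) R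
          refine (hM.iso_le hT.le (k + l) (i0 * 2 ^ l) (c := fun j ω => f (Y (fl n (pt T (k + l) j) z) ω))
            (C := C) (fun j => ?_) (fun j ω => hC _)).trans ?_
          · have hp := pt_nonneg hT.le (k + l) j
            exact hf.comp ((hY.meas _ (fl_nonneg hp hz0)).mono (F.mono (fl_le hp hz0)) le_rfl)
          · nlinarith [mul_nonneg hC0 hB0]
  have key := dbl_lim hDm hDb ENNReal.ofReal_ne_top measurableSet_Ioc (by simp)
    (c := ENNReal.ofReal δ) (fun z hz => by
      filter_upwards [h z hz] with n hn
      filter_upwards [hn] with l hl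
      rw [hDe n l z (ha.le.trans hz.1.le)]
      exact ENNReal.ofReal_le_ofReal hl) (x := ENNReal.ofReal (2 * δ * η)) (by
      rw [Real.volume_Ioc, ← ENNReal.ofReal_mul hδ.le]
      refine (ENNReal.ofReal_lt_ofReal_iff (by positivity)).2 ?_
      nlinarith [mul_pos hδ hη])
  filter_upwards [key] with n hn
  filter_upwards [hn] with l hl
  set X : Ω → ℝ := fun ω => ∑ j ∈ Finset.range (i0 * 2 ^ l), Hw f Y n (pt T (k + l) j) a η ω * dX M T (k + l) j ω
        - I q ω with hX
  have hXb : Bdd m X := by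
    refine Bdd.sub (Bdd.sum _ fun j _ => Bdd.mul ⟨?_, C, fun ω => Hw_bd hC n hη ω⟩ ((hM.md hT.le _).bddm j)) hIq
    exact (Hw_meas hY hf n (pt_nonneg hT.le _ _) ha.le hη.le).mono (F.le _) le_rfl
  have e1 : ∀ ω, ENNReal.ofReal η * ‖X ω‖ₑ ≤ ∫⁻ z in Ioc a (a + η), ‖kk n l (z, ω)‖ₑ := by
    intro ω
    have h1 := sum_Hw (M := M) (T := T) hY hf hC n (k + l) (i0 * 2 ^ l) (a := a) hη (I q ω) ω
    have h2 := enorm_integral_le_lintegral_enorm (μ := volume.restrict (Ioc a (a + η)))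
      (fun z => Zs f Y M T (k + l) (i0 * 2 ^ l) n z ω - I q ω)
    rw [h1, enorm_mul, Real.enorm_of_nonneg hη.le] at h2
    refine h2.trans (le_of_eq ?_)
    refine setLIntegral_congr_fun measurableSet_Ioc fun z hz => ?_
    show ‖_‖ₑ = _
    rw [hke n l z ω (ha.le.trans hz.1.le)]
  have e2 : ENNReal.ofReal η * ENNReal.ofReal (∫ ω in G, |X ω| ∂μ) ≤ ENNReal.ofReal (2 * δ * η) := by
    have := ofReal_integral_norm_eq_lintegral_enorm hXb.integrable.integrableOn (μ := μ.restrict G)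
    simp only [Real.norm_eq_abs] at this
    rw [this, ← lintegral_const_mul _ hXb.1.enorm]
    calc _ ≤ ∫⁻ ω in G, (∫⁻ z in Ioc a (a + η), ‖kk n l (z, ω)‖ₑ) ∂μ := lintegral_mono e1
      _ = ∫⁻ z in Ioc a (a + η), D n l z := by
          refine lintegral_lintegral_swap (f := fun ω z => ‖kk n l (z, ω)‖ₑ) ?_
          exact ((hkm n l).comp measurable_swap).enorm.aemeasurable
      _ ≤ _ := hl
  rw [← ENNReal.ofReal_mul hη.le] at e2
  have := (ENNReal.ofReal_le_ofReal_iff (by positivity)).1 e2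
  nlinarith

set_option maxHeartbeats 1600000 in
lemma avg_rep (hM : Drv μ F B M) (hY : Adp F Y) (hT : 0 < T) {f : ℝ → ℝ} (hf : Measurable f) {C : ℝ}
    (hC : ∀ x, |f x| ≤ C) (hG : MeasurableSet G) {I : ℝ → Ω → ℝ} {R : ℝ} (hR : 0 ≤ R)
    (hIc : ∀ ω, Continuous fun t => I t ω)
    (hIm : ∀ t, 0 ≤ t → Measurable (I t)) (hIR : ∀ t ω, |I t ω| ≤ R) 
    (hcp : ∀ t, 0 < t → t ≤ T → CP μ G (fun n => rsum (fun s ω => f (Y s ω)) M t n) (I t))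
    {k i0 : ℕ} (hi0 : 0 < i0) (hi1 : i0 ≤ 2 ^ k) {ε : ℝ} (hε : 0 < ε) :
    ∀ᶠ n in atTop, ∀ᶠ l in atTop, pr μ G (fun ω => ε < |∑ j ∈ Finset.range (i0 * 2 ^ l),
      hav (fun t => f (Y t ω)) (pt T (k + l) j) (pt T (k + l) j * 2 ^ n * (1 / pt T k i0)) * dX M T (k + l) j ω
        - I (pt T k i0) ω|) ≤ ε := by
  set q := pt T k i0 with hq
  have hq0 : 0 < q := by
    rw [hq]; unfold pt
    have : (0:ℝ) < i0 := by exact_mod_cast hi0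
    positivity
  have hqT : q ≤ T := pt_le hT.le hi1
  have hC0 : 0 ≤ C := (abs_nonneg _).trans (hC 0)
  set a := 1 / q with ha
  have ha0 : 0 < a := by positivity
  set δ := ε ^ 2 / 32 with hδ
  have hδ0 : 0 < δ := by positivity
  -- conditions near q
  have c1 : ∀ᶠ τ in nhds q, C ^ 2 * (phi μ M q - phi μ M τ) ≤ δ ^ 2 := by
    have h1 : ContinuousAt (phi μ M) q := hM.phi_cont.continuousAt (Ici_mem_nhds hq0)
    have h2 : Tendsto (fun τ => C ^ 2 * (phi μ M q - phi μ M τ)) (nhds q)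
        (nhds (C ^ 2 * (phi μ M q - phi μ M q))) := Tendsto.const_mul _ (Tendsto.const_sub _ h1)
    rw [sub_self, mul_zero] at h2
    filter_upwards [h2.eventually (gt_mem_nhds (by positivity : 0 < δ ^ 2))] with τ h using h.le
  have c2 : ∀ᶠ τ in nhds q, ∫ ω, |I τ ω - I q ω| ∂μ ≤ δ := by
    have h2 : Tendsto (fun τ => ∫ ω, |I τ ω - I q ω| ∂μ) (nhds q) (nhds (∫ ω, |I q ω - I q ω| ∂μ)) := by
      refine tendsto_integral_filter_of_dominated_convergence (fun _ => R + R) ?_ ?_ (integrable_const _) ?_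
      · filter_upwards [lt_mem_nhds hq0] with τ hτ
        exact (((hIm τ hτ.le).sub (hIm q hq0.le)).abs).aestronglyMeasurable
      · refine Eventually.of_forall fun τ => ae_of_all _ fun ω => ?_
        rw [Real.norm_eq_abs, abs_abs]
        exact (abs_sub _ _).trans (add_le_add (hIR _ _) (hIR _ _))
      · refine ae_of_all _ fun ω => ?_
        exact (((hIc ω).sub continuous_const).abs).tendsto q
    simp only [sub_self, abs_zero, integral_zero] at h2
    filter_upwards [h2.eventually (gt_mem_nhds hδ0)] with τ h using h.le
  have c3 : Tendsto (fun z : ℝ => 1 / z) (nhds a) (nhds q) := by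
    have : ContinuousAt (fun z : ℝ => 1 / z) a := continuousAt_const.div continuousAt_id ha0.ne'
    have h2 : Tendsto (fun z : ℝ => 1 / z) (nhds a) (nhds (1 / a)) := this
    rwa [ha, one_div_one_div] at h2
  obtain ⟨η1, hη1, hcl⟩ := Metric.eventually_nhds_iff.1 ((c3.eventually c1).and (c3.eventually c2))
  obtain ⟨η0, hη0, hcmp⟩ := Hw_cmp hM hY hT hf hC (k := k) (i0 := i0) ha0 (ε := ε ^ 3 / 8) (by positivity)
  set η := min η0 (η1 / 2) with hη
  have hηp : 0 < η := lt_min hη0 (by positivity)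
  have h4 := avg_win hM hY hT hf hC hG hR hIm hIR (k := k) (i0 := i0) (δ := 4 * δ) ha0 hηp (by positivity) (by
    intro z hz
    have hz0 : 0 < z := ha0.trans hz.1
    obtain ⟨d1, d2⟩ := hcl (y := z) (by
      rw [Real.dist_eq, abs_of_pos (by linarith [hz.1])]
      have := min_le_right η0 (η1 / 2)
      linarith [hz.2])
    have hτq : 1 / z ≤ q := by
      rw [div_le_iff₀ hz0]
      have := hz.1
      rw [ha, div_lt_iff₀ hq0] at this
      linarith
    have := L5a hM hY hT hf hC hG (fun t ht => ⟨hIm t ht, R, hIR t⟩) (τ := 1 / z) (by positivity) (k := k) (i0 := i0)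
      hτq (hcp _ (by positivity) (hτq.trans hqT)) hδ0 d1 d2
    rw [one_div_one_div] at this
    exact this)
  filter_upwards [h4, hcmp η hηp (min_le_left _ _)] with n h5 h6
  filter_upwards [h5, h6] with l h7 h8
  set X : Ω → ℝ := fun ω => ∑ j ∈ Finset.range (i0 * 2 ^ l), Hw f Y n (pt T (k + l) j) a η ω * dX M T (k + l) j ω
        - I q ω with hX
  set X' : Ω → ℝ := fun ω => ∑ j ∈ Finset.range (i0 * 2 ^ l), (Hw f Y n (pt T (k + l) j) a η ω -
        hav (fun t => f (Y t ω)) (pt T (k + l) j) (pt T (k + l) j * 2 ^ n * a)) * dX M T (k + l) j ω with hX'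
  have hw : ∀ j, Bdd m (Hw f Y n (pt T (k + l) j) a η) := fun j =>
    ⟨(Hw_meas hY hf n (pt_nonneg hT.le _ _) ha0.le hηp.le).mono (F.le _) le_rfl, C, fun ω => Hw_bd hC n hηp ω⟩
  have hXb : Bdd m X :=
    Bdd.sub (Bdd.sum _ fun j _ => Bdd.mul (hw j) ((hM.md hT.le _).bddm j)) ⟨hIm q hq0.le, R, hIR q⟩
  have hXb' : Bdd m X' := by
    refine Bdd.sum _ fun j _ => Bdd.mul ((hw j).sub ⟨?_, C, fun ω => ?_⟩) ((hM.md hT.le _).bddm j)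
    · have hp := pt_nonneg hT.le (k + l) j
      exact (hav_meas hY hf hp (by positivity)).mono (F.le _) le_rfl
    · have hp := pt_nonneg hT.le (k + l) j
      exact hav_bd (fun t => hC _) _ (by positivity)
  have p1 : pr μ G (fun ω => ε / 2 < |X ω|) ≤ ε / 2 := by
    refine (pr_le_setIntegral hG hXb.integrable.abs (fun ω => abs_nonneg _) (by positivity)).trans ?_
    rw [div_le_iff₀ (by positivity)]
    refine h7.trans (le_of_eq ?_)
    rw [hδ]; ring
  have p2 : pr μ G (fun ω => ε / 2 < |X' ω|) ≤ ε / 2 := by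
    refine (pr_le_integral_sq hXb'.sq.integrable (by positivity)).trans ?_
    rw [div_le_iff₀ (by positivity)]
    refine h8.trans (le_of_eq ?_)
    ring
  refine (pr_or (q := fun ω => ε / 2 < |X ω|) (r := fun ω => ε / 2 < |X' ω|) fun ω _ h => ?_).trans
    (by linarith : _ ≤ _)
  by_contra hcon
  push Not at hcon
  have e : ∑ j ∈ Finset.range (i0 * 2 ^ l), hav (fun t => f (Y t ω)) (pt T (k + l) j)
      (pt T (k + l) j * 2 ^ n * a) * dX M T (k + l) j ω - I q ω = X ω - X' ω := by
    simp only [hX, hX', sub_mul, Finset.sum_sub_distrib]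
    ring
  rw [e] at h
  have := abs_sub (X ω) (X' ω)
  linarith [hcon.1, hcon.2]

end

/-- shifted process, frozen before time `e` -/
def shX (e : ℝ) (X : ℝ → Ω → ℝ) (t : ℝ) (ω : Ω) : ℝ := X (max t e) ω - X e ω

/-- shifted filtration -/
def shF (e : ℝ) (F : Filtration ℝ m) : Filtration ℝ m where
  seq t := F (max t e)
  mono' _ _ h := F.mono (max_le_max_right e h)
  le' t := F.le _

lemma shF_apply (e : ℝ) (F : Filtration ℝ m) (t : ℝ) : shF e F t = F (max t e) := rfl

section
variable {μ : Measure Ω} [IsProbabilityMeasure μ] {F : Filtration ℝ m} {B : ℝ} {M N Y : ℝ → Ω → ℝ} {T : ℝ}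
  {G : Set Ω}

lemma pt_e {k0 k : ℕ} (h : k0 ≤ k) : pt T k0 1 = pt T k (2 ^ (k - k0)) := by
  have := pt_add (T := T) k0 (k - k0) 1
  rw [one_mul, Nat.add_sub_cancel' h] at this
  exact this.symm

lemma pt_max (hT : 0 ≤ T) {k0 k : ℕ} (h : k0 ≤ k) (i : ℕ) :
    max (pt T k i) (pt T k0 1) = pt T k (max i (2 ^ (k - k0))) := by
  rw [pt_e h]; exact ((pt_mono hT k).map_max).symm

lemma dX_sh_lt (hT : 0 ≤ T) {k0 k : ℕ} (h : k0 ≤ k) (X : ℝ → Ω → ℝ) {i : ℕ} (hi : i < 2 ^ (k - k0)) (ω : Ω) :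
    dX (shX (pt T k0 1) X) T k i ω = 0 := by
  unfold dX shX
  rw [pt_max hT h, pt_max hT h, max_eq_right hi, max_eq_right hi.le]; ring

lemma dX_sh_ge (hT : 0 ≤ T) {k0 k : ℕ} (h : k0 ≤ k) (X : ℝ → Ω → ℝ) {i : ℕ} (hi : 2 ^ (k - k0) ≤ i) (ω : Ω) :
    dX (shX (pt T k0 1) X) T k i ω = dX X T k i ω := by
  unfold dX shX
  rw [pt_max hT h, pt_max hT h, max_eq_left (hi.trans (Nat.le_succ i)), max_eq_left hi]; ring

lemma dX_Y (hT : 0 ≤ T) {k0 k : ℕ} (X : ℝ → Ω → ℝ) (i : ℕ) (ω : Ω) :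
    dX (fun t ω => X (max t (pt T k0 1)) ω) T k i ω = dX (shX (pt T k0 1) X) T k i ω := by
  unfold dX shX; ring

lemma Adp.sh (h : Adp F Y) {e : ℝ} : Adp (shF e F) (fun t ω => Y (max t e) ω) :=
  ⟨fun ω => (h.cont ω).comp (by fun_prop), fun t ht => h.meas _ (le_max_of_le_left ht)⟩

lemma Drv.sh (h : Drv μ F B M) {e : ℝ} (he : 0 ≤ e) : Drv μ (shF e F) (2 * B) (shX e M) where
  cont ω := ((h.cont ω).comp (by fun_prop : Continuous fun t => max t e)).sub continuous_const
  meas t ht := by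
    refine (h.meas _ (le_max_of_le_left ht)).sub ((h.meas e he).mono (F.mono (le_max_right _ _)) le_rfl)
  bd t ht ω := by
    have h1 := h.bd (max t e) (le_max_of_le_left ht) ω
    have h2 := h.bd e he ω
    exact (abs_sub _ _).trans (by linarith)
  zero ω := by simp [shX, he]
  mart s t hs hst Z hZ := by
    have := h.mart (max s e) (max t e) (le_max_of_le_left hs) (max_le_max_right e hst) Z hZ
    rw [← this]
    congr 1; funext ω; unfold shX; ring

lemma Orth.sh (h : Orth μ F T M N) (hT : 0 ≤ T) (k0 : ℕ) :
    Orth μ (shF (pt T k0 1) F) T (shX (pt T k0 1) M) (shX (pt T k0 1) N) := by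
  filter_upwards [h, eventually_ge_atTop k0] with n hn hk i Z hZ
  by_cases hi : i < 2 ^ (n - k0)
  · simp [dX_sh_lt hT hk _ hi]
  · have hi' := not_lt.1 hi
    simp_rw [dX_sh_ge hT hk _ hi']
    refine hn i Z ?_
    rw [shF_apply, pt_max hT hk, max_eq_left hi'] at hZ
    exact hZ

lemma cellS_sh (hT : 0 ≤ T) {k0 l : ℕ} (h : k0 ≤ l) (X : ℝ → Ω → ℝ) (i n : ℕ) (ω : Ω) :
    cellS (shX (pt T k0 1) X) T l i n ω = if i < 2 ^ (l - k0) then 0 else cellS X T l i n ω := by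
  have e : 2 ^ (l + n - k0) = 2 ^ (l - k0) * 2 ^ n := by
    rw [← pow_add]; congr 1; omega
  unfold cellS
  split_ifs with hi
  · refine Finset.sum_eq_zero fun j hj => ?_
    rw [dX_sh_lt hT (h.trans (Nat.le_add_right l n))]
    · simp
    · rw [e]
      have := Finset.mem_range.1 hj
      calc i * 2 ^ n + j < (i + 1) * 2 ^ n := by linarith
        _ ≤ _ := Nat.mul_le_mul_right _ hi
  · refine Finset.sum_congr rfl fun j hj => ?_
    rw [dX_sh_ge hT (h.trans (Nat.le_add_right l n))]
    rw [e]
    exact (Nat.mul_le_mul_right _ (not_lt.1 hi)).trans (Nat.le_add_right _ _)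

lemma CellDom.sh {c : ℝ} (h : CellDom μ G T c M N) (hT : 0 ≤ T) (k0 : ℕ) :
    CellDom μ G T c (shX (pt T k0 1) M) (shX (pt T k0 1) N) := by
  filter_upwards [h, eventually_ge_atTop k0] with l hl hk i hi δ hδ
  simp_rw [cellS_sh hT hk]
  by_cases hi' : i < 2 ^ (l - k0)
  · simp only [if_pos hi']
    refine Eventually.of_forall fun n => ?_
    rw [pr_false (by intro ω _ h; linarith)]; exact hδ.le
  · simp only [if_neg hi']
    exact hl i hi δ hδ

lemma sum_blocks (g : ℕ → ℝ) (i L : ℕ) :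
    ∑ j ∈ Finset.range ((i + 1) * L), g j = ∑ j ∈ Finset.range (i * L), g j + ∑ j ∈ Finset.range L, g (i * L + j) := by
  rw [add_mul, one_mul, Finset.sum_range_add]

set_option maxHeartbeats 1600000 in
lemma AP_tilde (hM : Drv μ F B M) (hY : Adp F Y) (hT : 0 < T) {f : ℝ → ℝ} (hf : Measurable f) {C : ℝ}
    (hC : ∀ x, |f x| ≤ C) (hG : MeasurableSet G) {I : ℝ → Ω → ℝ} {R : ℝ} (hR : 0 ≤ R)
    (hIc : ∀ ω, Continuous fun t => I t ω)
    (hIm : ∀ t, 0 ≤ t → Measurable (I t)) (hIR : ∀ t ω, |I t ω| ≤ R) 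
    (hcp : ∀ t, 0 < t → t ≤ T → CP μ G (fun n => rsum (fun s ω => f (Y s ω)) M t n) (I t)) (k0 : ℕ) :
    AP μ (shF (pt T k0 1) F) T G (shX (pt T k0 1) M) (shX (pt T k0 1) I) := by
  have hC0 : 0 ≤ C := (abs_nonneg _).trans (hC 0)
  have hB0 := hM.B_nonneg
  refine ⟨(2 * C * B + 1) * 2 ^ k0, C, by positivity, hC0, ?_⟩
  filter_upwards [eventually_ge_atTop k0] with k hk ε hε
  set ε' := ε / (2 * (2 ^ k + 1)) with hε'
  have hε'0 : 0 < ε' := by positivity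
  have hall : ∀ᶠ n in atTop, ∀ᶠ l in atTop, ∀ i0 ∈ Finset.Icc 1 (2 ^ k),
      pr μ G (fun ω => ε' < |∑ j ∈ Finset.range (i0 * 2 ^ l),
      hav (fun t => f (Y t ω)) (pt T (k + l) j) (pt T (k + l) j * 2 ^ n * (1 / pt T k i0)) * dX M T (k + l) j ω
        - I (pt T k i0) ω|) ≤ ε' := by
    have h1 : ∀ᶠ n in atTop, ∀ i0 ∈ Finset.Icc 1 (2 ^ k), ∀ᶠ l in atTop, 
      pr μ G (fun ω => ε' < |∑ j ∈ Finset.range (i0 * 2 ^ l),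
      hav (fun t => f (Y t ω)) (pt T (k + l) j) (pt T (k + l) j * 2 ^ n * (1 / pt T k i0)) * dX M T (k + l) j ω
        - I (pt T k i0) ω|) ≤ ε' := by
      rw [Filter.eventually_all_finset]
      intro i0 hi0
      rw [Finset.mem_Icc] at hi0
      exact avg_rep hM hY hT hf hC hG hR hIc hIm hIR hcp hi0.1 hi0.2 hε'0
    filter_upwards [h1] with n hn
    rw [Filter.eventually_all_finset]
    exact hn
  obtain ⟨n, hn⟩ := hall.exists
  obtain ⟨l, hl⟩ := hn.exists
  -- the ingredients
  set hh : ℕ → ℕ → Ω → ℝ := fun i J ω => hav (fun t => f (Y t ω)) (pt T (k + l) J)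
    (pt T (k + l) J * 2 ^ n * (1 / pt T k i)) with hhh
  have hp : ∀ J, 0 ≤ pt T (k + l) J := pt_nonneg hT.le _
  have hpk : ∀ i, 0 ≤ pt T k i := pt_nonneg hT.le _
  have hl0 : ∀ i J, 0 ≤ pt T (k + l) J * 2 ^ n * (1 / pt T k i) := fun i J => by
    have := hp J; have := hpk i; positivity
  have hhm : ∀ i J, Measurable[F (pt T (k + l) J)] (hh i J) := fun i J => hav_meas hY hf (hp J) (hl0 i J)
  have hhb : ∀ i J ω, |hh i J ω| ≤ C := fun i J ω => hav_bd (fun t => hC _) _ (hl0 i J)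
  have hhd : ∀ i, 0 < i → ∀ J ω, |hh (i + 1) J ω - hh i J ω| ≤ 2 * C / (i + 1) := by
    intro i hi J ω
    have hi' : (0:ℝ) < i := by exact_mod_cast hi
    have hqi : 0 < pt T k i := by unfold pt; positivity
    have hqi' : 0 < pt T k (i + 1) := by unfold pt; positivity
    rcases Nat.eq_zero_or_pos J with rfl | hJ
    · simp only [hhh, pt_zero, zero_mul, hav]; simp; positivity
    · have hpJ : 0 < pt T (k + l) J := by
        have : (0:ℝ) < J := by exact_mod_cast hJ
        unfold pt; positivity
      have := hav_diff (g := fun t => f (Y t ω)) (path_meas hY hf ω) (fun t => hC _) (pt T (k + l) J)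
        (l := pt T (k + l) J * 2 ^ n * (1 / pt T k (i + 1))) (l' := pt T (k + l) J * 2 ^ n * (1 / pt T k i))
        (by positivity) (by
          refine mul_le_mul_of_nonneg_left ?_ (by positivity)
          exact one_div_le_one_div_of_le hqi (pt_mono hT.le k (Nat.le_succ i)))
      refine this.trans (le_of_eq ?_)
      have e : pt T (k + l) J * 2 ^ n * (1 / pt T k (i + 1)) / (pt T (k + l) J * 2 ^ n * (1 / pt T k i)) =
        i / (i + 1) := by
        unfold pt; push_cast
        have : (J:ℝ) ≠ 0 := by positivity
        have := hT.ne'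
        field_simp
      rw [e]; field_simp; ring
  set b : ℕ → Ω → ℝ := fun i ω => if i < 2 ^ (k - k0) then 0 else
    ∑ J ∈ Finset.range (i * 2 ^ l), (hh (i + 1) J ω - hh i J ω) * dX M T (k + l) J ω with hb
  have hkl : k0 ≤ k + l := by omega
  have h2e : 2 ^ (k + l - k0) = 2 ^ (k - k0) * 2 ^ l := by
    rw [← pow_add]; congr 1; omega
  refine ⟨l, fun J => hh (J / 2 ^ l + 1) J, b, fun J => ?_, fun J ω => hhb _ _ _, ?_, ?_⟩
  · exact (hhm _ J).mono (F.mono (le_max_left _ _)) le_rfl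
  · intro r hr
    have hbb : ∀ i, Bdd m (b i) := by
      intro i
      simp only [hb]
      split_ifs with hi
      · exact Bdd.const 0
      · refine Bdd.sum _ fun J _ => Bdd.mul (Bdd.sub ⟨(hhm _ _).mono (F.le _) le_rfl, C, hhb _ _⟩
          ⟨(hhm _ _).mono (F.le _) le_rfl, C, hhb _ _⟩) ((hM.md hT.le _).bddm J)
    have hbi : ∀ i, ∫ ω, |b i ω| ∂μ ≤ (2 * C * B + 1) / 2 ^ (k - k0) := by
      intro i
      simp only [hb]
      split_ifs with hi
      · simp; positivity
      · have hi1 : 2 ^ (k - k0) ≤ i := not_lt.1 hi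
        have hi0 : 0 < i := lt_of_lt_of_le (by positivity) hi1
        have hic : (2:ℝ) ^ (k - k0) ≤ i := by exact_mod_cast hi1
        have hbb' := hbb i
        simp only [hb, if_neg hi] at hbb'
        have h1 := hM.iso_le hT.le (k + l) (i * 2 ^ l) (c := fun J ω => hh (i + 1) J ω - hh i J ω)
          (C := 2 * C / (i + 1)) (fun J => (hhm _ _).sub (hhm _ _)) (fun J ω => hhd i hi0 J ω)
        have h2 := abs_int_le (δ := (2 * C * B + 1) / (i + 1)) hbb' (by positivity) (h1.trans (by
          rw [← mul_pow, div_mul_eq_mul_div]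
          refine pow_le_pow_left₀ (by positivity) ?_ 2
          gcongr; linarith))
        refine h2.trans ?_
        gcongr
        linarith
    have hsb : Bdd m (fun ω => ∑ i ∈ Finset.range (2 ^ k), |b i ω|) := Bdd.sum _ fun i _ => (hbb i).abs
    refine (pr_le_integral hsb.integrable (fun ω => Finset.sum_nonneg fun i _ => abs_nonneg _) hr).trans ?_
    refine div_le_div_of_nonneg_right ?_ hr.le
    rw [integral_finsetSum _ fun i _ => (hbb i).abs.integrable]
    refine (Finset.sum_le_sum fun i _ => hbi i).trans ?_
    rw [Finset.sum_const, Finset.card_range, nsmul_eq_mul]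
    have : (2:ℝ) ^ k = 2 ^ k0 * 2 ^ (k - k0) := by rw [← pow_add]; congr 1; omega
    push_cast
    rw [this]
    refine le_of_eq ?_
    field_simp
  · refine (pr_mono (q := fun ω => ∃ i0 ∈ Finset.Icc 1 (2 ^ k), ε' < |∑ j ∈ Finset.range (i0 * 2 ^ l),
      hh i0 j ω * dX M T (k + l) j ω - I (pt T k i0) ω|) fun ω _ h => ?_).trans ((pr_exists _ _).trans
        ((Finset.sum_le_sum fun i hi => hl i hi).trans ?_))
    · obtain ⟨i, hi, h⟩ := h
      by_contra hcon
      push Not at hcon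
      have e2 : ∀ j ∈ Finset.range (2 ^ l), (i * 2 ^ l + j) / 2 ^ l = i := by
        intro j hj
        have := Finset.mem_range.1 hj
        rw [mul_comm, Nat.mul_add_div (by positivity), Nat.div_eq_of_lt this, add_zero]
      by_cases hik : i < 2 ^ (k - k0)
      · rw [dX_sh_lt hT.le hk _ hik] at h
        have h0 : ∑ j ∈ Finset.range (2 ^ l), hh ((i * 2 ^ l + j) / 2 ^ l + 1) (i * 2 ^ l + j) ω *
            dX (shX (pt T k0 1) M) T (k + l) (i * 2 ^ l + j) ω = 0 := by
          refine Finset.sum_eq_zero fun j hj => ?_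
          rw [dX_sh_lt hT.le hkl, mul_zero]
          rw [h2e]
          have := Finset.mem_range.1 hj
          calc i * 2 ^ l + j < (i + 1) * 2 ^ l := by linarith
            _ ≤ _ := Nat.mul_le_mul_right _ hik
        rw [h0] at h
        simp only [hb, if_pos hik] at h
        simp at h
        linarith
      · have hi1 : 2 ^ (k - k0) ≤ i := not_lt.1 hik
        have hi0 : 0 < i := lt_of_lt_of_le (by positivity) hi1
        rw [dX_sh_ge hT.le hk _ hi1] at h
        have c1 := hcon (i + 1) (Finset.mem_Icc.2 ⟨by omega, by omega⟩)
        have c2 := hcon i (Finset.mem_Icc.2 ⟨by omega, by omega⟩)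
        rw [sum_blocks] at c1
        have h0 : ∑ j ∈ Finset.range (2 ^ l), hh ((i * 2 ^ l + j) / 2 ^ l + 1) (i * 2 ^ l + j) ω *
            dX (shX (pt T k0 1) M) T (k + l) (i * 2 ^ l + j) ω =
            ∑ j ∈ Finset.range (2 ^ l), hh (i + 1) (i * 2 ^ l + j) ω * dX M T (k + l) (i * 2 ^ l + j) ω := by
          refine Finset.sum_congr rfl fun j hj => ?_
          rw [dX_sh_ge hT.le hkl, e2 j hj]
          rw [h2e]
          exact (Nat.mul_le_mul_right _ hi1).trans (Nat.le_add_right _ _)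
        rw [h0] at h
        simp only [hb, if_neg hik, sub_mul, Finset.sum_sub_distrib] at h
        have hee : 2 * ε' ≤ ε := by
          rw [hε', ← mul_div_assoc, div_le_iff₀ (by positivity)]
          nlinarith [pow_pos (show (0:ℝ) < 2 by norm_num) k]
        have : |dX I T k i ω - (∑ j ∈ Finset.range (2 ^ l), hh (i + 1) (i * 2 ^ l + j) ω *
            dX M T (k + l) (i * 2 ^ l + j) ω + (∑ x ∈ Finset.range (i * 2 ^ l), hh (i + 1) x ω *
            dX M T (k + l) x ω - ∑ x ∈ Finset.range (i * 2 ^ l), hh i x ω * dX M T (k + l) x ω))| ≤ 2 * ε' := by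
          unfold dX at c1 c2 ⊢
          rw [abs_le] at c1 c2 ⊢
          constructor <;> linarith [c1.1, c1.2, c2.1, c2.2]
        linarith
    · rw [Finset.sum_const, Nat.card_Icc, nsmul_eq_mul, hε', Nat.add_sub_cancel]
      push_cast
      have : (0:ℝ) < 2 ^ k := by positivity
      rw [← mul_div_assoc, div_le_iff₀ (by positivity)]
      nlinarith

end

/-- the localized driving data -/
structure Base (μ : Measure Ω) (F : Filtration ℝ m) (B T : ℝ) (G : Set Ω) (M N : ℝ → Ω → ℝ)
    (R V c : ℝ) (f g : ℝ → ℝ) (C : ℝ) (A : ℝ → Ω → ℝ) : Prop where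
  hM : Drv μ F B M
  hN : Drv μ F B N
  ho : Orth μ F T M N
  hT : 0 < T
  hG : MeasurableSet G
  hR : 0 < R
  cd : CellDom μ G T c M N
  hc : 0 ≤ c
  hf : Measurable f
  hC0 : 0 < C
  hfC : ∀ x, |f x| ≤ C
  hg : Monotone g
  hgC : ∀ x, |g x| ≤ C
  hfg : ∀ x y, |f x - f y| ≤ |g x - g y|
  var : ∀ ω ∈ G, ∀ u : ℕ → ℝ, Monotone u → (∀ i, u i ∈ Icc 0 T) → ∀ n,
    ∑ i ∈ Finset.range n, |A (u (i + 1)) ω - A (u i) ω| ≤ V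

/-- a localized solution -/
structure Sol (μ : Measure Ω) (F : Filtration ℝ m) (T : ℝ) (G : Set Ω) (M N : ℝ → Ω → ℝ)
    (R : ℝ) (f : ℝ → ℝ) (A : ℝ → Ω → ℝ) (y : ℝ) (I Y : ℝ → Ω → ℝ) : Prop where
  adp : Adp F Y
  Ic : ∀ ω, Continuous fun t => I t ω
  Im : ∀ t, 0 ≤ t → Measurable (I t)
  IR : ∃ R', 0 ≤ R' ∧ ∀ t ω, |I t ω| ≤ R'
  bd : ∀ ω ∈ G, ∀ t ∈ Icc 0 T, |Y t ω| ≤ R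
  eq : ∀ ω ∈ G, ∀ t ∈ Icc 0 T, Y t ω = y + I t ω + A t ω + N t ω
  I0 : ∀ ω ∈ G, I 0 ω = 0
  cp : ∀ t, 0 < t → t ≤ T → CP μ G (fun n => rsum (fun s ω => f (Y s ω)) M t n) (I t)

section
variable {μ : Measure Ω} [IsProbabilityMeasure μ] {F : Filtration ℝ m} {B T R V c C y : ℝ}
  {M N A I Y : ℝ → Ω → ℝ} {G : Set Ω} {f g : ℝ → ℝ}

lemma Base.var' (b : Base μ F B T G M N R V c f g C A) {φ : ℝ → ℝ} (hφ : Monotone φ)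
    (hm : ∀ t ∈ Icc 0 T, φ t ∈ Icc 0 T) {ω : Ω} (hω : ω ∈ G) (k : ℕ) :
    ∑ i ∈ Finset.range (2 ^ k), |A (φ (pt T k (i + 1))) ω - A (φ (pt T k i)) ω| ≤ V := by
  have := b.var ω hω (fun i => φ (pt T k (min i (2 ^ k))))
    (fun i j h => hφ (pt_mono b.hT.le k (min_le_min_right _ h)))
    (fun i => hm _ (pt_mem b.hT.le (min_le_right _ _))) (2 ^ k)
  refine le_trans (le_of_eq ?_) this
  refine Finset.sum_congr rfl fun i hi => ?_
  have hi := Finset.mem_range.1 hi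
  simp only [min_eq_left hi.le, min_eq_left (Nat.succ_le_of_lt hi)]

lemma Sol.sem (s : Sol μ F T G M N R f A y I Y) (b : Base μ F B T G M N R V c f g C A)
    (hap : AP μ F T G M I) : Sem μ F T G M N R V A I Y where
  adp := s.adp
  ap := hap
  bd := s.bd
  eq ω hω k i hi := by
    unfold dX
    rw [s.eq ω hω _ (pt_mem b.hT.le hi), s.eq ω hω _ (pt_mem b.hT.le hi.le)]; ring
  var ω hω k := b.var' (φ := id) monotone_id (fun t h => h) hω k

lemma Sol.tilde (s : Sol μ F T G M N R f A y I Y) (b : Base μ F B T G M N R V c f g C A) (k0 : ℕ) :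
    Sem μ (shF (pt T k0 1) F) T G (shX (pt T k0 1) M) (shX (pt T k0 1) N) R V (shX (pt T k0 1) A)
      (shX (pt T k0 1) I) (fun t ω => Y (max t (pt T k0 1)) ω) := by
  obtain ⟨R', hR', hIR⟩ := s.IR
  have he := pt_mem b.hT.le (n := k0) (i := 1) Nat.one_le_two_pow
  have hm : ∀ t ∈ Icc 0 T, max t (pt T k0 1) ∈ Icc 0 T := fun t h => ⟨le_max_of_le_left h.1, max_le h.2 he.2⟩
  refine ⟨s.adp.sh, AP_tilde b.hM s.adp b.hT b.hf b.hfC b.hG hR' s.Ic s.Im hIR s.cp k0, ?_, ?_, ?_⟩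
  · exact fun ω hω t ht => s.bd ω hω _ (hm t ht)
  · intro ω hω k i hi
    have e1 := s.eq ω hω _ (hm _ (pt_mem b.hT.le (n := k) (Nat.succ_le_of_lt hi : i + 1 ≤ 2 ^ k)))
    have e2 := s.eq ω hω _ (hm _ (pt_mem b.hT.le (n := k) hi.le))
    unfold dX shX
    beta_reduce
    rw [e1, e2]; ring
  · intro ω hω k
    have := b.var' (φ := fun t => max t (pt T k0 1)) (fun a b h => max_le_max_right _ h) hm hω k
    refine le_trans (le_of_eq ?_) this
    refine Finset.sum_congr rfl fun i _ => ?_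
    unfold dX shX
    congr 1; ring

set_option maxHeartbeats 1600000 in
lemma Sol.lemR (s : Sol μ F T G M N R f A y I Y) (b : Base μ F B T G M N R V c f g C A) {ε : ℝ} (hε : 0 < ε) :
    ∃ ρ > 0, ∀ᶠ n in atTop, ∀ σ : ℕ → ℕ, (∀ j, σ j ≤ j) → (∀ j, pt T n j - pt T n (σ j) ≤ ρ) →
      pr μ G (fun ω => ∃ i ≤ 2 ^ n, ε < |∑ j ∈ Finset.range i,
        (f (Y (pt T n j) ω) - f (Y (pt T n (σ j)) ω)) * dX M T n j ω|) ≤ ε := by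
  have hT := b.hT
  have hC0 := b.hC0
  have hc := b.hc
  obtain ⟨κ, hκ, hlen⟩ := b.hM.len_small (μ := μ) hT.le (2 * C) (half_pos hε)
  -- early part
  obtain ⟨k0, hk0⟩ : ∃ k0, (2 * C) ^ 2 * phi μ M (pt T k0 1) / (κ / 2) ≤ ε / 8 := by
    have h1 : Tendsto (fun x => (2 * C) ^ 2 * phi μ M x / (κ / 2)) (nhdsWithin 0 (Ici 0))
        (nhds ((2 * C) ^ 2 * phi μ M 0 / (κ / 2))) :=
      (Tendsto.const_mul _ (b.hM.phi_cont 0 (by simp : (0:ℝ) ∈ Ici 0))).div_const _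
    rw [b.hM.phi_zero, mul_zero, zero_div] at h1
    have := h1.eventually (gt_mem_nhds (by positivity : (0:ℝ) < ε / 8))
    rw [eventually_nhdsWithin_iff, Metric.eventually_nhds_iff] at this
    obtain ⟨δ, hδ, h⟩ := this
    obtain ⟨k0, h0⟩ := (mesh_small T (half_pos hδ)).exists
    refine ⟨k0, (h (y := pt T k0 1) ?_ ?_).le⟩
    · have e : pt T k0 1 = T / 2 ^ k0 := by simp [pt]
      rw [Real.dist_eq, sub_zero, e, abs_of_pos (by positivity)]; linarith
    · exact pt_nonneg hT.le _ _
  set e := pt T k0 1 with he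
  have he0 : 0 ≤ e := pt_nonneg hT.le _ _
  have hsem := s.tilde b k0
  have hM' := b.hM.sh (e := e) he0
  have hN' := b.hN.sh (e := e) he0
  obtain ⟨Λ, hΛ, hocc⟩ := occ hsem hsem hM' hN' (b.ho.sh hT.le k0) hT.le b.hR (ε := ε / 8) (by positivity)
  obtain ⟨δ, hδ, hδ1⟩ : ∃ δ > 0, 2 * C * (c * (3 * δ * C * Λ)) ≤ κ / 4 := by
    refine ⟨κ / 4 / (6 * C * C * Λ * (c + 1)), by positivity, ?_⟩
    rw [show 2 * C * (c * (3 * (κ / 4 / (6 * C * C * Λ * (c + 1))) * C * Λ)) = κ / 4 * (c / (c + 1)) by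
      field_simp; ring]
    have : c / (c + 1) ≤ 1 := by rw [div_le_one (by positivity)]; linarith
    nlinarith
  obtain ⟨wb, htf, wc, w0, wC, w1, -⟩ := tf_exists b.hg b.hgC hδ
  obtain ⟨ρ, hρ, E, -, hEμ, hE⟩ := s.adp.mod (μ := μ) hT.le hδ (show 0 < ε / 8 by positivity)
  set ε' := min (ε / 8) (κ / 4 / (2 * C) / 2) with hε'
  have hε'0 : 0 < ε' := by positivity
  have hwt := (b.cd.sh hT.le k0).weighted hM' hN' hT.le hc
    (w := fun t ω => wb (Y (max t e) ω) (Y (max t e) ω))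
    (fun ω => wc.comp ((hsem.adp.cont ω).prodMk (hsem.adp.cont ω)))
    (fun t ht => (wc.measurable.comp ((hsem.adp.meas t ht).prodMk (hsem.adp.meas t ht))).mono ((shF e F).le t) le_rfl)
    (W := 2 * C) (fun t ω => w0 _ _) (fun t ω => wC _ _) hε'0
  refine ⟨ρ, hρ, ?_⟩
  filter_upwards [hlen, hocc (3 * δ * C) (by positivity) _ _ wb htf, hwt, eventually_ge_atTop k0] with
    n h1 h2 h3 hnk σ hσ hσρ
  have hmc : ∀ j, Measurable[F (pt T n j)] (fun ω => f (Y (pt T n j) ω) - f (Y (pt T n (σ j)) ω)) := by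
    intro j
    refine Measurable.sub (b.hf.comp (s.adp.meas _ (pt_nonneg hT.le _ _))) ?_
    exact (b.hf.comp (s.adp.meas _ (pt_nonneg hT.le _ _))).mono (F.mono (pt_mono hT.le n (hσ j))) le_rfl
  have h4 := h1 G (fun j ω => f (Y (pt T n j) ω) - f (Y (pt T n (σ j)) ω)) hmc (fun j ω =>
    (abs_sub _ _).trans (by linarith [b.hfC (Y (pt T n j) ω), b.hfC (Y (pt T n (σ j)) ω)]))
  have h5 : pr μ G (fun ω => ∃ i ≤ 2 ^ n, ε < |∑ j ∈ Finset.range i,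
        (f (Y (pt T n j) ω) - f (Y (pt T n (σ j)) ω)) * dX M T n j ω|) ≤
      pr μ G (fun ω => ∃ i ≤ 2 ^ n, ε / 2 < |∑ j ∈ Finset.range i,
        (f (Y (pt T n j) ω) - f (Y (pt T n (σ j)) ω)) * dX M T n j ω|) :=
    pr_mono fun ω _ ⟨i, hi, h⟩ => ⟨i, hi, by linarith⟩
  have hsum2 : Bdd m (fun ω => (2 * C) ^ 2 * ∑ j ∈ Finset.range (2 ^ (n - k0)), dX M T n j ω ^ 2) :=
    (Bdd.const _).mul (Bdd.sum _ fun j _ => ((b.hM.md hT.le n).bddm j).sq)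
  have h6 : pr μ G (fun ω => κ / 2 < (2 * C) ^ 2 * ∑ j ∈ Finset.range (2 ^ (n - k0)), dX M T n j ω ^ 2) ≤ ε / 8 := by
    refine (pr_le_integral hsum2.integrable (fun ω => by
      have := Finset.sum_nonneg (s := Finset.range (2 ^ (n - k0))) (fun j _ => sq_nonneg (dX M T n j ω))
      positivity) (by positivity)).trans ?_
    rw [integral_const_mul, b.hM.sum_sq hT.le, ← pt_e hnk]
    exact hk0
  have h7 : pr μ G (fun ω => κ < ∑ j ∈ Finset.range (2 ^ n), (f (Y (pt T n j) ω) - f (Y (pt T n (σ j)) ω)) ^ 2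
      * dX M T n j ω ^ 2) ≤ ε / 8 + ε / 8 + ε / 8 + ε / 8 := by
    refine (pr_or4 (q := fun ω => ω ∈ E) (r := fun ω => κ / 2 < (2 * C) ^ 2 *
      ∑ j ∈ Finset.range (2 ^ (n - k0)), dX M T n j ω ^ 2) fun ω hω h => ?_).trans
      (add_le_add (add_le_add (add_le_add (pr_exc hEμ) h6) h2) (h3.trans (min_le_left _ _)))
    by_contra hcon
    push Not at hcon
    obtain ⟨g1, g2, g3, g4⟩ := hcon
    have hterm : ∀ j ∈ Finset.range (2 ^ n), (f (Y (pt T n j) ω) - f (Y (pt T n (σ j)) ω)) ^ 2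
      * dX M T n j ω ^ 2 ≤ (if j < 2 ^ (n - k0) then (2 * C) ^ 2 * dX M T n j ω ^ 2 else 0) +
        2 * C * (wb (Y (max (pt T n j) e) ω) (Y (max (pt T n j) e) ω) * dX (shX e M) T n j ω ^ 2) := by
      intro j hj
      have hj := Finset.mem_range.1 hj
      have hb : |f (Y (pt T n j) ω) - f (Y (pt T n (σ j)) ω)| ≤ 2 * C :=
        (abs_sub _ _).trans (by linarith [b.hfC (Y (pt T n j) ω), b.hfC (Y (pt T n (σ j)) ω)])
      split_ifs with hjk
      · have : 0 ≤ 2 * C * (wb (Y (max (pt T n j) e) ω) (Y (max (pt T n j) e) ω) * dX (shX e M) T n j ω ^ 2) := by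
          have := w0 (Y (max (pt T n j) e) ω) (Y (max (pt T n j) e) ω)
          positivity
        have : (f (Y (pt T n j) ω) - f (Y (pt T n (σ j)) ω)) ^ 2 ≤ (2 * C) ^ 2 := by
          rw [← sq_abs]; exact pow_le_pow_left₀ (abs_nonneg _) hb 2
        have := mul_le_mul_of_nonneg_right this (sq_nonneg (dX M T n j ω))
        linarith
      · have hjk' := not_lt.1 hjk
        rw [dX_sh_ge hT.le hnk _ hjk', pt_max hT.le hnk, max_eq_left hjk', zero_add, ← mul_assoc]
        refine mul_le_mul_of_nonneg_right ?_ (sq_nonneg _)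
        have hY : |Y (pt T n j) ω - Y (pt T n (σ j)) ω| ≤ δ := by
          refine hE ω g1 _ (pt_mem hT.le hj.le) _ (pt_mem hT.le ((hσ j).trans hj.le)) ?_
          rw [abs_of_nonneg (sub_nonneg.2 (pt_mono hT.le n (hσ j)))]
          exact hσρ j
        rw [abs_le] at hY
        have hgg : |g (Y (pt T n j) ω) - g (Y (pt T n (σ j)) ω)| ≤ wb (Y (pt T n j) ω) (Y (pt T n j) ω) := by
          refine le_trans ?_ (w1 _)
          have a1 := b.hg (show Y (pt T n j) ω ≤ Y (pt T n j) ω + δ by linarith)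
          have a2 := b.hg (show Y (pt T n j) ω - δ ≤ Y (pt T n j) ω by linarith)
          have a3 := b.hg (show Y (pt T n (σ j)) ω ≤ Y (pt T n j) ω + δ by linarith)
          have a4 := b.hg (show Y (pt T n j) ω - δ ≤ Y (pt T n (σ j)) ω by linarith)
          rw [abs_le]; constructor <;> linarith
        rw [← sq_abs, sq]
        exact mul_le_mul hb ((b.hfg _ _).trans hgg) (abs_nonneg _) (by positivity)
    have hs := Finset.sum_le_sum hterm
    rw [Finset.sum_add_distrib, ← Finset.mul_sum, ← Finset.sum_filter, ← Finset.mul_sum] at hs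
    have hfil : (Finset.range (2 ^ n)).filter (fun j => j < 2 ^ (n - k0)) = Finset.range (2 ^ (n - k0)) := by
      ext j
      simp only [Finset.mem_filter, Finset.mem_range]
      have : 2 ^ (n - k0) ≤ 2 ^ n := Nat.pow_le_pow_right (by norm_num) (by omega)
      omega
    rw [hfil] at hs
    have q1 : ε' ≤ κ / 4 / (2 * C) / 2 := min_le_right _ _
    have q2 : 2 * C * ε' ≤ κ / 8 := by
      calc _ ≤ 2 * C * (κ / 4 / (2 * C) / 2) := mul_le_mul_of_nonneg_left q1 (by positivity)
        _ = κ / 8 := by field_simp; norm_num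
    have q3 := mul_le_mul_of_nonneg_left g3 hc
    have q4 := mul_le_mul_of_nonneg_left (g4.trans (add_le_add_left q3 ε')) (show 0 ≤ 2 * C by positivity)
    rw [mul_add] at q4
    linarith
  linarith

end

/-- grid Riemann sums -/
def Sg (f : ℝ → ℝ) (Y M : ℝ → Ω → ℝ) (T : ℝ) (n i : ℕ) (ω : Ω) : ℝ :=
  ∑ j ∈ Finset.range i, f (Y (pt T n j) ω) * dX M T n j ω

lemma sum_dX_blk (X : ℝ → Ω → ℝ) (T : ℝ) (n a L : ℕ) (ω : Ω) :
    ∑ j ∈ Finset.range L, dX X T n (a + j) ω = X (pt T n (a + L)) ω - X (pt T n a) ω := by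
  induction L with
  | zero => simp
  | succ L ih => rw [Finset.sum_range_succ, ih, dX, ← Nat.add_assoc]; ring

section
variable {μ : Measure Ω} [IsProbabilityMeasure μ] {F : Filtration ℝ m} {B T R V c C y : ℝ}
  {M N A I Y : ℝ → Ω → ℝ} {G : Set Ω} {f g : ℝ → ℝ}

lemma rsum_fine (f : ℝ → ℝ) (k n : ℕ) {i : ℕ} (hi : 0 < i) (ω : Ω) :
    rsum (fun s ω => f (Y s ω)) M (pt T k i) n ω =
      ∑ J ∈ Finset.range (2 ^ n * i), f (Y (pt T (k + n) (J / i * i)) ω) * dX M T (k + n) J ω := by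
  have e : ∀ p : ℕ, pt (pt T k i) n p = pt T (k + n) (p * i) := by
    intro p; unfold pt; push_cast; rw [pow_add]; field_simp
  rw [rsum_pt, sum_range_mul']
  refine Finset.sum_congr rfl fun p _ => ?_
  have h1 : ∀ j ∈ Finset.range i, f (Y (pt T (k + n) ((p * i + j) / i * i)) ω) * dX M T (k + n) (p * i + j) ω
      = f (Y (pt T (k + n) (p * i)) ω) * dX M T (k + n) (p * i + j) ω := by
    intro j hj
    have hj := Finset.mem_range.1 hj
    rw [Nat.add_comm (p * i), Nat.add_mul_div_right _ _ hi, Nat.div_eq_of_lt hj, zero_add]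
  rw [Finset.sum_congr rfl h1, ← Finset.mul_sum, sum_dX_blk, e, dX, e, e, Nat.succ_mul]

lemma gap_le (hT : 0 ≤ T) (n : ℕ) {i : ℕ} (hi : 0 < i) (J : ℕ) :
    pt T n J - pt T n (J / i * i) ≤ T * i / 2 ^ n := by
  rw [pt_sub]
  have h1 : J < J / i * i + i := by
    have := Nat.lt_div_mul_add hi (a := J); omega
  have h2 : (J : ℝ) - ((J / i * i : ℕ) : ℝ) ≤ i := by
    have : (J : ℝ) < ((J / i * i : ℕ) : ℝ) + i := by exact_mod_cast h1
    linarith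
  gcongr

lemma Sol.pw (s : Sol μ F T G M N R f A y I Y) (b : Base μ F B T G M N R V c f g C A) (k : ℕ) {i : ℕ}
    (hi : i ≤ 2 ^ k) : CP μ G (fun n => Sg f Y M T (k + n) (i * 2 ^ n)) (I (pt T k i)) := by
  have hT := b.hT
  intro ε hε
  rcases Nat.eq_zero_or_pos i with rfl | hi0
  · refine Eventually.of_forall fun n => ?_
    refine (pr_false (μ := μ) (G := G) fun ω hω h => ?_).trans_le hε.le
    rw [pt_zero, s.I0 ω hω] at h
    simp [Sg] at h; linarith
  · have ht0 : 0 < pt T k i := by unfold pt; positivity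
    obtain ⟨ρ, hρ, h1⟩ := s.lemR b (half_pos hε)
    obtain ⟨n0, h1⟩ := eventually_atTop.1 h1
    filter_upwards [s.cp _ ht0 (pt_le hT.le hi) (ε / 2) (half_pos hε), mesh_small T hρ, eventually_ge_atTop n0] with
      n h2 h3 h4
    have h5 := h1 (k + n) (by omega) (fun J => J / i * i) (fun j => Nat.div_mul_le_self j i) (fun j => by
      refine (gap_le hT.le _ hi0 j).trans (le_trans ?_ h3)
      rw [pow_add, div_le_div_iff₀ (by positivity) (by positivity)]
      have : (i : ℝ) ≤ 2 ^ k := by exact_mod_cast hi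
      have := mul_le_mul_of_nonneg_left this (show 0 ≤ T * 2 ^ n by positivity)
      linarith)
    refine (pr_or fun ω hω h => ?_).trans ((add_le_add h5 h2).trans_eq (add_halves ε))
    by_contra hcon
    push Not at hcon
    obtain ⟨g1, g2⟩ := hcon
    have hle : 2 ^ n * i ≤ 2 ^ (k + n) := by rw [Nat.add_comm, pow_add]; exact Nat.mul_le_mul_left _ hi
    have g3 := g1 (2 ^ n * i) hle
    rw [rsum_fine f k n hi0] at g2
    simp only [sub_mul, Finset.sum_sub_distrib] at g3
    rw [Sg, Nat.mul_comm] at h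
    rw [abs_le] at g2 g3
    have : |∑ j ∈ Finset.range (2 ^ n * i), f (Y (pt T (k + n) j) ω) * dX M T (k + n) j ω - I (pt T k i) ω| ≤ ε := by
      rw [abs_le]; constructor <;> linarith
    linarith

set_option maxHeartbeats 800000 in
lemma Sol.unif (s : Sol μ F T G M N R f A y I Y) (b : Base μ F B T G M N R V c f g C A) {ε : ℝ} (hε : 0 < ε) :
    ∀ᶠ n in atTop, pr μ G (fun ω => ∃ i ≤ 2 ^ n, ε < |Sg f Y M T n i ω - I (pt T n i) ω|) ≤ ε := by
  have hT := b.hT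
  have hC0 := b.hC0
  have h8 : 0 < ε / 8 := by positivity
  obtain ⟨ρ, hρ, h1⟩ := s.lemR b h8
  obtain ⟨ρM, hρM, EM, -, hEMμ, hEM⟩ := b.hM.toAdp.mod (μ := μ) hT.le
    (show 0 < ε / 8 / C by positivity) h8
  let F0 : Filtration ℝ m := ⟨fun _ => m, fun _ _ _ => le_rfl, fun _ => le_rfl⟩
  have hIA : Adp F0 I := ⟨s.Ic, s.Im⟩
  obtain ⟨ρI, hρI, EI, -, hEIμ, hEI⟩ := hIA.mod (μ := μ) hT.le h8 h8
  obtain ⟨k, hk⟩ := (mesh_small T (show 0 < min ρ (min ρM ρI) by positivity)).exists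
  have hk1 := hk.trans (min_le_left _ _)
  have hk2 := hk.trans ((min_le_right _ _).trans (min_le_left _ _))
  have hk3 := hk.trans ((min_le_right _ _).trans (min_le_right _ _))
  have hε' : 0 < ε / 8 / (2 ^ k + 1) := by positivity
  have hpw : ∀ᶠ l in atTop, ∀ i ∈ Finset.range (2 ^ k + 1),
      pr μ G (fun ω => ε / 8 / (2 ^ k + 1) < |Sg f Y M T (k + l) (i * 2 ^ l) ω - I (pt T k i) ω|) ≤ ε / 8 / (2 ^ k + 1) := by
    rw [Filter.eventually_all_finset]
    intro i hi
    exact s.pw b k (Nat.lt_succ_iff.1 (Finset.mem_range.1 hi)) _ hε'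
  obtain ⟨l0, hpw⟩ := eventually_atTop.1 hpw
  filter_upwards [h1, eventually_ge_atTop (k + l0)] with n hn hnk
  obtain ⟨l, rfl⟩ : ∃ l, n = k + l := ⟨n - k, by omega⟩
  have hpw := hpw l (by omega)
  have hgap : ∀ j, pt T (k + l) j - pt T (k + l) (j / 2 ^ l * 2 ^ l) ≤ T / 2 ^ k := by
    intro j
    refine (gap_le hT.le _ (by positivity) j).trans_eq ?_
    push_cast; rw [pow_add]; field_simp
  have hR := hn (fun J => J / 2 ^ l * 2 ^ l) (fun j => Nat.div_mul_le_self _ _) (fun j => (hgap j).trans hk1)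
  have hex := pr_exists (μ := μ) (G := G) (Finset.range (2 ^ k + 1))
    (fun i ω => ε / 8 / (2 ^ k + 1) < |Sg f Y M T (k + l) (i * 2 ^ l) ω - I (pt T k i) ω|)
  have hex2 := hex.trans (Finset.sum_le_sum hpw)
  rw [Finset.sum_const, Finset.card_range, nsmul_eq_mul] at hex2
  have e1 : ((2 ^ k + 1 : ℕ) : ℝ) * (ε / 8 / (2 ^ k + 1)) = ε / 8 := by push_cast; field_simp
  rw [e1] at hex2
  refine (pr_or4 (p := _) (q := fun ω => ω ∈ EM) (r := fun ω => ω ∈ EI) fun ω hω h => ?_).trans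
    ((add_le_add (add_le_add (add_le_add (pr_exc hEMμ) (pr_exc hEIμ)) hR) hex2).trans (by linarith))
  by_contra hcon
  push Not at hcon
  obtain ⟨g1, g2, g3, g4⟩ := hcon
  obtain ⟨J, hJ, h⟩ := h
  set J0 := J / 2 ^ l with hJ0
  have hJ0le : J0 * 2 ^ l ≤ J := Nat.div_mul_le_self _ _
  have hJ0k : J0 ≤ 2 ^ k := by
    have : J0 * 2 ^ l ≤ 2 ^ k * 2 ^ l := by rw [← pow_add]; omega
    exact Nat.le_of_mul_le_mul_right this (by positivity)
  have a1 := g3 J hJ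
  have a2 := g3 (J0 * 2 ^ l) (hJ0le.trans hJ)
  have a3 := g4 J0 (Finset.mem_range.2 (by omega))
  have habs : |pt T (k + l) J - pt T (k + l) (J0 * 2 ^ l)| ≤ T / 2 ^ k := by
    rw [abs_of_nonneg (sub_nonneg.2 (pt_mono hT.le _ hJ0le))]; exact hgap J
  have a4 := hEI ω g2 _ (pt_mem hT.le hJ) _ (pt_mem hT.le (hJ0le.trans hJ)) (habs.trans hk3)
  have a5 := hEM ω g1 _ (pt_mem hT.le hJ) _ (pt_mem hT.le (hJ0le.trans hJ)) (habs.trans hk2)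
  rw [← pt_add k l] at a3
  have a3' : ε / 8 / (2 ^ k + 1) ≤ ε / 8 := div_le_self h8.le (by linarith [show (0:ℝ) < 2 ^ k by positivity])
  have a3 := a3.trans a3'
  obtain ⟨q, hq⟩ : ∃ q, J = J0 * 2 ^ l + q := ⟨J - J0 * 2 ^ l, by omega⟩
  have hq2 : q < 2 ^ l := by
    have := Nat.lt_div_mul_add (show 0 < 2 ^ l by positivity) (a := J)
    rw [← hJ0] at this; omega
  have a6 : |∑ j ∈ Finset.range J, f (Y (pt T (k + l) (j / 2 ^ l * 2 ^ l)) ω) * dX M T (k + l) j ω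
      - ∑ j ∈ Finset.range (J0 * 2 ^ l), f (Y (pt T (k + l) (j / 2 ^ l * 2 ^ l)) ω) * dX M T (k + l) j ω| ≤ ε / 8 := by
    have e2 : ∑ j ∈ Finset.range J, f (Y (pt T (k + l) (j / 2 ^ l * 2 ^ l)) ω) * dX M T (k + l) j ω
      - ∑ j ∈ Finset.range (J0 * 2 ^ l), f (Y (pt T (k + l) (j / 2 ^ l * 2 ^ l)) ω) * dX M T (k + l) j ω =
        f (Y (pt T (k + l) (J0 * 2 ^ l)) ω) * (M (pt T (k + l) J) ω - M (pt T (k + l) (J0 * 2 ^ l)) ω) := by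
      rw [hq, Finset.sum_range_add, add_sub_cancel_left, ← sum_dX_blk, Finset.mul_sum]
      refine Finset.sum_congr rfl fun j hj => ?_
      rw [block_div (lt_trans (Finset.mem_range.1 hj) hq2)]
    rw [e2, abs_mul]
    calc _ ≤ C * (ε / 8 / C) := mul_le_mul (b.hfC _) a5 (abs_nonneg _) hC0.le
      _ = ε / 8 := by field_simp
  simp only [sub_mul, Finset.sum_sub_distrib] at a1 a2
  unfold Sg at h a3
  rw [abs_le] at a1 a2 a3 a4 a6
  have : |∑ j ∈ Finset.range J, f (Y (pt T (k + l) j) ω) * dX M T (k + l) j ω - I (pt T (k + l) J) ω| ≤ ε := by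
    rw [abs_le]; constructor <;> linarith
  linarith

lemma Sol.ap (s : Sol μ F T G M N R f A y I Y) (b : Base μ F B T G M N R V c f g C A) : AP μ F T G M I := by
  have hT := b.hT
  refine ⟨0, C, le_rfl, b.hC0.le, Eventually.of_forall fun k ε hε => ?_⟩
  obtain ⟨n0, h⟩ := eventually_atTop.1 (s.unif b (show 0 < ε / 2 by positivity))
  have h := h (k + n0) (by omega)
  refine ⟨n0, fun j ω => f (Y (pt T (k + n0) j) ω), fun _ _ => 0, ?_, ?_, ?_, ?_⟩
  · exact fun j => b.hf.comp (s.adp.meas _ (pt_nonneg hT.le _ _))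
  · exact fun j ω => b.hfC _
  · intro r hr
    simp only [abs_zero, Finset.sum_const_zero, zero_div]
    exact (pr_false (μ := μ) (G := G) fun ω hω h => by linarith).le
  · refine (pr_mono fun ω hω hh => ?_).trans (h.trans (by linarith))
    by_contra hcon
    push Not at hcon
    obtain ⟨i, hi, hh⟩ := hh
    have hi1 : (i + 1) * 2 ^ n0 ≤ 2 ^ (k + n0) := by rw [pow_add]; exact Nat.mul_le_mul_right _ hi
    have hi2 : i * 2 ^ n0 ≤ 2 ^ (k + n0) := by rw [pow_add]; exact Nat.mul_le_mul_right _ hi.le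
    have a1 := hcon _ hi1
    have a2 := hcon _ hi2
    unfold Sg at a1 a2
    rw [sum_blocks, pt_add] at a1
    rw [pt_add] at a2
    rw [dX, add_zero] at hh
    rw [abs_le] at a1 a2
    have : |I (pt T k (i + 1)) ω - I (pt T k i) ω - ∑ j ∈ Finset.range (2 ^ n0),
        f (Y (pt T (k + n0) (i * 2 ^ n0 + j)) ω) * dX M T (k + n0) (i * 2 ^ n0 + j) ω| ≤ ε := by
      rw [abs_le]; constructor <;> linarith
    linarith

end

/-- the smooth convex test function -/
def Ph (ε x : ℝ) : ℝ := x * Real.arsinh (x / ε) - √(x ^ 2 + ε ^ 2) + ε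

lemma Ph_deriv {ε : ℝ} (hε : 0 < ε) (x : ℝ) : HasDerivAt (Ph ε) (Real.arsinh (x / ε)) x := by
  have h1 : HasDerivAt (fun x : ℝ => x / ε) (1 / ε) x := (hasDerivAt_id x).div_const ε
  have h2 := (Real.hasDerivAt_arsinh (x / ε)).comp x h1
  have h3 := (hasDerivAt_id x).mul h2
  have h4 : HasDerivAt (fun x : ℝ => x ^ 2 + ε ^ 2) (2 * x) x := by
    simpa using (hasDerivAt_pow 2 x).add_const (ε ^ 2)
  have hp : 0 < x ^ 2 + ε ^ 2 := by positivity
  have h5 := h4.sqrt hp.ne'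
  have h6 := (h3.sub h5).add_const ε
  refine h6.congr_deriv ?_
  have e : √(1 + (x / ε) ^ 2) = √(x ^ 2 + ε ^ 2) / ε := by
    rw [show 1 + (x / ε) ^ 2 = (x ^ 2 + ε ^ 2) / ε ^ 2 by field_simp; ring, Real.sqrt_div hp.le,
      Real.sqrt_sq hε.le]
  have hs : 0 < √(x ^ 2 + ε ^ 2) := Real.sqrt_pos.2 hp
  simp only [id, Function.comp]
  rw [e]
  field_simp
  ring

lemma psi_deriv {ε : ℝ} (hε : 0 < ε) (x : ℝ) :
    HasDerivAt (fun x => Real.arsinh (x / ε)) (1 / √(x ^ 2 + ε ^ 2)) x := by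
  have h1 : HasDerivAt (fun x : ℝ => x / ε) (1 / ε) x := (hasDerivAt_id x).div_const ε
  have h2 := (Real.hasDerivAt_arsinh (x / ε)).comp x h1
  refine h2.congr_deriv ?_
  have hp : 0 < x ^ 2 + ε ^ 2 := by positivity
  have e : √(1 + (x / ε) ^ 2) = √(x ^ 2 + ε ^ 2) / ε := by
    rw [show 1 + (x / ε) ^ 2 = (x ^ 2 + ε ^ 2) / ε ^ 2 by field_simp; ring, Real.sqrt_div hp.le,
      Real.sqrt_sq hε.le]
  have hs : 0 < √(x ^ 2 + ε ^ 2) := Real.sqrt_pos.2 hp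
  rw [e]
  field_simp

lemma Ph_cont {ε : ℝ} (hε : 0 < ε) : Continuous (Ph ε) :=
  continuous_iff_continuousAt.2 fun x => (Ph_deriv hε x).continuousAt

lemma psi_cont {ε : ℝ} (hε : 0 < ε) : Continuous (fun x => Real.arsinh (x / ε)) :=
  continuous_iff_continuousAt.2 fun x => (psi_deriv hε x).continuousAt

lemma Ph_zero {ε : ℝ} (hε : 0 < ε) : Ph ε 0 = 0 := by
  simp [Ph, Real.sqrt_sq hε.le]

/-- Taylor remainder -/
def rm (ε x h : ℝ) : ℝ := Ph ε (x + h) - Ph ε x - Real.arsinh (x / ε) * h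

lemma rm_le {ε x h L : ℝ} (hε : 0 < ε) (hL : ∀ z, |z - x| ≤ |h| → 1 / √(z ^ 2 + ε ^ 2) ≤ L) :
    rm ε x h ≤ L * h ^ 2 := by
  set s := Icc (x - |h|) (x + |h|) with hs
  have hsm : ∀ z ∈ s, |z - x| ≤ |h| := fun z hz => by
    rw [abs_le]; constructor <;> linarith [hz.1, hz.2]
  have hx : x ∈ s := ⟨by linarith [abs_nonneg h], by linarith [abs_nonneg h]⟩
  have hxh : x + h ∈ s := ⟨by linarith [neg_abs_le h], by linarith [le_abs_self h]⟩
  have h1 : ∀ z ∈ s, ‖Real.arsinh (z / ε) - Real.arsinh (x / ε)‖ ≤ L * ‖z - x‖ := by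
    intro z hz
    refine (convex_Icc _ _).norm_image_sub_le_of_norm_hasDerivWithin_le
      (f := fun x => Real.arsinh (x / ε)) (f' := fun x => 1 / √(x ^ 2 + ε ^ 2))
      (fun u hu => (psi_deriv hε u).hasDerivWithinAt) (fun u hu => ?_) hx hz
    rw [Real.norm_of_nonneg (by positivity)]
    exact hL u (hsm u hu)
  have hL0 : 0 ≤ L := le_trans (by positivity) (hL x (by simp))
  have h2 : ‖(Ph ε (x + h) - Real.arsinh (x / ε) * (x + h)) - (Ph ε x - Real.arsinh (x / ε) * x)‖ ≤ L * |h| * ‖x + h - x‖ := by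
    refine (convex_Icc _ _).norm_image_sub_le_of_norm_hasDerivWithin_le
      (f := fun z => Ph ε z - Real.arsinh (x / ε) * z) (f' := fun z => Real.arsinh (z / ε) - Real.arsinh (x / ε))
      (fun u hu => ?_) (fun u hu => ?_) hx hxh
    · have := (Ph_deriv hε u).sub ((hasDerivAt_id u).const_mul (Real.arsinh (x / ε)))
      rw [mul_one] at this
      exact this.hasDerivWithinAt
    · exact (h1 u hu).trans (mul_le_mul_of_nonneg_left (hsm u hu) hL0)
  rw [add_sub_cancel_left, Real.norm_eq_abs, Real.norm_eq_abs, mul_assoc, abs_mul_abs_self] at h2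
  have := (le_abs_self _).trans h2
  unfold rm
  nlinarith

lemma rm_le_glob {ε : ℝ} (hε : 0 < ε) (x h : ℝ) : rm ε x h ≤ 1 / ε * h ^ 2 := by
  refine rm_le hε fun z _ => one_div_le_one_div_of_le hε ?_
  exact Real.le_sqrt_of_sq_le (by nlinarith)

lemma rm_le_loc {ε : ℝ} (hε : 0 < ε) (x h : ℝ) (hh : |h| ≤ ε / 2) : rm ε x h ≤ 4 / (|x| + ε) * h ^ 2 := by
  refine rm_le hε fun z hz => ?_
  have h1 : ε ≤ √(z ^ 2 + ε ^ 2) := Real.le_sqrt_of_sq_le (by nlinarith)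
  have h2 : |z| ≤ √(z ^ 2 + ε ^ 2) := Real.le_sqrt_of_sq_le (by rw [sq_abs]; nlinarith)
  have h3 : |x| ≤ |z| + |z - x| := by
    have := abs_sub_abs_le_abs_sub x z
    rw [abs_sub_comm] at this; linarith
  rw [div_le_div_iff₀ (by linarith) (by positivity)]
  linarith

/-- convexity -/
lemma rm_nonneg {ε : ℝ} (hε : 0 < ε) (x h : ℝ) : 0 ≤ rm ε x h := by
  have hmono : Monotone (fun x => Real.arsinh (x / ε)) := by
    intro a b hab
    exact Real.arsinh_le_arsinh.2 (by gcongr)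
  have hd : deriv (Ph ε) = fun x => Real.arsinh (x / ε) := funext fun x => (Ph_deriv hε x).deriv
  have hc : ConvexOn ℝ univ (Ph ε) := Monotone.convexOn_univ_of_deriv (fun x => (Ph_deriv hε x).differentiableAt) (by rw [hd]; exact hmono)
  unfold rm
  rcases lt_trichotomy h 0 with hh | hh | hh
  · have := hc.slope_le_of_hasDerivAt (x := x + h) (y := x) (mem_univ _) (mem_univ _) (by linarith) (Ph_deriv hε x)
    rw [slope_def_field, div_le_iff₀ (by linarith)] at this
    linarith
  · subst hh; simp
  · have := hc.le_slope_of_hasDerivAt (x := x) (y := x + h) (mem_univ _) (mem_univ _) (by linarith) (Ph_deriv hε x)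
    rw [slope_def_field, le_div_iff₀ (by linarith)] at this
    linarith

lemma Ph_nonneg {ε : ℝ} (hε : 0 < ε) (x : ℝ) : 0 ≤ Ph ε x := by
  have := rm_nonneg hε 0 x
  simp [rm, Ph_zero hε] at this
  exact this

lemma Ph_lower {x0 K : ℝ} (hx : 0 < x0) (hK : 0 < K) :
    ∃ ε > 0, ∀ x, x0 < |x| → x0 * K < Ph ε x := by
  have hs : 0 < Real.sinh (K + 1) := Real.sinh_pos_iff.2 (by linarith)
  refine ⟨x0 / Real.sinh (K + 1), by positivity, fun x hxx => ?_⟩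
  set ε := x0 / Real.sinh (K + 1) with hεd
  have hε : 0 < ε := by positivity
  have e1 : x * Real.arsinh (x / ε) = |x| * Real.arsinh (|x| / ε) := by
    rcases abs_cases x with ⟨h, _⟩ | ⟨h, _⟩ <;> rw [h]
    rw [neg_div, Real.arsinh_neg]; ring
  have e2 : K + 1 ≤ Real.arsinh (|x| / ε) := by
    rw [← Real.arsinh_sinh (K + 1)]
    refine Real.arsinh_le_arsinh.2 ?_
    rw [le_div_iff₀ hε, hεd, mul_div_cancel₀ _ hs.ne']; exact hxx.le
  have e3 : √(x ^ 2 + ε ^ 2) ≤ |x| + ε := by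
    rw [Real.sqrt_le_left (by positivity)]
    nlinarith [sq_abs x, abs_nonneg x]
  unfold Ph
  rw [e1]
  have := mul_le_mul_of_nonneg_left e2 (abs_nonneg x)
  nlinarith

lemma Bdd.compc {m' : MeasurableSpace Ω} {X : Ω → ℝ} (h : Bdd m' X) {φ : ℝ → ℝ} (hφ : Continuous φ) :
    Bdd m' (fun ω => φ (X ω)) := by
  obtain ⟨h1, C, hC⟩ := h
  refine ⟨hφ.measurable.comp h1, ?_⟩
  obtain ⟨D, hD⟩ := (isCompact_Icc (a := -C) (b := C)).exists_bound_of_continuousOn hφ.continuousOn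
  exact ⟨D, fun ω => hD _ (abs_le.1 (hC ω))⟩

section
variable {μ : Measure Ω} [IsProbabilityMeasure μ] {F : Filtration ℝ m}

lemma MD.phi_max {Fn : ℕ → MeasurableSpace Ω} {d : ℕ → Ω → ℝ} (h : MD μ Fn d) {G : Set Ω} (n : ℕ) {ε K l : ℝ}
    (hε : 0 < ε) (hK : 0 ≤ K) (hl : 0 < l) {mx : Ω → ℝ} (hmx : Bdd m mx) (hm : ∀ ω, ∀ i < n, d i ω ^ 2 ≤ mx ω)
    (hm0 : ∀ ω, 0 ≤ mx ω) :
    pr μ G (fun ω => l < Ph ε (∑ j ∈ Finset.range n, d j ω)) ≤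
      pr μ G (fun ω => K < ∑ i ∈ Finset.range n, rm ε (∑ j ∈ Finset.range i, d j ω) (d i ω)) +
        (K + 1 / ε * ∫ ω, mx ω ∂μ) / l := by
  classical
  set S : ℕ → Ω → ℝ := fun i ω => ∑ j ∈ Finset.range i, d j ω with hS
  have hSb : ∀ i, Bdd (Fn i) (S i) := fun i => h.bdd_sum i
  set r : ℕ → Ω → ℝ := fun i ω => rm ε (S i ω) (d i ω) with hr
  have hS1 : ∀ i ω, S (i + 1) ω = S i ω + d i ω := fun i ω => Finset.sum_range_succ _ _
  have hrb : ∀ i, Bdd (Fn (i + 1)) (r i) := fun i => by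
    have a := ((hSb i).mono (h.mono (Nat.le_succ i)))
    exact (((a.add (h.bdd i)).compc (Ph_cont hε)).sub (a.compc (Ph_cont hε))).sub
      ((a.compc (psi_cont hε)).mul (h.bdd i))
  have hr0 : ∀ i ω, 0 ≤ r i ω := fun i ω => rm_nonneg hε _ _
  set Q : ℕ → Ω → ℝ := fun i ω => ∑ l ∈ Finset.range i, r l ω with hQ
  have hQb : ∀ i, Bdd (Fn i) (Q i) := fun i => Bdd.sum _ fun j hj =>
    (hrb j).mono (h.mono (Finset.mem_range.1 hj))
  have hQmono : ∀ ω, Monotone fun i => Q i ω := fun ω => monotone_nat_of_le_succ fun i => by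
    show Q i ω ≤ Q (i + 1) ω
    simp only [hQ, Finset.sum_range_succ]; linarith [hr0 i ω]
  set χ : ℕ → Ω → ℝ := fun i ω => if Q i ω ≤ K then 1 else 0 with hχ
  have hχb : ∀ i, Bdd (Fn i) (χ i) := fun i => Bdd.ind ((hQb i).mset_le K)
  set Z : ℕ → Ω → ℝ := fun i ω => ∑ j ∈ Finset.range i, χ j ω * (Ph ε (S (j + 1) ω) - Ph ε (S j ω)) with hZ
  have hmem : ∀ i ω, Q i ω ≤ K → Z i ω = Ph ε (S i ω) := by
    intro i ω hi
    have : ∀ j ∈ Finset.range i, χ j ω * (Ph ε (S (j + 1) ω) - Ph ε (S j ω)) = Ph ε (S (j + 1) ω) - Ph ε (S j ω) := by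
      intro j hj
      have : Q j ω ≤ K := (hQmono ω (Finset.mem_range.1 hj).le).trans hi
      simp [hχ, this]
    simp only [hZ]
    rw [Finset.sum_congr rfl this, Finset.sum_range_sub (fun j => Ph ε (S j ω))]
    simp [hS, Ph_zero hε]
  have hZ0 : ∀ i ω, 0 ≤ Z i ω ∧ (Q i ω ≤ K → True) := by
    intro i ω
    refine ⟨?_, fun _ => trivial⟩
    induction i with
    | zero => simp [hZ]
    | succ i ih =>
      have e : Z (i + 1) ω = Z i ω + χ i ω * (Ph ε (S (i + 1) ω) - Ph ε (S i ω)) := Finset.sum_range_succ _ _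
      rw [e]
      by_cases hq : Q i ω ≤ K
      · rw [hmem i ω hq]; simp only [hχ, hq, if_true]
        linarith [Ph_nonneg hε (S (i + 1) ω)]
      · simp only [hχ, hq, if_false]; linarith
  have hrs : ∀ i ≤ n, ∀ ω, ∑ j ∈ Finset.range i, χ j ω * r j ω ≤ K + 1 / ε * mx ω ∧
      (Q i ω ≤ K → ∑ j ∈ Finset.range i, χ j ω * r j ω ≤ K) := by
    intro i hi ω
    induction i with
    | zero =>
      have := hm0 ω
      simp only [Finset.range_zero, Finset.sum_empty]
      exact ⟨by positivity, fun _ => hK⟩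
    | succ i ih =>
      have ih := ih (by omega)
      rw [Finset.sum_range_succ]
      have hle : r i ω ≤ 1 / ε * mx ω := (rm_le_glob hε _ _).trans
        (mul_le_mul_of_nonneg_left (hm ω i (by omega)) (by positivity))
      refine ⟨?_, fun hq => ?_⟩
      · by_cases hq : Q i ω ≤ K
        · have := ih.2 hq
          simp only [hχ, hq, if_true] at this ⊢; linarith
        · have := ih.1
          simp only [hχ, hq, if_false] at this ⊢; linarith
      · have : ∑ j ∈ Finset.range (i + 1), χ j ω * r j ω ≤ Q (i + 1) ω := by
          refine Finset.sum_le_sum fun j _ => ?_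
          have := hr0 j ω
          simp only [hχ]; split_ifs <;> linarith
        rw [Finset.sum_range_succ] at this
        linarith
  have hZb : Bdd m (Z n) := Bdd.sum _ fun j _ => ((hχb j).mono (h.le _)).mul
    ((((hSb (j + 1)).compc (Ph_cont hε)).mono (h.le _)).sub (((hSb j).compc (Ph_cont hε)).mono (h.le _)))
  have hdec : ∀ ω, Z n ω = ∑ j ∈ Finset.range n, χ j ω * r j ω +
      ∑ j ∈ Finset.range n, (χ j ω * Real.arsinh (S j ω / ε)) * d j ω := by
    intro ω
    rw [← Finset.sum_add_distrib]
    refine Finset.sum_congr rfl fun j _ => ?_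
    simp only [hr, rm, hS1]; ring
  have b1 : Bdd m (fun ω => ∑ j ∈ Finset.range n, χ j ω * r j ω) :=
    Bdd.sum _ fun j _ => ((hχb j).mono (h.le _)).mul ((hrb j).mono (h.le _))
  have bc : ∀ j, Bdd (Fn j) (fun ω => χ j ω * Real.arsinh (S j ω / ε)) := fun j =>
    (hχb j).mul ((hSb j).compc (psi_cont hε))
  have b2 : ∀ j, Bdd m (fun ω => (χ j ω * Real.arsinh (S j ω / ε)) * d j ω) := fun j =>
    ((bc j).mono (h.le _)).mul (h.bddm j)
  have hIntg : ∫ ω, Z n ω ∂μ ≤ K + 1 / ε * ∫ ω, mx ω ∂μ := by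
    have e1 : ∫ ω, Z n ω ∂μ = ∫ ω, ∑ j ∈ Finset.range n, χ j ω * r j ω ∂μ := by
      rw [integral_congr_ae (ae_of_all _ hdec), integral_add b1.integrable (Bdd.sum _ fun j _ => b2 j).integrable,
        integral_finsetSum _ fun j _ => (b2 j).integrable]
      rw [Finset.sum_eq_zero fun j _ => h.orth j _ (bc j), add_zero]
    rw [e1]
    calc _ ≤ ∫ ω, (K + 1 / ε * mx ω) ∂μ := integral_mono b1.integrable
            (((Bdd.const K).add ((Bdd.const (1 / ε)).mul hmx)).integrable) fun ω => (hrs n le_rfl ω).1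
      _ = _ := by
        rw [integral_add (integrable_const _) (((Bdd.const (1 / ε)).mul hmx).integrable), integral_const_mul]
        simp
  have hfin : pr μ G (fun ω => l < Z n ω) ≤ (K + 1 / ε * ∫ ω, mx ω ∂μ) / l :=
    (pr_le_integral hZb.integrable (fun ω => (hZ0 n ω).1) hl).trans (by gcongr)
  refine (pr_or fun ω hω hh => ?_).trans (add_le_add le_rfl hfin)
  by_cases hq : Q n ω ≤ K
  · right; rw [hmem n ω hq]; exact hh
  · left; exact not_le.1 hq

end

section
variable {μ : Measure Ω} [IsProbabilityMeasure μ] {F : Filtration ℝ m} {B T R V c C y : ℝ}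
  {M N A I Y I' Y' : ℝ → Ω → ℝ} {G : Set Ω} {f g : ℝ → ℝ}

lemma pr_or5 {p q r s t u : Ω → Prop} (h : ∀ ω ∈ G, p ω → q ω ∨ r ω ∨ s ω ∨ t ω ∨ u ω) :
    pr μ G p ≤ pr μ G q + pr μ G r + pr μ G s + pr μ G t + pr μ G u := by
  have h1 := pr_or (μ := μ) (G := G) (p := p) (q := q) (r := fun ω => r ω ∨ s ω ∨ t ω ∨ u ω) h
  have h2 := pr_or4 (μ := μ) (G := G) (p := fun ω => r ω ∨ s ω ∨ t ω ∨ u ω) (q := r) (r := s) (s := t) (t := u)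
    (fun _ _ h => h)
  linarith

set_option maxHeartbeats 1600000 in
lemma core1 (b : Base μ F B T G M N R V c f g C A) (s : Sol μ F T G M N R f A y I Y)
    (s' : Sol μ F T G M N R f A y I' Y') {x η : ℝ} (hx : 0 < x) (hη : 0 < η) :
    pr μ G (fun ω => 2 * x < |Y T ω - Y' T ω|) ≤ 8 * η := by
  have hT := b.hT
  have hC0 := b.hC0
  have hc := b.hc
  obtain ⟨Λ, hΛ, hocc⟩ := occ (s.sem b (s.ap b)) (s'.sem b (s'.ap b)) b.hM b.hN b.ho hT.le b.hR hη
  set K : ℝ := 48 * C ^ 2 * c * Λ + 1 with hK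
  have hK0 : 0 < K := by positivity
  obtain ⟨ε, hε, hPh⟩ := Ph_lower hx (K := (K + 1) / (x * η)) (by positivity)
  obtain ⟨wb, htf, wc, w0, wC, -, w2⟩ := tf_exists b.hg b.hgC hε
  set ε' := min η (ε / (16 * C)) with hε'
  have hε'0 : 0 < ε' := by positivity
  have hwt := b.cd.weighted b.hM b.hN hT.le hc (w := fun t ω => wb (Y t ω) (Y' t ω))
    (fun ω => wc.comp ((s.adp.cont ω).prodMk (s'.adp.cont ω)))
    (fun t ht => (wc.measurable.comp ((s.adp.meas t ht).prodMk (s'.adp.meas t ht))).mono (F.le t) le_rfl)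
    (W := 2 * C) (fun t ω => w0 _ _) (fun t ω => wC _ _) hε'0
  obtain ⟨ρ1, hρ1, mx, hmxb, hmx0, hmxi, hmx⟩ := b.hM.osc hT.le (ε := ε / (2 * C) ^ 2) (by positivity)
  obtain ⟨ρ2, hρ2, E, -, hEμ, hE⟩ := b.hM.toAdp.mod (μ := μ) hT.le (show 0 < ε / (4 * C) by positivity) hη
  set u := min η (min (ε / 4) (x / 2)) with hu
  have hu0 : 0 < u := by positivity
  have hu1 : u ≤ η := min_le_left _ _
  have hu2 : u ≤ ε / 4 := (min_le_right _ _).trans (min_le_left _ _)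
  have hu3 : u ≤ x / 2 := (min_le_right _ _).trans (min_le_right _ _)
  obtain ⟨n, h1, h2, h3, h4, h5⟩ := ((s.unif b hu0).and ((s'.unif b hu0).and
    ((hocc (3 * ε * C) (by positivity) _ _ wb htf).and (hwt.and
      (mesh_small T (show 0 < min ρ1 ρ2 by positivity)))))).exists
  have h51 := h5.trans (min_le_left _ _)
  have h52 := h5.trans (min_le_right _ _)
  set cc : ℕ → Ω → ℝ := fun j ω => f (Y (pt T n j) ω) - f (Y' (pt T n j) ω) with hcc
  have hcC : ∀ j ω, |cc j ω| ≤ 2 * C := fun j ω =>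
    (abs_sub _ _).trans (by linarith [b.hfC (Y (pt T n j) ω), b.hfC (Y' (pt T n j) ω)])
  have hccb : ∀ j, Bdd (F (pt T n j)) (cc j) := fun j =>
    ⟨(b.hf.comp (s.adp.meas _ (pt_nonneg hT.le _ _))).sub (b.hf.comp (s'.adp.meas _ (pt_nonneg hT.le _ _))), _, hcC j⟩
  have hmd := (b.hM.md hT.le n).transform hccb
  have hstep : ∀ j, |pt T n (j + 1) - pt T n j| = T / 2 ^ n := fun j => by
    rw [pt_sub, abs_of_nonneg] <;> push_cast <;> ring_nf
    positivity
  have hph := hmd.phi_max (G := G) (2 ^ n) hε hK0.le (l := x * ((K + 1) / (x * η))) (by positivity)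
    (mx := fun ω => (2 * C) ^ 2 * mx ω) ((Bdd.const _).mul hmxb) (fun ω i hi => by
      rw [mul_pow]
      refine mul_le_mul ?_ ?_ (sq_nonneg _) (by positivity)
      · rw [← sq_abs]; exact pow_le_pow_left₀ (abs_nonneg _) (hcC i ω) 2
      · exact hmx ω _ (pt_mem hT.le hi) _ (pt_mem hT.le hi.le) ((hstep i).trans_le h51))
    (fun ω => mul_nonneg (by positivity) (hmx0 ω))
  have hl : (K + 1 / ε * ∫ ω, (2 * C) ^ 2 * mx ω ∂μ) / (x * ((K + 1) / (x * η))) ≤ η := by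
    have e1 : x * ((K + 1) / (x * η)) = (K + 1) / η := by field_simp
    rw [e1, integral_const_mul, div_le_iff₀ (by positivity), mul_div_cancel₀ _ hη.ne']
    have : 1 / ε * ((2 * C) ^ 2 * ∫ ω, mx ω ∂μ) ≤ 1 / ε * ((2 * C) ^ 2 * (ε / (2 * C) ^ 2)) := by gcongr
    have e2 : 1 / ε * ((2 * C) ^ 2 * (ε / (2 * C) ^ 2)) = 1 := by field_simp
    linarith
  have hSg : ∀ i ω, ∑ j ∈ Finset.range i, cc j ω * dX M T n j ω = Sg f Y M T n i ω - Sg f Y' M T n i ω := by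
    intro i ω
    unfold Sg
    rw [← Finset.sum_sub_distrib]
    exact Finset.sum_congr rfl fun j _ => by simp only [hcc]; ring
  have hclose : ∀ ω ∈ G, (∀ i ≤ 2 ^ n, |Sg f Y M T n i ω - I (pt T n i) ω| ≤ u) →
      (∀ i ≤ 2 ^ n, |Sg f Y' M T n i ω - I' (pt T n i) ω| ≤ u) → ∀ i ≤ 2 ^ n,
      |∑ j ∈ Finset.range i, cc j ω * dX M T n j ω - (Y (pt T n i) ω - Y' (pt T n i) ω)| ≤ 2 * u := by
    intro ω hω g1 g2 i hi
    have g1 := g1 i hi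
    have g2 := g2 i hi
    rw [hSg, s.eq ω hω _ (pt_mem hT.le hi), s'.eq ω hω _ (pt_mem hT.le hi)]
    rw [abs_le] at g1 g2 ⊢
    constructor <;> linarith
  have hrm : pr μ G (fun ω => K < ∑ i ∈ Finset.range (2 ^ n),
      rm ε (∑ j ∈ Finset.range i, cc j ω * dX M T n j ω) (cc i ω * dX M T n i ω)) ≤ 5 * η := by
    refine (pr_or5 (q := fun ω => ω ∈ E) fun ω hω hh => ?_).trans
      ((add_le_add (add_le_add (add_le_add (add_le_add (pr_exc hEμ) (h1.trans hu1)) (h2.trans hu1)) h3)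
        (h4.trans (min_le_left _ _))).trans (by linarith))
    by_contra hcon
    push Not at hcon
    obtain ⟨g1, g2, g3, g4, g5⟩ := hcon
    have hterm : ∀ i ∈ Finset.range (2 ^ n), rm ε (∑ j ∈ Finset.range i, cc j ω * dX M T n j ω) (cc i ω * dX M T n i ω)
        ≤ 16 * C / ε * (wb (Y (pt T n i) ω) (Y' (pt T n i) ω) * dX M T n i ω ^ 2) := by
      intro i hi
      have hi := Finset.mem_range.1 hi
      have hd : |dX M T n i ω| ≤ ε / (4 * C) := hE ω g1 _ (pt_mem hT.le hi) _ (pt_mem hT.le hi.le) ((hstep i).trans_le h52)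
      have hd2 : |cc i ω * dX M T n i ω| ≤ ε / 2 := by
        rw [abs_mul]
        calc _ ≤ 2 * C * (ε / (4 * C)) := mul_le_mul (hcC i ω) hd (abs_nonneg _) (by positivity)
          _ = ε / 2 := by field_simp; norm_num
      refine (rm_le_loc hε _ _ hd2).trans ?_
      have hcl := hclose ω hω g2 g3 i hi.le
      set Dh := ∑ j ∈ Finset.range i, cc j ω * dX M T n j ω with hDh
      set D := Y (pt T n i) ω - Y' (pt T n i) ω with hD
      have hDD : (|D| + ε) / 2 ≤ |Dh| + ε := by
        have := abs_sub_abs_le_abs_sub D Dh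
        rw [abs_sub_comm D Dh] at this
        linarith [abs_nonneg D]
      have hpos : 0 < |D| + ε := by positivity
      have hw := w2 (Y (pt T n i) ω) (Y' (pt T n i) ω)
      have hc2 : cc i ω ^ 2 ≤ 2 * C * (wb (Y (pt T n i) ω) (Y' (pt T n i) ω) * (|D| + ε) / ε) := by
        rw [← sq_abs, sq]
        refine mul_le_mul (hcC i ω) ?_ (abs_nonneg _) (by positivity)
        rw [le_div_iff₀ hε, mul_comm]
        exact (mul_le_mul_of_nonneg_left (b.hfg _ _) hε.le).trans hw
      rw [mul_pow, ← mul_assoc, ← mul_assoc]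
      refine mul_le_mul_of_nonneg_right ?_ (sq_nonneg _)
      calc 4 / (|Dh| + ε) * cc i ω ^ 2 ≤ 4 / ((|D| + ε) / 2) * (2 * C * (wb (Y (pt T n i) ω) (Y' (pt T n i) ω) * (|D| + ε) / ε)) := by
            gcongr
        _ = _ := by field_simp; ring
    have hs := Finset.sum_le_sum hterm
    rw [← Finset.mul_sum] at hs
    have q3 := mul_le_mul_of_nonneg_left g4 hc
    have q4 : ∑ i ∈ Finset.range (2 ^ n), wb (Y (pt T n i) ω) (Y' (pt T n i) ω) * dX M T n i ω ^ 2 ≤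
        c * (3 * ε * C * Λ) + ε / (16 * C) := by
      have : ε' ≤ ε / (16 * C) := min_le_right _ _
      linarith
    have q5 := mul_le_mul_of_nonneg_left q4 (show 0 ≤ 16 * C / ε by positivity)
    have q6 : 16 * C / ε * (c * (3 * ε * C * Λ) + ε / (16 * C)) = K := by
      rw [hK]; field_simp; ring
    linarith
  have hPhT := hph.trans (add_le_add hrm hl)
  refine (pr_or3 fun ω hω hh => ?_).trans
    ((add_le_add (add_le_add (h1.trans hu1) (h2.trans hu1)) hPhT).trans (by linarith))
  by_contra hcon
  push Not at hcon
  obtain ⟨g1, g2, g3⟩ := hcon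
  have hcl := hclose ω hω g1 g2 (2 ^ n) le_rfl
  rw [pt_top] at hcl
  have : x < |∑ j ∈ Finset.range (2 ^ n), cc j ω * dX M T n j ω| := by
    have := abs_sub_abs_le_abs_sub (Y T ω - Y' T ω) (∑ j ∈ Finset.range (2 ^ n), cc j ω * dX M T n j ω)
    rw [abs_sub_comm (Y T ω - Y' T ω)] at this
    linarith
  exact absurd (hPh _ this) (not_lt.2 g3)

lemma core (b : Base μ F B T G M N R V c f g C A) (s : Sol μ F T G M N R f A y I Y)
    (s' : Sol μ F T G M N R f A y I' Y') : μ {ω | ω ∈ G ∧ Y T ω ≠ Y' T ω} = 0 := by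
  have h0 : ∀ x > 0, μ {ω | ω ∈ G ∧ 2 * x < |Y T ω - Y' T ω|} = 0 := by
    intro x hx
    have : pr μ G (fun ω => 2 * x < |Y T ω - Y' T ω|) ≤ 0 := by
      refine le_of_forall_pos_le_add fun η hη => ?_
      have := core1 b s s' hx (show 0 < η / 8 by positivity)
      linarith
    have := le_antisymm this (pr_nonneg _)
    exact (measureReal_eq_zero_iff (measure_ne_top _ _)).1 this
  have h1 : {ω | ω ∈ G ∧ Y T ω ≠ Y' T ω} ⊆ ⋃ k : ℕ, {ω | ω ∈ G ∧ 2 * (1 / ((k : ℝ) + 1)) < |Y T ω - Y' T ω|} := by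
    rintro ω ⟨h, h'⟩
    have hp : 0 < |Y T ω - Y' T ω| / 2 := by
      have := abs_pos.2 (sub_ne_zero.2 h'); positivity
    obtain ⟨k, hk⟩ := exists_nat_one_div_lt hp
    exact mem_iUnion.2 ⟨k, h, by linarith⟩
  refine measure_mono_null h1 (measure_iUnion_null fun k => h0 _ (by positivity))

end

/-- augmented filtration (null sets inside the ambient σ-algebra) -/
def aug (μ : Measure Ω) (F : Filtration ℝ m) : Filtration ℝ m where
  seq t := eventuallyMeasurableSpace (F t) (ae μ) ⊓ m
  mono' := by
    intro s t h
    refine inf_le_inf_right _ ?_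
    rintro A ⟨A', hA', e⟩
    exact ⟨A', F.mono h _ hA', e⟩
  le' t := inf_le_right

section
variable {μ : Measure Ω} [IsProbabilityMeasure μ] {F : Filtration ℝ m}

lemma aug_set {t : ℝ} {A : Set Ω} :
    MeasurableSet[aug μ F t] A ↔ (∃ A', MeasurableSet[F t] A' ∧ A =ᵐ[μ] A') ∧ MeasurableSet A :=
  MeasurableSpace.measurableSet_inf

lemma le_aug (t : ℝ) : F t ≤ aug μ F t := fun A hA =>
  aug_set.2 ⟨⟨A, hA, ae_eq_refl A⟩, F.le t _ hA⟩

lemma aug_meas {t : ℝ} {X X' : Ω → ℝ} (hX : Measurable[F t] X) (hX' : Measurable X')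
    (h : X' =ᵐ[μ] X) : Measurable[aug μ F t] X' := by
  intro s hs
  refine aug_set.2 ⟨⟨X ⁻¹' s, hX hs, ?_⟩, hX' hs⟩
  filter_upwards [h] with ω hω
  apply propext
  show X' ω ∈ s ↔ X ω ∈ s
  rw [hω]

lemma aug_mart {X X' : ℝ → Ω → ℝ} (hX : Martingale X F μ) (hm : ∀ t, Measurable (X' t))
    (h : ∀ t, X' t =ᵐ[μ] X t) : Martingale X' (aug μ F) μ := by
  have had : ∀ t, Measurable[aug μ F t] (X' t) := fun t =>
    aug_meas (hX.1 t).measurable (hm t) (h t)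
  refine ⟨fun t => (had t).stronglyMeasurable, fun s t hst => ?_⟩
  have hi : ∀ t, Integrable (X' t) μ := fun t => (hX.integrable t).congr (h t).symm
  symm
  refine ae_eq_condExp_of_forall_setIntegral_eq ((aug μ F).le s) (hi t)
    (fun _ _ _ => (hi s).integrableOn) ?_ (had s).stronglyMeasurable.aestronglyMeasurable
  intro A hA _
  obtain ⟨⟨A', hA', e⟩, _⟩ := aug_set.1 hA
  rw [setIntegral_congr_set e, setIntegral_congr_set e,
    integral_congr_ae (ae_restrict_of_ae (h s)), integral_congr_ae (ae_restrict_of_ae (h t))]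
  exact hX.setIntegral_eq hst hA'

lemma mart_orth {X : ℝ → Ω → ℝ} (hX : Martingale X F μ) {s t : ℝ} (hst : s ≤ t) {Z : Ω → ℝ}
    (hZ : Bdd (F s) Z) : ∫ ω, Z ω * (X t ω - X s ω) ∂μ = 0 := by
  obtain ⟨hZm, C, hC⟩ := hZ
  have hi : Integrable (X t - X s) μ := (hX.integrable t).sub (hX.integrable s)
  have h1 := condExp_stronglyMeasurable_mul_of_bound (μ := μ) (F.le s) hZm.stronglyMeasurable hi C
    (Eventually.of_forall hC)
  have h2 : μ[X t - X s | F s] =ᵐ[μ] 0 := by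
    have h3 := condExp_sub (hX.integrable t) (hX.integrable s) (F s)
    filter_upwards [h3, hX.2 s t hst, hX.2 s s le_rfl] with ω a b c
    rw [a, Pi.sub_apply, b, c]; simp
  have h4 : ∫ ω, (Z * (X t - X s)) ω ∂μ = 0 := by
    rw [← integral_condExp (F.le s)]
    rw [integral_congr_ae h1]
    rw [integral_congr_ae (g := fun _ => (0 : ℝ))]
    · simp
    · filter_upwards [h2] with ω hω
      rw [Pi.mul_apply, hω]; simp
  exact h4

/-- grid on `[s,t]` -/
def gr (s t : ℝ) (n i : ℕ) : ℝ := s + (t - s) * i / 2 ^ n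

lemma gr_mono {s t : ℝ} (h : s ≤ t) (n : ℕ) : Monotone (gr s t n) := by
  intro i j hij
  unfold gr
  have : 0 ≤ t - s := by linarith
  gcongr

lemma gr_zero {s t : ℝ} (n : ℕ) : gr s t n 0 = s := by simp [gr]
lemma gr_top {s t : ℝ} (n : ℕ) : gr s t n (2 ^ n) = t := by simp [gr]
lemma gr_ge {s t : ℝ} (h : s ≤ t) (n i : ℕ) : s ≤ gr s t n i := by
  exact (gr_zero (s := s) (t := t) n).symm.trans_le (gr_mono h n (Nat.zero_le _))
lemma gr_le {s t : ℝ} (h : s ≤ t) {n i : ℕ} (hi : i ≤ 2 ^ n) : gr s t n i ≤ t := by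
  exact (gr_mono h n hi).trans_eq (gr_top n)
lemma gr_succ {s t : ℝ} (n i : ℕ) : gr s t n (i + 1) = gr s t n i + (t - s) / 2 ^ n := by
  unfold gr; push_cast; ring

open Classical in
/-- index of stopping -/
lemma stop_index (u : ℕ → ℝ) (hu : Monotone u) (σ : ℝ) (K : ℕ) :
    ∃ j ≤ K, (∀ x : ℝ → ℝ, ∑ i ∈ Finset.range K, (if u i < σ then 1 else 0) * (x (u (i + 1)) - x (u i))
      = x (u j) - x (u 0)) ∧ (∀ i < j, u i < σ) ∧ (j < K → σ ≤ u j) := by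
  induction K with
  | zero => exact ⟨0, le_rfl, by simp, by simp, by simp⟩
  | succ K ih =>
    obtain ⟨j, hj, h1, h2, h3⟩ := ih
    by_cases hK : u K < σ
    · have hjK : j = K := by
        by_contra hne
        have := h3 (lt_of_le_of_ne hj hne)
        linarith [hu hj]
      subst hjK
      refine ⟨j + 1, le_rfl, fun x => ?_, fun i hi => ?_, by simp⟩
      · rw [Finset.sum_range_succ, h1, if_pos hK]; ring
      · exact (hu (Nat.lt_succ_iff.1 hi)).trans_lt hK
    · refine ⟨j, by omega, fun x => ?_, h2, fun _ => ?_⟩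
      · rw [Finset.sum_range_succ, h1, if_neg hK]; ring
      · rcases Nat.lt_or_ge j K with h | h
        · exact h3 h
        · have : j = K := by omega
          subst this; linarith

open Classical in
/-- discretized stopping -/
def dst (σ : Ω → ℝ) (s t : ℝ) (n : ℕ) (ω : Ω) : ℝ :=
  s + ∑ i ∈ Finset.range (2 ^ n), (if gr s t n i < σ ω then 1 else 0) * (gr s t n (i + 1) - gr s t n i)

open Classical in
lemma dst_spec (σ : Ω → ℝ) {s t : ℝ} (hst : s ≤ t) (n : ℕ) (ω : Ω) :
    ∃ j ≤ 2 ^ n, dst σ s t n ω = gr s t n j ∧ (∀ x : ℝ → ℝ,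
      ∑ i ∈ Finset.range (2 ^ n), (if gr s t n i < σ ω then 1 else 0) *
        (x (gr s t n (i + 1)) - x (gr s t n i)) = x (dst σ s t n ω) - x s) ∧
      (∀ i < j, gr s t n i < σ ω) ∧ (j < 2 ^ n → σ ω ≤ gr s t n j) := by
  obtain ⟨j, hj, h1, h2, h3⟩ := stop_index (gr s t n) (gr_mono hst n) (σ ω) (2 ^ n)
  have e : dst σ s t n ω = gr s t n j := by
    unfold dst
    have := h1 id
    simp only [id] at this
    rw [this, gr_zero]; ring
  refine ⟨j, hj, e, fun x => ?_, h2, h3⟩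
  rw [h1 x, e, gr_zero]

lemma dst_close (σ : Ω → ℝ) {s t : ℝ} (hst : s ≤ t) (n : ℕ) (ω : Ω) :
    |dst σ s t n ω - max (min t (σ ω)) s| ≤ (t - s) / 2 ^ n := by
  obtain ⟨j, hj, e, -, h2, h3⟩ := dst_spec σ hst n ω
  rw [e]
  have hp : 0 ≤ (t - s) / 2 ^ n := by have : 0 ≤ t - s := by linarith
                                      positivity
  have hs := gr_ge hst n j
  have ht := gr_le hst hj
  have hA : gr s t n j ≤ max (min t (σ ω)) s + (t - s) / 2 ^ n := by
    rcases Nat.eq_zero_or_pos j with rfl | hj0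
    · rw [gr_zero]; linarith [le_max_right (min t (σ ω)) s]
    · obtain ⟨i, rfl⟩ : ∃ i, j = i + 1 := ⟨j - 1, by omega⟩
      have := h2 i (by omega)
      have h5 := gr_le hst (n := n) (i := i) (by omega)
      rw [gr_succ]
      have : gr s t n i ≤ min t (σ ω) := le_min h5 this.le
      linarith [le_max_left (min t (σ ω)) s]
  have hB : max (min t (σ ω)) s ≤ gr s t n j := by
    refine max_le ?_ hs
    rcases Nat.lt_or_ge j (2 ^ n) with h | h
    · exact (min_le_right _ _).trans (h3 h)
    · have : j = 2 ^ n := by omega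
      subst this
      rw [gr_top]; exact min_le_left _ _
  rw [abs_le]; constructor <;> linarith

lemma dst_tendsto (σ : Ω → ℝ) {s t : ℝ} (hst : s ≤ t) (ω : Ω) :
    Tendsto (fun n => dst σ s t n ω) atTop (nhds (max (min t (σ ω)) s)) := by
  rw [tendsto_iff_dist_tendsto_zero]
  refine squeeze_zero (fun n => dist_nonneg) (fun n => dst_close σ hst n ω) ?_
  have : Tendsto (fun n : ℕ => (t - s) * (1 / 2 : ℝ) ^ n) atTop (nhds ((t - s) * 0)) :=
    (tendsto_pow_atTop_nhds_zero_of_lt_one (by norm_num) (by norm_num)).const_mul _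
  rw [mul_zero] at this
  refine this.congr fun n => ?_
  rw [div_pow, one_pow]; ring

/-- adaptedness of stopped continuous processes -/
lemma stop_meas {X : ℝ → Ω → ℝ} {σ : Ω → ℝ} (hc : ∀ ω, Continuous fun t => X t ω)
    (hX : ∀ t, 0 ≤ t → Measurable[F t] (X t)) (hσ : ∀ u, 0 ≤ u → MeasurableSet[F u] {ω | u < σ ω})
    {t : ℝ} (ht : 0 ≤ t) : Measurable[F t] (fun ω => X (max (min t (σ ω)) 0) ω) := by
  classical
  have h1 : ∀ n, Measurable[F t] (fun ω => X (dst σ 0 t n ω) ω) := by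
    intro n
    have e : (fun ω => X (dst σ 0 t n ω) ω) = fun ω => X 0 ω + ∑ i ∈ Finset.range (2 ^ n),
        (if gr 0 t n i < σ ω then 1 else 0) * (X (gr 0 t n (i + 1)) ω - X (gr 0 t n i) ω) := by
      ext ω
      obtain ⟨j, hj, e, h, -⟩ := dst_spec σ ht n ω
      have := h (fun u => X u ω)
      beta_reduce at this
      rw [this]; ring
    rw [e]
    have hm : ∀ i ≤ 2 ^ n, Measurable[F t] (X (gr 0 t n i)) := fun i hi =>
      (hX _ (gr_ge ht n i)).mono (F.mono (gr_le ht hi)) le_rfl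
    refine Measurable.add ((hX 0 le_rfl).mono (F.mono ht) le_rfl) ?_
    refine Finset.measurable_sum _ fun i hi => ?_
    have hi := Finset.mem_range.1 hi
    refine Measurable.mul ?_ ((hm _ (by omega)).sub (hm _ hi.le))
    exact Measurable.ite (F.mono (gr_le ht hi.le) _ (hσ _ (gr_ge ht n i)))
      measurable_const measurable_const
  refine @measurable_of_tendsto_metrizable Ω ℝ (F t) _ _ _ _ _ _ h1 ?_
  rw [tendsto_pi_nhds]
  intro ω
  exact ((hc ω).tendsto _).comp (dst_tendsto σ ht ω)

end

section
variable {μ : Measure Ω} [IsProbabilityMeasure μ] {F : Filtration ℝ m}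

lemma dst_stopd {σ : Ω → ℝ} (hσ : ∀ u, 0 ≤ u → MeasurableSet[F u] {ω | u < σ ω}) {s t : ℝ}
    (hs : 0 ≤ s) (hst : s ≤ t) (n : ℕ) :
    IsStoppingTime F (fun ω => (dst σ s t n ω : WithTop ℝ)) := by
  classical
  intro r
  show MeasurableSet[F r] {ω | (dst σ s t n ω : WithTop ℝ) ≤ (r : WithTop ℝ)}
  simp only [WithTop.coe_le_coe]
  rcases lt_or_ge r s with hr | hr
  · have : {ω | dst σ s t n ω ≤ r} = ∅ := by
      ext ω
      simp only [mem_ofPred_eq, mem_empty_iff_false, iff_false, not_le]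
      obtain ⟨j, hj, e, -⟩ := dst_spec σ hst n ω
      rw [e]; exact hr.trans_le (gr_ge hst n j)
    rw [this]; exact @MeasurableSet.empty _ (F r)
  · have : {ω | dst σ s t n ω ≤ r} = ⋂ i ∈ Finset.range (2 ^ n),
        {ω | gr s t n i ≤ r ∧ r < gr s t n (i + 1) → σ ω ≤ gr s t n i} := by
      ext ω
      simp only [mem_ofPred_eq, mem_iInter, Finset.mem_range]
      obtain ⟨j, hj, e, -, h2, h3⟩ := dst_spec σ hst n ω
      rw [e]
      constructor
      · intro h i hi hri
        have hji : j ≤ i := by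
          by_contra hc
          have := gr_mono hst n (show i + 1 ≤ j by omega)
          linarith [hri.2]
        exact (h3 (by omega)).trans (gr_mono hst n hji)
      · intro h
        by_contra hc
        push Not at hc
        have hex : ∃ i, r < gr s t n i := ⟨j, hc⟩
        have hf := Nat.find_spec hex
        have hne : Nat.find hex ≠ 0 := by
          intro h0; rw [h0, gr_zero] at hf; linarith
        obtain ⟨i, hi⟩ := Nat.exists_eq_succ_of_ne_zero hne
        have h6 : Nat.find hex ≤ j := Nat.find_le hc
        have h5 : ¬ r < gr s t n i := Nat.find_min hex (by omega)
        rw [hi] at hf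
        have := h i (by omega) ⟨not_lt.1 h5, hf⟩
        linarith [h2 i (by omega)]
    rw [this]
    refine Finset.measurableSet_biInter _ fun i _ => ?_
    by_cases hp : gr s t n i ≤ r ∧ r < gr s t n (i + 1)
    · simp only [hp, and_self, true_implies]
      have h0 : 0 ≤ gr s t n i := hs.trans (gr_ge hst n i)
      have := (hσ _ h0).compl
      have e : {ω | σ ω ≤ gr s t n i} = {ω | gr s t n i < σ ω}ᶜ := by
        ext ω; simp
      rw [e]
      exact F.mono hp.1 _ this
    · simp [hp]

lemma stop_lim {X : ℝ → Ω → ℝ} (hX : Martingale X F μ) (hc : ∀ ω, Continuous fun t => X t ω)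
    {σ : Ω → ℝ} (hσ : ∀ u, 0 ≤ u → MeasurableSet[F u] {ω | u < σ ω}) {s t : ℝ}
    (hs : 0 ≤ s) (hst : s ≤ t) (hi : Integrable (fun ω => X (max (min t (σ ω)) s) ω) μ) :
    (∀ n, Integrable (fun ω => X (dst σ s t n ω) ω) μ) ∧
    Tendsto (fun n => eLpNorm ((fun ω => X (dst σ s t n ω) ω) -
      fun ω => X (max (min t (σ ω)) s) ω) 1 μ) atTop (nhds 0) := by
  have hle : ∀ n ω, (dst σ s t n ω : WithTop ℝ) ≤ (t : WithTop ℝ) := by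
    intro n ω
    obtain ⟨j, hj, e, -⟩ := dst_spec σ hst n ω
    rw [e]; exact_mod_cast gr_le hst hj
  have hst' := fun n => dst_stopd (F := F) hσ hs hst n
  have hrange : ∀ n, (Set.range fun ω => (dst σ s t n ω : WithTop ℝ)).Countable := by
    intro n
    refine ((Set.finite_Iic (2 ^ n)).image
      (fun j => ((gr s t n j : ℝ) : WithTop ℝ))).countable.mono ?_
    rintro _ ⟨ω, rfl⟩
    obtain ⟨j, hj, e, -⟩ := dst_spec σ hst n ω
    exact ⟨j, hj, by simp [e]⟩
  have hce : ∀ n, (fun ω => X (dst σ s t n ω) ω) =ᵐ[μ] μ[X t | (hst' n).measurableSpace] := by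
    intro n
    have := hX.stoppedValue_ae_eq_condExp_of_le_const_of_countable_range (hst' n) (hle n) (hrange n)
    exact this
  have hui := (hX.integrable t).uniformIntegrable_condExp (μ := μ)
    (ℱ := fun n => (hst' n).measurableSpace)
    (fun n => (hst' n).measurableSpace_le_of_le (hle n))
  have hIntg : ∀ n, Integrable (fun ω => X (dst σ s t n ω) ω) μ := fun n =>
    integrable_condExp.congr (hce n).symm
  refine ⟨hIntg, ?_⟩
  have hui' : UnifIntegrable (fun n ω => X (dst σ s t n ω) ω) 1 μ :=
    hui.unifIntegrable.ae_eq (fun n => (hce n).symm)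
  refine tendsto_Lp_finite_of_tendsto_ae le_rfl ENNReal.one_ne_top (fun n => (hIntg n).1)
    (memLp_one_iff_integrable.2 hi) hui' ?_
  exact Eventually.of_forall fun ω => ((hc ω).tendsto _).comp (dst_tendsto σ hst ω)

/-- optional stopping -/
lemma stop_mart {X : ℝ → Ω → ℝ} (hX : Martingale X F μ) (hc : ∀ ω, Continuous fun t => X t ω)
    {σ : Ω → ℝ} (hσ : ∀ u, 0 ≤ u → MeasurableSet[F u] {ω | u < σ ω}) {s t : ℝ}
    (hs : 0 ≤ s) (hst : s ≤ t) {Z : Ω → ℝ} (hZ : Bdd (F s) Z)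
    (hi : Integrable (fun ω => X (max (min t (σ ω)) s) ω) μ) :
    ∫ ω, Z ω * (X (max (min t (σ ω)) s) ω - X s ω) ∂μ = 0 := by
  classical
  obtain ⟨hIntg, hlim⟩ := stop_lim hX hc hσ hs hst hi
  have hZm : Bdd m Z := hZ.mono (F.le s)
  obtain ⟨C, hC⟩ := hZ.2
  have h0 : ∀ n, ∫ ω, Z ω * (X (dst σ s t n ω) ω - X s ω) ∂μ = 0 := by
    intro n
    have e : (fun ω => Z ω * (X (dst σ s t n ω) ω - X s ω)) = fun ω =>
        ∑ i ∈ Finset.range (2 ^ n), (Z ω * (if gr s t n i < σ ω then 1 else 0)) *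
          (X (gr s t n (i + 1)) ω - X (gr s t n i) ω) := by
      ext ω
      obtain ⟨j, hj, e, h, -⟩ := dst_spec σ hst n ω
      have := h (fun u => X u ω)
      beta_reduce at this
      rw [← this, Finset.mul_sum]
      exact Finset.sum_congr rfl fun i _ => by ring
    have hb : ∀ i, Bdd (F (gr s t n i)) (fun ω => Z ω * (if gr s t n i < σ ω then 1 else 0)) :=
      fun i => (hZ.mono (F.mono (gr_ge hst n i))).mul
        (Bdd.ind (hσ _ (hs.trans (gr_ge hst n i))))
    rw [e, integral_finsetSum]
    · refine Finset.sum_eq_zero fun i _ => ?_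
      exact mart_orth hX (gr_mono hst n (Nat.le_succ i)) (hb i)
    · intro i _
      obtain ⟨C', hC'⟩ := (hb i).2
      exact ((hX.integrable _).sub (hX.integrable _)).bdd_mul
        ((hb i).1.mono (F.le _) le_rfl).aestronglyMeasurable (Eventually.of_forall hC')
  have h1 : Tendsto (fun n => ∫ ω, Z ω * (X (dst σ s t n ω) ω - X s ω) ∂μ) atTop
      (nhds (∫ ω, Z ω * (X (max (min t (σ ω)) s) ω - X s ω) ∂μ)) := by
    have hbm : ∀ {g : Ω → ℝ}, Integrable g μ → Integrable (fun ω => Z ω * g ω) μ := fun hg =>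
      hg.bdd_mul hZm.1.aestronglyMeasurable (Eventually.of_forall hC)
    have hXs := hX.integrable s
    refine tendsto_integral_of_L1 _ (hbm (hi.sub hXs)).1
      (Eventually.of_forall fun n => hbm ((hIntg n).sub hXs)) ?_
    have h2 : ∀ n, ∫⁻ ω, ‖Z ω * (X (dst σ s t n ω) ω - X s ω) -
        Z ω * (X (max (min t (σ ω)) s) ω - X s ω)‖ₑ ∂μ ≤ ENNReal.ofReal C *
        eLpNorm ((fun ω => X (dst σ s t n ω) ω) - fun ω => X (max (min t (σ ω)) s) ω) 1 μ := by
      intro n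
      rw [eLpNorm_one_eq_lintegral_enorm, ← lintegral_const_mul' _ _ ENNReal.ofReal_ne_top]
      refine lintegral_mono fun ω => ?_
      rw [show Z ω * (X (dst σ s t n ω) ω - X s ω) - Z ω * (X (max (min t (σ ω)) s) ω - X s ω)
        = Z ω * (X (dst σ s t n ω) ω - X (max (min t (σ ω)) s) ω) by ring, enorm_mul]
      refine mul_le_mul' ?_ le_rfl
      rw [← ofReal_norm_eq_enorm]
      exact ENNReal.ofReal_le_ofReal (hC ω)
    have h3 := ENNReal.Tendsto.const_mul (a := ENNReal.ofReal C) hlim (Or.inr ENNReal.ofReal_ne_top)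
    rw [mul_zero] at h3
    exact tendsto_of_tendsto_of_tendsto_of_le_of_le tendsto_const_nhds h3 (fun _ => zero_le) h2
  simp only [h0] at h1
  exact tendsto_nhds_unique h1 tendsto_const_nhds

end

/-- stopped process -/
def stp (X : ℝ → Ω → ℝ) (σ : Ω → ℝ) (t : ℝ) (ω : Ω) : ℝ := X (max (min t (σ ω)) 0) ω

lemma stp_of_le {X : ℝ → Ω → ℝ} {σ : Ω → ℝ} {t : ℝ} {ω : Ω} (ht : 0 ≤ t) (h : t ≤ σ ω) :
    stp X σ t ω = X t ω := by
  unfold stp; rw [min_eq_left h, max_eq_left ht]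

lemma stp_of_ge {X : ℝ → Ω → ℝ} {σ : Ω → ℝ} {t : ℝ} {ω : Ω} (ht : 0 ≤ σ ω) (h : σ ω ≤ t) :
    stp X σ t ω = X (σ ω) ω := by
  unfold stp; rw [min_eq_right h, max_eq_left ht]

section
variable {μ : Measure Ω} [IsProbabilityMeasure μ] {F : Filtration ℝ m}

lemma drv_of {M : ℝ → Ω → ℝ} (hM : Adp F M) (h0 : ∀ ω, M 0 ω = 0) {τ σ : Ω → ℝ}
    (hX : Martingale (fun t ω => M (min t (τ ω)) ω) F μ) (hσ0 : ∀ ω, 0 ≤ σ ω)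
    (hστ : ∀ ω, σ ω ≤ max (τ ω) 0) (hσ : ∀ u, 0 ≤ u → MeasurableSet[F u] {ω | u < σ ω})
    {B : ℝ} (hB : ∀ r ω, 0 ≤ r → r ≤ σ ω → |M r ω| ≤ B) : Drv μ F B (stp M σ) := by
  have hmeas : ∀ t, 0 ≤ t → Measurable[F t] (stp M σ t) := fun t ht =>
    stop_meas hM.cont hM.meas hσ ht
  have hbd : ∀ t, 0 ≤ t → ∀ ω, |stp M σ t ω| ≤ B := by
    intro t ht ω
    refine hB _ ω (le_max_right _ _) ?_
    exact max_le (min_le_right _ _) (hσ0 ω)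
  refine ⟨⟨fun ω => ?_, hmeas⟩, hbd, fun ω => ?_, ?_⟩
  · exact (hM.cont ω).comp (by fun_prop)
  · unfold stp; rw [min_eq_left (hσ0 ω), max_self, h0]
  · intro s t hs hst Z hZ
    have e : ∀ ω, M (min (max (min t (σ ω)) s) (τ ω)) ω - M (min s (τ ω)) ω =
        stp M σ t ω - stp M σ s ω := by
      intro ω
      rcases lt_or_ge (τ ω) 0 with hτ | hτ
      · have h1 : σ ω = 0 := by
          have := hστ ω
          rw [max_eq_right hτ.le] at this
          exact le_antisymm this (hσ0 ω)
        rw [stp_of_ge (hσ0 ω) (by rw [h1]; linarith), stp_of_ge (hσ0 ω) (by rw [h1]; linarith)]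
        rw [min_eq_right (by linarith : τ ω ≤ s), min_eq_right]
        · simp
        · exact (hτ.le.trans hs).trans (le_max_right _ _)
      · have h1 : σ ω ≤ τ ω := by
          have := hστ ω
          rwa [max_eq_left hτ] at this
        rcases le_or_gt (σ ω) s with h2 | h2
        · rw [stp_of_ge (hσ0 ω) h2, stp_of_ge (hσ0 ω) (h2.trans hst), max_eq_right]
          · simp
          · exact (min_le_right _ _).trans h2
        · rw [stp_of_le hs h2.le, max_eq_left (le_min hst h2.le),
            min_eq_left (h2.le.trans h1), min_eq_left ((min_le_right _ _).trans h1)]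
          unfold stp
          rw [max_eq_left (le_min (hs.trans hst) (hσ0 ω))]
    have hcX : ∀ ω, Continuous fun t => M (min t (τ ω)) ω := fun ω =>
      (hM.cont ω).comp (by fun_prop)
    have hd : Bdd m (fun ω => stp M σ t ω - stp M σ s ω) :=
      Bdd.sub ⟨(hmeas t (hs.trans hst)).mono (F.le _) le_rfl, B, hbd t (hs.trans hst)⟩
        ⟨(hmeas s hs).mono (F.le _) le_rfl, B, hbd s hs⟩
    have hi : Integrable (fun ω => M (min (max (min t (σ ω)) s) (τ ω)) ω) μ := by
      have : (fun ω => M (min (max (min t (σ ω)) s) (τ ω)) ω) = fun ω =>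
          M (min s (τ ω)) ω + (stp M σ t ω - stp M σ s ω) := by
        ext ω; rw [← e ω]; ring
      rw [this]
      exact (hX.integrable s).add hd.integrable
    have := stop_mart hX hcX hσ hs hst hZ hi
    simp only [e] at this
    exact this

/-- first exit from `(-B,B)` of either of two processes, capped at `T` -/
def hit (M N : ℝ → Ω → ℝ) (T B : ℝ) (ω : Ω) : ℝ :=
  sSup {u | u ∈ Icc 0 T ∧ ∀ r ∈ Icc 0 u, |M r ω| < B ∧ |N r ω| < B}

section hitsec
variable {M N : ℝ → Ω → ℝ} {T B : ℝ}

lemma hit_bdd (ω : Ω) :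
    BddAbove {u | u ∈ Icc 0 T ∧ ∀ r ∈ Icc 0 u, |M r ω| < B ∧ |N r ω| < B} :=
  ⟨T, fun _ h => h.1.2⟩

lemma hit_zero_mem (hT : 0 ≤ T) (hB : 0 < B) {ω : Ω} (hM : M 0 ω = 0) (hN : N 0 ω = 0) :
    (0:ℝ) ∈ {u | u ∈ Icc 0 T ∧ ∀ r ∈ Icc 0 u, |M r ω| < B ∧ |N r ω| < B} := by
  refine ⟨⟨le_rfl, hT⟩, fun r hr => ?_⟩
  have : r = 0 := le_antisymm hr.2 hr.1
  rw [this, hM, hN]; simp [hB]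

lemma hit_nonneg (hT : 0 ≤ T) (hB : 0 < B) {ω : Ω} (hM : M 0 ω = 0) (hN : N 0 ω = 0) :
    0 ≤ hit M N T B ω := le_csSup (hit_bdd ω) (hit_zero_mem hT hB hM hN)

lemma hit_le (hT : 0 ≤ T) (hB : 0 < B) {ω : Ω} (hM : M 0 ω = 0) (hN : N 0 ω = 0) :
    hit M N T B ω ≤ T := csSup_le ⟨0, hit_zero_mem hT hB hM hN⟩ fun _ h => h.1.2

lemma hit_eq (hT : 0 ≤ T) (hB : 0 < B) {ω : Ω} (hM : M 0 ω = 0) (hN : N 0 ω = 0)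
    (h : ∀ r ∈ Icc 0 T, |M r ω| < B ∧ |N r ω| < B) : hit M N T B ω = T :=
  le_antisymm (hit_le hT hB hM hN) (le_csSup (hit_bdd ω) ⟨⟨hT, le_rfl⟩, h⟩)

lemma lt_hit (hT : 0 ≤ T) (hB : 0 < B) {ω : Ω} (hM : M 0 ω = 0) (hN : N 0 ω = 0)
    (cM : Continuous fun t => M t ω) (cN : Continuous fun t => N t ω) {u : ℝ} (hu : 0 ≤ u) :
    u < hit M N T B ω ↔ u < T ∧ ∀ r ∈ Icc 0 u, |M r ω| < B ∧ |N r ω| < B := by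
  constructor
  · intro h
    obtain ⟨v, ⟨hv, hv'⟩, huv⟩ := exists_lt_of_lt_csSup ⟨0, hit_zero_mem hT hB hM hN⟩ h
    exact ⟨huv.trans_le hv.2, fun r hr => hv' r ⟨hr.1, hr.2.trans huv.le⟩⟩
  · rintro ⟨h1, h2⟩
    have ho : IsOpen {r | |M r ω| < B ∧ |N r ω| < B} :=
      (isOpen_lt cM.abs continuous_const).inter (isOpen_lt cN.abs continuous_const)
    obtain ⟨ε, hε, hb⟩ := Metric.isOpen_iff.1 ho u (h2 u ⟨hu, le_rfl⟩)
    set v := min (u + ε / 2) T with hv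
    have huv : u < v := lt_min (by linarith) h1
    refine huv.trans_le (le_csSup (hit_bdd ω) ⟨⟨hu.trans huv.le, min_le_right _ _⟩, ?_⟩)
    intro r hr
    rcases le_or_gt r u with h | h
    · exact h2 r ⟨hr.1, h⟩
    · apply hb
      rw [Metric.mem_ball, Real.dist_eq, abs_of_pos (by linarith)]
      have := hr.2.trans (min_le_left (u + ε / 2) T)
      linarith

lemma hit_bound (hT : 0 ≤ T) (hB : 0 < B) {ω : Ω} (hM : M 0 ω = 0) (hN : N 0 ω = 0)
    (cM : Continuous fun t => M t ω) (cN : Continuous fun t => N t ω) {r : ℝ} (hr : 0 ≤ r)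
    (h : r ≤ hit M N T B ω) : |M r ω| ≤ B ∧ |N r ω| ≤ B := by
  rcases hr.eq_or_lt with rfl | hr0
  · rw [hM, hN]; simp [hB.le]
  have hcl : IsClosed {r | |M r ω| ≤ B ∧ |N r ω| ≤ B} :=
    (isClosed_le cM.abs continuous_const).inter (isClosed_le cN.abs continuous_const)
  have h1 : Icc (0:ℝ) r ⊆ {r | |M r ω| ≤ B ∧ |N r ω| ≤ B} := by
    rw [← closure_Ico hr0.ne]
    refine hcl.closure_subset_iff.2 fun u hu => ?_
    have := ((lt_hit hT hB hM hN cM cN hu.1).1 (hu.2.trans_le h)).2 u ⟨hu.1, le_rfl⟩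
    exact ⟨this.1.le, this.2.le⟩
  exact h1 ⟨hr, le_rfl⟩

lemma sup_meas {X : ℝ → Ω → ℝ} (hX : Adp F X) {u : ℝ} (hu : 0 ≤ u) (B : ℝ) :
    MeasurableSet[F u] {ω | ∀ r ∈ Icc 0 u, |X r ω| ≤ B} := by
  haveI : Nonempty (Icc (0:ℝ) u) := ⟨⟨0, le_rfl, hu⟩⟩
  let q : ℕ → Icc (0:ℝ) u := TopologicalSpace.denseSeq _
  have hq : DenseRange q := TopologicalSpace.denseRange_denseSeq _
  have : {ω | ∀ r ∈ Icc 0 u, |X r ω| ≤ B} = ⋂ i, {ω | |X (q i) ω| ≤ B} := by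
    ext ω
    simp only [mem_ofPred_eq, mem_iInter]
    constructor
    · exact fun h i => h _ (q i).2
    · intro h r hr
      have hcl : IsClosed {r : Icc (0:ℝ) u | |X r ω| ≤ B} :=
        isClosed_le (((hX.cont ω).comp continuous_subtype_val).abs) continuous_const
      have h2 : closure (range q) ⊆ {r : Icc (0:ℝ) u | |X r ω| ≤ B} :=
        hcl.closure_subset_iff.2 (by rintro _ ⟨i, rfl⟩; exact h i)
      exact h2 (hq ⟨r, hr⟩)
  rw [this]
  refine MeasurableSet.iInter fun i => ?_
  have h1 : Measurable[F u] (X (q i)) := (hX.meas _ (q i).2.1).mono (F.mono (q i).2.2) le_rfl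
  have h2 : {ω | |X (q i) ω| ≤ B} = X (q i) ⁻¹' (Icc (-B) B) := by
    ext ω; simp [abs_le]
  rw [h2]; exact h1 measurableSet_Icc

lemma sup_meas_lt {X : ℝ → Ω → ℝ} (hX : Adp F X) {u : ℝ} (hu : 0 ≤ u) (B : ℝ) :
    MeasurableSet[F u] {ω | ∀ r ∈ Icc 0 u, |X r ω| < B} := by
  have : {ω | ∀ r ∈ Icc 0 u, |X r ω| < B} =
      ⋃ k : ℕ, {ω | ∀ r ∈ Icc 0 u, |X r ω| ≤ B - 1 / ((k : ℝ) + 1)} := by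
    ext ω
    simp only [mem_ofPred_eq, mem_iUnion]
    constructor
    · intro h
      obtain ⟨r, hr, hmax⟩ := isCompact_Icc.exists_isMaxOn (nonempty_Icc.2 hu)
        (hX.cont ω).abs.continuousOn
      obtain ⟨k, hk⟩ := exists_nat_one_div_lt (sub_pos.2 (h r hr))
      refine ⟨k, fun r' hr' => ?_⟩
      have := hmax hr'
      simp only [mem_ofPred_eq] at this
      linarith
    · rintro ⟨k, hk⟩ r hr
      have := hk r hr
      have : (0:ℝ) < 1 / ((k : ℝ) + 1) := by positivity
      linarith
  rw [this]
  exact MeasurableSet.iUnion fun k => sup_meas hX hu _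

lemma hit_meas (hM : Adp F M) (hN : Adp F N) (hM0 : ∀ ω, M 0 ω = 0) (hN0 : ∀ ω, N 0 ω = 0)
    (hT : 0 ≤ T) (hB : 0 < B) {u : ℝ} (hu : 0 ≤ u) :
    MeasurableSet[F u] {ω | u < hit M N T B ω} := by
  have : {ω | u < hit M N T B ω} = {ω | u < T} ∩
      ({ω | ∀ r ∈ Icc 0 u, |M r ω| < B} ∩ {ω | ∀ r ∈ Icc 0 u, |N r ω| < B}) := by
    ext ω
    simp only [mem_ofPred_eq, mem_inter_iff]
    rw [lt_hit hT hB (hM0 ω) (hN0 ω) (hM.cont ω) (hN.cont ω) hu]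
    constructor
    · rintro ⟨h1, h2⟩; exact ⟨h1, fun r hr => (h2 r hr).1, fun r hr => (h2 r hr).2⟩
    · rintro ⟨h1, h2, h3⟩; exact ⟨h1, fun r hr => ⟨h2 r hr, h3 r hr⟩⟩
  rw [this]
  exact (@MeasurableSet.const _ (F u) _).inter ((sup_meas_lt hM hu B).inter (sup_meas_lt hN hu B))

end hitsec

end

/-- pair of everywhere continuous local martingales started at `0` -/
structure LM (μ : Measure Ω) (F : Filtration ℝ m) (M N : ℝ → Ω → ℝ) (τ τ' : ℕ → Ω → ℝ) : Prop where
  hM : Adp F M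
  hN : Adp F N
  M0 : ∀ ω, M 0 ω = 0
  N0 : ∀ ω, N 0 ω = 0
  st : ∀ k u, 0 ≤ u → MeasurableSet[F u] {ω | u < τ k ω}
  st' : ∀ k u, 0 ≤ u → MeasurableSet[F u] {ω | u < τ' k ω}
  lim : ∀ᵐ ω ∂μ, Tendsto (fun n => τ n ω) atTop atTop
  lim' : ∀ᵐ ω ∂μ, Tendsto (fun n => τ' n ω) atTop atTop
  mart : ∀ k, Martingale (fun t ω => M (min t (τ k ω)) ω) F μ
  mart' : ∀ k, Martingale (fun t ω => N (min t (τ' k ω)) ω) F μ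

section
variable {μ : Measure Ω} [IsProbabilityMeasure μ] {F : Filtration ℝ m}
  {M N : ℝ → Ω → ℝ} {τ τ' : ℕ → Ω → ℝ}

lemma exists_small_compl {G : ℕ → Set Ω} (hG : ∀ n, MeasurableSet (G n))
    (h : ∀ᵐ ω ∂μ, ∀ᶠ n in atTop, ω ∈ G n) {η : ℝ} (hη : 0 < η) : ∃ n, μ.real (G n)ᶜ ≤ η := by
  have := tendsto_measure_of_ae_tendsto_indicator_of_isFiniteMeasure (μ := μ) (A := ∅)
    (As := fun n => (G n)ᶜ) atTop
    MeasurableSet.empty (fun n => (hG n).compl) (by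
      filter_upwards [h] with ω hω
      filter_upwards [hω] with n hn
      simp [hn])
  rw [measure_empty] at this
  have h2 := (ENNReal.tendsto_toReal ENNReal.zero_ne_top).comp this
  obtain ⟨n, hn⟩ := (h2.eventually (gt_mem_nhds (by simpa using hη))).exists
  exact ⟨n, hn.le⟩

lemma cont_bdd_ev {x : ℝ → ℝ} (hx : Continuous x) (T : ℝ) :
    ∀ᶠ n : ℕ in atTop, ∀ r ∈ Icc 0 T, |x r| < (n : ℝ) + 1 := by
  obtain ⟨C, hC⟩ := isCompact_Icc.exists_bound_of_continuousOn (s := Icc 0 T) hx.continuousOn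
  obtain ⟨k, hk⟩ := exists_nat_ge C
  filter_upwards [eventually_ge_atTop k] with n hn r hr
  have h1 := hC r hr
  rw [Real.norm_eq_abs] at h1
  have : (k : ℝ) ≤ n := by exact_mod_cast hn
  linarith

lemma LM.loc (h : LM μ F M N τ τ') {T : ℝ} (hT : 0 < T) {η : ℝ} (hη : 0 < η) :
    ∃ (B : ℝ) (σ : Ω → ℝ) (G : Set Ω), 0 < B ∧ MeasurableSet G ∧ μ.real Gᶜ ≤ η ∧
      (∀ ω, 0 ≤ σ ω) ∧ (∀ ω, σ ω ≤ T) ∧ Drv μ F B (stp M σ) ∧ Drv μ F B (stp N σ) ∧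
      ∀ ω ∈ G, σ ω = T := by
  let G : ℕ → Set Ω := fun n => ({ω | ∀ r ∈ Icc 0 T, |M r ω| < (n : ℝ) + 1} ∩
    {ω | ∀ r ∈ Icc 0 T, |N r ω| < (n : ℝ) + 1}) ∩ ({ω | T < τ n ω} ∩ {ω | T < τ' n ω})
  have hG : ∀ n, MeasurableSet (G n) := fun n =>
    ((F.le T _ (sup_meas_lt h.hM hT.le _)).inter (F.le T _ (sup_meas_lt h.hN hT.le _))).inter
    ((F.le T _ (h.st n T hT.le)).inter (F.le T _ (h.st' n T hT.le)))
  obtain ⟨n, hn⟩ := exists_small_compl (μ := μ) hG (by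
    filter_upwards [h.lim, h.lim'] with ω h1 h2
    filter_upwards [cont_bdd_ev (h.hM.cont ω) T, cont_bdd_ev (h.hN.cont ω) T,
      h1.eventually_gt_atTop T, h2.eventually_gt_atTop T] with n a b c d
    exact ⟨⟨a, b⟩, c, d⟩) hη
  have hB : (0:ℝ) < (n : ℝ) + 1 := by positivity
  let H := hit M N T ((n : ℝ) + 1)
  let σ : Ω → ℝ := fun ω => min (H ω) (min (max (τ n ω) 0) (max (τ' n ω) 0))
  have hH0 : ∀ ω, 0 ≤ H ω := fun ω => hit_nonneg hT.le hB (h.M0 ω) (h.N0 ω)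
  have hσ0 : ∀ ω, 0 ≤ σ ω := fun ω => le_min (hH0 ω) (le_min (le_max_right _ _) (le_max_right _ _))
  have hσm : ∀ u, 0 ≤ u → MeasurableSet[F u] {ω | u < σ ω} := by
    intro u hu
    have : {ω | u < σ ω} = {ω | u < H ω} ∩ ({ω | u < τ n ω} ∩ {ω | u < τ' n ω}) := by
      ext ω
      simp only [σ, mem_ofPred_eq, mem_inter_iff, lt_min_iff, lt_max_iff, not_lt.2 hu, or_false]
    rw [this]
    exact (hit_meas h.hM h.hN h.M0 h.N0 hT.le hB hu).inter ((h.st n u hu).inter (h.st' n u hu))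
  have hb : ∀ r ω, 0 ≤ r → r ≤ σ ω → |M r ω| ≤ (n : ℝ) + 1 ∧ |N r ω| ≤ (n : ℝ) + 1 :=
    fun r ω hr hrσ => hit_bound hT.le hB (h.M0 ω) (h.N0 ω) (h.hM.cont ω) (h.hN.cont ω) hr
      (hrσ.trans (min_le_left _ _))
  refine ⟨(n : ℝ) + 1, σ, G n, hB, hG n, hn, hσ0,
    fun ω => (min_le_left _ _).trans (hit_le hT.le hB (h.M0 ω) (h.N0 ω)), ?_, ?_, ?_⟩
  · exact drv_of h.hM h.M0 (h.mart n) hσ0 (fun ω => (min_le_right _ _).trans (min_le_left _ _))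
      hσm (fun r ω a b => (hb r ω a b).1)
  · exact drv_of h.hN h.N0 (h.mart' n) hσ0 (fun ω => (min_le_right _ _).trans (min_le_right _ _))
      hσm (fun r ω a b => (hb r ω a b).2)
  · rintro ω ⟨⟨a, b⟩, c, d⟩
    have e : H ω = T := hit_eq hT.le hB (h.M0 ω) (h.N0 ω) fun r hr => ⟨a r hr, b r hr⟩
    have c : T < τ n ω := c
    have d : T < τ' n ω := d
    show min (H ω) (min (max (τ n ω) 0) (max (τ' n ω) 0)) = T
    rw [e, min_eq_left]
    exact le_min (c.le.trans (le_max_left _ _)) (d.le.trans (le_max_left _ _))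

end

/-- transform by in-block oscillation -/
def osT (X Z : ℝ → Ω → ℝ) (T : ℝ) (n b i : ℕ) (ω : Ω) : ℝ :=
  ∑ j ∈ Finset.range i, (Z (pt T n j) ω - Z (pt T n (b * (j / b))) ω) * dX X T n j ω

/-- cross variation on the grid -/
def crs (X Z : ℝ → Ω → ℝ) (T : ℝ) (n i : ℕ) (ω : Ω) : ℝ :=
  ∑ j ∈ Finset.range i, dX X T n j ω * dX Z T n j ω

lemma crs_block (X Z : ℝ → Ω → ℝ) (T : ℝ) (N b i r : ℕ) (hr : r ≤ b) (ω : Ω) :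
    crs X Z T N (i * b + r) ω - crs X Z T N (i * b) ω =
    (X (pt T N (i * b + r)) ω - X (pt T N (i * b)) ω) *
      (Z (pt T N (i * b + r)) ω - Z (pt T N (i * b)) ω) -
      (osT X Z T N b (i * b + r) ω - osT X Z T N b (i * b) ω) -
      (osT Z X T N b (i * b + r) ω - osT Z X T N b (i * b) ω) := by
  induction r with
  | zero => simp
  | succ r ih =>
    have hb : 0 < b := by omega
    have e : (i * b + r) / b = i := by
      rw [Nat.add_comm, Nat.add_mul_div_right _ _ hb, Nat.div_eq_of_lt (by omega), zero_add]
    have := ih (by omega)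
    unfold crs osT at *
    simp only [← add_assoc, Finset.sum_range_succ]
    rw [e, mul_comm b i]
    unfold dX at *
    linear_combination this

section
variable {μ : Measure Ω} [IsProbabilityMeasure μ] {F : Filtration ℝ m} {B B' : ℝ}
  {X Z : ℝ → Ω → ℝ} {T : ℝ}

lemma osT_meas (hZ : Drv μ F B' Z) (hT : 0 ≤ T) (n b j : ℕ) :
    Measurable[F (pt T n j)] (fun ω => Z (pt T n j) ω - Z (pt T n (b * (j / b))) ω) :=
  ((hZ.bdd (pt_nonneg hT n j)).sub
      ((hZ.bdd (pt_nonneg hT n _)).mono (F.mono (pt_mono hT n (Nat.mul_div_le j b))))).1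

lemma osT_bd (hZ : Drv μ F B' Z) (hT : 0 ≤ T) (n b j : ℕ) (ω : Ω) :
    |Z (pt T n j) ω - Z (pt T n (b * (j / b))) ω| ≤ 2 * B' := by
  have h1 := hZ.bd _ (pt_nonneg hT n j) ω
  have h2 := hZ.bd _ (pt_nonneg hT n (b * (j / b))) ω
  rw [abs_le] at h1 h2
  rw [abs_le]; constructor <;> linarith

lemma osT_small (h : Drv μ F B X) (hZ : Drv μ F B' Z) (hT : 0 ≤ T) {ε : ℝ} (hε : 0 < ε) :
    ∃ k₀, ∀ k ≥ k₀, ∀ᶠ l in atTop, ∀ G : Set Ω,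
      pr μ G (fun ω => ∃ i ≤ 2 ^ (k + l), ε < |osT X Z T (k + l) (2 ^ l) i ω|) ≤ ε := by
  obtain ⟨δ, hδ, hev⟩ := h.len_osc (μ := μ) hT (2 * B') (half_pos hε)
  obtain ⟨ρ, hρ, E, hE, hμ, hmod⟩ := hZ.toAdp.mod (μ := μ) hT hδ (half_pos hε)
  obtain ⟨k₀, hk₀⟩ := eventually_atTop.1 (mesh_small T hρ)
  refine ⟨k₀, fun k hk => ?_⟩
  have hmesh := hk₀ k hk
  have ha : Tendsto (fun n => k + n) atTop atTop := tendsto_atTop_mono (fun n => by simp) tendsto_id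
  filter_upwards [ha.eventually hev] with l hn G
  set n := k + l with hnn
  set b := 2 ^ l with hbb
  have hb : 0 < b := by positivity
  have hle : ∀ j, b * (j / b) ≤ j := fun j => Nat.mul_div_le j b
  have h1 := hn G (fun j ω => Z (pt T n j) ω - Z (pt T n (b * (j / b))) ω)
    (osT_meas hZ hT n b) (osT_bd hZ hT n b)
  have h2 : pr μ G (fun ω => ∃ i ≤ 2 ^ n, ε < |osT X Z T n b i ω|) ≤
    pr μ G (fun ω => ∃ i ≤ 2 ^ n, ε / 2 < |∑ j ∈ Finset.range i,
      (Z (pt T n j) ω - Z (pt T n (b * (j / b))) ω) * dX X T n j ω|) :=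
    pr_mono fun ω _ ⟨i, hi, h⟩ => ⟨i, hi, by unfold osT at h; linarith⟩
  have h3 : pr μ G (fun ω => ∃ j < 2 ^ n,
      δ < |Z (pt T n j) ω - Z (pt T n (b * (j / b))) ω|) ≤ μ.real E := by
    refine measureReal_mono ?_ (measure_ne_top _ _)
    rintro ω ⟨_, j, hj, hd⟩
    by_contra hω
    refine absurd hd (not_lt.2 (hmod ω hω _ (pt_mem hT hj.le) _
      (pt_mem hT ((hle j).trans hj.le)) ?_))
    rw [pt_sub]
    have h5 : j % b < b := Nat.mod_lt j hb
    have h4 : ((j : ℝ) - (b * (j / b) : ℕ)) ≤ b ∧ 0 ≤ ((j : ℝ) - (b * (j / b) : ℕ)) := by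
      have h6 := Nat.div_add_mod j b
      have : (j : ℝ) = (b * (j / b) : ℕ) + (j % b : ℕ) := by exact_mod_cast h6.symm
      rw [this]
      have h7 : ((j % b : ℕ) : ℝ) ≤ b := by exact_mod_cast h5.le
      constructor <;> simp only [add_sub_cancel_left]
      · exact h7
      · positivity
    rw [abs_of_nonneg (by have := h4.2; positivity)]
    refine le_trans ?_ hmesh
    rw [div_le_div_iff₀ (by positivity) (by positivity)]
    have e : (2 : ℝ) ^ n = b * 2 ^ k := by rw [hnn, hbb, pow_add]; push_cast; ring
    rw [e]
    have := mul_le_mul_of_nonneg_right (mul_le_mul_of_nonneg_left h4.1 hT)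
      (by positivity : (0 : ℝ) ≤ 2 ^ k)
    linarith
  linarith

/-- uniform smallness of the cross variation -/
lemma crs_unif (h : Drv μ F B X) (hZ : Drv μ F B' Z) (hT : 0 ≤ T) {G : Set Ω}
    (hcp : ∀ t ∈ Icc 0 T, CP μ G (fun n ω => qsum X Z t n ω) 0) {ε : ℝ} (hε : 0 < ε) :
    ∀ᶠ n in atTop, pr μ G (fun ω => ∃ i ≤ 2 ^ n, ε < |crs X Z T n i ω|) ≤ ε := by
  set e := min (ε / 8) 1 with he
  have he0 : 0 < e := by positivity
  have he1 : e ≤ ε / 8 := min_le_left _ _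
  have he2 : e ≤ 1 := min_le_right _ _
  obtain ⟨k1, hk1⟩ := osT_small h hZ hT he0
  obtain ⟨k2, hk2⟩ := osT_small hZ h hT he0
  obtain ⟨ρ, hρ, E, hE, hμ, hmod⟩ := h.toAdp.mod (μ := μ) hT he0 he0
  obtain ⟨ρ', hρ', E', hE', hμ', hmod'⟩ := hZ.toAdp.mod (μ := μ) hT he0 he0
  obtain ⟨k3, hk3⟩ := eventually_atTop.1 (mesh_small T hρ)
  obtain ⟨k4, hk4⟩ := eventually_atTop.1 (mesh_small T hρ')
  set k := max (max k1 k2) (max k3 k4) with hk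
  have hk3 := hk3 k (by omega)
  have hk4 := hk4 k (by omega)
  have hco : ∀ i ≤ 2 ^ k, CP μ G (fun l ω => crs X Z T (k + l) (i * 2 ^ l) ω) 0 := by
    intro i hi
    exact (hcp _ (pt_mem hT hi)).sub_zero (h.qsum_fine hZ hT G k i hi)
  set e' := e / (2 ^ k + 1) with he'
  have he'0 : 0 < e' := by positivity
  have he'e : e' ≤ e := div_le_self he0.le (by have : (0:ℝ) ≤ 2 ^ k := by positivity
                                               linarith)
  have hco2 : ∀ᶠ l in atTop, ∀ i ∈ Finset.range (2 ^ k + 1),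
      pr μ G (fun ω => e < |crs X Z T (k + l) (i * 2 ^ l) ω|) ≤ e' := by
    rw [Filter.eventually_all_finset]
    intro i hi
    filter_upwards [hco i (by rw [Finset.mem_range] at hi; omega) e' he'0] with l hl
    refine le_trans (pr_mono fun ω _ h => ?_) hl
    rw [Pi.zero_apply, sub_zero]; linarith
  have hmain : ∀ᶠ l in atTop,
      pr μ G (fun ω => ∃ i ≤ 2 ^ (k + l), ε < |crs X Z T (k + l) i ω|) ≤ ε := by
    filter_upwards [hco2, hk1 k (by omega), hk2 k (by omega)] with l h1 h2 h3
    have h2 := h2 G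
    have h3 := h3 G
    have h1' : pr μ G (fun ω => ∃ i ∈ Finset.range (2 ^ k + 1),
        e < |crs X Z T (k + l) (i * 2 ^ l) ω|) ≤ e := by
      refine (pr_exists _ _).trans ((Finset.sum_le_sum h1).trans ?_)
      rw [Finset.sum_const, Finset.card_range, nsmul_eq_mul, he']
      push_cast
      rw [mul_div_cancel₀ _ (by positivity)]
    have h4 : pr μ G (fun ω => ω ∈ E ∪ E') ≤ e + e := by
      refine le_trans (measureReal_mono (fun ω h => h.2) (measure_ne_top _ _)) ?_
      exact (measureReal_union_le _ _).trans (add_le_add hμ hμ')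
    refine (pr_or4 (q := _) (r := _) (s := _) (t := _) ?_).trans
      (le_trans (add_le_add (add_le_add (add_le_add h1' h2) h3) h4) (by linarith))
    rintro ω _ ⟨J, hJ, hlt⟩
    by_contra hcon
    push Not at hcon
    obtain ⟨c1, c2, c3, c4⟩ := hcon
    rw [mem_union, not_or] at c4
    set b := 2 ^ l with hb
    have hb0 : 0 < b := by positivity
    have hJe : J / b * b + J % b = J := Nat.div_add_mod' J b
    have hr : J % b ≤ b := (Nat.mod_lt J hb0).le
    have hlow : J / b * b ≤ J := Nat.div_mul_le_self J b
    have hid := crs_block X Z T (k + l) b (J / b) (J % b) hr ω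
    rw [hJe] at hid
    have hJb : J / b ≤ 2 ^ k := by
      apply Nat.div_le_of_le_mul
      rw [hb, ← pow_add, add_comm]; exact hJ
    have d1 := c1 (J / b) (Finset.mem_range.2 (by omega))
    have d2 := c2 J hJ
    have d2' := c2 _ (hlow.trans hJ)
    have d3 := c3 J hJ
    have d3' := c3 _ (hlow.trans hJ)
    have hdist : |pt T (k + l) J - pt T (k + l) (J / b * b)| ≤ T / 2 ^ k := by
      rw [pt_sub]
      have h6 : (J : ℝ) = (J / b * b : ℕ) + (J % b : ℕ) := by exact_mod_cast hJe.symm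
      have h7 : ((J % b : ℕ) : ℝ) ≤ b := by exact_mod_cast hr
      rw [h6, add_sub_cancel_left, abs_of_nonneg (by positivity),
        div_le_div_iff₀ (by positivity) (by positivity)]
      have e : (2 : ℝ) ^ (k + l) = b * 2 ^ k := by rw [hb, pow_add]; push_cast; ring
      rw [e]
      have := mul_le_mul_of_nonneg_right (mul_le_mul_of_nonneg_left h7 hT)
        (by positivity : (0 : ℝ) ≤ 2 ^ k)
      linarith
    have o1 := hmod ω c4.1 _ (pt_mem hT hJ) _ (pt_mem hT (hlow.trans hJ)) (hdist.trans hk3)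
    have o2 := hmod' ω c4.2 _ (pt_mem hT hJ) _ (pt_mem hT (hlow.trans hJ)) (hdist.trans hk4)
    have o3 : |(X (pt T (k + l) J) ω - X (pt T (k + l) (J / b * b)) ω) *
      (Z (pt T (k + l) J) ω - Z (pt T (k + l) (J / b * b)) ω)| ≤ e := by
      rw [abs_mul]
      calc _ ≤ e * 1 := mul_le_mul o1 (o2.trans he2) (abs_nonneg _) he0.le
        _ = e := mul_one e
    rw [abs_le] at d1 d2 d2' d3 d3' o3
    have : |crs X Z T (k + l) J ω| ≤ ε := by
      rw [abs_le]; constructor <;> linarith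
    linarith
  obtain ⟨l0, hl0⟩ := eventually_atTop.1 hmain
  refine eventually_atTop.2 ⟨k + l0, fun n hn => ?_⟩
  have := hl0 (n - k) (by omega)
  rwa [show k + (n - k) = n by omega] at this

end

/-- stopped cross variation, pathwise -/
lemma crs_stp (M N : ℝ → Ω → ℝ) {σ : Ω → ℝ} {T : ℝ} (hT : 0 ≤ T) (n J : ℕ) (ω : Ω)
    (h0 : 0 ≤ σ ω) :
    (pt T n J ≤ σ ω → crs (stp M σ) (stp N σ) T n J ω = crs M N T n J ω) ∧
    (σ ω < pt T n J → ∃ K < J, pt T n K ≤ σ ω ∧ σ ω ≤ pt T n (K + 1) ∧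
      crs (stp M σ) (stp N σ) T n J ω = crs M N T n K ω +
        (M (σ ω) ω - M (pt T n K) ω) * (N (σ ω) ω - N (pt T n K) ω)) := by
  induction J with
  | zero =>
    refine ⟨fun _ => by simp [crs], fun h => ?_⟩
    rw [pt_zero] at h; linarith
  | succ J ih =>
    have hmono := pt_mono hT n (Nat.le_succ J)
    have hc : ∀ X Z : ℝ → Ω → ℝ, crs X Z T n (J + 1) ω =
        crs X Z T n J ω + dX X T n J ω * dX Z T n J ω := by
      intro X Z; unfold crs; rw [Finset.sum_range_succ]
    constructor
    · intro h
      rw [hc, hc, ih.1 (hmono.trans h)]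
      unfold dX
      rw [stp_of_le (pt_nonneg hT n _) h, stp_of_le (pt_nonneg hT n _) h,
        stp_of_le (pt_nonneg hT n _) (hmono.trans h), stp_of_le (pt_nonneg hT n _) (hmono.trans h)]
    · intro h
      rcases le_or_gt (pt T n J) (σ ω) with h1 | h1
      · refine ⟨J, Nat.lt_succ_self J, h1, h.le, ?_⟩
        rw [hc, ih.1 h1]
        unfold dX
        rw [stp_of_ge h0 h.le, stp_of_ge h0 h.le,
          stp_of_le (pt_nonneg hT n _) h1, stp_of_le (pt_nonneg hT n _) h1]
      · obtain ⟨K, hK, a, b, e⟩ := ih.2 h1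
        refine ⟨K, by omega, a, b, ?_⟩
        rw [hc, e]
        unfold dX
        rw [stp_of_ge h0 h.le, stp_of_ge h0 h1.le, sub_self, zero_mul, add_zero]

section
variable {μ : Measure Ω} [IsProbabilityMeasure μ] {F : Filtration ℝ m} {B B' : ℝ}
  {X Z : ℝ → Ω → ℝ} {T : ℝ}

lemma osT_md (h : Drv μ F B X) (hZ : Drv μ F B' Z) (hT : 0 ≤ T) (n b : ℕ) :
    MD μ (fun i => F (pt T n i))
      (fun j ω => (Z (pt T n j) ω - Z (pt T n (b * (j / b))) ω) * dX X T n j ω) :=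
  (h.md hT n).transform fun j => ⟨osT_meas hZ hT n b j, _, osT_bd hZ hT n b j⟩

lemma osT_bdd (h : Drv μ F B X) (hZ : Drv μ F B' Z) (hT : 0 ≤ T) (n b i : ℕ) :
    Bdd m (osT X Z T n b i) := ((osT_md h hZ hT n b).bdd_sum i).mono (F.le _)

lemma osT_orth (h : Drv μ F B X) (hZ : Drv μ F B' Z) (hT : 0 ≤ T) (n b i r : ℕ) {W : Ω → ℝ}
    (hW : Bdd (F (pt T n i)) W) :
    ∫ ω, W ω * (osT X Z T n b (i + r) ω - osT X Z T n b i ω) ∂μ = 0 := by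
  have e : ∀ ω, W ω * (osT X Z T n b (i + r) ω - osT X Z T n b i ω) =
      ∑ j ∈ Finset.range r, W ω * ((Z (pt T n (i + j)) ω - Z (pt T n (b * ((i + j) / b))) ω)
        * dX X T n (i + j) ω) := by
    intro ω
    unfold osT
    rw [Finset.sum_range_add, add_sub_cancel_left, Finset.mul_sum]
  simp_rw [e]
  rw [integral_finsetSum]
  · refine Finset.sum_eq_zero fun j _ => ?_
    exact (osT_md h hZ hT n b).orth (i + j) W (hW.mono (F.mono (pt_mono hT n (Nat.le_add_right i j))))
  · intro j _
    exact ((hW.mono (F.le _)).mul ((osT_md h hZ hT n b).bddm (i + j))).integrable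

lemma osT_sq (h : Drv μ F B X) (hZ : Drv μ F B' Z) (hT : 0 ≤ T) (n b i : ℕ) :
    ∫ ω, osT X Z T n b i ω ^ 2 ∂μ ≤ (2 * B') ^ 2 * B ^ 2 :=
  h.iso_le hT n i (osT_meas hZ hT n b) (osT_bd hZ hT n b)

lemma crs_bdd (h : Drv μ F B X) (hZ : Drv μ F B' Z) (hT : 0 ≤ T) (n i : ℕ) :
    Bdd m (crs X Z T n i) :=
  Bdd.sum _ fun j _ => ((h.md hT n).bddm j).mul ((hZ.md hT n).bddm j)

lemma dX_bdd (h : Drv μ F B X) (hT : 0 ≤ T) (n i : ℕ) (ω : Ω) : |dX X T n i ω| ≤ 2 * B := by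
  have h1 := h.bd _ (pt_nonneg hT n i) ω
  have h2 := h.bd _ (pt_nonneg hT n (i + 1)) ω
  rw [abs_le] at h1 h2
  unfold dX
  rw [abs_le]; constructor <;> linarith

lemma cell_id (k l i : ℕ) (ω : Ω) : 
    crs X Z T (k + l) ((i + 1) * 2 ^ l) ω - crs X Z T (k + l) (i * 2 ^ l) ω =
    dX X T k i ω * dX Z T k i ω -
      (osT X Z T (k + l) (2 ^ l) (i * 2 ^ l + 2 ^ l) ω - osT X Z T (k + l) (2 ^ l) (i * 2 ^ l) ω) -
      (osT Z X T (k + l) (2 ^ l) (i * 2 ^ l + 2 ^ l) ω - osT Z X T (k + l) (2 ^ l) (i * 2 ^ l) ω) := by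
  have := crs_block X Z T (k + l) (2 ^ l) i (2 ^ l) le_rfl ω
  rw [← Nat.succ_mul, pt_add, pt_add] at this
  rw [← Nat.succ_mul]
  exact this

lemma cell_int (h : Drv μ F B X) (hZ : Drv μ F B' Z) (hT : 0 ≤ T) (k l i : ℕ) {W : Ω → ℝ}
    (hW : Bdd (F (pt T k i)) W) :
    ∫ ω, W ω * (crs X Z T (k + l) ((i + 1) * 2 ^ l) ω - crs X Z T (k + l) (i * 2 ^ l) ω) ∂μ =
    ∫ ω, W ω * (dX X T k i ω * dX Z T k i ω) ∂μ := by
  have hW' : Bdd (F (pt T (k + l) (i * 2 ^ l))) W := by rw [pt_add]; exact hW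
  have hWm : Bdd m W := hW.mono (F.le _)
  have o1 := osT_orth h hZ hT (k + l) (2 ^ l) (i * 2 ^ l) (2 ^ l) hW'
  have o2 := osT_orth hZ h hT (k + l) (2 ^ l) (i * 2 ^ l) (2 ^ l) hW'
  simp_rw [cell_id, mul_sub (W _)]
  simp_rw [mul_sub (W _)] at o1 o2
  have b0 := (hWm.mul (((h.md hT k).bddm i).mul ((hZ.md hT k).bddm i))).integrable (μ := μ)
  have b1 := fun j => (hWm.mul (osT_bdd h hZ hT (k + l) (2 ^ l) j)).integrable (μ := μ)
  have b2 := fun j => (hWm.mul (osT_bdd hZ h hT (k + l) (2 ^ l) j)).integrable (μ := μ)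
  have b3 := (b1 (i * 2 ^ l + 2 ^ l)).sub (b1 (i * 2 ^ l))
  have b4 := (b2 (i * 2 ^ l + 2 ^ l)).sub (b2 (i * 2 ^ l))
  have e1 := integral_sub (b0.sub b3) b4
  have e2 := integral_sub b0 b3
  simp only [Pi.sub_apply] at e1 e2
  rw [e1, e2, o1, o2, sub_zero, sub_zero]

lemma cell_sq (h : Drv μ F B X) (hZ : Drv μ F B Z) (hT : 0 ≤ T) (k l i : ℕ) :
    ∫ ω, (crs X Z T (k + l) ((i + 1) * 2 ^ l) ω - crs X Z T (k + l) (i * 2 ^ l) ω) ^ 2 ∂μ ≤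
    160 * B ^ 4 := by
  have hB := h.B_nonneg
  have s1 := fun j => osT_sq h hZ hT (k + l) (2 ^ l) j
  have s2 := fun j => osT_sq hZ h hT (k + l) (2 ^ l) j
  have i1 := fun j => (osT_bdd h hZ hT (k + l) (2 ^ l) j).sq.integrable (μ := μ)
  have i2 := fun j => (osT_bdd hZ h hT (k + l) (2 ^ l) j).sq.integrable (μ := μ)
  have hp : ∀ ω, (crs X Z T (k + l) ((i + 1) * 2 ^ l) ω - crs X Z T (k + l) (i * 2 ^ l) ω) ^ 2 ≤
      5 * (16 * B ^ 4 + (osT X Z T (k + l) (2 ^ l) (i * 2 ^ l + 2 ^ l) ω ^ 2 +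
        osT X Z T (k + l) (2 ^ l) (i * 2 ^ l) ω ^ 2 +
        (osT Z X T (k + l) (2 ^ l) (i * 2 ^ l + 2 ^ l) ω ^ 2 +
        osT Z X T (k + l) (2 ^ l) (i * 2 ^ l) ω ^ 2))) := by
    intro ω
    rw [cell_id]
    have h1 : |dX X T k i ω * dX Z T k i ω| ≤ 4 * B ^ 2 := by
      rw [abs_mul]
      calc _ ≤ (2 * B) * (2 * B) := mul_le_mul (dX_bdd h hT k i ω) (dX_bdd hZ hT k i ω)
            (abs_nonneg _) (by positivity)
        _ = 4 * B ^ 2 := by ring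
    have h2 : (dX X T k i ω * dX Z T k i ω) ^ 2 ≤ 16 * B ^ 4 := by
      rw [← sq_abs]
      calc _ ≤ (4 * B ^ 2) ^ 2 := pow_le_pow_left₀ (abs_nonneg _) h1 2
        _ = 16 * B ^ 4 := by ring
    generalize dX X T k i ω * dX Z T k i ω = a at *
    generalize osT X Z T (k + l) (2 ^ l) (i * 2 ^ l + 2 ^ l) ω = b
    generalize osT X Z T (k + l) (2 ^ l) (i * 2 ^ l) ω = c
    generalize osT Z X T (k + l) (2 ^ l) (i * 2 ^ l + 2 ^ l) ω = d
    generalize osT Z X T (k + l) (2 ^ l) (i * 2 ^ l) ω = e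
    nlinarith [sq_nonneg (a + b), sq_nonneg (a - c), sq_nonneg (a + d), sq_nonneg (a - e),
      sq_nonneg (b + c), sq_nonneg (b - d), sq_nonneg (b + e), sq_nonneg (c + d), sq_nonneg (c - e),
      sq_nonneg (d + e)]
  have hD := ((crs_bdd h hZ hT (k + l) ((i + 1) * 2 ^ l)).sub
    (crs_bdd h hZ hT (k + l) (i * 2 ^ l))).sq.integrable (μ := μ)
  have I1 := (i1 (i * 2 ^ l + 2 ^ l)).add (i1 (i * 2 ^ l))
  have I2 := (i2 (i * 2 ^ l + 2 ^ l)).add (i2 (i * 2 ^ l))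
  refine (integral_mono hD ((((integrable_const (16 * B ^ 4)).add (I1.add I2)).const_mul 5)) hp).trans ?_
  rw [integral_const_mul]
  have e1 := integral_add (integrable_const (μ := μ) (16 * B ^ 4)) (I1.add I2)
  have e2 := integral_add I1 I2
  have e3 := integral_add (i1 (i * 2 ^ l + 2 ^ l)) (i1 (i * 2 ^ l))
  have e4 := integral_add (i2 (i * 2 ^ l + 2 ^ l)) (i2 (i * 2 ^ l))
  simp only [Pi.add_apply] at e1 e2 ⊢
  rw [e1, e2, e3, e4, integral_const, probReal_univ, one_smul]
  have a1 := s1 (i * 2 ^ l + 2 ^ l)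
  have a2 := s1 (i * 2 ^ l)
  have a3 := s2 (i * 2 ^ l + 2 ^ l)
  have a4 := s2 (i * 2 ^ l)
  nlinarith

/-- abstract: bounded second moments and smallness in probability force a vanishing integral -/
lemma int_zero_of {W : Ω → ℝ} (hW : Bdd m W) {K a : ℝ} (hK : 0 ≤ K)
    (H : ∀ ε > 0, ∃ S : Ω → ℝ, Bdd m S ∧ ∫ ω, W ω * S ω ∂μ = a ∧ ∫ ω, S ω ^ 2 ∂μ ≤ K ∧
      μ.real {ω | ε < |S ω|} ≤ ε) : a = 0 := by
  obtain ⟨hWm, C, hC⟩ := hW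
  by_contra ha
  have ha' : 0 < |a| := abs_pos.2 ha
  have hC0 : 0 ≤ C := by
    by_contra hc
    push Not at hc
    have : ∀ ω, False := fun ω => absurd (hC ω) (not_le.2 (hc.trans_le (abs_nonneg _)))
    obtain ⟨S, -, e, -⟩ := H 1 one_pos
    have : IsEmpty Ω := ⟨this⟩
    rw [integral_of_isEmpty] at e
    exact ha e.symm
  -- for all ε λ : |a| ≤ C (ε + λ K + ε / λ)
  have key : ∀ ε > 0, ∀ r > 0, |a| ≤ C * (ε + (r * K + ε / r)) := by
    intro ε hε r hr
    obtain ⟨S, hS, e, h2, hp⟩ := H ε hε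
    set E := {ω | ε < |S ω|} with hE
    have hEm : MeasurableSet E := measurableSet_lt measurable_const hS.1.abs
    have hpt : ∀ ω, |W ω * S ω| ≤ C * (ε + (r * S ω ^ 2 + E.indicator (fun _ => 1 / r) ω)) := by
      intro ω
      rw [abs_mul]
      refine mul_le_mul (hC ω) ?_ (abs_nonneg _) hC0
      by_cases hω : ω ∈ E
      · rw [indicator_of_mem hω]
        have : 0 ≤ (r * |S ω| - 1) ^ 2 / r := by positivity
        have e2 : (r * |S ω| - 1) ^ 2 / r = r * S ω ^ 2 - 2 * |S ω| + 1 / r := by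
          rw [← sq_abs (S ω)]; field_simp; ring
        have := abs_nonneg (S ω)
        linarith
      · rw [indicator_of_notMem hω]
        have : |S ω| ≤ ε := not_lt.1 hω
        have : 0 ≤ r * S ω ^ 2 := by positivity
        linarith
    have iE : Integrable (E.indicator (fun _ => 1 / r)) μ := (integrable_const _).indicator hEm
    have i2 := (hS.sq.integrable (μ := μ)).const_mul r
    have i3 := (i2.add iE)
    have hWS : Bdd m (fun ω => W ω * S ω) := Bdd.mul ⟨hWm, C, hC⟩ hS
    calc |a| = |∫ ω, W ω * S ω ∂μ| := by rw [e]
      _ ≤ ∫ ω, |W ω * S ω| ∂μ := abs_integral_le_integral_abs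
      _ ≤ ∫ ω, C * (ε + (r * S ω ^ 2 + E.indicator (fun _ => 1 / r) ω)) ∂μ :=
          integral_mono hWS.integrable.abs (((integrable_const ε).add i3).const_mul C) hpt
      _ = C * (ε + (r * ∫ ω, S ω ^ 2 ∂μ + μ.real E * (1 / r))) := by
          rw [integral_const_mul]
          have e1 := integral_add (integrable_const (μ := μ) ε) i3
          have e2 := integral_add i2 iE
          simp only [Pi.add_apply] at e1
          rw [e1, e2, integral_const_mul, integral_indicator hEm, integral_const, integral_const,
            probReal_univ, one_smul, measureReal_restrict_apply_univ, smul_eq_mul]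
      _ ≤ C * (ε + (r * K + ε / r)) := by
          refine mul_le_mul_of_nonneg_left ?_ hC0
          have : μ.real E * (1 / r) ≤ ε * (1 / r) := mul_le_mul_of_nonneg_right hp (by positivity)
          have : r * ∫ ω, S ω ^ 2 ∂μ ≤ r * K := mul_le_mul_of_nonneg_left h2 hr.le
          rw [div_eq_mul_one_div ε r]
          linarith
  -- take ε = r^2
  have lim : Tendsto (fun r : ℝ => C * (r ^ 2 + (r * K + r))) (nhdsWithin 0 (Ioi 0)) (nhds 0) := by
    have : Continuous (fun r : ℝ => C * (r ^ 2 + (r * K + r))) := by fun_prop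
    have := this.tendsto 0
    simp only [ne_eq, OfNat.ofNat_ne_zero, not_false_eq_true, zero_pow, zero_mul, add_zero,
      mul_zero] at this
    exact this.mono_left nhdsWithin_le_nhds
  have := ge_of_tendsto lim (b := |a|) (by
    filter_upwards [self_mem_nhdsWithin] with r hr
    have hr : 0 < r := hr
    have := key (r ^ 2) (by positivity) r hr
    rwa [show r ^ 2 / r = r by field_simp] at this)
  linarith

end

lemma crs_congr {M N M' N' : ℝ → Ω → ℝ} {T : ℝ} (hT : 0 ≤ T) {n J : ℕ} (hJ : J ≤ 2 ^ n) {ω : Ω}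
    (h : ∀ t ∈ Icc 0 T, M t ω = M' t ω) (h' : ∀ t ∈ Icc 0 T, N t ω = N' t ω) :
    crs M N T n J ω = crs M' N' T n J ω := by
  unfold crs
  refine Finset.sum_congr rfl fun j hj => ?_
  rw [Finset.mem_range] at hj
  unfold dX
  have a := pt_mem hT (show j ≤ 2 ^ n by omega)
  have b := pt_mem hT (show j + 1 ≤ 2 ^ n by omega)
  rw [h _ a, h _ b, h' _ a, h' _ b]

lemma grid_mem {t T : ℝ} (ht : t ∈ Icc 0 T) {n j : ℕ} (hj : j ≤ 2 ^ n) :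
    t * (j : ℝ) / 2 ^ n ∈ Icc 0 T := by
  have := pt_mem ht.1 hj
  unfold pt at this
  exact ⟨this.1, this.2.trans ht.2⟩

lemma qsum_congr {M N M' N' : ℝ → Ω → ℝ} {T t : ℝ} (ht : t ∈ Icc 0 T) (n : ℕ) {ω : Ω}
    (h : ∀ t ∈ Icc 0 T, M t ω = M' t ω) (h' : ∀ t ∈ Icc 0 T, N t ω = N' t ω) :
    qsum M N t n ω = qsum M' N' t n ω := by
  unfold qsum
  refine Finset.sum_congr rfl fun j hj => ?_
  rw [Finset.mem_range] at hj
  have a := grid_mem ht (show j ≤ 2 ^ n by omega)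
  have b := grid_mem ht (show j + 1 ≤ 2 ^ n by omega)
  push_cast at b
  rw [h _ a, h _ b, h' _ a, h' _ b]

section
variable {μ : Measure Ω} [IsProbabilityMeasure μ] {F : Filtration ℝ m}
  {M N : ℝ → Ω → ℝ} {τ τ' : ℕ → Ω → ℝ}

set_option maxHeartbeats 1600000 in
lemma LM.orth (h : LM μ F M N τ τ') {T : ℝ} (hT : 0 < T)
    (hq : ∀ t ∈ Icc 0 T, CP μ univ (fun n ω => qsum M N t n ω) 0) {B : ℝ} {σ : Ω → ℝ}
    (hσ0 : ∀ ω, 0 ≤ σ ω) (hσT : ∀ ω, σ ω ≤ T) (hdM : Drv μ F B (stp M σ))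
    (hdN : Drv μ F B (stp N σ)) : Orth μ F T (stp M σ) (stp N σ) := by
  refine Eventually.of_forall fun k i W hW => ?_
  rcases le_or_gt (2 ^ k) i with hi | hi
  · have hz : ∀ ω, dX (stp M σ) T k i ω = 0 := by
      intro ω
      have h1 : σ ω ≤ pt T k i := by
        refine (hσT ω).trans ?_
        exact (pt_top (T := T) k).symm.le.trans (pt_mono hT.le k hi)
      unfold dX
      rw [stp_of_ge (hσ0 ω) h1, stp_of_ge (hσ0 ω) (h1.trans (pt_mono hT.le k (Nat.le_succ i))),
        sub_self]
    simp [hz]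
  refine int_zero_of (μ := μ) (hW.mono (F.le _)) (K := 160 * B ^ 4) (by positivity) fun ε hε => ?_
  obtain ⟨B', σ', G', hB', hG', hμG, hσ'0, hσ'T, dM, dN, hσG⟩ := h.loc hT (show 0 < ε / 4 by positivity)
  have eM : ∀ ω ∈ G', ∀ t ∈ Icc 0 T, M t ω = stp M σ' t ω := fun ω hω t ht =>
    (stp_of_le ht.1 (by rw [hσG ω hω]; exact ht.2)).symm
  have eN : ∀ ω ∈ G', ∀ t ∈ Icc 0 T, N t ω = stp N σ' t ω := fun ω hω t ht =>
    (stp_of_le ht.1 (by rw [hσG ω hω]; exact ht.2)).symm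
  have hcp : ∀ t ∈ Icc 0 T, CP μ G' (fun n ω => qsum (stp M σ') (stp N σ') t n ω) 0 := by
    intro t ht δ hδ
    filter_upwards [hq t ht δ hδ] with n hn
    refine le_trans (pr_le_of_subset fun ω hω hp => ⟨mem_univ _, ?_⟩) hn
    rw [qsum_congr ht n (eM ω hω) (eN ω hω)]
    exact hp
  set e := min (ε / 8) 1 with he
  have he0 : 0 < e := by positivity
  have he1 : e ≤ ε / 8 := min_le_left _ _
  have he2 : e ≤ 1 := min_le_right _ _
  have hu := crs_unif dM dN hT.le hcp he0
  obtain ⟨ρ, hρ, E, hE, hμ, hmod⟩ := dM.toAdp.mod (μ := μ) hT.le he0 he0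
  obtain ⟨ρ', hρ', E', hE', hμ', hmod'⟩ := dN.toAdp.mod (μ := μ) hT.le he0 he0
  have ha : Tendsto (fun n => k + n) atTop atTop := tendsto_atTop_mono (fun n => by simp) tendsto_id
  obtain ⟨l, hl1, hl2, hl3⟩ := ((ha.eventually hu).and ((ha.eventually (mesh_small T hρ)).and
    (ha.eventually (mesh_small T hρ')))).exists
  refine ⟨fun ω => crs (stp M σ) (stp N σ) T (k + l) ((i + 1) * 2 ^ l) ω -
    crs (stp M σ) (stp N σ) T (k + l) (i * 2 ^ l) ω,
    (crs_bdd hdM hdN hT.le _ _).sub (crs_bdd hdM hdN hT.le _ _),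
    cell_int hdM hdN hT.le k l i hW, cell_sq hdM hdN hT.le k l i, ?_⟩
  have hsub : {ω | ε < |crs (stp M σ) (stp N σ) T (k + l) ((i + 1) * 2 ^ l) ω -
      crs (stp M σ) (stp N σ) T (k + l) (i * 2 ^ l) ω|} ⊆
      (G'ᶜ ∪ {ω | ω ∈ G' ∧ ∃ i ≤ 2 ^ (k + l), e < |crs (stp M σ') (stp N σ') T (k + l) i ω|}) ∪
        (E ∪ E') := by
    intro ω hω
    by_contra hcon
    simp only [mem_union, mem_compl_iff, mem_ofPred_eq, not_or, not_not, not_and, not_exists,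
      not_lt] at hcon
    obtain ⟨⟨c1, c2⟩, c3, c4⟩ := hcon
    have c2 := c2 c1
    have hb : ∀ J ≤ 2 ^ (k + l), |crs (stp M σ) (stp N σ) T (k + l) J ω| ≤ 2 * e := by
      intro J hJ
      have hs := crs_stp M N hT.le (k + l) J ω (hσ0 ω)
      rcases le_or_gt (pt T (k + l) J) (σ ω) with h1 | h1
      · rw [hs.1 h1, crs_congr hT.le hJ (eM ω c1) (eN ω c1)]
        have := c2 J hJ
        linarith
      · obtain ⟨K, hK, a, b, e1⟩ := hs.2 h1
        rw [e1, crs_congr hT.le (hK.le.trans hJ) (eM ω c1) (eN ω c1)]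
        have m1 : σ ω ∈ Icc 0 T := ⟨hσ0 ω, hσT ω⟩
        have m2 := pt_mem hT.le (hK.le.trans hJ)
        rw [eM ω c1 _ m1, eM ω c1 _ m2, eN ω c1 _ m1, eN ω c1 _ m2]
        have hd : |σ ω - pt T (k + l) K| ≤ T / 2 ^ (k + l) := by
          rw [abs_of_nonneg (by linarith)]
          have := pt_sub (T := T) (k + l) (K + 1) K
          push_cast at this
          rw [add_sub_cancel_left, mul_one] at this
          linarith
        have o1 := hmod ω c3 _ m1 _ m2 (hd.trans hl2)
        have o2 := hmod' ω c4 _ m1 _ m2 (hd.trans hl3)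
        have := c2 K (hK.le.trans hJ)
        refine (abs_add_le _ _).trans ?_
        rw [abs_mul]
        have : |stp M σ' (σ ω) ω - stp M σ' (pt T (k + l) K) ω| *
            |stp N σ' (σ ω) ω - stp N σ' (pt T (k + l) K) ω| ≤ e * 1 :=
          mul_le_mul o1 (o2.trans he2) (abs_nonneg _) he0.le
        linarith
    have j1 : (i + 1) * 2 ^ l ≤ 2 ^ (k + l) := by
      rw [pow_add]; exact Nat.mul_le_mul_right _ hi
    have j2 : i * 2 ^ l ≤ 2 ^ (k + l) := by
      rw [pow_add]; exact Nat.mul_le_mul_right _ hi.le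
    have b1 := hb _ j1
    have b2 := hb _ j2
    have hω : ε < |crs (stp M σ) (stp N σ) T (k + l) ((i + 1) * 2 ^ l) ω -
      crs (stp M σ) (stp N σ) T (k + l) (i * 2 ^ l) ω| := hω
    have := abs_sub (crs (stp M σ) (stp N σ) T (k + l) ((i + 1) * 2 ^ l) ω)
      (crs (stp M σ) (stp N σ) T (k + l) (i * 2 ^ l) ω)
    linarith
  refine (measureReal_mono hsub (measure_ne_top _ _)).trans ?_
  refine (measureReal_union_le _ _).trans ?_
  have q1 := measureReal_union_le (μ := μ) G'ᶜ
    {ω | ω ∈ G' ∧ ∃ i ≤ 2 ^ (k + l), e < |crs (stp M σ') (stp N σ') T (k + l) i ω|}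
  have q2 := measureReal_union_le (μ := μ) E E'
  have q3 : μ.real {ω | ω ∈ G' ∧ ∃ i ≤ 2 ^ (k + l),
    e < |crs (stp M σ') (stp N σ') T (k + l) i ω|} ≤ e := hl1
  linarith

end

lemma sum_abs_grid (x : ℕ → ℝ) (k : ℕ → ℕ) (hk : Monotone k) (n K : ℕ) (hK : k n ≤ K) :
    ∑ i ∈ Finset.range n, |x (k (i + 1)) - x (k i)| ≤ ∑ j ∈ Finset.range K, |x (j + 1) - x j| := by
  have h1 : ∀ a b, a ≤ b → |x b - x a| ≤
      ∑ j ∈ Finset.range b, |x (j + 1) - x j| - ∑ j ∈ Finset.range a, |x (j + 1) - x j| := by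
    intro a b hab
    induction b, hab using Nat.le_induction with
    | base => simp
    | succ b hab ih =>
      rw [Finset.sum_range_succ]
      have := abs_sub_le (x (b + 1)) (x b) (x a)
      linarith
  have h2 : ∀ n, ∑ i ∈ Finset.range n, |x (k (i + 1)) - x (k i)| ≤
      ∑ j ∈ Finset.range (k n), |x (j + 1) - x j| := by
    intro n
    induction n with
    | zero => simp; exact Finset.sum_nonneg fun _ _ => abs_nonneg _
    | succ n ih =>
      rw [Finset.sum_range_succ]
      have := h1 _ _ (hk (Nat.le_succ n))
      simp only [Nat.succ_eq_add_one] at this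
      linarith
  refine (h2 n).trans (Finset.sum_le_sum_of_subset_of_nonneg ?_ fun _ _ _ => abs_nonneg _)
  intro i hi
  rw [Finset.mem_range] at *
  omega

lemma var_of_grid {x : ℝ → ℝ} (hx : Continuous x) {T V : ℝ} (hT : 0 < T)
    (h : ∀ n : ℕ, ∑ j ∈ Finset.range (2 ^ n), |x (pt T n (j + 1)) - x (pt T n j)| ≤ V)
    (u : ℕ → ℝ) (hu : Monotone u) (hm : ∀ i, u i ∈ Icc 0 T) (N : ℕ) :
    ∑ i ∈ Finset.range N, |x (u (i + 1)) - x (u i)| ≤ V := by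
  let κ : ℕ → ℝ → ℕ := fun n t => ⌊t * 2 ^ n / T⌋₊
  have hκ : ∀ n, Monotone (κ n) := fun n s t hst => Nat.floor_mono (by gcongr)
  have hκT : ∀ n, ∀ t ∈ Icc 0 T, κ n t ≤ 2 ^ n := by
    intro n t ht
    have : t * 2 ^ n / T ≤ ((2 ^ n : ℕ) : ℝ) := by
      rw [div_le_iff₀ hT]; push_cast; nlinarith [ht.2, pow_pos (two_pos (α := ℝ)) n]
    calc κ n t ≤ ⌊((2 ^ n : ℕ) : ℝ)⌋₊ := Nat.floor_mono this
      _ = 2 ^ n := Nat.floor_natCast _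
  have hlim : ∀ t ∈ Icc 0 T, Tendsto (fun n => pt T n (κ n t)) atTop (nhds t) := by
    intro t ht
    rw [tendsto_iff_dist_tendsto_zero]
    have : Tendsto (fun n : ℕ => T * (1 / 2 : ℝ) ^ n) atTop (nhds (T * 0)) :=
      (tendsto_pow_atTop_nhds_zero_of_lt_one (by norm_num) (by norm_num)).const_mul T
    rw [mul_zero] at this
    refine squeeze_zero (fun n => dist_nonneg) (fun n => ?_) this
    have h0 : 0 ≤ t * 2 ^ n / T := by have := ht.1; positivity
    have a := Nat.floor_le h0
    have b := Nat.lt_floor_add_one (t * 2 ^ n / T)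
    have e : t = T * (t * 2 ^ n / T) / 2 ^ n := by field_simp
    have e2 : T * (1 / 2 : ℝ) ^ n = T * 1 / 2 ^ n := by rw [div_pow, one_pow]; ring
    rw [Real.dist_eq, abs_sub_comm]
    have e3 : t - pt T n (κ n t) = T * (t * 2 ^ n / T - κ n t) / 2 ^ n := by
      unfold pt; rw [mul_sub, sub_div, ← e]
    have a' : (0:ℝ) ≤ t * 2 ^ n / T - κ n t := by simp only [κ]; linarith
    rw [e3, e2, abs_of_nonneg (by positivity)]
    gcongr
    simp only [κ]; linarith
  have hl : Tendsto (fun n => ∑ i ∈ Finset.range N,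
      |x (pt T n (κ n (u (i + 1)))) - x (pt T n (κ n (u i)))|) atTop
      (nhds (∑ i ∈ Finset.range N, |x (u (i + 1)) - x (u i)|)) := by
    refine tendsto_finsetSum _ fun i _ => ?_
    exact (((hx.tendsto _).comp (hlim _ (hm (i + 1)))).sub
      ((hx.tendsto _).comp (hlim _ (hm i)))).abs
  refine le_of_tendsto hl (Eventually.of_forall fun n => ?_)
  exact (sum_abs_grid (fun j => x (pt T n j)) (fun i => κ n (u i))
    (fun i j hij => hκ n (hu hij)) N (2 ^ n) (hκT n _ (hm N))).trans (h n)

lemma grid_of_bv {x : ℝ → ℝ} {T : ℝ} (hT : 0 < T) (h : BoundedVariationOn x (Icc 0 T)) :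
    ∀ n : ℕ, ∑ j ∈ Finset.range (2 ^ n), |x (pt T n (j + 1)) - x (pt T n j)| ≤
      (eVariationOn x (Icc 0 T)).toReal := by
  intro n
  have h1 := eVariationOn.sum_le (f := x) (s := Icc 0 T) (n := 2 ^ n)
    (u := fun i => pt T n (min i (2 ^ n)))
    (fun i j hij => pt_mono hT.le n (min_le_min_right _ hij))
    (fun i => pt_mem hT.le (min_le_right _ _))
  have e : ∑ i ∈ Finset.range (2 ^ n), edist (x (pt T n (min (i + 1) (2 ^ n))))
      (x (pt T n (min i (2 ^ n)))) =
      ENNReal.ofReal (∑ j ∈ Finset.range (2 ^ n), |x (pt T n (j + 1)) - x (pt T n j)|) := by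
    rw [ENNReal.ofReal_sum_of_nonneg fun _ _ => abs_nonneg _]
    refine Finset.sum_congr rfl fun i hi => ?_
    have hi := Finset.mem_range.1 hi
    rw [min_eq_left hi.le, min_eq_left (Nat.succ_le_of_lt hi), edist_dist, Real.dist_eq]
  rw [e] at h1
  have h2 := ENNReal.toReal_mono h h1
  rwa [ENNReal.toReal_ofReal (Finset.sum_nonneg fun _ _ => abs_nonneg _)] at h2

/-- truncation -/
def clp (R x : ℝ) : ℝ := max (-R) (min x R)

lemma clp_mono (R : ℝ) : Monotone (clp R) := fun a b h => by
  unfold clp; exact max_le_max le_rfl (min_le_min_right _ h)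
lemma clp_cont (R : ℝ) : Continuous (clp R) := by unfold clp; fun_prop
lemma clp_eq {R x : ℝ} (h : |x| ≤ R) : clp R x = x := by
  rw [abs_le] at h; unfold clp; rw [min_eq_left h.2, max_eq_right h.1]
lemma clp_bd {R : ℝ} (hR : 0 ≤ R) (x : ℝ) : |clp R x| ≤ R := by
  rw [abs_le]; unfold clp
  exact ⟨le_max_left _ _, max_le (by linarith) (min_le_right _ _)⟩

lemma mono_clp_bd {p : ℝ → ℝ} (hp : Monotone p) {R : ℝ} (hR : 0 ≤ R) (x : ℝ) :
    |p (clp R x)| ≤ |p R| + |p (-R)| := by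
  have h := abs_le.1 (clp_bd hR x)
  have h1 := hp h.1
  have h2 := hp h.2
  have a := le_abs_self (p R)
  have b := neg_abs_le (p (-R))
  have c := abs_nonneg (p R)
  have d := abs_nonneg (p (-R))
  rw [abs_le]; constructor <;> linarith

lemma diff_le {p q : ℝ → ℝ} (hp : Monotone p) (hq : Monotone q) (x y : ℝ) :
    |(p x - q x) - (p y - q y)| ≤ |(p x + q x) - (p y + q y)| := by
  rcases le_total x y with h | h
  · have a := hp h
    have b := hq h
    rw [abs_of_nonpos (by linarith : (p x + q x) - (p y + q y) ≤ 0), abs_le]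
    constructor <;> linarith
  · have a := hp h
    have b := hq h
    rw [abs_of_nonneg (by linarith : 0 ≤ (p x + q x) - (p y + q y)), abs_le]
    constructor <;> linarith

lemma dom_ineq {ν : Measure ℝ} {Q P q : ℝ → ℝ} {c : ℝ} (hc : 0 ≤ c)
    (hν : ∀ a b : ℝ, 0 ≤ a → a ≤ b → ν (Ioc a b) = ENNReal.ofReal (Q b - Q a))
    (hq : ∀ t, q t ∈ Icc 0 c)
    (hP : ∀ t, 0 ≤ t → P t = ∫ s in Ioc (0:ℝ) t, q s ∂ν) {a b : ℝ} (ha : 0 ≤ a) (hab : a ≤ b) :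
    P b - P a ≤ c * max (Q b - Q a) 0 := by
  have hPa : 0 ≤ P a := by
    rw [hP a ha]; exact integral_nonneg fun t => (hq t).1
  have hr : 0 ≤ c * max (Q b - Q a) 0 := mul_nonneg hc (le_max_right _ _)
  by_cases hi : IntegrableOn q (Ioc 0 b) ν
  · have e : ∫ s in Ioc (0:ℝ) b, q s ∂ν = ∫ s in Ioc (0:ℝ) a, q s ∂ν + ∫ s in Ioc a b, q s ∂ν := by
      rw [← Ioc_union_Ioc_eq_Ioc ha hab]
      exact setIntegral_union (Ioc_disjoint_Ioc_of_le le_rfl) measurableSet_Ioc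
        (hi.mono_set (Ioc_subset_Ioc_right hab)) (hi.mono_set (Ioc_subset_Ioc_left ha))
    rw [hP b (ha.trans hab), hP a ha, e, add_sub_cancel_left]
    have hfin : ν (Ioc a b) < ⊤ := by rw [hν a b ha hab]; exact ENNReal.ofReal_lt_top
    have h1 := norm_setIntegral_le_of_norm_le_const (μ := ν) (f := q) (C := c) hfin
      (fun x _ => by rw [Real.norm_eq_abs, abs_of_nonneg (hq x).1]; exact (hq x).2)
    have h2 := (le_abs_self _).trans h1
    refine h2.trans_eq ?_
    rw [measureReal_def, hν a b ha hab, ENNReal.toReal_ofReal']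
  · have : P b = 0 := by rw [hP b (ha.trans hab)]; exact integral_undef hi
    linarith

section
variable {μ : Measure Ω} [IsProbabilityMeasure μ]

lemma cp_of_tim {X : ℕ → Ω → ℝ} {Y : Ω → ℝ} (h : TendstoInMeasure μ X atTop Y) (G : Set Ω) :
    CP μ G X Y := by
  intro ε hε
  have h1 := (ENNReal.tendsto_toReal ENNReal.zero_ne_top).comp (h (ENNReal.ofReal ε) (by simpa using hε))
  filter_upwards [h1.eventually (gt_mem_nhds (by simpa using hε))] with n hn
  refine le_trans (measureReal_mono ?_ (measure_ne_top _ _)) hn.le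
  rintro ω ⟨_, hω⟩
  show ENNReal.ofReal ε ≤ edist (X n ω) (Y ω)
  rw [edist_dist, Real.dist_eq]
  exact ENNReal.ofReal_le_ofReal hω.le

lemma cp_congr {X X' : ℕ → Ω → ℝ} {Y Y' : Ω → ℝ} {G G' : Set Ω} (h : CP μ G X Y)
    (hG : ∀ ω ∈ G', ω ∈ G) (hX : ∀ n, ∀ ω ∈ G', X' n ω = X n ω) (hY : ∀ ω ∈ G', Y' ω = Y ω) :
    CP μ G' X' Y' := by
  intro ε hε
  filter_upwards [h ε hε] with n hn
  refine (pr_le_of_subset fun ω hω hp => ⟨hG ω hω, ?_⟩).trans hn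
  rwa [hX n ω hω, hY ω hω] at hp

end

/-- regularized data -/
structure RB (μ : Measure Ω) (F : Filtration ℝ m) (Λ : Set Ω) (M N A QM QN : ℝ → Ω → ℝ)
    (τ τ' : ℕ → Ω → ℝ) (c : ℝ) : Prop where
  lm : LM μ F M N τ τ'
  hA : Adp F A
  hΛ : MeasurableSet Λ
  full : ∀ᵐ ω ∂μ, ω ∈ Λ
  hq : ∀ t, 0 ≤ t → CP μ univ (fun n ω => qsum M N t n ω) 0
  hQM : ∀ t, 0 ≤ t → CP μ Λ (fun n => qsum M M t n) (QM t)
  hQN : ∀ t, 0 ≤ t → CP μ Λ (fun n => qsum N N t n) (QN t)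
  hc : 0 ≤ c
  hdom : ∀ ω ∈ Λ, ∀ a b, 0 ≤ a → a ≤ b → QM b ω - QM a ω ≤ c * max (QN b ω - QN a ω) 0
  hbv : ∀ ω ∈ Λ, ∀ t, 0 ≤ t → BoundedVariationOn (fun s => A s ω) (Icc 0 t)
  A0 : ∀ ω ∈ Λ, A 0 ω = 0

/-- regularized solution -/
structure RS (μ : Measure Ω) (F : Filtration ℝ m) (Λ : Set Ω) (M N A : ℝ → Ω → ℝ)
    (f : ℝ → ℝ) (y : ℝ) (I Y : ℝ → Ω → ℝ) : Prop where
  hY : Adp F Y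
  cp : ∀ t, 0 ≤ t → CP μ Λ (fun n => rsum (fun s ω => f (Y s ω)) M t n) (I t)
  eq : ∀ ω ∈ Λ, ∀ t, 0 ≤ t → Y t ω = y + I t ω + A t ω + N t ω
  Y0 : ∀ ω ∈ Λ, Y 0 ω = y

section
variable {μ : Measure Ω} [IsProbabilityMeasure μ] {F : Filtration ℝ m}
  {M N A QM QN I I' Y Y' : ℝ → Ω → ℝ} {τ τ' : ℕ → Ω → ℝ} {Λ : Set Ω} {c y : ℝ}

lemma rsum_congr {H X H' X' : ℝ → Ω → ℝ} {T t : ℝ} (ht : t ∈ Icc 0 T) (n : ℕ) {ω : Ω}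
    (h : ∀ t ∈ Icc 0 T, H t ω = H' t ω) (h' : ∀ t ∈ Icc 0 T, X t ω = X' t ω) :
    rsum H X t n ω = rsum H' X' t n ω := by
  unfold rsum
  refine Finset.sum_congr rfl fun j hj => ?_
  rw [Finset.mem_range] at hj
  have a := grid_mem ht (show j ≤ 2 ^ n by omega)
  have b := grid_mem ht (show j + 1 ≤ 2 ^ n by omega)
  push_cast at b
  rw [h _ a, h' _ a, h' _ b]

lemma RS.sol {f : ℝ → ℝ} (s : RS μ F Λ M N A f y I Y) (hA : Adp F A) (A0 : ∀ ω ∈ Λ, A 0 ω = 0)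
    {T B R : ℝ} (hT : 0 < T) (hB : 0 < B) (hR : 0 < R) {σ : Ω → ℝ} {G : Set Ω}
    (hN : Drv μ F B (stp N σ)) (hσ : ∀ ω ∈ G, σ ω = T) (hGΛ : ∀ ω ∈ G, ω ∈ Λ)
    (hGY : ∀ ω ∈ G, ∀ t ∈ Icc 0 T, |Y t ω| ≤ R) (hGA : ∀ ω ∈ G, ∀ t ∈ Icc 0 T, |A t ω| ≤ R) :
    ∃ J, Sol μ F T G (stp M σ) (stp N σ) R (fun x => f (clp R x)) A y J Y := by
  let R' := R + |y| + R + B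
  have hR' : 0 ≤ R' := by have := abs_nonneg y; simp only [R']; linarith
  let J : ℝ → Ω → ℝ := fun t ω => clp R' (Y t ω - y - A t ω - stp N σ t ω)
  have hJ : ∀ ω ∈ G, ∀ t ∈ Icc 0 T, J t ω = Y t ω - y - A t ω - stp N σ t ω := by
    intro ω hω t ht
    refine clp_eq ?_
    have h1 := abs_le.1 (hGY ω hω t ht)
    have h2 := abs_le.1 (hGA ω hω t ht)
    have h3 := abs_le.1 (hN.bd t ht.1 ω)
    have h4 := le_abs_self y
    have h5 := neg_abs_le y
    rw [abs_le]; simp only [R']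
    constructor <;> linarith
  have hst : ∀ X : ℝ → Ω → ℝ, ∀ ω ∈ G, ∀ t ∈ Icc 0 T, stp X σ t ω = X t ω := fun X ω hω t ht =>
    stp_of_le ht.1 (by rw [hσ ω hω]; exact ht.2)
  refine ⟨J, s.hY, ?_, ?_, ⟨R', hR', fun t ω => clp_bd hR' _⟩, hGY, ?_, ?_, ?_⟩
  · intro ω
    have h1 := s.hY.cont ω
    have h2 := hA.cont ω
    have h3 := hN.cont ω
    exact (clp_cont R').comp (((h1.sub continuous_const).sub h2).sub h3)
  · intro t ht
    have h1 := (s.hY.meas t ht).mono (F.le t) le_rfl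
    have h2 := (hA.meas t ht).mono (F.le t) le_rfl
    have h3 := (hN.meas t ht).mono (F.le t) le_rfl
    exact (clp_cont R').measurable.comp (((h1.sub measurable_const).sub h2).sub h3)
  · intro ω hω t ht
    rw [hJ ω hω t ht]; ring
  · intro ω hω
    rw [hJ ω hω 0 ⟨le_rfl, hT.le⟩, s.Y0 ω (hGΛ ω hω), A0 ω (hGΛ ω hω), hN.zero]; ring
  · intro t ht htT
    have htm : t ∈ Icc 0 T := ⟨ht.le, htT⟩
    refine cp_congr (s.cp t ht.le) hGΛ (fun n ω hω => ?_) (fun ω hω => ?_)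
    · refine rsum_congr htm n (fun r hr => ?_) (hst M ω hω)
      rw [clp_eq (hGY ω hω r hr)]
    · rw [hJ ω hω t htm, hst N ω hω t htm, s.eq ω (hGΛ ω hω) t ht.le]; ring

set_option maxHeartbeats 1600000 in
lemma reg_core {fP fM : ℝ → ℝ} (hP : Monotone fP) (hMm : Monotone fM)
    (b : RB μ F Λ M N A QM QN τ τ' c)
    (s : RS μ F Λ M N A (fun x => fP x - fM x) y I Y)
    (s' : RS μ F Λ M N A (fun x => fP x - fM x) y I' Y') {T : ℝ} (hT : 0 < T) :
    μ {ω | Y T ω ≠ Y' T ω} = 0 := by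
  suffices h : ∀ η > 0, μ.real {ω | Y T ω ≠ Y' T ω} ≤ η by
    have : μ.real {ω | Y T ω ≠ Y' T ω} = 0 :=
      le_antisymm (le_of_forall_pos_le_add fun η hη => by simpa using h η hη) measureReal_nonneg
    exact (measureReal_eq_zero_iff (measure_ne_top _ _)).1 this
  intro η hη
  obtain ⟨B, σ, G₁, hB, hG₁, hG₁η, hσ0, hσT, hdM, hdN, hσ⟩ := b.lm.loc hT (half_pos hη)
  let G₂ : ℕ → Set Ω := fun n => (Λ ∩ ({ω | ∀ r ∈ Icc 0 T, |Y r ω| ≤ (n : ℝ) + 1} ∩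
    {ω | ∀ r ∈ Icc 0 T, |Y' r ω| ≤ (n : ℝ) + 1})) ∩ ({ω | ∀ r ∈ Icc 0 T, |A r ω| ≤ (n : ℝ) + 1} ∩
    ⋂ k : ℕ, {ω | ∑ j ∈ Finset.range (2 ^ k), |A (pt T k (j + 1)) ω - A (pt T k j) ω| ≤ (n : ℝ) + 1})
  have hG₂ : ∀ n, MeasurableSet (G₂ n) := by
    intro n
    refine (b.hΛ.inter ((F.le T _ (sup_meas s.hY hT.le _)).inter
      (F.le T _ (sup_meas s'.hY hT.le _)))).inter ((F.le T _ (sup_meas b.hA hT.le _)).inter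
      (MeasurableSet.iInter fun k => measurableSet_le ?_ measurable_const))
    refine Finset.measurable_sum _ fun j _ => ?_
    have h1 := (b.hA.meas _ (pt_nonneg hT.le k j)).mono (F.le _) le_rfl
    have h2 := (b.hA.meas _ (pt_nonneg hT.le k (j + 1))).mono (F.le _) le_rfl
    exact (h2.sub h1).abs
  obtain ⟨n, hn⟩ := exists_small_compl (μ := μ) hG₂ (by
    filter_upwards [b.full] with ω hω
    obtain ⟨K, hK⟩ := exists_nat_ge (eVariationOn (fun s => A s ω) (Icc 0 T)).toReal
    filter_upwards [cont_bdd_ev (s.hY.cont ω) T, cont_bdd_ev (s'.hY.cont ω) T,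
      cont_bdd_ev (b.hA.cont ω) T, eventually_ge_atTop K] with n h1 h2 h3 h4
    refine ⟨⟨hω, fun r hr => (h1 r hr).le, fun r hr => (h2 r hr).le⟩, fun r hr => (h3 r hr).le,
      mem_iInter.2 fun k => ?_⟩
    refine (grid_of_bv hT (b.hbv ω hω T hT.le) k).trans (hK.trans ?_)
    have : (K : ℝ) ≤ n := by exact_mod_cast h4
    linarith) (half_pos hη)
  set R : ℝ := (n : ℝ) + 1 with hRd
  have hR : 0 < R := by positivity
  set G := G₁ ∩ G₂ n with hGd
  have hGΛ : ∀ ω ∈ G, ω ∈ Λ := fun ω hω => hω.2.1.1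
  have hGY : ∀ ω ∈ G, ∀ t ∈ Icc 0 T, |Y t ω| ≤ R := fun ω hω => hω.2.1.2.1
  have hGY' : ∀ ω ∈ G, ∀ t ∈ Icc 0 T, |Y' t ω| ≤ R := fun ω hω => hω.2.1.2.2
  have hGA : ∀ ω ∈ G, ∀ t ∈ Icc 0 T, |A t ω| ≤ R := fun ω hω => hω.2.2.1
  have hGσ : ∀ ω ∈ G, σ ω = T := fun ω hω => hσ ω hω.1
  have hst : ∀ X : ℝ → Ω → ℝ, ∀ ω ∈ G, ∀ t ∈ Icc 0 T, stp X σ t ω = X t ω := fun X ω hω t ht =>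
    stp_of_le ht.1 (by rw [hGσ ω hω]; exact ht.2)
  obtain ⟨J, hJ⟩ := s.sol b.hA b.A0 hT hB hR hdN hGσ hGΛ hGY hGA
  obtain ⟨J', hJ'⟩ := s'.sol b.hA b.A0 hT hB hR hdN hGσ hGΛ hGY' hGA
  set C := |fP R| + |fP (-R)| + (|fM R| + |fM (-R)|) + 1 with hC
  have base : Base μ F B T G (stp M σ) (stp N σ) R R c (fun x => fP (clp R x) - fM (clp R x))
      (fun x => fP (clp R x) + fM (clp R x)) C A := by
    refine ⟨hdM, hdN, b.lm.orth hT (fun t ht => b.hq t ht.1) hσ0 hσT hdM hdN, hT,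
      hG₁.inter (hG₂ n), hR, ?_, b.hc, ?_, by positivity, ?_, ?_, ?_, ?_, ?_⟩
    · refine CellDom.of_qv hdM hdN hT.le b.hc (QM := QM) (QN := QN) (fun t ht => ?_) (fun t ht => ?_)
        (fun ω hω => b.hdom ω (hGΛ ω hω))
      · exact cp_congr (b.hQM t ht.1) hGΛ
          (fun n ω hω => qsum_congr ht n (hst M ω hω) (hst M ω hω)) (fun _ _ => rfl)
      · exact cp_congr (b.hQN t ht.1) hGΛ
          (fun n ω hω => qsum_congr ht n (hst N ω hω) (hst N ω hω)) (fun _ _ => rfl)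
    · exact (hP.comp (clp_mono R)).measurable.sub (hMm.comp (clp_mono R)).measurable
    · intro x
      have h1 := abs_sub (fP (clp R x)) (fM (clp R x))
      have h2 := mono_clp_bd hP hR.le x
      have h3 := mono_clp_bd hMm hR.le x
      linarith
    · exact (hP.comp (clp_mono R)).add (hMm.comp (clp_mono R))
    · intro x
      have h1 := abs_add_le (fP (clp R x)) (fM (clp R x))
      have h2 := mono_clp_bd hP hR.le x
      have h3 := mono_clp_bd hMm hR.le x
      linarith
    · intro x y
      exact diff_le (hP.comp (clp_mono R)) (hMm.comp (clp_mono R)) x y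
    · intro ω hω u hu hm k
      exact var_of_grid (b.hA.cont ω) hT (fun k => mem_iInter.1 hω.2.2.2 k) u hu hm k
  have hz := core base hJ hJ'
  have hle : μ.real {ω | Y T ω ≠ Y' T ω} ≤
      μ.real ({ω | ω ∈ G ∧ Y T ω ≠ Y' T ω} ∪ (G₁ᶜ ∪ (G₂ n)ᶜ)) := by
    refine measureReal_mono (fun ω hω => ?_) (measure_ne_top _ _)
    by_cases h1 : ω ∈ G₁
    · by_cases h2 : ω ∈ G₂ n
      · exact Or.inl ⟨⟨h1, h2⟩, hω⟩
      · exact Or.inr (Or.inr h2)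
    · exact Or.inr (Or.inl h1)
  have h1 := measureReal_union_le (μ := μ) {ω | ω ∈ G ∧ Y T ω ≠ Y' T ω} (G₁ᶜ ∪ (G₂ n)ᶜ)
  have h2 := measureReal_union_le (μ := μ) G₁ᶜ (G₂ n)ᶜ
  have h3 : μ.real {ω | ω ∈ G ∧ Y T ω ≠ Y' T ω} = 0 := by
    rw [measureReal_def, hz]; rfl
  linarith

end

/-- cutting a process outside of a set of full measure -/
def cut (Λ : Set Ω) (X : ℝ → Ω → ℝ) (t : ℝ) : Ω → ℝ := Λ.indicator (X t)

lemma cut_eq {Λ : Set Ω} {X : ℝ → Ω → ℝ} {t : ℝ} {ω : Ω} (h : ω ∈ Λ) : cut Λ X t ω = X t ω :=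
  indicator_of_mem h _

section
variable {μ : Measure Ω} [IsProbabilityMeasure μ] {F : Filtration ℝ m} {Λ : Set Ω}

lemma exists_full {p : Ω → Prop} (h : ∀ᵐ ω ∂μ, p ω) :
    ∃ Λ : Set Ω, (∀ ω ∈ Λ, p ω) ∧ MeasurableSet Λ ∧ ∀ᵐ ω ∂μ, ω ∈ Λ := by
  obtain ⟨t, ht, hm, h0⟩ := exists_measurable_superset_of_null (ae_iff.1 h)
  refine ⟨tᶜ, fun ω hω => ?_, hm.compl, ?_⟩
  · by_contra h
    exact hω (ht h)
  · rw [ae_iff]; simpa using h0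

lemma cut_ae (hΛ : ∀ᵐ ω ∂μ, ω ∈ Λ) (X : ℝ → Ω → ℝ) (t : ℝ) : cut Λ X t =ᵐ[μ] X t := by
  filter_upwards [hΛ] with ω hω using cut_eq hω

lemma cut_adp {X : ℝ → Ω → ℝ} (hm : MeasurableSet Λ) (hΛ : ∀ᵐ ω ∂μ, ω ∈ Λ)
    (hX : ∀ t, 0 ≤ t → Measurable[F t] (X t)) (hc : ∀ ω ∈ Λ, Continuous fun t => X t ω) :
    Adp (aug μ F) (cut Λ X) := by
  refine ⟨fun ω => ?_, fun t ht => ?_⟩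
  · by_cases h : ω ∈ Λ
    · simpa only [cut_eq h] using hc ω h
    · simp only [cut, indicator_of_notMem h]; exact continuous_const
  · exact aug_meas (hX t ht) (((hX t ht).mono (F.le t) le_rfl).indicator hm) (cut_ae hΛ X t)

lemma cut_mart {X : ℝ → Ω → ℝ} {τ : Ω → ℝ} (hm : MeasurableSet Λ) (hΛ : ∀ᵐ ω ∂μ, ω ∈ Λ)
    (hX : Martingale (fun t ω => X (min t (τ ω)) ω) F μ) :
    Martingale (fun t ω => cut Λ X (min t (τ ω)) ω) (aug μ F) μ := by
  refine aug_mart hX (fun t => ?_) (fun t => ?_)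
  · have h1 := ((hX.1 t).measurable.mono (F.le t) le_rfl).indicator hm
    exact h1
  · filter_upwards [hΛ] with ω hω using cut_eq hω

lemma cut_st {τ : ℕ → Ω → ℝ} (h : ∀ n, IsStoppingTime F (fun ω => (τ n ω : WithTop ℝ))) :
    ∀ k u, 0 ≤ u → MeasurableSet[aug μ F u] {ω | u < τ k ω} := by
  intro k u _
  have h1 := ((h k) u).compl
  refine le_aug u _ ?_
  convert h1 using 1
  ext ω
  simp

lemma cp_full {X X' : ℕ → Ω → ℝ} {Y Y' : Ω → ℝ} (hΛ : ∀ᵐ ω ∂μ, ω ∈ Λ) (h : CP μ univ X Y)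
    (hX : ∀ n, ∀ ω ∈ Λ, X' n ω = X n ω) (hY : ∀ ω ∈ Λ, Y' ω = Y ω) : CP μ univ X' Y' := by
  intro ε hε
  filter_upwards [h ε hε] with n hn
  refine le_of_eq_of_le ?_ hn
  refine measureReal_congr ?_
  filter_upwards [hΛ] with ω hω
  apply propext
  show (ω ∈ univ ∧ ε < |X' n ω - Y' ω|) ↔ (ω ∈ univ ∧ ε < |X n ω - Y ω|)
  rw [hX n ω hω, hY ω hω]

lemma qsum_cut {X X' : ℝ → Ω → ℝ} {t : ℝ} {n : ℕ} {ω : Ω} (h : ω ∈ Λ) :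
    qsum (cut Λ X) (cut Λ X') t n ω = qsum X X' t n ω := by
  unfold qsum; simp only [cut_eq h]

lemma sol_cut {f : ℝ → ℝ} {M N A I Y : ℝ → Ω → ℝ} {y : ℝ} (hm : MeasurableSet Λ)
    (hΛ : ∀ᵐ ω ∂μ, ω ∈ Λ) (hY : ∀ t : ℝ, 0 ≤ t → MeasurableSpace.comap (Y t) inferInstance ≤ F t)
    (hc : ∀ ω ∈ Λ, Continuous fun t => Y t ω) (hI : IsSI μ (fun s ω => f (Y s ω)) M I)
    (h0 : ∀ ω ∈ Λ, I 0 ω = 0 ∧ A 0 ω = 0 ∧ N 0 ω = 0)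
    (he : ∀ ω ∈ Λ, ∀ t : ℝ, 0 ≤ t → Y t ω = y + I t ω + A t ω + N t ω) :
    RS μ (aug μ F) Λ (cut Λ M) (cut Λ N) (cut Λ A) f y I (cut Λ Y) := by
  refine ⟨cut_adp hm hΛ (fun t ht => measurable_iff_comap_le.2 (hY t ht)) hc, fun t ht => ?_,
    fun ω hω t ht => ?_, fun ω hω => ?_⟩
  · refine cp_congr (cp_of_tim (hI.2 t ht) univ) (fun _ _ => trivial) (fun n ω hω => ?_)
      (fun _ _ => rfl)
    unfold rsum; simp only [cut_eq hω]
  · rw [cut_eq hω, cut_eq hω, cut_eq hω]; exact he ω hω t ht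
  · rw [cut_eq hω, he ω hω 0 le_rfl, (h0 ω hω).1, (h0 ω hω).2.1, (h0 ω hω).2.2]; ring

end

set_option maxHeartbeats 400000 in
lemma main_aux
    {Ω : Type*} [m : MeasurableSpace Ω] (μ : Measure Ω) [IsProbabilityMeasure μ]
    (F : Filtration ℝ m) (M N A : ℝ → Ω → ℝ) (c : ℝ) (hc : 0 ≤ c)
    (f fP fM : ℝ → ℝ) (hfP : Monotone fP) (hfM : Monotone fM)
    (hf : f = fun x => fP x - fM x)
    (hM : IsContLocMart μ F M) (hN : IsContLocMart μ F N)
    (hM0 : ∀ᵐ ω ∂μ, M 0 ω = 0) (hN0 : ∀ᵐ ω ∂μ, N 0 ω = 0)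
    (horth : Orthogonal μ M N) (hdom : Dominated μ F M N c)
    (hAadp : ∀ t : ℝ, 0 ≤ t → MeasurableSpace.comap (A t) inferInstance ≤ F t)
    (hA0 : ∀ᵐ ω ∂μ, A 0 ω = 0)
    (hAcont : ∀ᵐ ω ∂μ, Continuous fun t => A t ω)
    (hAbv : ∀ᵐ ω ∂μ, ∀ t : ℝ, 0 ≤ t → BoundedVariationOn (fun s => A s ω) (Icc 0 t))
    (y : ℝ) (Y Y' : ℝ → Ω → ℝ)
    (hY : SolvesGenPerturbedTanaka μ (fun t => F t) f M N A y Y)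
    (hY' : SolvesGenPerturbedTanaka μ (fun t => F t) f M N A y Y') :
    ∀ᵐ ω ∂μ, ∀ t : ℝ, 0 ≤ t → Y t ω = Y' t ω := by
  subst hf
  obtain ⟨hMc, hMa, τ, hτ, hτl, hτm⟩ := hM
  obtain ⟨hNc, hNa, τ', hτ', hτl', hτm'⟩ := hN
  obtain ⟨QM, QN, q, hQM, hQN, -, hq, hν⟩ := hdom
  obtain ⟨hYa, hYc, I, hI, hYe⟩ := hY
  obtain ⟨hYa', hYc', I', hI', hYe'⟩ := hY'
  have hall := hMc.and (hNc.and (hM0.and (hN0.and (hA0.and (hAcont.and (hAbv.and (hν.and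
    (hYc.and (hYe.and (hYc'.and (hYe'.and (hI.1.and hI'.1))))))))))))
  obtain ⟨Λ, hΛs, hΛm, hΛ⟩ := exists_full hall
  have lm : LM μ (aug μ F) (cut Λ M) (cut Λ N) τ τ' := by
    refine ⟨cut_adp hΛm hΛ (fun t _ => (hMa t).measurable) fun ω hω => (hΛs ω hω).1,
      cut_adp hΛm hΛ (fun t _ => (hNa t).measurable) fun ω hω => (hΛs ω hω).2.1,
      fun ω => ?_, fun ω => ?_, cut_st hτ, cut_st hτ', hτl, hτl',
      fun k => cut_mart hΛm hΛ (hτm k), fun k => cut_mart hΛm hΛ (hτm' k)⟩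
    · by_cases h : ω ∈ Λ
      · rw [cut_eq h]; exact (hΛs ω h).2.2.1
      · exact indicator_of_notMem h _
    · by_cases h : ω ∈ Λ
      · rw [cut_eq h]; exact (hΛs ω h).2.2.2.1
      · exact indicator_of_notMem h _
  have rb : RB μ (aug μ F) Λ (cut Λ M) (cut Λ N) (cut Λ A) QM QN τ τ' c := by
    refine ⟨lm, cut_adp hΛm hΛ (fun t ht => measurable_iff_comap_le.2 (hAadp t ht))
      fun ω hω => (hΛs ω hω).2.2.2.2.2.1, hΛm, hΛ, fun t ht => ?_, fun t ht => ?_, fun t ht => ?_, hc,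
      fun ω hω a b ha hab => ?_, fun ω hω t ht => ?_, fun ω hω => ?_⟩
    · exact cp_full hΛ (cp_of_tim (horth t ht) univ) (fun n ω hω => qsum_cut hω) fun _ _ => rfl
    · exact cp_congr (cp_of_tim (hQM t ht) univ) (fun _ _ => trivial) (fun n ω hω => qsum_cut hω)
        fun _ _ => rfl
    · exact cp_congr (cp_of_tim (hQN t ht) univ) (fun _ _ => trivial) (fun n ω hω => qsum_cut hω)
        fun _ _ => rfl
    · obtain ⟨ν, h1, h2⟩ := (hΛs ω hω).2.2.2.2.2.2.2.1
      exact dom_ineq hc (Q := fun t => QN t ω) (P := fun t => QM t ω) (q := fun t => q t ω) h1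
        (fun t => hq t ω) h2 ha hab
    · simp only [cut_eq hω]
      exact (hΛs ω hω).2.2.2.2.2.2.1 t ht
    · rw [cut_eq hω]; exact (hΛs ω hω).2.2.2.2.1
  have s := sol_cut (μ := μ) (F := F) (A := A) (f := fun x => fP x - fM x) (M := M) (I := I) (Y := Y) (N := N) (y := y) hΛm hΛ hYa
    (fun ω hω => (hΛs ω hω).2.2.2.2.2.2.2.2.1) hI
    (fun ω hω => ⟨(hΛs ω hω).2.2.2.2.2.2.2.2.2.2.2.2.1, (hΛs ω hω).2.2.2.2.1, (hΛs ω hω).2.2.2.1⟩)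
    (fun ω hω => (hΛs ω hω).2.2.2.2.2.2.2.2.2.1)
  have s' := sol_cut (μ := μ) (F := F) (A := A) (f := fun x => fP x - fM x) (M := M) (I := I') (Y := Y') (N := N) (y := y) hΛm hΛ hYa'
    (fun ω hω => (hΛs ω hω).2.2.2.2.2.2.2.2.2.2.1) hI'
    (fun ω hω => ⟨(hΛs ω hω).2.2.2.2.2.2.2.2.2.2.2.2.2, (hΛs ω hω).2.2.2.2.1, (hΛs ω hω).2.2.2.1⟩)
    (fun ω hω => (hΛs ω hω).2.2.2.2.2.2.2.2.2.2.2.1)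
  have hrat : ∀ᵐ ω ∂μ, ∀ r : ℚ, 0 < (r : ℝ) → cut Λ Y r ω = cut Λ Y' r ω := by
    rw [ae_all_iff]
    intro r
    by_cases hr : 0 < (r : ℝ)
    · have := reg_core hfP hfM rb s s' hr
      have h2 : ∀ᵐ ω ∂μ, cut Λ Y r ω = cut Λ Y' r ω := this
      filter_upwards [h2] with ω h _ using h
    · exact Eventually.of_forall fun ω h => absurd h hr
  filter_upwards [hrat, hΛ] with ω h hω
  have hYc := (hΛs ω hω).2.2.2.2.2.2.2.2.1
  have hYc' := (hΛs ω hω).2.2.2.2.2.2.2.2.2.2.1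
  have hcl : IsClosed {t : ℝ | Y t ω = Y' t ω} := isClosed_eq hYc hYc'
  have hsub : Ioi (0:ℝ) ∩ range ((↑) : ℚ → ℝ) ⊆ {t : ℝ | Y t ω = Y' t ω} := by
    rintro _ ⟨hr, r, rfl⟩
    have := h r hr
    rw [cut_eq hω, cut_eq hω] at this
    exact this
  have hd : Ici (0:ℝ) ⊆ closure (Ioi (0:ℝ) ∩ range ((↑) : ℚ → ℝ)) := by
    have h1 : Ioi (0:ℝ) ⊆ closure (Ioi (0:ℝ) ∩ range ((↑) : ℚ → ℝ)) :=
      Rat.denseRange_cast.open_subset_closure_inter isOpen_Ioi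
    have h2 := closure_minimal h1 isClosed_closure
    rwa [closure_Ioi] at h2
  intro t ht
  exact hcl.closure_subset_iff.2 hsub (hd ht)

/-- Theorem 4 of the paper. Let `f : ℝ → ℝ` be of finite variation,
i.e. `f = f₊ − f₋` with `f₊, f₋` increasing, and let `A` be a continuous adapted
process with `A(0) = 0` and finite total variation on compact intervals.  If `M, N`
are continuous local martingales vanishing at `0` with `⟨M,N⟩ ≡ 0` and
`⟨M⟩(t) = ∫₀ᵗ q(s) d⟨N⟩(s)` for a progressively measurable `q` with values in `[0,c]`,
then pathwise uniqueness holds for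
`Y(t) = y + ∫₀ᵗ f(Y(s)) dM(s) + A(t) + N(t)`. -/
theorem generalized_perturbed_tanaka_pathwise_uniqueness
    {Ω : Type*} [m : MeasurableSpace Ω] (μ : Measure Ω) [IsProbabilityMeasure μ]
    (F : Filtration ℝ m) (M N A : ℝ → Ω → ℝ) (c : ℝ) (hc : 0 ≤ c)
    (f fP fM : ℝ → ℝ) (hfP : Monotone fP) (hfM : Monotone fM)
    (hf : f = fun x => fP x - fM x)
    (hM : IsContLocMart μ F M) (hN : IsContLocMart μ F N)
    (hM0 : ∀ᵐ ω ∂μ, M 0 ω = 0) (hN0 : ∀ᵐ ω ∂μ, N 0 ω = 0)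
    (horth : Orthogonal μ M N) (hdom : Dominated μ F M N c)
    (hAadp : ∀ t : ℝ, 0 ≤ t → MeasurableSpace.comap (A t) inferInstance ≤ F t)
    (hA0 : ∀ᵐ ω ∂μ, A 0 ω = 0)
    (hAcont : ∀ᵐ ω ∂μ, Continuous fun t => A t ω)
    (hAbv : ∀ᵐ ω ∂μ, ∀ t : ℝ, 0 ≤ t → BoundedVariationOn (fun s => A s ω) (Icc 0 t))
    (y : ℝ) (Y Y' : ℝ → Ω → ℝ)
    (hY : SolvesGenPerturbedTanaka μ (fun t => F t) f M N A y Y)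
    (hY' : SolvesGenPerturbedTanaka μ (fun t => F t) f M N A y Y') :
    ∀ᵐ ω ∂μ, ∀ t : ℝ, 0 ≤ t → Y t ω = Y' t ω := by
  exact main_aux μ F M N A c hc f fP fM hfP hfM hf hM hN hM0 hN0 horth hdom hAadp hA0 hAcont hAbv y Y Y' hY hY'

end SDEPaper
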